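/- Let Φ and Ψ be linear flows on X = ℝ^d. Then the following are equivalent: (i) Φ and Ψ are all-Hölder equivalent (Φ ~^{1⁻} Ψ); (ii) there exists α ∈ ℝ∖{0} such that A^Φ and α A^Ψ are Lyapunov similar (i.e. Λ^Φ = α Λ^Ψ) and the central-part generators A^{Φ_C} and α A^{Ψ_C} are similar. -/

import Mathlib

noncomputable section
namespace LF

open Filter Topology

/-- `ℝ^d` with the Euclidean norm. -/
abbrev Euc (d : ℕ) := EuclideanSpace ℝ (Fin d)

variable {d : ℕ}

/-- The time-`t` map of the linear flow on `ℝ^d` generated by the matrix `A`,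
i.e. `x ↦ exp (t A) x`. -/
def linFlow (A : Matrix (Fin d) (Fin d) ℝ) (t : ℝ) (x : Euc d) : Euc d :=
  Matrix.toEuclideanLin (NormedSpace.exp (t • A)) x

/-- The orbit `{Φ_t x : t ∈ ℝ}` of `x` under the linear flow generated by `A`. -/
def flowOrbit (A : Matrix (Fin d) (Fin d) ℝ) (x : Euc d) : Set (Euc d) :=
  Set.range fun t : ℝ => linFlow A t x

/-- `Φ` is `h`-related to `Ψ`: the homeomorphism `h` maps every orbit of the flow
generated by `A` onto an orbit of the flow generated by `B`. -/
def IsOrbitEquiv (A B : Matrix (Fin d) (Fin d) ℝ) (h : Euc d ≃ₜ Euc d) : Prop :=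
  ∀ x : Euc d, h '' flowOrbit A x = flowOrbit B (h x)

/-- `f` satisfies a `β`-Hölder condition on some ball centred at `0`. -/
def HolderNearZero (β : ℝ) (f : Euc d → Euc d) : Prop :=
  ∃ r > (0 : ℝ), ∃ K : ℝ, ∀ x ∈ Metric.ball (0 : Euc d) r, ∀ y ∈ Metric.ball (0 : Euc d) r,
    dist (f x) (f y) ≤ K * dist x y ^ β

/-- `h ∈ 𝓗_β`: `h 0 = 0` and `h`, `h⁻¹` both satisfy a `β`-Hölder condition near `0`. -/
def MemHolderClass (β : ℝ) (h : Euc d ≃ₜ Euc d) : Prop :=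
  h 0 = 0 ∧ HolderNearZero β ⇑h ∧ HolderNearZero β ⇑h.symm

/-- `h ∈ 𝓗_0`: homeomorphisms fixing `0`. -/
def MemH0 (h : Euc d ≃ₜ Euc d) : Prop := h 0 = 0

/-- `h ∈ 𝓗_{0⁺} = ⋃_{γ>0} 𝓗_γ`. -/
def MemH0plus (h : Euc d ≃ₜ Euc d) : Prop := ∃ γ : ℝ, 0 < γ ∧ MemHolderClass γ h

/-- `h ∈ 𝓗_{1⁻} = ⋂_{0<γ<1} 𝓗_γ`. -/
def MemH1minus (h : Euc d ≃ₜ Euc d) : Prop := ∀ γ : ℝ, 0 < γ → γ < 1 → MemHolderClass γ h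

/-- `h ∈ 𝓗_{β⁻} = ⋂_{0<γ<β} 𝓗_γ`. -/
def MemHBelow (β : ℝ) (h : Euc d ≃ₜ Euc d) : Prop :=
  ∀ γ : ℝ, 0 < γ → γ < β → MemHolderClass γ h

/-- `h ∈ 𝓗_{β⁺} = ⋃_{γ>β} 𝓗_γ`. -/
def MemHAbove (β : ℝ) (h : Euc d ≃ₜ Euc d) : Prop :=
  ∃ γ : ℝ, β < γ ∧ MemHolderClass γ h

/-- `φ ~^⋆ ψ`: `φ` is `h`-related to `ψ` for some `h` in the class `P`. -/
def RelEquivWith (P : (Euc d ≃ₜ Euc d) → Prop) (A B : Matrix (Fin d) (Fin d) ℝ) : Prop :=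
  ∃ h : Euc d ≃ₜ Euc d, P h ∧ IsOrbitEquiv A B h

/-- `φ ≃^⋆ ψ`: there are `h` in the class `P` and `α ≠ 0` with
`h (φ t x) = ψ (α t) (h x)` for all `t`, `x`. -/
def SimEquivWith (P : (Euc d ≃ₜ Euc d) → Prop) (A B : Matrix (Fin d) (Fin d) ℝ) : Prop :=
  ∃ (h : Euc d ≃ₜ Euc d) (α : ℝ), α ≠ 0 ∧ P h ∧
    ∀ (t : ℝ) (x : Euc d), h (linFlow A t x) = linFlow B (α * t) (h x)

/-- The stable set `X_S^Φ = {x : Φ_t x → 0 as t → ∞}`. -/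
def stableSet (A : Matrix (Fin d) (Fin d) ℝ) : Set (Euc d) :=
  {x | Tendsto (fun t : ℝ => linFlow A t x) atTop (𝓝 0)}

/-- The unstable set `X_U^Φ = {x : Φ_t x → 0 as t → -∞}`. -/
def unstableSet (A : Matrix (Fin d) (Fin d) ℝ) : Set (Euc d) :=
  {x | Tendsto (fun t : ℝ => linFlow A t x) atBot (𝓝 0)}

/-- The central set `X_C^Φ = {x : e^{-ε|t|} Φ_t x → 0 as |t| → ∞, for every ε > 0}`. -/
def centralSet (A : Matrix (Fin d) (Fin d) ℝ) : Set (Euc d) :=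
  {x | ∀ ε > (0 : ℝ),
    Tendsto (fun t : ℝ => Real.exp (-(ε * |t|)) • linFlow A t x) (atBot ⊔ atTop) (𝓝 0)}

/-- The stable subspace of the flow generated by `A` (the stable set is a subspace,
so taking its span is innocuous). -/
def XS (A : Matrix (Fin d) (Fin d) ℝ) : Submodule ℝ (Euc d) := Submodule.span ℝ (stableSet A)

/-- The unstable subspace. -/
def XU (A : Matrix (Fin d) (Fin d) ℝ) : Submodule ℝ (Euc d) := Submodule.span ℝ (unstableSet A)

/-- The central subspace. -/
def XC (A : Matrix (Fin d) (Fin d) ℝ) : Submodule ℝ (Euc d) := Submodule.span ℝ (centralSet A)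

/-- The hyperbolic subspace `X_H^Φ = X_S^Φ ⊕ X_U^Φ`. -/
def XH (A : Matrix (Fin d) (Fin d) ℝ) : Submodule ℝ (Euc d) := XS A ⊔ XU A

def dimS (A : Matrix (Fin d) (Fin d) ℝ) : ℕ := Module.finrank ℝ (XS A)
def dimU (A : Matrix (Fin d) (Fin d) ℝ) : ℕ := Module.finrank ℝ (XU A)
def dimHyp (A : Matrix (Fin d) (Fin d) ℝ) : ℕ := Module.finrank ℝ (XH A)

/-- The central-part generators `A^{Φ_C}` and `α A^{Ψ_C}` are similar, i.e.
`Q A_C = (α B_C) Q` for some linear isomorphism `Q : X_C^Φ → X_C^Ψ`. -/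
def IsCentralSimilar (A B : Matrix (Fin d) (Fin d) ℝ) (α : ℝ) : Prop :=
  ∃ (hA : ∀ x ∈ XC A, Matrix.toEuclideanLin A x ∈ XC A)
    (hB : ∀ x ∈ XC B, Matrix.toEuclideanLin B x ∈ XC B)
    (Q : XC A ≃ₗ[ℝ] XC B),
    ∀ x : XC A, Q ((Matrix.toEuclideanLin A).restrict hA x)
      = α • (Matrix.toEuclideanLin B).restrict hB (Q x)

/-- The forward Lyapunov exponent `λ_+^Φ(x) = lim_{t→∞} log ‖Φ_t x‖ / t`
(the limit exists for `x ≠ 0`, so it equals the `limsup` used here). -/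
def lyap (A : Matrix (Fin d) (Fin d) ℝ) (x : Euc d) : ℝ :=
  Filter.limsup (fun t : ℝ => Real.log ‖linFlow A t x‖ / t) atTop

/-- The Lyapunov space `L^Φ(s) = {x : λ_+^Φ(x) ≤ s}` (with `λ_+^Φ(0) = -∞`), as a set. -/
def lyapSet (A : Matrix (Fin d) (Fin d) ℝ) (s : ℝ) : Set (Euc d) :=
  {x | x = 0 ∨ lyap A x ≤ s}

/-- `ℓ^Φ(s) = dim L^Φ(s)` (the Lyapunov set is a subspace, so taking its span is innocuous). -/
def ell (A : Matrix (Fin d) (Fin d) ℝ) (s : ℝ) : ℕ :=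
  Module.finrank ℝ (Submodule.span ℝ (lyapSet A s))

/-- The `(j+1)`-st smallest Lyapunov exponent `λ_{j+1}^Φ`, counted with multiplicity. -/
def lyapExp (A : Matrix (Fin d) (Fin d) ℝ) (j : ℕ) : ℝ :=
  sInf {s : ℝ | j + 1 ≤ ell A s}

/-- The Lyapunov space at `s` of the restriction of the flow to the invariant set `V`. -/
def lyapSetIn (A : Matrix (Fin d) (Fin d) ℝ) (V : Set (Euc d)) (s : ℝ) : Set (Euc d) :=
  {x | x ∈ V ∧ (x = 0 ∨ lyap A x ≤ s)}

def ellIn (A : Matrix (Fin d) (Fin d) ℝ) (V : Set (Euc d)) (s : ℝ) : ℕ :=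
  Module.finrank ℝ (Submodule.span ℝ (lyapSetIn A V s))

/-- The `(j+1)`-st smallest Lyapunov exponent of the flow restricted to `V`. -/
def lyapExpIn (A : Matrix (Fin d) (Fin d) ℝ) (V : Set (Euc d)) (j : ℕ) : ℝ :=
  sInf {s : ℝ | j + 1 ≤ ellIn A V s}

/-- `λ_{j+1}^{Φ_H}`: the `(j+1)`-st smallest Lyapunov exponent of the restriction
of the flow to the hyperbolic subspace. -/
def lyapExpH (A : Matrix (Fin d) (Fin d) ℝ) (j : ℕ) : ℝ :=
  lyapExpIn A (XH A) j

/-- The flow generated by `A` is stable: every orbit tends to `0` as `t → ∞`. -/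
def IsStable (A : Matrix (Fin d) (Fin d) ℝ) : Prop := ∀ x : Euc d, x ∈ stableSet A

/-- The flow generated by `A` is unstable: every orbit tends to `0` as `t → -∞`. -/
def IsUnstable (A : Matrix (Fin d) (Fin d) ℝ) : Prop := ∀ x : Euc d, x ∈ unstableSet A

/-- The flow generated by `A` is hyperbolic: `X = X_S ⊕ X_U`. -/
def IsHyperbolic (A : Matrix (Fin d) (Fin d) ℝ) : Prop := IsCompl (XS A) (XU A)

/-- `ρ_+(Φ,Ψ) = (min_j λ_j^Φ/λ_j^Ψ) / |max_j λ_j^Φ/λ_j^Ψ|`. -/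
def rhoPlus (A B : Matrix (Fin d) (Fin d) ℝ) : ℝ :=
  (⨅ j : Fin d, lyapExp A j / lyapExp B j) / |⨆ j : Fin d, lyapExp A j / lyapExp B j|

/-- The Lyapunov cross ratio `ρ(Φ,Ψ) = max {ρ_+(Φ,Ψ), ρ_+(Φ*,Ψ)}`, where `Φ*` is the
time-reversal of `Φ`, generated by `-A`. -/
def rho (A B : Matrix (Fin d) (Fin d) ℝ) : ℝ := max (rhoPlus A B) (rhoPlus (-A) B)

/-- The minimal period `T_x^Φ = inf {t > 0 : Φ_t x = x} ∈ [0,∞]` (with `inf ∅ = ∞`). -/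
def minPeriod (A : Matrix (Fin d) (Fin d) ℝ) (x : Euc d) : EReal :=
  sInf {T : EReal | ∃ t : ℝ, 0 < t ∧ linFlow A t x = x ∧ T = (t : EReal)}

/-- The set of complex eigenvalues of the real matrix `A`. -/
def cSpec {n : ℕ} (A : Matrix (Fin n) (Fin n) ℝ) : Set ℂ :=
  spectrum ℂ (A.map Complex.ofReal)

/-- `x` is a fixed point of the flow generated by `A`. -/
def IsFixedPt (A : Matrix (Fin d) (Fin d) ℝ) (x : Euc d) : Prop :=
  ∀ t : ℝ, linFlow A t x = x

/-- The nilpotent `m × m` Jordan block `J_m` (ones on the superdiagonal). -/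
def jordanNil (m : ℕ) : Matrix (Fin m) (Fin m) ℝ :=
  Matrix.of fun i j => if (i : ℕ) + 1 = (j : ℕ) then 1 else 0

section
section StructureTheorem

open Polynomial in
lemma real_irred_form (q : ℝ[X]) (hq : Irreducible q) (hm : q.Monic) :
    ∃ a b : ℝ, 0 ≤ b ∧ q = (if b = 0 then (X - C a) else (X - C a) ^ 2 + C (b ^ 2)) := by
  have hd := hq.degree_le_two
  have hn : q.natDegree ≤ 2 := natDegree_le_of_degree_le hd
  have hpos : 0 < q.natDegree := hq.natDegree_pos
  have : q.natDegree = 1 ∨ q.natDegree = 2 := by omega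
  rcases this with h1 | h2
  · refine ⟨-q.coeff 0, 0, le_rfl, ?_⟩
    rw [if_pos rfl]
    have := hm.eq_X_add_C h1
    rw [this]
    simp
  · have hq2 : q = X ^ 2 + C (q.coeff 1) * X + C (q.coeff 0) := by
      have := q.as_sum_range_C_mul_X_pow
      rw [h2] at this
      simp only [Finset.sum_range_succ, Finset.sum_range_zero] at this
      have hc : q.coeff 2 = 1 := by have := hm.coeff_natDegree; rwa [h2] at this
      rw [hc] at this
      rw [this]; simp; ring
    set c := q.coeff 1
    set e := q.coeff 0
    have hpos2 : 0 < e - c ^ 2 / 4 := by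
      by_contra hneg
      push Not at hneg
      have hroot : q.IsRoot (-c / 2 + Real.sqrt (c ^ 2 / 4 - e)) := by
        rw [IsRoot.def, hq2]
        simp
        have := Real.sq_sqrt (show 0 ≤ c ^ 2 / 4 - e by linarith)
        nlinarith
      have := degree_eq_one_of_irreducible_of_root hq hroot
      have h3 : q.natDegree = 1 := natDegree_eq_of_degree_eq_some this
      rw [h2] at h3
      norm_num at h3
    refine ⟨-c / 2, Real.sqrt (e - c ^ 2 / 4), Real.sqrt_nonneg _, ?_⟩
    rw [if_neg (Real.sqrt_ne_zero'.2 hpos2), Real.sq_sqrt hpos2.le, hq2]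
    have h4 : C (-c / 2) = - C (c / 2) := by rw [← C_neg]; congr 1; ring
    have h5 : C (e - c ^ 2 / 4) = C e - C (c / 2) ^ 2 := by
      rw [← C_pow, ← C_sub]; congr 1; ring
    have h6 : C c = 2 * C (c / 2) := by
      rw [show (2 : ℝ[X]) = C 2 by rfl, ← C_mul]; congr 1; ring
    rw [h4, h5, h6]; ring

/-- Algebraic splitting of an operator into real part, imaginary part and nilpotent part. -/
structure Spl {V : Type*} [NormedAddCommGroup V] [NormedSpace ℝ V] (A : V →L[ℝ] V) where
  q : ℕ
  a : Fin q → ℝ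
  b : Fin q → ℝ
  P : Fin q → (V →L[ℝ] V)
  K : V →L[ℝ] V
  N : V →L[ℝ] V
  b_nonneg : ∀ i, 0 ≤ b i
  sumP : ∑ i, P i = 1
  orth : ∀ i j, i ≠ j → P i * P j = 0
  idem : ∀ i, P i * P i = P i
  PK : ∀ i, Commute (P i) K
  PN : ∀ i, Commute (P i) N
  KN : Commute K N
  dec : A = ∑ i, a i • P i + K + N
  nilp : IsNilpotent N
  KK : ∀ i, K * K * P i = -(b i ^ 2) • P i
  K0 : ∀ i, b i = 0 → K * P i = 0

open Polynomial in
set_option maxHeartbeats 1000000 in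
lemma exists_spl_alg {R : Type*} [Ring R] [Algebra ℝ R] [Nontrivial R] (s n : R) (p : ℝ[X])
    (hp : p.Monic) (hsq : Squarefree p) (hs : aeval s p = 0) (hc : Commute s n) :
    ∃ (q : ℕ) (a b : Fin q → ℝ) (P : Fin q → R) (K : R), (∀ i, 0 ≤ b i) ∧ ∑ i, P i = 1 ∧
      (∀ i j, i ≠ j → P i * P j = 0) ∧ (∀ i, P i * P i = P i) ∧ (∀ i, Commute (P i) K) ∧
      (∀ i, Commute (P i) n) ∧ Commute K n ∧ s = ∑ i, a i • P i + K ∧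
      (∀ i, K * K * P i = -(b i ^ 2) • P i) ∧ (∀ i, b i = 0 → K * P i = 0) := by
  classical
  set F := UniqueFactorizationMonoid.normalizedFactors p
  have hp0 : p ≠ 0 := hp.ne_zero
  have hnd : F.Nodup :=
    (UniqueFactorizationMonoid.squarefree_iff_nodup_normalizedFactors hp0).1 hsq
  have hprod : F.prod = p := by
    rw [UniqueFactorizationMonoid.prod_normalizedFactors_eq hp0, hp.normalize_eq_self]
  have hmem : ∀ x ∈ F, Irreducible x ∧ x.Monic := fun x hx => by
    have := (Polynomial.mem_normalizedFactors_iff hp0).1 hx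
    exact ⟨this.1, this.2.1⟩
  let G : Finset ℝ[X] := ⟨F, hnd⟩
  let e := (Fintype.equivFin G).symm
  set q := Fintype.card G
  let Q : Fin q → ℝ[X] := fun i => (e i : ℝ[X])
  have hQ : ∀ i, Irreducible (Q i) ∧ (Q i).Monic := fun i => hmem _ (e i).2
  have hQprod : ∏ i, Q i = p := by
    rw [← hprod]
    have h1 : ∏ i, Q i = ∏ x : G, (x : ℝ[X]) := e.prod_comp (fun x : G => (x : ℝ[X]))
    rw [h1, Finset.prod_coe_sort G (fun x => x)]
    simp [Finset.prod, G]
  have hinj : Function.Injective Q := Subtype.val_injective.comp e.injective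
  have hcop : Pairwise (Function.onFun IsCoprime Q) := by
    intro i j hij
    have h1 : IsCoprime (Q i) (Q j) := (hQ i).1.coprime_iff_not_dvd.2 (fun hdvd => hij (hinj
      (eq_of_monic_of_associated (hQ i).2 (hQ j).2
        ((hQ i).1.associated_of_dvd (hQ j).1 hdvd))))
    exact h1
  have hne : Nonempty (Fin q) := by
    by_contra hemp
    rw [not_nonempty_iff] at hemp
    have : p = 1 := by rw [← hQprod]; simp
    rw [this] at hs; simp at hs
  obtain ⟨μ, hμ⟩ := exists_sum_eq_one_iff_pairwise_coprime'.2 hcop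
  choose a b hb hform using fun i => real_irred_form (Q i) (hQ i).1 (hQ i).2
  let E : Fin q → ℝ[X] := fun i => μ i * ∏ j ∈ {i}ᶜ, Q j
  have hE : ∑ i, E i = 1 := hμ
  have hQE : ∀ i, Q i * E i = μ i * p := fun i => by
    simp only [E]
    have h1 : (∏ j ∈ ({i} : Finset (Fin q)), Q j) * ∏ j ∈ {i}ᶜ, Q j = ∏ j, Q j :=
      Finset.prod_mul_prod_compl _ _
    rw [Finset.prod_singleton] at h1
    rw [← hQprod, ← h1]
    ring
  have hzero : ∀ x : ℝ[X], p ∣ x → aeval s x = 0 := by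
    rintro x ⟨y, rfl⟩; rw [map_mul, hs, zero_mul]
  have hEE : ∀ i j, i ≠ j → p ∣ E i * E j := by
    intro i j hij
    have : Q i ∣ E j := by
      refine Dvd.dvd.mul_left (Finset.dvd_prod_of_mem _ ?_) _
      simp [hij]
    obtain ⟨y, hy⟩ := this
    rw [hy]
    refine ⟨μ i * y, ?_⟩
    linear_combination y * hQE i
  let P : Fin q → R := fun i => aeval s (E i)
  let Kp : ℝ[X] := ∑ i, (X - C (a i)) * E i
  have hcomm : ∀ x y : ℝ[X], Commute (aeval s x) (aeval s y) := fun x y => by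
    rw [commute_iff_eq, ← map_mul, ← map_mul, mul_comm]
  have hcommn : ∀ x : ℝ[X], Commute (aeval s x) n := fun x => by
    induction x using Polynomial.induction_on' with
    | add x y hx hy => rw [map_add]; exact hx.add_left hy
    | monomial k c =>
      rw [aeval_monomial]
      exact (show Commute (algebraMap ℝ R c) n from Algebra.commutes c n).mul_left (hc.pow_left k)
  have hsum : ∑ i, P i = 1 := by
    rw [← map_sum, hE, map_one]
  have horth : ∀ i j, i ≠ j → P i * P j = 0 := fun i j hij => by
    rw [← map_mul]; exact hzero _ (hEE i j hij)
  have hidem : ∀ i, P i * P i = P i := fun i => by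
    conv_rhs => rw [← mul_one (P i), ← hsum, Finset.mul_sum]
    rw [Finset.sum_eq_single i]
    · intro j _ hj; exact horth i j hj.symm
    · simp
  have hKP : ∀ i, aeval s Kp * P i = aeval s (X - C (a i)) * P i := fun i => by
    simp only [Kp, map_sum, Finset.sum_mul]
    rw [Finset.sum_eq_single i]
    · rw [map_mul, mul_assoc]; congr 1; exact hidem i
    · intro j _ hj; rw [map_mul, mul_assoc]
      have := horth j i hj
      simp only [P] at this ⊢
      rw [this, mul_zero]
    · simp
  have hQP : ∀ i, aeval s (Q i) * P i = 0 := fun i => by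
    rw [← map_mul, hQE]; exact hzero _ (dvd_mul_left _ _)
  refine ⟨q, a, b, P, aeval s Kp, hb, hsum, horth, hidem, fun i => hcomm _ _,
    fun i => hcommn _, hcommn _, ?_, ?_, ?_⟩
  · have : s = aeval s (X : ℝ[X]) := by simp
    conv_lhs => rw [this]
    have h2 : (X : ℝ[X]) = ∑ i, C (a i) * E i + Kp := by
      simp only [Kp]
      rw [← Finset.sum_add_distrib]
      calc (X : ℝ[X]) = X * ∑ i, E i := by rw [hE, mul_one]
        _ = ∑ i, X * E i := Finset.mul_sum _ _ _
        _ = _ := Finset.sum_congr rfl fun i _ => by ring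
    refine (congrArg (aeval s) h2).trans ?_
    rw [map_add, map_sum]
    congr 1
    refine Finset.sum_congr rfl fun i _ => ?_
    rw [map_mul, aeval_C, Algebra.smul_def]
  · intro i
    have hcK := hcomm Kp (X - C (a i))
    have h0 : aeval s Kp * aeval s Kp * P i
        = aeval s ((X - C (a i)) * (X - C (a i))) * P i := by
      calc aeval s Kp * aeval s Kp * P i = aeval s Kp * (aeval s Kp * P i) := mul_assoc _ _ _
        _ = aeval s Kp * (aeval s (X - C (a i)) * P i) := by rw [hKP]
        _ = (aeval s Kp * aeval s (X - C (a i))) * P i := (mul_assoc _ _ _).symm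
        _ = (aeval s (X - C (a i)) * aeval s Kp) * P i := by rw [hcK.eq]
        _ = aeval s (X - C (a i)) * (aeval s Kp * P i) := mul_assoc _ _ _
        _ = aeval s (X - C (a i)) * (aeval s (X - C (a i)) * P i) := by rw [hKP]
        _ = (aeval s (X - C (a i)) * aeval s (X - C (a i))) * P i := (mul_assoc _ _ _).symm
        _ = _ := by rw [map_mul]
    rw [h0]
    have h1 := hQP i
    rw [hform i] at h1
    split_ifs at h1 with h00
    · rw [map_mul, mul_assoc, h1, h00]; simp
    · rw [map_add, add_mul, pow_two, aeval_C] at h1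
      rw [neg_smul, Algebra.smul_def]
      exact eq_neg_of_add_eq_zero_left h1
  · intro i h0
    rw [hKP]
    have h1 := hQP i
    rwa [hform i, if_pos h0] at h1

theorem exists_spl {V : Type*} [NormedAddCommGroup V] [NormedSpace ℝ V] [FiniteDimensional ℝ V]
    (A : V →L[ℝ] V) : Nonempty (Spl A) := by
  rcases subsingleton_or_nontrivial V with hV | hV
  · have : Subsingleton (V →L[ℝ] V) := ⟨fun f g => by ext x; exact Subsingleton.elim _ _⟩
    exact ⟨{ q := 0, a := fun _ => 0, b := fun _ => 0, P := fun _ => 0, K := 0, N := 0,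
             b_nonneg := fun _ => le_rfl, sumP := Subsingleton.elim _ _,
             orth := fun _ _ _ => Subsingleton.elim _ _, idem := fun _ => Subsingleton.elim _ _,
             PK := fun _ => Subsingleton.elim _ _, PN := fun _ => Subsingleton.elim _ _,
             KN := Subsingleton.elim _ _, dec := Subsingleton.elim _ _,
             nilp := ⟨1, Subsingleton.elim _ _⟩, KK := fun _ => Subsingleton.elim _ _,
             K0 := fun _ _ => Subsingleton.elim _ _ }⟩
  · let T := Module.End.toContinuousLinearMap (𝕜 := ℝ) V
    obtain ⟨n, hn, s, hs, hnil, hss, hA⟩ :=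
      Module.End.exists_isNilpotent_isSemisimple (f := T.symm A)
    have hc : Commute s n := Algebra.commute_of_mem_adjoin_singleton_of_commute hn
      (Algebra.commute_of_mem_adjoin_self hs).symm
    obtain ⟨q, a, b, P, K, h1, h2, h3, h4, h5, h6, h7, h8, h9, h10⟩ :=
      exists_spl_alg (T s) (T n) (minpoly ℝ s) (minpoly.monic (Algebra.IsIntegral.isIntegral s))
      hss.minpoly_squarefree (by
        have := minpoly.aeval ℝ s
        rw [← AlgEquiv.coe_toAlgHom, Polynomial.aeval_algHom_apply, this, map_zero]) (hc.map T)
    refine ⟨⟨q, a, b, P, K, T n, h1, h2, h3, h4, h5, h6, h7, ?_, hnil.map T, h9, h10⟩⟩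
    rw [← h8, add_comm, ← map_add, ← hA]; simp
end StructureTheorem
end

section
set_option linter.unusedSectionVars false
set_option linter.style.haveILetI false
section Flows
variable {V : Type*} [NormedAddCommGroup V] [NormedSpace ℝ V] [CompleteSpace V]

/-- The linear flow generated by a bounded operator. -/
def fl (A : V →L[ℝ] V) (t : ℝ) : V →L[ℝ] V := NormedSpace.exp (t • A)

lemma exp_add_comm' {X Y : V →L[ℝ] V} (h : Commute X Y) :
    NormedSpace.exp (X + Y) = NormedSpace.exp X * NormedSpace.exp Y := by
  letI : NormedAlgebra ℚ (V →L[ℝ] V) := NormedAlgebra.restrictScalars ℚ ℝ _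
  exact NormedSpace.exp_add_of_commute h

@[simp] lemma fl_zero (A : V →L[ℝ] V) : fl A 0 = 1 := by simp [fl]

lemma fl_add (A : V →L[ℝ] V) (s t : ℝ) : fl A (s + t) = fl A s * fl A t := by
  rw [fl, add_smul, exp_add_comm' ((Commute.refl A).smul_left s |>.smul_right t)]; rfl

lemma fl_add_apply (A : V →L[ℝ] V) (s t : ℝ) (x : V) : fl A (s + t) x = fl A s (fl A t x) := by
  rw [fl_add]; rfl

lemma fl_neg_self (A : V →L[ℝ] V) (t : ℝ) (x : V) : fl A (-t) (fl A t x) = x := by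
  rw [← fl_add_apply]; simp

lemma fl_self_neg (A : V →L[ℝ] V) (t : ℝ) (x : V) : fl A t (fl A (-t) x) = x := by
  rw [← fl_add_apply]; simp

lemma fl_smul (A : V →L[ℝ] V) (c t : ℝ) : fl (c • A) t = fl A (t * c) := by
  simp [fl, smul_smul]

lemma fl_neg (A : V →L[ℝ] V) (t : ℝ) : fl (-A) t = fl A (-t) := by
  simp [fl]

lemma fl_add_op {A B : V →L[ℝ] V} (h : Commute A B) (t : ℝ) : fl (A + B) t = fl A t * fl B t := by
  rw [fl, smul_add, exp_add_comm' (h.smul_left t |>.smul_right t)]; rfl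

lemma fl_commute {A B : V →L[ℝ] V} (h : Commute B A) (t : ℝ) : Commute B (fl A t) :=
  (h.smul_right t).exp_right

lemma fl_hasDerivAt (A : V →L[ℝ] V) (t : ℝ) : HasDerivAt (fl A) (A * fl A t) t :=
  hasDerivAt_exp_smul_const' A t

lemma fl_hasDerivAt_apply (A : V →L[ℝ] V) (x : V) (t : ℝ) :
    HasDerivAt (fun s => fl A s x) (A (fl A t x)) t := by
  have := (fl_hasDerivAt A t).clm_apply (hasDerivAt_const t x)
  simpa using this

lemma fl_continuous (A : V →L[ℝ] V) : Continuous (fl A) :=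
  continuous_iff_continuousAt.2 fun t => (fl_hasDerivAt A t).continuousAt

lemma fl_cont (A : V →L[ℝ] V) : Continuous fun p : ℝ × V => fl A p.1 p.2 :=
  ((fl_continuous A).comp continuous_fst).clm_apply continuous_snd

lemma exp_mul_congr {X Y P : V →L[ℝ] V} (h : X * P = Y * P) (hY : Commute Y P) :
    NormedSpace.exp X * P = NormedSpace.exp Y * P := by
  have hpow : ∀ n : ℕ, X ^ n * P = Y ^ n * P := by
    intro n
    induction n with
    | zero => rfl
    | succ n ih =>
      calc X ^ (n + 1) * P = X ^ n * (X * P) := by rw [pow_succ, mul_assoc]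
        _ = X ^ n * P * Y := by rw [h, hY.eq, mul_assoc]
        _ = Y ^ n * (P * Y) := by rw [ih, mul_assoc]
        _ = Y ^ (n + 1) * P := by rw [← hY.eq, pow_succ, mul_assoc]
  have h1 := (NormedSpace.exp_series_hasSum_exp' (𝕂 := ℝ) X).mul_right P
  have h2 := (NormedSpace.exp_series_hasSum_exp' (𝕂 := ℝ) Y).mul_right P
  refine h1.unique ?_
  convert h2 using 2 with n
  rw [smul_mul_assoc, smul_mul_assoc, hpow]

lemma fl_mul_congr {X Y P : V →L[ℝ] V} (h : X * P = Y * P) (hY : Commute Y P) (t : ℝ) :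
    fl X t * P = fl Y t * P :=
  exp_mul_congr (by rw [smul_mul_assoc, h, smul_mul_assoc]) (hY.smul_left t)

lemma fl_scalar (a t : ℝ) : fl (a • (1 : V →L[ℝ] V)) t = Real.exp (a * t) • (1 : V →L[ℝ] V) := by
  have := NormedSpace.algebraMap_exp_comm (𝕂 := ℝ) (𝔸 := V →L[ℝ] V) (a * t)
  rw [← Real.exp_eq_exp_ℝ, Algebra.algebraMap_eq_smul_one, Algebra.algebraMap_eq_smul_one] at this
  rw [this, fl, smul_smul, mul_comm]

/-- Subexponential growth. -/
def SubExp (M : V →L[ℝ] V) : Prop :=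
  ∀ ε > 0, ∃ c > 0, ∀ t : ℝ, ‖fl M t‖ ≤ c * Real.exp (ε * |t|)

lemma nilp_fl (N : V →L[ℝ] V) {p : ℕ} (hN : N ^ p = 0) (t : ℝ) :
    fl N t = ∑ k ∈ Finset.range p, (t ^ k / k.factorial) • N ^ k := by
  have h1 := NormedSpace.exp_series_hasSum_exp' (𝕂 := ℝ) (t • N)
  have h2 : HasSum (fun n : ℕ => ((n.factorial : ℝ))⁻¹ • (t • N) ^ n)
      (∑ k ∈ Finset.range p, (t ^ k / k.factorial) • N ^ k) := by
    have : (∑ k ∈ Finset.range p, (t ^ k / k.factorial) • N ^ k) =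
        ∑ k ∈ Finset.range p, ((k.factorial : ℝ))⁻¹ • (t • N) ^ k := by
      refine Finset.sum_congr rfl fun k _ => ?_
      rw [smul_pow, smul_smul]; congr 1; ring
    rw [this]
    refine hasSum_sum_of_ne_finset_zero fun n hn => ?_
    simp only [Finset.mem_range, not_lt] at hn
    rw [smul_pow, pow_eq_zero_of_le hn hN]; simp
  exact h1.unique h2

lemma nilp_subExp (N : V →L[ℝ] V) (hN : IsNilpotent N) : SubExp N := by
  obtain ⟨p, hp⟩ := hN
  intro ε hε
  refine ⟨1 + ∑ k ∈ Finset.range p, ‖N ^ k‖ / ε ^ k,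
    by have : 0 ≤ ∑ k ∈ Finset.range p, ‖N ^ k‖ / ε ^ k :=
         Finset.sum_nonneg fun k _ => by positivity
       linarith, fun t => ?_⟩
  rw [nilp_fl N hp t]
  have hb : ‖∑ k ∈ Finset.range p, (t ^ k / k.factorial) • N ^ k‖ ≤
      ∑ k ∈ Finset.range p, ‖N ^ k‖ / ε ^ k * Real.exp (ε * |t|) := by
    refine (norm_sum_le _ _).trans (Finset.sum_le_sum fun k _ => ?_)
    rw [norm_smul]
    have h1 := Real.pow_div_factorial_le_exp (ε * |t|) (by positivity) k
    have h2 : ‖t ^ k / (k.factorial : ℝ)‖ ≤ Real.exp (ε * |t|) / ε ^ k := by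
      rw [le_div_iff₀ (by positivity), norm_div, norm_pow, Real.norm_eq_abs, Real.norm_natCast]
      rw [mul_pow] at h1
      calc _ = ε ^ k * |t| ^ k / k.factorial := by ring
        _ ≤ _ := h1
    calc _ ≤ Real.exp (ε * |t|) / ε ^ k * ‖N ^ k‖ := by gcongr
      _ = _ := by ring
  refine hb.trans ?_
  rw [← Finset.sum_mul]
  gcongr
  linarith

lemma rot_fl {K P : V →L[ℝ] V} {b : ℝ} (hb : 0 < b) (hK : K * K * P = -(b ^ 2) • P) (t : ℝ) :
    fl K t * P = Real.cos (b * t) • P + (Real.sin (b * t) / b) • (K * P) := by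
  set g : ℝ → (V →L[ℝ] V) := fun t => Real.cos (b * t) • P + (Real.sin (b * t) / b) • (K * P)
  have hg : ∀ t, HasDerivAt g (K * g t) t := by
    intro t
    have h1 : HasDerivAt (fun t : ℝ => b * t) b t := by simpa using (hasDerivAt_id t).const_mul b
    have h2 := (h1.cos.smul_const P).add (((h1.sin).div_const b).smul_const (K * P))
    refine h2.congr_deriv ?_
    simp only [g, mul_add, mul_smul_comm, ← mul_assoc, hK, smul_smul]
    have e1 : Real.cos (b * t) * b / b = Real.cos (b * t) := by field_simp
    have e2 : Real.sin (b * t) / b * -b ^ 2 = -Real.sin (b * t) * b := by field_simp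
    rw [e1, e2, add_comm]
  have hconst : ∀ t, fl K (-t) * g t = P := by
    intro t
    have hd : ∀ t, HasDerivAt (fun t => fl K (-t) * g t) 0 t := by
      intro t
      have h1 : HasDerivAt (fun t => fl K (-t)) (-(K * fl K (-t))) t := by
        have := fl_hasDerivAt (-K) t
        have e : fl (-K) = fun t => fl K (-t) := funext fun t => fl_neg K t
        rw [e] at this
        simpa only [neg_mul] using this
      refine (h1.mul (hg t)).congr_deriv ?_
      have hc : K * fl K (-t) = fl K (-t) * K := (fl_commute (Commute.refl K) (-t)).eq
      rw [hc, neg_mul, mul_assoc, neg_add_cancel]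
    have := is_const_of_deriv_eq_zero (fun t => (hd t).differentiableAt) (fun t => (hd t).deriv) t 0
    rw [this]; simp [g]
  calc fl K t * P = fl K t * (fl K (-t) * g t) := by rw [hconst]
    _ = fl K (t + -t) * g t := by rw [fl_add, mul_assoc]
    _ = _ := by simp [g]

lemma rot_fl_zero {K P : V →L[ℝ] V} (hK : K * P = 0) (t : ℝ) :
    fl K t * P = P := by
  have := fl_mul_congr (X := K) (Y := 0) (P := P) (by rw [hK, zero_mul]) (Commute.zero_left _) t
  rw [this]; simp [fl]

namespace Spl
variable {A : V →L[ℝ] V} (σ : Spl A)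

lemma rot_bdd : ∃ c > 0, ∀ t, ‖fl σ.K t‖ ≤ c := by
  have h : ∀ i, ∃ c, ∀ t, ‖fl σ.K t * σ.P i‖ ≤ c := by
    intro i
    rcases (σ.b_nonneg i).eq_or_lt with h0 | h0
    · exact ⟨‖σ.P i‖, fun t => by rw [rot_fl_zero (σ.K0 i h0.symm)]⟩
    · refine ⟨‖σ.P i‖ + 1 / σ.b i * ‖σ.K * σ.P i‖, fun t => ?_⟩
      rw [rot_fl h0 (σ.KK i)]
      refine (norm_add_le _ _).trans (add_le_add ?_ ?_)
      · rw [norm_smul]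
        exact mul_le_of_le_one_left (norm_nonneg _) (Real.abs_cos_le_one _)
      · rw [norm_smul, norm_div, Real.norm_eq_abs, Real.norm_eq_abs, abs_of_pos h0]
        gcongr
        exact Real.abs_sin_le_one _
  choose c hc using h
  refine ⟨1 + |∑ i, c i|, by positivity, fun t => ?_⟩
  calc ‖fl σ.K t‖ = ‖∑ i, fl σ.K t * σ.P i‖ := by rw [← Finset.mul_sum, σ.sumP, mul_one]
    _ ≤ ∑ i, c i := (norm_sum_le _ _).trans (Finset.sum_le_sum fun i _ => hc i t)
    _ ≤ _ := by linarith [le_abs_self (∑ i, c i)]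

lemma subExp_KN : SubExp (σ.K + σ.N) := by
  intro ε hε
  obtain ⟨c, hc, h1⟩ := σ.rot_bdd
  obtain ⟨c', hc', h2⟩ := nilp_subExp σ.N σ.nilp ε hε
  refine ⟨c * c', by positivity, fun t => ?_⟩
  rw [fl_add_op σ.KN, mul_assoc]
  refine (norm_mul_le _ _).trans ?_
  gcongr
  exacts [h1 t, h2 t]

lemma AP (i : Fin σ.q) : A * σ.P i = (σ.a i • 1 + (σ.K + σ.N)) * σ.P i := by
  have h : A * σ.P i = (∑ i, σ.a i • σ.P i + σ.K + σ.N) * σ.P i := congrArg (· * σ.P i) σ.dec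
  rw [h, add_assoc, add_mul, add_mul, Finset.sum_mul, Finset.sum_eq_single i]
  · simp [σ.idem, add_mul]
  · intro j _ hj; rw [smul_mul_assoc, σ.orth j i hj, smul_zero]
  · simp

lemma PKN (i : Fin σ.q) : Commute (σ.P i) (σ.K + σ.N) := (σ.PK i).add_right (σ.PN i)

lemma PA (i : Fin σ.q) : Commute (σ.P i) A := by
  suffices h : Commute (σ.P i) (∑ i, σ.a i • σ.P i + (σ.K + σ.N)) by
    have e := σ.dec
    rw [add_assoc] at e
    have h' := h.eq
    rw [← e] at h'
    exact h'
  refine Commute.add_right (Commute.sum_right _ _ _ fun j _ => Commute.smul_right ?_ _) (σ.PKN i)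
  by_cases hij : i = j
  · rw [hij]
    exact Commute.refl _
  · rw [commute_iff_eq, σ.orth i j hij, σ.orth j i (Ne.symm hij)]

lemma fl_P (i : Fin σ.q) (t : ℝ) :
    fl A t * σ.P i = Real.exp (σ.a i * t) • (fl (σ.K + σ.N) t * σ.P i) := by
  rw [fl_mul_congr (σ.AP i) (((Commute.one_left _).smul_left _).add_left (σ.PKN i).symm),
    fl_add_op ((Commute.one_left _).smul_left _), fl_scalar, smul_mul_assoc, one_mul,
    smul_mul_assoc]

/-- scaling -/
def scale (α : ℝ) : Spl (α • A) where
  q := σ.q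
  a := fun i => α * σ.a i
  b := fun i => |α| * σ.b i
  P := σ.P
  K := α • σ.K
  N := α • σ.N
  b_nonneg := fun i => mul_nonneg (abs_nonneg _) (σ.b_nonneg i)
  sumP := σ.sumP
  orth := σ.orth
  idem := σ.idem
  PK := fun i => (σ.PK i).smul_right α
  PN := fun i => (σ.PN i).smul_right α
  KN := (σ.KN.smul_right α).smul_left α
  dec := by
    have h := congrArg (α • ·) σ.dec
    refine h.trans ?_
    simp [smul_add, Finset.smul_sum, smul_smul]
  nilp := by
    obtain ⟨n, hn⟩ := σ.nilp
    exact ⟨n, by rw [smul_pow, hn, smul_zero]⟩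
  KK := fun i => by
    rw [smul_mul_smul_comm, smul_mul_assoc, σ.KK, smul_smul, mul_pow, sq_abs]; congr 1; ring
  K0 := fun i h => by
    rcases mul_eq_zero.1 h with h | h
    · rw [abs_eq_zero.1 h]; simp
    · rw [smul_mul_assoc, σ.K0 i h, smul_zero]

end Spl
end Flows

/-- bridge -/
def opOf {d : ℕ} (A : Matrix (Fin d) (Fin d) ℝ) : Euc d →L[ℝ] Euc d :=
  Matrix.toEuclideanCLM (𝕜 := ℝ) A

lemma opOf_apply {d : ℕ} (A : Matrix (Fin d) (Fin d) ℝ) (x : Euc d) :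
    opOf A x = Matrix.toEuclideanLin A x := rfl

lemma opOf_smul {d : ℕ} (c : ℝ) (A : Matrix (Fin d) (Fin d) ℝ) : opOf (c • A) = c • opOf A :=
  map_smul (Matrix.toEuclideanCLM (𝕜 := ℝ) (n := Fin d)) c A

open scoped Matrix.Norms.Operator in
lemma linFlow_eq {d : ℕ} (A : Matrix (Fin d) (Fin d) ℝ) (t : ℝ) (x : Euc d) :
    linFlow A t x = fl (opOf A) t x := by
  have h : Matrix.toEuclideanCLM (𝕜 := ℝ) (NormedSpace.exp (t • A))
      = NormedSpace.exp (Matrix.toEuclideanCLM (𝕜 := ℝ) (t • A)) := by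
    letI : NormedAlgebra ℚ (Matrix (Fin d) (Fin d) ℝ) := NormedAlgebra.restrictScalars ℚ ℝ _
    letI : NormedAlgebra ℚ (Euc d →L[ℝ] Euc d) := NormedAlgebra.restrictScalars ℚ ℝ _
    refine NormedSpace.map_exp (Matrix.toEuclideanCLM (𝕜 := ℝ) (n := Fin d)) ?_ _
    exact LinearMap.continuous_of_finiteDimensional
      (Matrix.toEuclideanCLM (𝕜 := ℝ) (n := Fin d)).toAlgEquiv.toLinearMap
  have h2 : linFlow A t x = Matrix.toEuclideanCLM (𝕜 := ℝ) (NormedSpace.exp (t • A)) x := rfl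
  rw [h2, h, map_smul]; rfl
end

section
section Lyap
variable {V : Type*} [NormedAddCommGroup V] [NormedSpace ℝ V] [CompleteSpace V]
set_option linter.unusedSectionVars false

namespace Spl
variable {A : V →L[ℝ] V} (σ : Spl A)

lemma fl_P_apply (i : Fin σ.q) (t : ℝ) (x : V) :
    fl A t (σ.P i x) = Real.exp (σ.a i * t) • fl (σ.K + σ.N) t (σ.P i x) := by
  have := congrArg (fun L : V →L[ℝ] V => L x) (σ.fl_P i t)
  simpa using this

lemma P_fl (i : Fin σ.q) (t : ℝ) (x : V) : σ.P i (fl A t x) = fl A t (σ.P i x) := by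
  have := congrArg (fun L : V →L[ℝ] V => L x) (fl_commute (σ.PA i) t).eq
  simpa using this

lemma sum_P (x : V) : ∑ i, σ.P i x = x := by
  have := congrArg (fun L : V →L[ℝ] V => L x) σ.sumP
  simpa using this

lemma P_idem (i : Fin σ.q) (x : V) : σ.P i (σ.P i x) = σ.P i x := by
  have := congrArg (fun L : V →L[ℝ] V => L x) (σ.idem i)
  simpa using this

lemma P_orth {i j : Fin σ.q} (h : i ≠ j) (x : V) : σ.P i (σ.P j x) = 0 := by
  have := congrArg (fun L : V →L[ℝ] V => L x) (σ.orth i j h)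
  simpa using this

lemma upper_one {ε : ℝ} (hε : 0 < ε) : ∃ c > 0, ∀ i x t,
    ‖fl A t (σ.P i x)‖ ≤ c * Real.exp (ε * |t|) * Real.exp (σ.a i * t) * ‖σ.P i x‖ := by
  obtain ⟨c, hc, h⟩ := σ.subExp_KN ε hε
  refine ⟨c, hc, fun i x t => ?_⟩
  rw [fl_P_apply, norm_smul, Real.norm_eq_abs, Real.abs_exp]
  calc _ ≤ Real.exp (σ.a i * t) * (c * Real.exp (ε * |t|) * ‖σ.P i x‖) := by
        gcongr
        exact (ContinuousLinearMap.le_opNorm _ _).trans (by gcongr; exact h t)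
    _ = _ := by ring

lemma lower_one {ε : ℝ} (hε : 0 < ε) : ∃ c > 0, ∀ i x t,
    ‖σ.P i x‖ ≤ c * Real.exp (ε * |t|) * Real.exp (-(σ.a i * t)) * ‖fl A t (σ.P i x)‖ := by
  obtain ⟨c, hc, h⟩ := σ.upper_one hε
  refine ⟨c, hc, fun i x t => ?_⟩
  have := h i (fl A t x) (-t)
  rw [P_fl, fl_neg_self, abs_neg] at this
  convert this using 4
  ring

lemma tendsto_lyap {x : V} (i : Fin σ.q) (hi : σ.P i x ≠ 0)
    (hmax : ∀ j, σ.P j x ≠ 0 → σ.a j ≤ σ.a i) :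
    Tendsto (fun t : ℝ => Real.log ‖fl A t x‖ / t) atTop (𝓝 (σ.a i)) := by
  have hx : ∀ t, fl A t x ≠ 0 := by
    intro t h
    have : σ.P i (fl A t x) = 0 := by rw [h, map_zero]
    rw [P_fl] at this
    apply hi
    rw [← fl_neg_self A t (σ.P i x), this, map_zero]
  have up : ∀ ε > 0, ∃ c > 0, ∀ t ≥ 0, ‖fl A t x‖ ≤ c * Real.exp ((σ.a i + ε) * t) := by
    intro ε hε
    obtain ⟨c, hc, h⟩ := σ.upper_one hε
    refine ⟨1 + ∑ j, c * ‖σ.P j x‖, by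
      have : 0 ≤ ∑ j, c * ‖σ.P j x‖ := Finset.sum_nonneg fun _ _ => by positivity
      linarith, fun t ht => ?_⟩
    calc ‖fl A t x‖ = ‖∑ j, fl A t (σ.P j x)‖ := by rw [← map_sum, σ.sum_P]
      _ ≤ ∑ j, c * ‖σ.P j x‖ * Real.exp ((σ.a i + ε) * t) := by
        refine (norm_sum_le _ _).trans (Finset.sum_le_sum fun j _ => ?_)
        by_cases hj : σ.P j x = 0
        · simp [hj]
        · refine (h j x t).trans ?_
          rw [abs_of_nonneg ht]
          calc _ = c * ‖σ.P j x‖ * Real.exp ((σ.a j + ε) * t) := by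
                rw [add_mul, Real.exp_add]; ring
            _ ≤ _ := by gcongr; exact hmax j hj
      _ ≤ _ := by rw [← Finset.sum_mul]; gcongr; linarith
  have lo : ∀ ε > 0, ∃ c > 0, ∀ t ≥ 0, c * Real.exp ((σ.a i - ε) * t) ≤ ‖fl A t x‖ := by
    intro ε hε
    obtain ⟨c, hc, h⟩ := σ.lower_one hε
    have hp : 0 < ‖σ.P i x‖ := norm_pos_iff.2 hi
    refine ⟨‖σ.P i x‖ / (c * (‖σ.P i‖ + 1)), by positivity, fun t ht => ?_⟩
    have h1 := h i x t
    rw [abs_of_nonneg ht, ← P_fl] at h1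
    have h2 : ‖σ.P i (fl A t x)‖ ≤ (‖σ.P i‖ + 1) * ‖fl A t x‖ :=
      (ContinuousLinearMap.le_opNorm _ _).trans (by gcongr; linarith)
    rw [div_mul_eq_mul_div, div_le_iff₀ (by positivity)]
    calc _ ≤ (c * Real.exp (ε * t) * Real.exp (-(σ.a i * t)) * ((‖σ.P i‖ + 1) * ‖fl A t x‖)) *
            Real.exp ((σ.a i - ε) * t) := by gcongr; exact h1.trans (by gcongr)
      _ = (Real.exp (ε * t) * Real.exp (-(σ.a i * t)) * Real.exp ((σ.a i - ε) * t)) *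
          (‖fl A t x‖ * (c * (‖σ.P i‖ + 1))) := by ring
      _ = _ := by
        rw [← Real.exp_add, ← Real.exp_add]
        have : ε * t + -(σ.a i * t) + (σ.a i - ε) * t = 0 := by ring
        rw [this, Real.exp_zero, one_mul]
  rw [Metric.tendsto_atTop]
  intro e he
  obtain ⟨c1, hc1, h1⟩ := up (e/2) (by positivity)
  obtain ⟨c2, hc2, h2⟩ := lo (e/2) (by positivity)
  refine ⟨1 + 2 / e * (|Real.log c1| + |Real.log c2|), fun t ht => ?_⟩
  have ht0 : 0 < t := lt_of_lt_of_le (by positivity) ht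
  have hb : |Real.log c1| + |Real.log c2| < e / 2 * t := by
    have : 2 / e * (|Real.log c1| + |Real.log c2|) < t := by linarith
    rw [div_mul_eq_mul_div, div_lt_iff₀ he] at this
    linarith
  have hn : 0 < ‖fl A t x‖ := norm_pos_iff.2 (hx t)
  have l1 := Real.log_le_log hn (h1 t ht0.le)
  have l2 := Real.log_le_log (by positivity) (h2 t ht0.le)
  rw [Real.log_mul hc1.ne' (Real.exp_pos _).ne', Real.log_exp] at l1
  rw [Real.log_mul hc2.ne' (Real.exp_pos _).ne', Real.log_exp] at l2
  have g1 := le_abs_self (Real.log c1)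
  have g2 := neg_abs_le (Real.log c2)
  have g3 := abs_nonneg (Real.log c1)
  have g4 := abs_nonneg (Real.log c2)
  rw [Real.dist_eq, abs_lt]
  constructor
  · rw [lt_sub_iff_add_lt, lt_div_iff₀ ht0]; nlinarith
  · rw [sub_lt_iff_lt_add, div_lt_iff₀ ht0]; nlinarith

lemma exists_max {x : V} (hx : x ≠ 0) : ∃ i, σ.P i x ≠ 0 ∧ ∀ j, σ.P j x ≠ 0 → σ.a j ≤ σ.a i := by
  classical
  have hne : (Finset.univ.filter fun i => σ.P i x ≠ 0).Nonempty := by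
    by_contra h
    rw [Finset.not_nonempty_iff_eq_empty] at h
    apply hx
    rw [← σ.sum_P x]
    refine Finset.sum_eq_zero fun i _ => ?_
    by_contra h'
    have : i ∈ (Finset.univ.filter fun i => σ.P i x ≠ 0) := by simp [h']
    simp [h] at this
  obtain ⟨i, hi, h⟩ := Finset.exists_max_image _ σ.a hne
  simp only [Finset.mem_filter, Finset.mem_univ, true_and] at hi h
  exact ⟨i, hi, h⟩

/-- The subspace cut out by vanishing of components. -/
def sub (p : Fin σ.q → Prop) : Submodule ℝ V where
  carrier := {x | ∀ i, ¬ p i → σ.P i x = 0}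
  add_mem' := fun {x y} hx hy i hi => by rw [map_add, hx i hi, hy i hi, add_zero]
  zero_mem' := fun i _ => map_zero _
  smul_mem' := fun c x hx i hi => by rw [map_smul, hx i hi, smul_zero]

lemma mem_sub {p : Fin σ.q → Prop} {x : V} : x ∈ σ.sub p ↔ ∀ i, ¬ p i → σ.P i x = 0 := Iff.rfl

end Spl
end Lyap

section Mat
variable {d : ℕ} {A : Matrix (Fin d) (Fin d) ℝ} (σ : Spl (opOf A))

lemma lyapSet_eq (s : ℝ) : lyapSet A s = (σ.sub fun i => σ.a i ≤ s : Submodule ℝ (Euc d)) := by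
  ext x
  by_cases hx : x = 0
  · subst hx; simp [lyapSet]
  obtain ⟨i, hi, hm⟩ := σ.exists_max hx
  have hl : lyap A x = σ.a i := by
    have := (σ.tendsto_lyap i hi hm).limsup_eq
    simpa only [lyap, linFlow_eq] using this
  simp only [lyapSet, Set.mem_setOf_eq, hx, false_or, hl, SetLike.mem_coe, Spl.mem_sub, not_le]
  constructor
  · intro h j hj
    by_contra h'
    linarith [hm j h']
  · intro h
    by_contra h'
    exact hi (h i (not_le.1 h'))

lemma centralSet_eq : centralSet A = (σ.sub fun i => σ.a i = 0 : Submodule ℝ (Euc d)) := by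
  ext x
  simp only [centralSet, Set.mem_setOf_eq, SetLike.mem_coe, Spl.mem_sub, linFlow_eq]
  constructor
  · intro h i hi
    by_contra h'
    have hai : 0 < |σ.a i| := abs_pos.2 hi
    have h1 := h (|σ.a i| / 4) (by positivity)
    obtain ⟨c, hc, h2⟩ := σ.lower_one (ε := |σ.a i| / 4) (by positivity)
    have h3 : Tendsto (fun t => c * ‖σ.P i (Real.exp (-(|σ.a i| / 4 * |t|)) • fl (opOf A) t x)‖)
        (atBot ⊔ atTop) (𝓝 (c * ‖σ.P i 0‖)) :=
      (((σ.P i).continuous.tendsto 0).comp h1).norm.const_mul c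
    rw [map_zero, norm_zero, mul_zero] at h3
    have h4 : ∀ᶠ t : ℝ in atBot ⊔ atTop, c * ‖σ.P i (Real.exp (-(|σ.a i| / 4 * |t|)) • fl (opOf A) t x)‖ < ‖σ.P i x‖ :=
      (tendsto_order.1 h3).2 _ (norm_pos_iff.2 h')
    have key : ∀ t, σ.a i * t = |σ.a i| * |t| → ¬
        c * ‖σ.P i (Real.exp (-(|σ.a i| / 4 * |t|)) • fl (opOf A) t x)‖ < ‖σ.P i x‖ := by
      intro t ht
      rw [not_lt]
      refine (h2 i x t).trans ?_
      rw [map_smul, norm_smul, Real.norm_eq_abs, Real.abs_exp, σ.P_fl, ht, mul_assoc c,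
        ← Real.exp_add, mul_assoc c]
      gcongr
      nlinarith [abs_nonneg t]
    rw [eventually_sup] at h4
    rcases lt_or_gt_of_ne hi with hneg | hpos
    · obtain ⟨t, ht1, ht2⟩ := (h4.1.and (eventually_le_atBot 0)).exists
      exact key t (by rw [abs_of_neg hneg, abs_of_nonpos ht2]; ring) ht1
    · obtain ⟨t, ht1, ht2⟩ := (h4.2.and (eventually_ge_atTop 0)).exists
      exact key t (by rw [abs_of_pos hpos, abs_of_nonneg ht2]) ht1
  · intro h ε hε
    obtain ⟨c, hc, h2⟩ := σ.upper_one (ε := ε / 2) (by positivity)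
    have hle : ∀ t, ‖Real.exp (-(ε * |t|)) • fl (opOf A) t x‖ ≤
        (∑ i, c * ‖σ.P i x‖) * Real.exp (-(ε / 2 * |t|)) := by
      intro t
      rw [norm_smul, Real.norm_eq_abs, Real.abs_exp]
      have h5 : ‖fl (opOf A) t x‖ ≤ (∑ i, c * ‖σ.P i x‖) * Real.exp (ε / 2 * |t|) := by
        calc ‖fl (opOf A) t x‖ = ‖∑ j, fl (opOf A) t (σ.P j x)‖ := by rw [← map_sum, σ.sum_P]
          _ ≤ ∑ j, c * ‖σ.P j x‖ * Real.exp (ε / 2 * |t|) := by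
            refine (norm_sum_le _ _).trans (Finset.sum_le_sum fun j _ => ?_)
            by_cases hj : σ.a j = 0
            · refine (h2 j x t).trans (le_of_eq ?_)
              rw [hj, zero_mul, Real.exp_zero]; ring
            · simp [h j hj]
          _ = _ := by rw [Finset.sum_mul]
      calc _ ≤ Real.exp (-(ε * |t|)) * ((∑ i, c * ‖σ.P i x‖) * Real.exp (ε / 2 * |t|)) := by gcongr
        _ = (∑ i, c * ‖σ.P i x‖) * (Real.exp (-(ε * |t|)) * Real.exp (ε / 2 * |t|)) := by ring
        _ = _ := by rw [← Real.exp_add]; congr 2; ring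
    refine squeeze_zero_norm hle ?_
    have h6 : Tendsto (fun t : ℝ => ε / 2 * |t|) (atBot ⊔ atTop) atTop :=
      Tendsto.const_mul_atTop (by positivity)
        (tendsto_sup.2 ⟨tendsto_abs_atBot_atTop, tendsto_abs_atTop_atTop⟩)
    have := (Real.tendsto_exp_neg_atTop_nhds_zero.comp h6).const_mul (∑ i, c * ‖σ.P i x‖)
    simpa using this

lemma XC_eq : XC A = σ.sub fun i => σ.a i = 0 := by
  rw [XC, centralSet_eq σ, Submodule.span_eq]

lemma ell_eq (s : ℝ) : ell A s = Module.finrank ℝ (σ.sub fun i => σ.a i ≤ s) := by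
  rw [ell, lyapSet_eq σ, Submodule.span_eq]

end Mat
end

section
set_option linter.unusedSectionVars false

section Inter
variable {V W : Type*} [NormedAddCommGroup V] [NormedSpace ℝ V] [CompleteSpace V]
  [NormedAddCommGroup W] [NormedSpace ℝ W] [CompleteSpace W]

lemma fl_intertwine {A : V →L[ℝ] V} {B : W →L[ℝ] W} {L : V →L[ℝ] W}
    (h : ∀ x, L (A x) = B (L x)) (t : ℝ) (x : V) : L (fl A t x) = fl B t (L x) := by
  have hd : ∀ t, HasDerivAt (fun t => fl B (-t) (L (fl A t x))) 0 t := by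
    intro t
    have h1 : HasDerivAt (fun t => fl B (-t)) (-(B * fl B (-t))) t := by
      have := fl_hasDerivAt (-B) t
      have e : fl (-B) = fun t => fl B (-t) := funext fun t => fl_neg B t
      rw [e] at this
      simpa only [neg_mul] using this
    have h2 : HasDerivAt (fun t => L (fl A t x)) (L (A (fl A t x))) t :=
      L.hasFDerivAt.comp_hasDerivAt t (fl_hasDerivAt_apply A x t)
    refine (h1.clm_apply h2).congr_deriv ?_
    have hc : B * fl B (-t) = fl B (-t) * B := (fl_commute (Commute.refl B) (-t)).eq
    rw [hc, h]
    simp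
  have := is_const_of_deriv_eq_zero (fun t => (hd t).differentiableAt) (fun t => (hd t).deriv) t 0
  simp only [neg_zero, fl_zero, ContinuousLinearMap.one_apply] at this
  rw [← this, fl_self_neg]

end Inter

section Cnt
variable {V : Type*} [NormedAddCommGroup V] [NormedSpace ℝ V] [CompleteSpace V]

namespace Spl
variable {A : V →L[ℝ] V} (σ : Spl A)

/-- range of a projection -/
abbrev rg (i : Fin σ.q) : Submodule ℝ V := LinearMap.range (σ.P i : V →ₗ[ℝ] V)

lemma P_rg (i : Fin σ.q) (v : σ.rg i) : σ.P i v = v := by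
  obtain ⟨v, w, rfl⟩ := v
  exact σ.P_idem i w

lemma P_rg' {i j : Fin σ.q} (h : j ≠ i) (v : σ.rg i) : σ.P j v = 0 := by
  rw [← σ.P_rg i v, σ.P_orth h]

open Classical in
/-- Decomposition of `sub p`. -/
def subEquiv (p : Fin σ.q → Prop) : σ.sub p ≃ₗ[ℝ] (∀ i : {i // p i}, σ.rg i.1) where
  toFun x i := ⟨σ.P i.1 x, x, rfl⟩
  map_add' x y := by ext i; simp
  map_smul' c x := by ext i; simp
  invFun v := ⟨∑ i, (v i : V), fun j hj => by
    rw [map_sum]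
    refine Finset.sum_eq_zero fun i _ => σ.P_rg' ?_ _
    rintro rfl
    exact hj i.2⟩
  left_inv x := by
    ext
    simp only
    conv_rhs => rw [← σ.sum_P (x : V)]
    rw [← Fintype.sum_subtype_add_sum_subtype p, left_eq_add]
    exact Finset.sum_eq_zero fun i _ => x.2 i.1 i.2
  right_inv v := by
    ext i
    simp only
    rw [map_sum, Finset.sum_eq_single i, σ.P_rg]
    · intro j _ hj
      exact σ.P_rg' (fun h => hj (Subtype.ext h.symm)) _
    · simp

variable [FiniteDimensional ℝ V]
open Classical in
lemma finrank_sub (p : Fin σ.q → Prop) :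
    Module.finrank ℝ (σ.sub p) = ∑ i, if p i then Module.finrank ℝ (σ.rg i) else 0 := by
  rw [(σ.subEquiv p).finrank_eq, Module.finrank_pi_fintype, ← Finset.sum_filter]
  symm
  apply Finset.sum_subtype
  simp

end Spl

lemma step_exists {ι : Type*} [Fintype ι] (a : ι → ℝ) (r : ι → ℕ) (k : ℕ) (hk : 0 < k)
    (hk' : k ≤ ∑ i, r i) : ∃ m : ℝ, ∀ s, k ≤ (∑ i, if a i ≤ s then r i else 0) ↔ m ≤ s := by
  classical
  set f : ℝ → ℕ := fun s => ∑ i, if a i ≤ s then r i else 0 with hf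
  have mono : Monotone f := by
    intro s t hst
    refine Finset.sum_le_sum fun i _ => ?_
    by_cases h : a i ≤ s
    · rw [if_pos h, if_pos (h.trans hst)]
    · rw [if_neg h]; exact Nat.zero_le _
  have hatt : ∀ s, k ≤ f s → ∃ i, a i ≤ s ∧ k ≤ f (a i) := by
    intro s hs
    have hne : (Finset.univ.filter fun i => a i ≤ s).Nonempty := by
      by_contra h
      rw [Finset.not_nonempty_iff_eq_empty, Finset.filter_eq_empty_iff] at h
      have : f s = 0 := Finset.sum_eq_zero fun i hi => if_neg (h hi)
      omega
    obtain ⟨i, hi, h⟩ := Finset.exists_max_image _ a hne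
    simp only [Finset.mem_filter, Finset.mem_univ, true_and] at hi h
    refine ⟨i, hi, hs.trans (le_of_eq ?_)⟩
    refine Finset.sum_congr rfl fun j _ => ?_
    by_cases hj : a j ≤ s
    · rw [if_pos hj, if_pos (h j hj)]
    · rw [if_neg hj, if_neg fun h' => hj (h'.trans hi)]
  have hne : (Finset.univ.filter fun i => k ≤ f (a i)).Nonempty := by
    have : k ≤ f (∑ i, |a i|) := by
      refine hk'.trans (Finset.sum_le_sum fun i _ => ?_)
      rw [if_pos ((le_abs_self _).trans (Finset.single_le_sum (fun j _ => abs_nonneg (a j)) (Finset.mem_univ i)))]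
    obtain ⟨i, _, h⟩ := hatt _ this
    exact ⟨i, by simp [h]⟩
  obtain ⟨i, hi, h⟩ := Finset.exists_min_image _ a hne
  simp only [Finset.mem_filter, Finset.mem_univ, true_and] at hi h
  refine ⟨a i, fun s => ⟨fun hs => ?_, fun hs => hi.trans (mono hs)⟩⟩
  obtain ⟨j, hj, hj'⟩ := hatt s hs
  exact (h j hj').trans hj

lemma ell_form {d : ℕ} {A : Matrix (Fin d) (Fin d) ℝ} (σ : Spl (opOf A)) (s : ℝ) :
    ell A s = ∑ i, if σ.a i ≤ s then Module.finrank ℝ (σ.rg i) else 0 := by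
  classical
  rw [ell_eq σ, σ.finrank_sub]

lemma sum_rg {V : Type*} [NormedAddCommGroup V] [NormedSpace ℝ V] [CompleteSpace V]
    [FiniteDimensional ℝ V] {A : V →L[ℝ] V} (σ : Spl A) :
    ∑ i, Module.finrank ℝ (σ.rg i) = Module.finrank ℝ V := by
  classical
  have := σ.finrank_sub fun _ => True
  simp only [if_true] at this
  rw [← this]
  have h : σ.sub (fun _ => True) = ⊤ := by
    ext x; simp [Spl.mem_sub]
  rw [h, finrank_top]

lemma lyapExp_iff {d : ℕ} (A : Matrix (Fin d) (Fin d) ℝ) {j : ℕ} (hj : j < d) (s : ℝ) :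
    j + 1 ≤ ell A s ↔ lyapExp A j ≤ s := by
  obtain ⟨σ⟩ := exists_spl (opOf A)
  obtain ⟨m, hm⟩ := step_exists σ.a (fun i => Module.finrank ℝ (σ.rg i)) (j+1) (by omega)
    (by rw [sum_rg]; simpa using hj)
  simp only [← ell_form σ] at hm
  have : lyapExp A j = m := by
    rw [lyapExp]
    have : {s | j + 1 ≤ ell A s} = Set.Ici m := by ext s; simp [hm]
    rw [this, csInf_Ici]
  rw [this, hm]

lemma lyapExp_eq_iff {d : ℕ} (A B : Matrix (Fin d) (Fin d) ℝ) :
    (∀ j < d, lyapExp A j = lyapExp B j) ↔ ∀ s, ell A s = ell B s := by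
  constructor
  · intro h s
    have hA : ell A s ≤ d := (Submodule.finrank_le _).trans (by simp)
    have hB : ell B s ≤ d := (Submodule.finrank_le _).trans (by simp)
    have key : ∀ j < d, (j + 1 ≤ ell A s ↔ j + 1 ≤ ell B s) := fun j hj => by
      rw [lyapExp_iff A hj, lyapExp_iff B hj, h j hj]
    rcases lt_trichotomy (ell A s) (ell B s) with h1 | h1 | h1
    · have := (key (ell A s) (by omega)).2 (by omega); omega
    · exact h1
    · have := (key (ell B s) (by omega)).1 (by omega); omega
  · intro h j _
    simp only [lyapExp, h]
end Cnt
end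

section
set_option linter.unusedSectionVars false

section AH
variable {E F G : Type*} [NormedAddCommGroup E] [NormedSpace ℝ E]
  [NormedAddCommGroup F] [NormedSpace ℝ F] [NormedAddCommGroup G] [NormedSpace ℝ G]

/-- all-Hölder near zero -/
def Hol (f : E → F) : Prop := ∀ γ : ℝ, 0 < γ → γ < 1 → ∃ r > 0, ∃ K : ℝ,
  ∀ x ∈ Metric.ball (0 : E) r, ∀ y ∈ Metric.ball (0 : E) r, dist (f x) (f y) ≤ K * dist x y ^ γ

/-- all-Hölder homeomorphisms -/
structure AH (h : E ≃ₜ F) : Prop where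
  zero : h 0 = 0
  hol : Hol h
  hol' : Hol h.symm

lemma Hol.get {f : E → F} (hf : Hol f) {γ : ℝ} (h0 : 0 < γ) (h1 : γ < 1) :
    ∃ r > 0, ∃ K > 0, ∀ x y, ‖x‖ < r → ‖y‖ < r → ‖f x - f y‖ ≤ K * ‖x - y‖ ^ γ := by
  obtain ⟨r, hr, K, h⟩ := hf γ h0 h1
  refine ⟨r, hr, |K| + 1, by positivity, fun x y hx hy => ?_⟩
  have := h x (by simpa using hx) y (by simpa using hy)
  rw [dist_eq_norm, dist_eq_norm] at this
  refine this.trans ?_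
  gcongr
  linarith [le_abs_self K]

lemma Hol.comp {f : E → F} {g : F → G} (hg : Hol g) (hf : Hol f) (h0 : f 0 = 0)
    (hc : ContinuousAt f 0) : Hol (g ∘ f) := by
  intro γ hγ0 hγ1
  have hs0 : 0 < √γ := Real.sqrt_pos.2 hγ0
  have hs1 : √γ < 1 := by rw [Real.sqrt_lt' one_pos]; simpa using hγ1
  obtain ⟨r, hr, K, hK, h⟩ := hf.get hs0 hs1
  obtain ⟨r', hr', K', hK', h'⟩ := hg.get hs0 hs1
  have hev : ∀ᶠ x in 𝓝 (0 : E), ‖f x‖ < r' := by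
    have h2 : Tendsto (fun x => ‖f x‖) (𝓝 0) (𝓝 ‖f 0‖) := hc.norm
    rw [h0, norm_zero] at h2
    exact (tendsto_order.1 h2).2 r' hr'
  obtain ⟨ρ, hρ, h3⟩ := Metric.eventually_nhds_iff.1 hev
  refine ⟨min r ρ, lt_min hr hρ, K' * K ^ √γ, fun x hx y hy => ?_⟩
  rw [Metric.mem_ball] at hx hy
  have hx' := h3 (hx.trans_le (min_le_right _ _))
  have hy' := h3 (hy.trans_le (min_le_right _ _))
  rw [dist_zero_right] at hx hy
  rw [dist_eq_norm, dist_eq_norm]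
  calc _ ≤ K' * ‖f x - f y‖ ^ √γ := h' _ _ hx' hy'
    _ ≤ K' * (K * ‖x - y‖ ^ √γ) ^ √γ := by
      gcongr
      exact h _ _ (hx.trans_le (min_le_left _ _)) (hy.trans_le (min_le_left _ _))
    _ = _ := by
      rw [Real.mul_rpow hK.le (by positivity), ← Real.rpow_mul (norm_nonneg _),
        Real.mul_self_sqrt hγ0.le, mul_assoc]

lemma AH.symm {h : E ≃ₜ F} (H : AH h) : AH h.symm :=
  ⟨by rw [Homeomorph.symm_apply_eq, H.zero], H.hol', by simpa using H.hol⟩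

lemma AH.trans {h : E ≃ₜ F} {k : F ≃ₜ G} (H : AH h) (H' : AH k) : AH (h.trans k) where
  zero := by simp [H.zero, H'.zero]
  hol := H'.hol.comp H.hol H.zero h.continuous.continuousAt
  hol' := H.hol'.comp H'.hol' H'.symm.zero k.symm.continuous.continuousAt

lemma hol_linear (L : E →L[ℝ] F) : Hol L := by
  intro γ h0 h1
  refine ⟨1/2, by norm_num, ‖L‖, fun x hx y hy => ?_⟩
  rw [Metric.mem_ball] at hx hy
  have hd : dist x y ≤ 1 := by
    have := dist_triangle_right x y 0
    linarith
  rw [dist_eq_norm, ← map_sub]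
  refine (L.le_opNorm _).trans ?_
  gcongr
  rw [← dist_eq_norm]
  calc dist x y = dist x y ^ (1:ℝ) := (Real.rpow_one _).symm
    _ ≤ _ := by
      rcases (dist_nonneg (x := x) (y := y)).eq_or_lt with h | h
      · rw [← h, Real.zero_rpow h0.ne', Real.zero_rpow one_ne_zero]
      · exact Real.rpow_le_rpow_of_exponent_ge h hd h1.le

lemma AH.linear (e : E ≃L[ℝ] F) : AH e.toHomeomorph :=
  ⟨by simp, hol_linear (e : E →L[ℝ] F), hol_linear (e.symm : F →L[ℝ] E)⟩

end AH

section Step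
variable {V : Type*} [NormedAddCommGroup V] [NormedSpace ℝ V] [CompleteSpace V]

lemma fl_sub_le (M : V →L[ℝ] V) {a b c : ℝ} (hc : ∀ s ∈ Set.uIcc a b, ‖fl M s‖ ≤ c) :
    ‖fl M a - fl M b‖ ≤ ‖M‖ * c * |a - b| := by
  have := Convex.norm_image_sub_le_of_norm_hasDerivWithin_le (f := fl M) (f' := fun s => M * fl M s)
    (s := Set.uIcc a b) (C := ‖M‖ * c) (x := b) (y := a)
    (fun s _ => (fl_hasDerivAt M s).hasDerivWithinAt)
    (fun s hs => (norm_mul_le _ _).trans (by gcongr; exact hc s hs))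
    (convex_uIcc a b) Set.right_mem_uIcc Set.left_mem_uIcc
  simpa using this

lemma holder_core (M : V →L[ℝ] V) (θ : V → ℝ) (R : ℝ)
    (H1 : ∀ δ : ℝ, δ > 0 → ∃ C > 0, ∀ x : V, x ≠ 0 → ‖x‖ ≤ R → ∀ s, |s| ≤ |θ x| → ‖fl M s‖ ≤ C * ‖x‖ ^ (-δ))
    (H2 : ∀ δ : ℝ, δ > 0 → ∃ C > 0, ∀ x y : V, x ≠ 0 → y ≠ 0 → ‖x‖ ≤ R → ‖y‖ ≤ ‖x‖ → ‖x‖ ≤ 2 * ‖y‖ →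
      |θ x - θ y| ≤ C * ‖x - y‖ * ‖x‖ ^ (-1 - δ))
    {γ : ℝ} (h0 : 0 < γ) (h1 : γ < 1) :
    ∃ K > 0, ∀ x y : V, ‖x‖ ≤ R → ‖y‖ ≤ R → ‖fl M (θ x) x - fl M (θ y) y‖ ≤ K * ‖x - y‖ ^ γ := by
  obtain ⟨C1, hC1, B1⟩ := H1 (1 - γ) (by linarith)
  obtain ⟨C2, hC2, B2⟩ := H1 ((1 - γ) / 2) (by linarith)
  obtain ⟨C3, hC3, B3⟩ := H2 ((1 - γ) / 2) (by linarith)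
  set c4 : ℝ := ‖M‖ * (C2 * 2 ^ ((1 - γ) / 2)) * C3 with hc4
  have hc40 : 0 ≤ c4 := by positivity
  have small : ∀ x : V, ‖x‖ ≤ R → ‖fl M (θ x) x‖ ≤ C1 * ‖x‖ ^ γ := by
    intro x hx
    by_cases hx0 : x = 0
    · simp only [hx0, map_zero, norm_zero]; positivity
    have hp : 0 < ‖x‖ := norm_pos_iff.2 hx0
    calc _ ≤ ‖fl M (θ x)‖ * ‖x‖ := ContinuousLinearMap.le_opNorm _ _
      _ ≤ C1 * ‖x‖ ^ (-(1 - γ)) * ‖x‖ := by gcongr; exact B1 x hx0 hx _ le_rfl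
      _ = C1 * (‖x‖ ^ (-(1 - γ)) * ‖x‖ ^ (1:ℝ)) := by rw [Real.rpow_one, mul_assoc]
      _ = _ := by rw [← Real.rpow_add hp]; congr 2; ring
  have main : ∀ x y : V, ‖x‖ ≤ R → ‖y‖ ≤ ‖x‖ →
      ‖fl M (θ x) x - fl M (θ y) y‖ ≤ (2 * C1 * 2 ^ γ + C1 + c4) * ‖x - y‖ ^ γ := by
    intro x y hx hyx
    set D := ‖x - y‖ with hD
    have hD0 : 0 ≤ D := norm_nonneg _
    by_cases hcase : ‖x‖ ≤ 2 * D
    · have e1 := small x hx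
      have e2 := small y (hyx.trans hx)
      have e3 : ‖x‖ ^ γ ≤ 2 ^ γ * D ^ γ := by
        rw [← Real.mul_rpow (by norm_num) hD0]; gcongr
      have e4 : ‖y‖ ^ γ ≤ 2 ^ γ * D ^ γ := by
        rw [← Real.mul_rpow (by norm_num) hD0]; gcongr; linarith
      calc _ ≤ ‖fl M (θ x) x‖ + ‖fl M (θ y) y‖ := norm_sub_le _ _
        _ ≤ C1 * (2 ^ γ * D ^ γ) + C1 * (2 ^ γ * D ^ γ) :=
          add_le_add (e1.trans (by gcongr)) (e2.trans (by gcongr))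
        _ = (2 * C1 * 2 ^ γ) * D ^ γ := by ring
        _ ≤ _ := by gcongr; linarith
    · rw [not_le] at hcase
      have hxp : 0 < ‖x‖ := by linarith
      have hx0 : x ≠ 0 := norm_pos_iff.1 hxp
      have hy2 : ‖x‖ ≤ 2 * ‖y‖ := by
        have := norm_sub_norm_le x y
        linarith
      have hyp : 0 < ‖y‖ := by linarith
      have hy0 : y ≠ 0 := norm_pos_iff.1 hyp
      rcases hD0.eq_or_lt with hz | hDp
      · have : x = y := by rw [← sub_eq_zero, ← norm_eq_zero]; exact hz.symm
        subst this
        rw [sub_self, norm_zero]; positivity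
      have hDx : D ≤ ‖x‖ := by linarith
      have hdec : fl M (θ x) x - fl M (θ y) y = fl M (θ x) (x - y) + (fl M (θ x) - fl M (θ y)) y := by
        simp
      have T1 : ‖fl M (θ x) (x - y)‖ ≤ C1 * D ^ γ := by
        calc _ ≤ ‖fl M (θ x)‖ * ‖x - y‖ := ContinuousLinearMap.le_opNorm _ _
          _ ≤ C1 * ‖x‖ ^ (-(1 - γ)) * D := by gcongr; exact B1 x hx0 hx _ le_rfl
          _ ≤ C1 * D ^ (-(1 - γ)) * D := by
            refine mul_le_mul_of_nonneg_right (mul_le_mul_of_nonneg_left ?_ hC1.le) hD0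
            exact Real.rpow_le_rpow_of_nonpos hDp hDx (by linarith)
          _ = C1 * (D ^ (-(1 - γ)) * D ^ (1:ℝ)) := by rw [Real.rpow_one, mul_assoc]
          _ = _ := by rw [← Real.rpow_add hDp]; congr 2; ring
      have hb : ∀ s ∈ Set.uIcc (θ x) (θ y), ‖fl M s‖ ≤ C2 * 2 ^ ((1 - γ) / 2) * ‖x‖ ^ (-((1 - γ) / 2)) := by
        intro s hs
        have hs' : |s| ≤ |θ x| ∨ |s| ≤ |θ y| := by
          rw [Set.mem_uIcc] at hs
          rw [← le_max_iff]
          rcases hs with hs | hs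
          · exact abs_le_max_abs_abs hs.1 hs.2
          · rw [max_comm]; exact abs_le_max_abs_abs hs.1 hs.2
        have hyx2 : ‖y‖ ^ (-((1 - γ) / 2)) ≤ 2 ^ ((1 - γ) / 2) * ‖x‖ ^ (-((1 - γ) / 2)) := by
          calc _ ≤ (‖x‖ / 2) ^ (-((1 - γ) / 2)) :=
                Real.rpow_le_rpow_of_nonpos (by positivity) (by linarith) (by linarith)
            _ = _ := by
              rw [Real.div_rpow hxp.le (by norm_num), Real.rpow_neg (by norm_num : (0:ℝ) ≤ 2),
                div_inv_eq_mul, mul_comm]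
        rcases hs' with h | h
        · refine (B2 x hx0 hx s h).trans ?_
          have : (1:ℝ) ≤ 2 ^ ((1 - γ) / 2) := Real.one_le_rpow (by norm_num) (by linarith)
          gcongr
          nlinarith
        · refine (B2 y hy0 (hyx.trans hx) s h).trans ?_
          rw [mul_assoc]
          gcongr
      have T2 : ‖(fl M (θ x) - fl M (θ y)) y‖ ≤ c4 * D ^ γ := by
        calc _ ≤ ‖fl M (θ x) - fl M (θ y)‖ * ‖y‖ := ContinuousLinearMap.le_opNorm _ _
          _ ≤ (‖M‖ * (C2 * 2 ^ ((1 - γ) / 2) * ‖x‖ ^ (-((1 - γ) / 2))) * |θ x - θ y|) * ‖x‖ := by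
            gcongr
            exact fl_sub_le M hb
          _ ≤ (‖M‖ * (C2 * 2 ^ ((1 - γ) / 2) * ‖x‖ ^ (-((1 - γ) / 2))) *
              (C3 * D * ‖x‖ ^ (-1 - (1 - γ) / 2))) * ‖x‖ := by
            gcongr
            exact B3 x y hx0 hy0 hx hyx hy2
          _ = c4 * D * (‖x‖ ^ (-((1 - γ) / 2)) * ‖x‖ ^ (-1 - (1 - γ) / 2) * ‖x‖ ^ (1:ℝ)) := by
            rw [Real.rpow_one, hc4]; ring
          _ = c4 * D * ‖x‖ ^ (-(1 - γ)) := by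
            rw [← Real.rpow_add hxp, ← Real.rpow_add hxp]; congr 2; ring
          _ ≤ c4 * D * D ^ (-(1 - γ)) := by
            refine mul_le_mul_of_nonneg_left ?_ (by positivity)
            exact Real.rpow_le_rpow_of_nonpos hDp hDx (by linarith)
          _ = c4 * (D ^ (1:ℝ) * D ^ (-(1 - γ))) := by rw [Real.rpow_one, mul_assoc]
          _ = _ := by rw [← Real.rpow_add hDp]; congr 2; ring
      rw [hdec]
      calc _ ≤ C1 * D ^ γ + c4 * D ^ γ := (norm_add_le _ _).trans (add_le_add T1 T2)
        _ = (C1 + c4) * D ^ γ := by ring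
        _ ≤ _ := by
          gcongr
          have : 0 ≤ 2 * C1 * 2 ^ γ := by positivity
          linarith
  refine ⟨2 * C1 * 2 ^ γ + C1 + c4, by positivity, fun x y hx hy => ?_⟩
  rcases le_total ‖y‖ ‖x‖ with h | h
  · exact main x y hx h
  · rw [norm_sub_rev, norm_sub_rev x y]
    exact main y x hy h

end Step
end

section
set_option linter.unusedSectionVars false
set_option linter.deprecated false
set_option linter.unusedVariables false

section Step
variable {V : Type*} [NormedAddCommGroup V] [NormedSpace ℝ V] [CompleteSpace V]

/-- adapted norm -/
def nu (M : V →L[ℝ] V) (ε : ℝ) (v : V) : ℝ := ⨆ t : ℝ, Real.exp (-(ε * |t|)) * ‖fl M t v‖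

section nu
variable {M : V →L[ℝ] V} {ε c : ℝ}

lemma nu_term (hc : ∀ t, ‖fl M t‖ ≤ c * Real.exp (ε * |t|)) (v : V) (t : ℝ) : Real.exp (-(ε * |t|)) * ‖fl M t v‖ ≤ c * ‖v‖ := by
  calc _ ≤ Real.exp (-(ε * |t|)) * ((c * Real.exp (ε * |t|)) * ‖v‖) := by
        gcongr
        exact (ContinuousLinearMap.le_opNorm _ _).trans (by gcongr; exact hc t)
    _ = (Real.exp (-(ε * |t|)) * Real.exp (ε * |t|)) * (c * ‖v‖) := by ring
    _ = _ := by rw [← Real.exp_add, neg_add_cancel, Real.exp_zero, one_mul]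

lemma nu_bdd (hc : ∀ t, ‖fl M t‖ ≤ c * Real.exp (ε * |t|)) (v : V) : BddAbove (Set.range fun t : ℝ => Real.exp (-(ε * |t|)) * ‖fl M t v‖) :=
  ⟨c * ‖v‖, by rintro _ ⟨t, rfl⟩; exact nu_term hc v t⟩

lemma nu_le (hc : ∀ t, ‖fl M t‖ ≤ c * Real.exp (ε * |t|)) (v : V) : nu M ε v ≤ c * ‖v‖ := ciSup_le fun t => nu_term hc v t

lemma le_nu (hc : ∀ t, ‖fl M t‖ ≤ c * Real.exp (ε * |t|)) (v : V) : ‖v‖ ≤ nu M ε v := by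
  have := le_ciSup (nu_bdd hc v) 0
  simpa [nu] using this

lemma nu_pos (hc : ∀ t, ‖fl M t‖ ≤ c * Real.exp (ε * |t|)) {v : V} (hv : v ≠ 0) : 0 < nu M ε v := (norm_pos_iff.2 hv).trans_le (le_nu hc v)

lemma nu_sub (hc : ∀ t, ‖fl M t‖ ≤ c * Real.exp (ε * |t|)) (v w : V) : nu M ε v ≤ nu M ε w + c * ‖v - w‖ := by
  refine ciSup_le fun t => ?_
  have h1 := le_ciSup (nu_bdd hc w) t
  have h2 := nu_term hc (v - w) t
  have h3 : ‖fl M t v‖ ≤ ‖fl M t w‖ + ‖fl M t (v - w)‖ := by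
    have := norm_add_le (fl M t w) (fl M t (v - w))
    rwa [← map_add, add_sub_cancel] at this
  calc _ ≤ Real.exp (-(ε * |t|)) * (‖fl M t w‖ + ‖fl M t (v - w)‖) := by gcongr
    _ ≤ _ := by rw [mul_add]; exact add_le_add h1 h2

lemma nu_smul (hc : ∀ t, ‖fl M t‖ ≤ c * Real.exp (ε * |t|)) {a : ℝ} (ha : 0 < a) (v : V) : nu M ε (a • v) = a * nu M ε v := by
  rw [nu, nu, Real.mul_iSup_of_nonneg ha.le]
  congr 1; ext t
  rw [map_smul, norm_smul, Real.norm_eq_abs, abs_of_pos ha]; ring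

lemma nu_fl (hc : ∀ t, ‖fl M t‖ ≤ c * Real.exp (ε * |t|)) (hε : 0 ≤ ε) (s : ℝ) (v : V) : nu M ε (fl M s v) ≤ Real.exp (ε * |s|) * nu M ε v := by
  refine ciSup_le fun t => ?_
  have h1 := le_ciSup (nu_bdd hc v) (t + s)
  rw [← fl_add_apply]
  calc _ = Real.exp (-(ε * |t|)) * Real.exp (ε * |t + s|) *
        (Real.exp (-(ε * |t + s|)) * ‖fl M (t + s) v‖) := by
        rw [← mul_assoc, mul_assoc (Real.exp (-(ε * |t|))), ← Real.exp_add, add_neg_cancel,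
          Real.exp_zero, mul_one]
    _ ≤ Real.exp (ε * |s|) * nu M ε v := by
        have : Real.exp (-(ε * |t|)) * Real.exp (ε * |t + s|) ≤ Real.exp (ε * |s|) := by
          rw [← Real.exp_add]
          apply Real.exp_le_exp.2
          nlinarith [abs_add_le t s]
        gcongr
        exact h1

lemma log_nu_fl (hc : ∀ t, ‖fl M t‖ ≤ c * Real.exp (ε * |t|)) (hε : 0 ≤ ε) (s : ℝ) {v : V} (hv : v ≠ 0) :
    |Real.log (nu M ε (fl M s v)) - Real.log (nu M ε v)| ≤ ε * |s| := by
  have hv' : fl M s v ≠ 0 := fun h => hv (by rw [← fl_neg_self M s v, h, map_zero])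
  have h1 := Real.log_le_log (nu_pos hc hv') (nu_fl hc hε s v)
  have h2 := nu_fl hc hε (-s) (fl M s v)
  rw [fl_neg_self] at h2
  have h2 := Real.log_le_log (nu_pos hc hv) h2
  rw [Real.log_mul (Real.exp_pos _).ne' (nu_pos hc hv).ne', Real.log_exp] at h1
  rw [Real.log_mul (Real.exp_pos _).ne' (nu_pos hc hv').ne', Real.log_exp, abs_neg] at h2
  rw [abs_le]; constructor <;> linarith

lemma log_nu_lip (hc : ∀ t, ‖fl M t‖ ≤ c * Real.exp (ε * |t|)) (hc0 : 0 < c) {v w : V} {m : ℝ} (hm : 0 < m) (hv : m ≤ ‖v‖) (hw : m ≤ ‖w‖) :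
    |Real.log (nu M ε v) - Real.log (nu M ε w)| ≤ c * ‖v - w‖ / m := by
  have aux : ∀ v w : V, m ≤ ‖v‖ → m ≤ ‖w‖ →
      Real.log (nu M ε v) - Real.log (nu M ε w) ≤ c * ‖v - w‖ / m := by
    intro v w hv hw
    have pv : 0 < nu M ε v := (hm.trans_le hv).trans_le (le_nu hc v)
    have pw : m ≤ nu M ε w := hw.trans (le_nu hc w)
    have pw' : 0 < nu M ε w := hm.trans_le pw
    rw [← Real.log_div pv.ne' pw'.ne']
    have h1 := Real.log_le_sub_one_of_pos (div_pos pv pw')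
    refine h1.trans ?_
    rw [div_sub_one pw'.ne', div_le_div_iff₀ pw' hm]
    have h2 := nu_sub hc v w
    have : 0 ≤ c * ‖v - w‖ := by positivity
    calc (nu M ε v - nu M ε w) * m ≤ (c * ‖v - w‖) * m := by gcongr; linarith
      _ ≤ _ := by gcongr
  rw [abs_le]
  have := aux v w hv hw
  have := aux w v hw hv
  rw [norm_sub_rev] at this
  constructor <;> linarith

end nu

lemma H1_of_log {M : V →L[ℝ] V} (hM : SubExp M) {θ : V → ℝ} {c1 c2 R : ℝ} (hc2 : 0 < c2)
    (hR : 0 < R) (h : ∀ x, x ≠ 0 → |θ x| ≤ c1 + c2 * |Real.log ‖x‖|) :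
    ∀ δ : ℝ, δ > 0 → ∃ C > 0, ∀ x : V, x ≠ 0 → ‖x‖ ≤ R → ∀ s, |s| ≤ |θ x| →
      ‖fl M s‖ ≤ C * ‖x‖ ^ (-δ) := by
  intro δ hδ
  obtain ⟨c, hc, hb⟩ := hM (δ / c2) (by positivity)
  refine ⟨c * Real.exp (δ / c2 * c1 + δ * (2 * |Real.log R|)), by positivity, fun x hx hxR s hs => ?_⟩
  have hp : 0 < ‖x‖ := norm_pos_iff.2 hx
  refine (hb s).trans ?_
  rw [Real.rpow_def_of_pos hp, mul_assoc, ← Real.exp_add]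
  gcongr
  have h1 := h x hx
  have h2 : |Real.log ‖x‖| ≤ -Real.log ‖x‖ + 2 * |Real.log R| := by
    have := Real.log_le_log hp hxR
    rcases abs_cases (Real.log ‖x‖) with h | h <;> rcases abs_cases (Real.log R) with h' | h' <;>
      linarith
  calc δ / c2 * |s| ≤ δ / c2 * (c1 + c2 * (-Real.log ‖x‖ + 2 * |Real.log R|)) := by
        gcongr
        refine hs.trans (h1.trans ?_)
        gcongr
    _ = _ := by field_simp; ring

/-- Change of the time normalisation in one hyperbolic block. -/
theorem step_conj {A P M : V →L[ℝ] V} {lam : ℝ} (hlam : lam ≠ 0) (hPP : P * P = P)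
    (hMP : M * P = M) (hPM : P * M = M) (hAM : Commute A M) (hPA : Commute P A)
    (hAP : (A - M) * P = lam • P) (hM : SubExp M) :
    ∃ g : V ≃ₜ V, AH g ∧ ∀ t x, g (fl (A - M) t x) = fl A t (g x) := by
  have hl : 0 < |lam| := abs_pos.2 hlam
  set ε := |lam| / 2 with hεd
  have hε : 0 < ε := by positivity
  obtain ⟨c, hc0, hc⟩ := hM ε hε
  set th : V → ℝ := fun v => Real.log (nu M ε v) / lam with hth
  have hPcM : Commute P M := by rw [commute_iff_eq, hMP, hPM]
  have P_fl : ∀ s x, P (fl M s x) = fl M s (P x) := by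
    intro s x
    have := congrArg (fun L : V →L[ℝ] V => L x) (fl_commute hPcM s).eq
    simpa using this
  have fl_ne : ∀ s {v : V}, v ≠ 0 → fl M s v ≠ 0 := by
    intro s v hv h
    exact hv (by rw [← fl_neg_self M s v, h, map_zero])
  have th_zero : th 0 = 0 := by
    have : nu M ε (0 : V) = 0 := by simp [nu]
    simp [hth, this]
  have th_fl : ∀ s (v : V), |th (fl M s v) - th v| ≤ 1 / 2 * |s| := by
    intro s v
    by_cases hv : v = 0
    · rw [hv, map_zero, sub_self, abs_zero]; positivity
    rw [hth]; simp only
    rw [← sub_div, abs_div, div_le_iff₀ hl]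
    refine (log_nu_fl hc hε.le s hv).trans (le_of_eq ?_)
    rw [hεd]; ring
  -- fixed point
  have hfix : ∀ z : V, ∃ s : ℝ, th (fl M (-s) z) = s := by
    intro z
    have hcw : ContractingWith (1/2 : NNReal) (fun s : ℝ => th (fl M (-s) z)) := by
      refine ⟨by norm_num, LipschitzWith.of_dist_le_mul fun s s' => ?_⟩
      have := th_fl (s' - s) (fl M (-s') z)
      rw [← fl_add_apply] at this
      have e : s' - s + -s' = -s := by ring
      rw [e] at this
      rw [Real.dist_eq, Real.dist_eq, abs_sub_comm s s']
      simpa using this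
    exact ⟨_, hcw.fixedPoint_isFixedPt⟩
  choose th1 hth1 using hfix
  have uniq : ∀ (z : V) s s', th (fl M (-s) z) = s → th (fl M (-s') z) = s' → s = s' := by
    intro z s s' h h'
    have := th_fl (s' - s) (fl M (-s') z)
    rw [← fl_add_apply] at this
    have e : s' - s + -s' = -s := by ring
    rw [e, h, h', abs_sub_comm s s'] at this
    have h0 : |s' - s| = 0 := by linarith [abs_nonneg (s' - s)]
    linarith [abs_eq_zero.1 h0]
  -- bounds
  have th_bd : ∀ x : V, x ≠ 0 → |th x| ≤ |Real.log c| / |lam| + 1 / |lam| * |Real.log ‖x‖| := by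
    intro x hx
    have hp := norm_pos_iff.2 hx
    have h1 := Real.log_le_log hp (le_nu hc x)
    have h2 := Real.log_le_log (nu_pos hc hx) (nu_le hc x)
    rw [Real.log_mul hc0.ne' hp.ne'] at h2
    have h3 : |Real.log (nu M ε x)| ≤ |Real.log c| + |Real.log ‖x‖| := by
      rw [abs_le]
      constructor
      · linarith [neg_abs_le (Real.log ‖x‖), abs_nonneg (Real.log c)]
      · linarith [le_abs_self (Real.log ‖x‖), le_abs_self (Real.log c)]
    simp only [hth]
    rw [abs_div, div_le_iff₀ hl]
    refine h3.trans (le_of_eq ?_)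
    field_simp
  have th1_le : ∀ x : V, |th1 x| ≤ 2 * |th x| := by
    intro x
    have := th_fl (-(th1 x)) x
    rw [hth1, abs_neg] at this
    have h2 := abs_sub_abs_le_abs_sub (th1 x) (th x)
    linarith
  have th1_bd : ∀ x : V, x ≠ 0 →
      |-th1 x| ≤ 2 * (|Real.log c| / |lam|) + 2 * (1 / |lam|) * |Real.log ‖x‖| := by
    intro x hx
    have h1 := th1_le x
    have h2 := th_bd x hx
    rw [abs_neg]; linarith
  have L0 : ∀ R > 0, ∀ δ : ℝ, δ > 0 → ∃ C > 0, ∀ x : V, x ≠ 0 → ‖x‖ ≤ R → ∀ s, |s| ≤ |-th1 x| →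
      ‖fl M s‖ ≤ C * ‖x‖ ^ (-δ) := fun R hR => H1_of_log hM (by positivity) hR th1_bd
  -- Hölder for both maps
  have K0 : ∀ R > 0, ∀ γ : ℝ, 0 < γ → γ < 1 → ∃ K > 0, ∀ x y : V, ‖x‖ ≤ R → ‖y‖ ≤ R →
      ‖fl M (th x) x - fl M (th y) y‖ ≤ K * ‖x - y‖ ^ γ := by
    intro R hR γ h0 h1
    refine holder_core M th R (H1_of_log hM (by positivity) hR th_bd) ?_ h0 h1
    intro δ hδ
    refine ⟨2 * c / |lam| * R ^ δ, by positivity, fun x y hx hy hxR hyx hxy => ?_⟩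
    have hp := norm_pos_iff.2 hx
    have h3 := log_nu_lip hc hc0 (v := x) (w := y) (m := ‖x‖ / 2) (by positivity) (by linarith)
      (by linarith)
    simp only [hth]
    rw [← sub_div, abs_div, div_le_iff₀ hl]
    refine h3.trans ?_
    have h4 : 1 ≤ R ^ δ * ‖x‖ ^ (-δ) := by
      rw [Real.rpow_neg hp.le, ← div_eq_mul_inv, le_div_iff₀ (by positivity), one_mul]
      gcongr
    have h5 : ‖x‖ ^ (-1 - δ) = ‖x‖⁻¹ * ‖x‖ ^ (-δ) := by
      rw [sub_eq_add_neg, Real.rpow_add hp, Real.rpow_neg_one]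
    calc _ = 2 * c * ‖x - y‖ * ‖x‖⁻¹ * 1 := by field_simp
      _ ≤ 2 * c * ‖x - y‖ * ‖x‖⁻¹ * (R ^ δ * ‖x‖ ^ (-δ)) := by gcongr
      _ = _ := by rw [h5]; field_simp
  have K1 : ∀ R > 0, ∀ γ : ℝ, 0 < γ → γ < 1 → ∃ K > 0, ∀ x y : V, ‖x‖ ≤ R → ‖y‖ ≤ R →
      ‖fl M (-th1 x) x - fl M (-th1 y) y‖ ≤ K * ‖x - y‖ ^ γ := by
    intro R hR γ h0 h1
    refine holder_core M (fun x => -th1 x) R (L0 R hR) ?_ h0 h1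
    intro δ hδ
    obtain ⟨C, hC, hb⟩ := L0 R hR (δ / 2) (by positivity)
    refine ⟨2 * (c * C * C * 2) / |lam|, by positivity, fun x y hx hy hxR hyx hxy => ?_⟩
    have hp := norm_pos_iff.2 hx
    set u := ‖x‖ ^ (-(δ / 2)) with hu
    have hu0 : 0 < u := by positivity
    have low : ∀ v : V, ‖v‖ ≤ C * u * ‖fl M (-th1 x) v‖ := by
      intro v
      calc ‖v‖ = ‖fl M (th1 x) (fl M (-th1 x) v)‖ := by rw [fl_self_neg]
        _ ≤ ‖fl M (th1 x)‖ * ‖fl M (-th1 x) v‖ := ContinuousLinearMap.le_opNorm _ _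
        _ ≤ _ := by gcongr; exact hb x hx hxR _ (by rw [abs_neg])
    have h3 := log_nu_lip hc hc0 (v := fl M (-th1 x) x) (w := fl M (-th1 x) y)
      (m := ‖x‖ / (2 * (C * u))) (by positivity)
      (by rw [div_le_iff₀ (by positivity)]; linarith [low x, norm_nonneg x])
      (by rw [div_le_iff₀ (by positivity)]; linarith [low y, norm_nonneg y])
    have h6 := th_fl (th1 y - th1 x) (fl M (-th1 y) y)
    rw [← fl_add_apply] at h6
    have e : th1 y - th1 x + -th1 y = -th1 x := by ring
    rw [e, hth1] at h6
    have h7 : |th (fl M (-th1 x) x) - th (fl M (-th1 x) y)| ≤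
        (c * ‖fl M (-th1 x) x - fl M (-th1 x) y‖ / (‖x‖ / (2 * (C * u)))) / |lam| := by
      simp only [hth]
      rw [← sub_div, abs_div]
      gcongr
    rw [hth1] at h7
    have h8 : |th1 x - th1 y| ≤ 2 * ((c * ‖fl M (-th1 x) x - fl M (-th1 x) y‖ /
        (‖x‖ / (2 * (C * u)))) / |lam|) := by
      have := abs_sub_le (th1 x) (th (fl M (-th1 x) y)) (th1 y)
      rw [abs_sub_comm (th1 y) (th1 x)] at h6
      linarith
    have h9 : ‖fl M (-th1 x) x - fl M (-th1 x) y‖ ≤ C * u * ‖x - y‖ := by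
      rw [← map_sub]
      exact (ContinuousLinearMap.le_opNorm _ _).trans (by gcongr; exact hb x hx hxR _ le_rfl)
    have h5 : ‖x‖ ^ (-1 - δ) = ‖x‖⁻¹ * (u * u) := by
      rw [hu, ← Real.rpow_neg_one, ← Real.rpow_add hp, ← Real.rpow_add hp]; congr 1; ring
    have : |-th1 x - -th1 y| = |th1 x - th1 y| := by
      rw [← abs_neg]; congr 1; ring
    rw [this]
    refine h8.trans ?_
    calc _ ≤ 2 * ((c * (C * u * ‖x - y‖) / (‖x‖ / (2 * (C * u)))) / |lam|) := by gcongr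
      _ = _ := by rw [h5]; field_simp
  -- splitting
  have spl : ∀ s x, fl M s x = (x - P x) + fl M s (P x) := by
    intro s x
    have h1 : fl M s * (1 - P) = 1 - P := rot_fl_zero (by rw [mul_sub, hMP, mul_one, sub_self]) s
    have h2 := congrArg (fun L : V →L[ℝ] V => L x) h1
    simp only [ContinuousLinearMap.mul_apply, ContinuousLinearMap.sub_apply,
      ContinuousLinearMap.one_apply, map_sub] at h2
    rw [← h2]; abel
  have hol_ext : ∀ ϑ : V → ℝ, (∀ R > 0, ∀ γ : ℝ, 0 < γ → γ < 1 → ∃ K > 0, ∀ x y : V,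
      ‖x‖ ≤ R → ‖y‖ ≤ R → ‖fl M (ϑ x) x - fl M (ϑ y) y‖ ≤ K * ‖x - y‖ ^ γ) →
      Hol (fun x => fl M (ϑ (P x)) x) ∧ Continuous (fun x => fl M (ϑ (P x)) x) := by
    intro ϑ hϑ
    have hfun : (fun x => fl M (ϑ (P x)) x) = fun x => (1 - P) x + fl M (ϑ (P x)) (P x) := by
      funext x; rw [spl]; simp
    have hcont0 : Continuous (fun v => fl M (ϑ v) v) := by
      rw [continuous_iff_continuousAt]
      intro v
      obtain ⟨K, hK, h⟩ := hϑ (‖v‖ + 1) (by positivity) (1/2) (by norm_num) (by norm_num)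
      rw [ContinuousAt, tendsto_iff_norm_sub_tendsto_zero]
      have hlim : Tendsto (fun w => K * ‖w - v‖ ^ (1/2 : ℝ)) (𝓝 v) (𝓝 0) := by
        have h1 : Tendsto (fun w => ‖w - v‖) (𝓝 v) (𝓝 0) := by
          have := (continuous_id.sub continuous_const : Continuous fun w : V => w - v).norm.tendsto v
          simpa using this
        have := (h1.rpow_const (p := 1/2) (Or.inr (by norm_num))).const_mul K
        rwa [Real.zero_rpow (by norm_num), mul_zero] at this
      refine squeeze_zero' (Eventually.of_forall fun _ => norm_nonneg _) ?_ hlim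
      filter_upwards [Metric.ball_mem_nhds v one_pos] with w hw
      rw [Metric.mem_ball, dist_eq_norm] at hw
      refine h w v ?_ (by linarith)
      have := norm_sub_norm_le w v
      linarith
    refine ⟨?_, ?_⟩
    · intro γ h0 h1
      obtain ⟨r, hr, K, hK, h⟩ := (hol_linear (1 - P)).get h0 h1
      obtain ⟨K', hK', h'⟩ := hϑ ((‖P‖ + 1) * r) (by positivity) γ h0 h1
      refine ⟨r, hr, K + K' * ‖P‖ ^ γ, fun x hx y hy => ?_⟩
      rw [mem_ball_zero_iff] at hx hy
      have bP : ∀ x : V, ‖x‖ < r → ‖P x‖ ≤ (‖P‖ + 1) * r := fun x hx => by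
        refine (P.le_opNorm x).trans ?_
        gcongr
        linarith
      have h2 := h x y hx hy
      have h3 := h' (P x) (P y) (bP x hx) (bP y hy)
      have h4 : ‖P x - P y‖ ^ γ ≤ ‖P‖ ^ γ * ‖x - y‖ ^ γ := by
        rw [← Real.mul_rpow (norm_nonneg _) (norm_nonneg _), ← map_sub]
        gcongr
        exact P.le_opNorm _
      rw [hfun, dist_eq_norm, dist_eq_norm]
      simp only
      rw [add_sub_add_comm]
      refine (norm_add_le _ _).trans ?_
      rw [add_mul]
      refine add_le_add h2 (h3.trans ?_)
      rw [mul_assoc]; gcongr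
    · rw [hfun]
      exact (1 - P).continuous.add (hcont0.comp P.continuous)
  obtain ⟨F_hol, F_cont⟩ := hol_ext th K0
  obtain ⟨G_hol, G_cont⟩ := hol_ext (fun x => -th1 x) K1
  let g : V ≃ₜ V :=
    { toFun := fun x => fl M (th (P x)) x
      invFun := fun z => fl M (-th1 (P z)) z
      left_inv := fun x => by
        simp only
        have : th1 (P (fl M (th (P x)) x)) = th (P x) := by
          refine uniq _ _ _ (hth1 _) ?_
          rw [P_fl, fl_neg_self]
        rw [this, fl_neg_self]
      right_inv := fun z => by
        simp only
        rw [P_fl, hth1, fl_self_neg]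
      continuous_toFun := F_cont
      continuous_invFun := G_cont }
  refine ⟨g, ⟨?_, F_hol, G_hol⟩, fun t x => ?_⟩
  · change fl M _ 0 = 0
    exact map_zero _
  · change fl M (th (P (fl (A - M) t x))) (fl (A - M) t x) = fl A t (fl M (th (P x)) x)
    have hcomm : Commute P (A - M) := hPA.sub_right hPcM
    have e1 : P (fl (A - M) t x) = Real.exp (lam * t) • P x := by
      have h1 := congrArg (fun L : V →L[ℝ] V => L x) (fl_commute hcomm t).eq
      have h2 := congrArg (fun L : V →L[ℝ] V => L x)
        (fl_mul_congr (X := A - M) (Y := lam • 1) (P := P) (by rw [hAP]; simp)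
          ((Commute.one_left _).smul_left _) t)
      simp only [ContinuousLinearMap.mul_apply, fl_scalar, ContinuousLinearMap.smul_apply,
        ContinuousLinearMap.one_apply] at h1 h2
      rw [h1, h2]
    have e2 : P x ≠ 0 → th (Real.exp (lam * t) • P x) = t + th (P x) := by
      intro h
      simp only [hth]
      rw [nu_smul hc (Real.exp_pos _), Real.log_mul (Real.exp_pos _).ne' (nu_pos hc h).ne',
        Real.log_exp]
      field_simp
    have e3 : fl A t = fl (A - M) t * fl M t := by
      have : Commute (A - M) M := hAM.sub_left (Commute.refl M)
      rw [← fl_add_op this, sub_add_cancel]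
    have e4 : ∀ s y, fl M s (fl (A - M) t y) = fl (A - M) t (fl M s y) := by
      intro s y
      have hcm : Commute (fl M s) (A - M) :=
        (fl_commute (hAM.sub_left (Commute.refl M)) s).symm
      have h1 := congrArg (fun L : V →L[ℝ] V => L y) (fl_commute hcm t).eq
      simpa using h1
    rw [e1, e4, e3, ContinuousLinearMap.mul_apply]
    congr 1
    by_cases h : P x = 0
    · have : ∀ s, fl M s x = x := fun s => by rw [spl, h]; simp
      rw [this, this, this]
    · rw [e2 h, fl_add_apply]

end Step
end

section
set_option linter.unusedSectionVars false
set_option linter.deprecated false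
set_option linter.unusedVariables false

/-- Model flow: diagonal hyperbolic part times a central part. -/
structure Mdl (ι C : Type*) [Fintype ι] [NormedAddCommGroup C] [NormedSpace ℝ C]
    [FiniteDimensional ℝ C] where
  lam : ι → ℝ
  lam_ne : ∀ i, lam i ≠ 0
  Ac : C →L[ℝ] C
  σ : Spl Ac
  hz : Ac = σ.K + σ.N

namespace Mdl
variable {ι C : Type*} [Fintype ι] [NormedAddCommGroup C] [NormedSpace ℝ C]
    [FiniteDimensional ℝ C] (M : Mdl ι C)

/-- generator -/
def gen : ((ι → ℝ) × C) →L[ℝ] ((ι → ℝ) × C) :=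
  (ContinuousLinearMap.pi fun i => M.lam i • ContinuousLinearMap.proj i).prodMap M.Ac

lemma gen_apply (x : (ι → ℝ) × C) : M.gen x = (fun i => M.lam i * x.1 i, M.Ac x.2) := by
  ext <;> simp [gen]

/-- the model flow -/
def φ (t : ℝ) (x : (ι → ℝ) × C) : (ι → ℝ) × C := fl M.gen t x

lemma φ_snd (t : ℝ) (x : (ι → ℝ) × C) : (M.φ t x).2 = fl M.Ac t x.2 := by
  haveI : CompleteSpace C := FiniteDimensional.complete ℝ C
  exact fl_intertwine (A := M.gen) (B := M.Ac) (L := ContinuousLinearMap.snd ℝ (ι → ℝ) C)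
    (fun x => by simp [gen_apply]) t x

lemma φ_fst (t : ℝ) (x : (ι → ℝ) × C) (i : ι) :
    (M.φ t x).1 i = Real.exp (M.lam i * t) * x.1 i := by
  haveI : CompleteSpace C := FiniteDimensional.complete ℝ C
  have := fl_intertwine (A := M.gen) (B := M.lam i • (1 : ℝ →L[ℝ] ℝ))
    (L := (ContinuousLinearMap.proj i).comp (ContinuousLinearMap.fst ℝ (ι → ℝ) C))
    (fun x => by simp [gen_apply]) t x
  rw [fl_scalar] at this
  simpa [φ] using this

lemma φ_eq (t : ℝ) (x : (ι → ℝ) × C) :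
    M.φ t x = (fun i => Real.exp (M.lam i * t) * x.1 i, fl M.Ac t x.2) := by
  ext
  · exact M.φ_fst t x _
  · exact M.φ_snd t x

/-- time scaling -/
def scale (α : ℝ) (hα : α ≠ 0) : Mdl ι C where
  lam i := α * M.lam i
  lam_ne i := mul_ne_zero hα (M.lam_ne i)
  Ac := α • M.Ac
  σ := M.σ.scale α
  hz := by
    have := congrArg (fun L => α • L) M.hz
    simpa [Spl.scale, smul_add] using this

lemma φ_scale (α : ℝ) (hα : α ≠ 0) (t : ℝ) (x : (ι → ℝ) × C) :
    (M.scale α hα).φ t x = M.φ (t * α) x := by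
  rw [φ_eq, φ_eq]
  ext
  · simp only [scale]; congr 2; ring
  · simp only [scale]; rw [fl_smul]

/-- orbits -/
def orb (x : (ι → ℝ) × C) : Set ((ι → ℝ) × C) := Set.range fun t => M.φ t x

end Mdl

section Build
variable {V : Type*} [NormedAddCommGroup V] [NormedSpace ℝ V] [CompleteSpace V]

lemma Spl.A_eq {A : V →L[ℝ] V} (σ : Spl A) (x : V) :
    A x = ∑ i, σ.a i • σ.P i x + (σ.K + σ.N) x := by
  have := congrArg (fun L : V →L[ℝ] V => L x) σ.dec
  simpa [add_assoc] using this

lemma Spl.A_KN {A : V →L[ℝ] V} (σ : Spl A) : Commute A (σ.K + σ.N) := by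
  rw [commute_iff_eq]
  ext x
  simp only [ContinuousLinearMap.mul_apply]
  rw [σ.A_eq, σ.A_eq x, map_add, map_sum]
  congr 1
  refine Finset.sum_congr rfl fun i _ => ?_
  have := congrArg (fun L : V →L[ℝ] V => L x) (σ.PKN i).eq
  simp only [ContinuousLinearMap.mul_apply] at this
  rw [map_smul, this]

lemma Spl.center_of_subExp {A : V →L[ℝ] V} (σ : Spl A) (h : SubExp A) : A = σ.K + σ.N := by
  have key : ∀ i x, σ.a i ≠ 0 → σ.P i x = 0 := by
    intro i x hi
    have hai : 0 < |σ.a i| := abs_pos.2 hi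
    obtain ⟨c, hc, h1⟩ := σ.lower_one (ε := |σ.a i| / 4) (by positivity)
    obtain ⟨c', hc', h2⟩ := h (|σ.a i| / 4) (by positivity)
    have h3 : ∀ T ≥ 0, ‖σ.P i x‖ ≤ c * c' * ‖σ.P i x‖ * Real.exp (-(|σ.a i| / 2 * T)) := by
      intro T hT
      obtain ⟨t, ht1, ht2⟩ : ∃ t, |t| = T ∧ σ.a i * t = |σ.a i| * T := by
        rcases lt_or_gt_of_ne hi with hneg | hpos
        · exact ⟨-T, by rw [abs_neg, abs_of_nonneg hT], by rw [abs_of_neg hneg]; ring⟩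
        · exact ⟨T, abs_of_nonneg hT, by rw [abs_of_pos hpos]⟩
      have h4 := h1 i x t
      have h5 : ‖fl A t (σ.P i x)‖ ≤ c' * Real.exp (|σ.a i| / 4 * T) * ‖σ.P i x‖ :=
        (ContinuousLinearMap.le_opNorm _ _).trans (by gcongr; rw [← ht1]; exact h2 t)
      rw [ht1, ht2] at h4
      refine h4.trans ?_
      calc _ ≤ c * Real.exp (|σ.a i| / 4 * T) * Real.exp (-(|σ.a i| * T)) *
            (c' * Real.exp (|σ.a i| / 4 * T) * ‖σ.P i x‖) := by gcongr
        _ = c * c' * ‖σ.P i x‖ * (Real.exp (|σ.a i| / 4 * T) * Real.exp (-(|σ.a i| * T)) *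
            Real.exp (|σ.a i| / 4 * T)) := by ring
        _ = _ := by rw [← Real.exp_add, ← Real.exp_add]; congr 2; ring
    have h6 : Tendsto (fun T : ℝ => c * c' * ‖σ.P i x‖ * Real.exp (-(|σ.a i| / 2 * T))) atTop (𝓝 0) := by
      have h7 : Tendsto (fun T : ℝ => |σ.a i| / 2 * T) atTop atTop :=
        tendsto_id.const_mul_atTop (by positivity)
      have := (Real.tendsto_exp_neg_atTop_nhds_zero.comp h7).const_mul (c * c' * ‖σ.P i x‖)
      simpa using this
    have := ge_of_tendsto h6 (eventually_atTop.2 ⟨0, h3⟩)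
    exact norm_le_zero_iff.1 this
  ext x
  rw [σ.A_eq]
  rw [Finset.sum_eq_zero, zero_add]
  intro i _
  by_cases hi : σ.a i = 0
  · rw [hi, zero_smul]
  · rw [key i x hi, smul_zero]

lemma subExp_block {X P : V →L[ℝ] V} (hX : SubExp X) (hPP : P * P = P) (hc : Commute P X) :
    SubExp (X * P) := by
  intro ε hε
  obtain ⟨c, hc0, h⟩ := hX ε hε
  refine ⟨‖1 - P‖ + c * ‖P‖ + 1, by positivity, fun t => ?_⟩
  have e1 : fl (X * P) t * P = fl X t * P :=
    fl_mul_congr (by rw [mul_assoc, hPP]) hc.symm t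
  have e2 : fl (X * P) t * (1 - P) = 1 - P :=
    rot_fl_zero (by rw [mul_sub, mul_one, mul_assoc, hPP, sub_self]) t
  have e3 : fl (X * P) t = (1 - P) + fl X t * P := by
    rw [← e1, ← e2, ← mul_add, sub_add_cancel, mul_one]
  have h1 : 1 ≤ Real.exp (ε * |t|) := Real.one_le_exp (by positivity)
  rw [e3]
  calc _ ≤ ‖1 - P‖ * Real.exp (ε * |t|) + c * Real.exp (ε * |t|) * ‖P‖ := by
        refine (norm_add_le _ _).trans (add_le_add ?_ ?_)
        · exact le_mul_of_one_le_right (norm_nonneg _) h1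
        · exact (norm_mul_le _ _).trans (by gcongr; exact h t)
    _ = (‖1 - P‖ + c * ‖P‖) * Real.exp (ε * |t|) := by ring
    _ ≤ _ := by gcongr ?_ * _; linarith

lemma multi_step {A : V →L[ℝ] V} (σ : Spl A) (s : Finset (Fin σ.q)) (hs : ∀ i ∈ s, σ.a i ≠ 0) :
    ∃ g : V ≃ₜ V, AH g ∧
      ∀ t x, g (fl (A - ∑ i ∈ s, (σ.K + σ.N) * σ.P i) t x) = fl A t (g x) := by
  classical
  induction s using Finset.induction_on with
  | empty =>
    refine ⟨Homeomorph.refl V, ?_, fun t x => by simp⟩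
    exact AH.linear (ContinuousLinearEquiv.refl ℝ V)
  | insert j s hj ih =>
    obtain ⟨g, hg, hgc⟩ := ih fun i hi => hs i (Finset.mem_insert_of_mem hi)
    set A1 := A - ∑ i ∈ s, (σ.K + σ.N) * σ.P i with hA1
    have hPc : ∀ i, Commute (σ.P j) (σ.P i) := by
      intro i
      by_cases hij : j = i
      · rw [hij]
      · rw [commute_iff_eq, σ.orth j i hij, σ.orth i j (Ne.symm hij)]
    have c1 : Commute (σ.P j) A1 :=
      (σ.PA j).sub_right (Commute.sum_right _ _ _ fun i _ => (σ.PKN j).mul_right (hPc i))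
    have c2 : Commute (σ.K + σ.N) A1 :=
      σ.A_KN.symm.sub_right (Commute.sum_right _ _ _ fun i _ =>
        (Commute.refl _).mul_right (σ.PKN i).symm)
    have hz : (∑ i ∈ s, (σ.K + σ.N) * σ.P i) * σ.P j = 0 := by
      rw [Finset.sum_mul]
      refine Finset.sum_eq_zero fun i hi => ?_
      rw [mul_assoc, σ.orth i j (fun h => hj (h ▸ hi)), mul_zero]
    have hAP := σ.AP j
    obtain ⟨g', hg', hgc'⟩ := step_conj (A := A1) (P := σ.P j) (M := (σ.K + σ.N) * σ.P j)
      (hs j (Finset.mem_insert_self _ _)) (σ.idem j)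
      (by rw [mul_assoc, σ.idem]) (by rw [← mul_assoc, (σ.PKN j).eq, mul_assoc, σ.idem])
      (c2.symm.mul_right c1.symm) c1
      (by rw [sub_mul, hA1, sub_mul, hz, sub_zero, hAP, mul_assoc, σ.idem, add_mul]; simp)
      (subExp_block σ.subExp_KN (σ.idem j) (σ.PKN j))
    refine ⟨g'.trans g, hg'.trans hg, fun t x => ?_⟩
    have : A - ∑ i ∈ insert j s, (σ.K + σ.N) * σ.P i = A1 - (σ.K + σ.N) * σ.P j := by
      rw [Finset.sum_insert hj, hA1]; abel
    rw [this]
    simp only [Homeomorph.trans_apply]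
    rw [hgc', hgc]

variable [FiniteDimensional ℝ V]

/-- index type of the hyperbolic coordinates -/
abbrev Spl.Idx {A : V →L[ℝ] V} (σ : Spl A) : Type :=
  Σ i : {i : Fin σ.q // σ.a i ≠ 0}, Fin (Module.finrank ℝ (σ.rg i.1))

lemma Spl.A_mem {A : V →L[ℝ] V} (σ : Spl A) (p : Fin σ.q → Prop) {x : V} (hx : x ∈ σ.sub p) :
    A x ∈ σ.sub p := by
  intro i hi
  have := congrArg (fun L : V →L[ℝ] V => L x) (σ.PA i).eq
  simp only [ContinuousLinearMap.mul_apply] at this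
  rw [this, hx i hi, map_zero]

theorem exists_model_aux {A : V →L[ℝ] V} (σ : Spl A) (S : Submodule ℝ V)
    (hS : S = σ.sub fun i => σ.a i = 0) :
    ∃ (M : Mdl σ.Idx S) (g : V ≃ₜ ((σ.Idx → ℝ) × S)), AH g ∧
      (∀ t x, g (fl A t x) = M.φ t (g x)) ∧ (∀ x : S, (M.Ac x : V) = A x) ∧
      ∀ j, M.lam j = σ.a j.1.1 := by
  classical
  subst hS
  set S := σ.sub fun i => σ.a i = 0
  let Ac : S →L[ℝ] S := (A.comp S.subtypeL).codRestrict S fun x => σ.A_mem _ x.2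
  have hAc : ∀ x : S, (Ac x : V) = A x := fun x => rfl
  have hAKN : ∀ x : S, S.subtypeL (Ac x) = (σ.K + σ.N) (S.subtypeL x) := by
    intro x
    change A x = (σ.K + σ.N) x
    rw [σ.A_eq, Finset.sum_eq_zero, zero_add]
    intro i _
    by_cases hi : σ.a i = 0
    · rw [hi, zero_smul]
    · rw [x.2 i hi, smul_zero]
  have hsub : SubExp Ac := by
    intro ε hε
    obtain ⟨c, hc, h⟩ := σ.subExp_KN ε hε
    refine ⟨c, hc, fun t => ContinuousLinearMap.opNorm_le_bound _ (by positivity) fun x => ?_⟩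
    have h1 := fl_intertwine hAKN t x
    have h2 : ‖fl Ac t x‖ = ‖S.subtypeL (fl Ac t x)‖ := rfl
    rw [h2, h1]
    exact (ContinuousLinearMap.le_opNorm _ _).trans (by gcongr; exact h t; exact le_rfl)
  obtain ⟨σc⟩ := exists_spl Ac
  let M : Mdl σ.Idx S :=
    { lam := fun j => σ.a j.1.1, lam_ne := fun j => j.1.2, Ac := Ac, σ := σc,
      hz := σc.center_of_subExp hsub }
  obtain ⟨g, hg, hgc⟩ := multi_step σ (Finset.univ.filter fun i => σ.a i ≠ 0) (by simp)
  set A0 := A - ∑ i ∈ Finset.univ.filter (fun i => σ.a i ≠ 0), (σ.K + σ.N) * σ.P i with hA0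
  -- the linear map
  let P0 : V →L[ℝ] V := ∑ i, if σ.a i = 0 then σ.P i else 0
  have P_P0 : ∀ i x, σ.P i (P0 x) = if σ.a i = 0 then σ.P i x else 0 := by
    intro i x
    simp only [P0, ContinuousLinearMap.sum_apply, map_sum]
    rw [Finset.sum_eq_single i]
    · split_ifs <;> simp [σ.P_idem]
    · intro j _ hj
      split_ifs
      · exact σ.P_orth hj.symm x
      · simp
    · simp
  have P0_mem : ∀ x, P0 x ∈ S := fun x i hi => by rw [P_P0, if_neg hi]
  let L1 : V →ₗ[ℝ] (σ.Idx → ℝ) := LinearMap.pi fun j =>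
    ((Module.finBasis ℝ (σ.rg j.1.1)).coord j.2).comp (σ.P j.1.1 : V →ₗ[ℝ] V).rangeRestrict
  let L : V →ₗ[ℝ] (σ.Idx → ℝ) × S :=
    L1.prod ((P0 : V →ₗ[ℝ] V).codRestrict S P0_mem)
  have L1_apply : ∀ x j, (L x).1 j =
      (Module.finBasis ℝ (σ.rg j.1.1)).repr ⟨σ.P j.1.1 x, x, rfl⟩ j.2 := fun x j => rfl
  have L2_apply : ∀ x, ((L x).2 : V) = P0 x := fun x => rfl
  have Linj : Function.Injective L := by
    rw [injective_iff_map_eq_zero]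
    intro x hx
    rw [← σ.sum_P x]
    refine Finset.sum_eq_zero fun i _ => ?_
    by_cases hi : σ.a i = 0
    · have h1 : P0 x = 0 := by rw [← L2_apply, hx]; rfl
      have h2 := P_P0 i x
      rw [h1, map_zero, if_pos hi] at h2
      exact h2.symm
    · have h1 : (⟨σ.P i x, x, rfl⟩ : σ.rg i) = 0 := by
        apply (Module.finBasis ℝ (σ.rg i)).repr.injective
        ext k
        rw [← L1_apply x ⟨⟨i, hi⟩, k⟩, hx, map_zero]; rfl
      exact congrArg Subtype.val h1
  have hdim : Module.finrank ℝ V = Module.finrank ℝ ((σ.Idx → ℝ) × S) := by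
    rw [Module.finrank_prod, Module.finrank_fintype_fun_eq_card, Fintype.card_sigma, σ.finrank_sub,
      ← sum_rg σ]
    simp only [Fintype.card_fin]
    rw [← Fintype.sum_subtype_add_sum_subtype (fun i => σ.a i ≠ 0)]
    congr 1
    rw [← Finset.sum_filter]
    symm
    apply Finset.sum_subtype
    simp
  let e : V ≃L[ℝ] (σ.Idx → ℝ) × S := (L.linearEquivOfInjective Linj hdim).toContinuousLinearEquiv
  have he : ∀ x, e x = L x := fun x => rfl
  have hP0A : ∀ i x, σ.P i (A0 x) = if σ.a i = 0 then σ.P i (A x) else σ.a i • σ.P i x := by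
    intro i x
    have c1 : ∀ y, σ.P i ((σ.K + σ.N) y) = (σ.K + σ.N) (σ.P i y) := fun y => by
      have := congrArg (fun L : V →L[ℝ] V => L y) (σ.PKN i).eq
      simpa only [ContinuousLinearMap.mul_apply] using this
    have h0 : σ.P i (∑ j, σ.a j • σ.P j x) = σ.a i • σ.P i x := by
      rw [map_sum, Finset.sum_eq_single i]
      · rw [map_smul, σ.P_idem]
      · intro j _ hj; rw [map_smul, σ.P_orth hj.symm, smul_zero]
      · simp
    simp only [hA0, ContinuousLinearMap.sub_apply, ContinuousLinearMap.sum_apply, map_sub, map_sum,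
      ContinuousLinearMap.mul_apply, c1]
    split_ifs with hi
    · rw [Finset.sum_eq_zero, sub_zero]
      intro j hj
      rw [σ.P_orth, map_zero]
      rintro rfl
      simp [hi] at hj
    · rw [Finset.sum_eq_single i]
      · rw [σ.P_idem, σ.A_eq, map_add, h0, c1, add_sub_cancel_right]
      · intro j _ hj
        rw [σ.P_orth hj.symm, map_zero]
      · simp [hi]
  have hintw : ∀ x, e (A0 x) = M.gen (e x) := by
    intro x
    rw [he, he, M.gen_apply]
    ext j
    · simp only [L1_apply]
      have : (⟨σ.P j.1.1 (A0 x), A0 x, rfl⟩ : σ.rg j.1.1) = σ.a j.1.1 • ⟨σ.P j.1.1 x, x, rfl⟩ := by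
        ext
        change σ.P j.1.1 (A0 x) = σ.a j.1.1 • σ.P j.1.1 x
        rw [hP0A, if_neg j.1.2]
      rw [this, map_smul]; rfl
    · rw [L2_apply]
      change P0 (A0 x) = A (P0 x)
      rw [← σ.sum_P (P0 (A0 x)), ← σ.sum_P (A (P0 x))]
      refine Finset.sum_congr rfl fun i _ => ?_
      have c2 : ∀ y, σ.P i (A y) = A (σ.P i y) := fun y => by
        have := congrArg (fun L : V →L[ℝ] V => L y) (σ.PA i).eq
        simpa only [ContinuousLinearMap.mul_apply] using this
      rw [P_P0, hP0A, c2 (P0 x), P_P0]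
      split_ifs
      · exact c2 x
      · simp
  refine ⟨M, g.symm.trans e.toHomeomorph, hg.symm.trans (AH.linear e), fun t x => ?_, hAc, fun j => rfl⟩
  simp only [Homeomorph.trans_apply]
  have h1 : g.symm (fl A t x) = fl A0 t (g.symm x) := by
    rw [Homeomorph.symm_apply_eq, hgc, Homeomorph.apply_symm_apply]
  rw [h1]
  exact fl_intertwine (L := (e : V →L[ℝ] (σ.Idx → ℝ) × S)) hintw t (g.symm x)

end Build

/-- number of hyperbolic exponents at most `s` -/
def Mdl.cnt {ι C : Type*} [Fintype ι] [NormedAddCommGroup C] [NormedSpace ℝ C]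
    [FiniteDimensional ℝ C] (M : Mdl ι C) (s : ℝ) : ℕ := Nat.card {i // M.lam i ≤ s}

lemma ell_form' {d : ℕ} {A : Matrix (Fin d) (Fin d) ℝ} {X : Euc d →L[ℝ] Euc d} (hX : opOf A = X)
    (σ : Spl X) (s : ℝ) :
    ell A s = ∑ i, if σ.a i ≤ s then Module.finrank ℝ (σ.rg i) else 0 := by
  subst hX
  exact ell_form σ s

open Classical in
theorem exists_model {d : ℕ} (A : Matrix (Fin d) (Fin d) ℝ) :
    ∃ (ι : Type) (_ : Fintype ι) (M : Mdl ι (XC A)) (g : Euc d ≃ₜ ((ι → ℝ) × XC A)), AH g ∧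
      (∀ t x, g (linFlow A t x) = M.φ t (g x)) ∧
      (∀ x : XC A, (M.Ac x : Euc d) = Matrix.toEuclideanLin A x) ∧
      ∀ α (hα : α ≠ 0), ∀ s, ell (α • A) s =
        (M.scale α hα).cnt s + if 0 ≤ s then Module.finrank ℝ (XC A) else 0 := by
  obtain ⟨σ⟩ := exists_spl (opOf A)
  obtain ⟨M, g, hg, hc, hA, hl⟩ := exists_model_aux σ (XC A) (XC_eq σ)
  refine ⟨σ.Idx, inferInstance, M, g, hg, fun t x => by rw [linFlow_eq, hc], hA, fun α hα s => ?_⟩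
  have h0 : Module.finrank ℝ (XC A) = ∑ i, if σ.a i = 0 then Module.finrank ℝ (σ.rg i) else 0 := by
    rw [XC_eq σ, σ.finrank_sub]
  rw [ell_form' (opOf_smul α A) (σ.scale α), h0]
  change (∑ i : Fin σ.q, if α * σ.a i ≤ s then Module.finrank ℝ (σ.rg i) else 0) = _
  have h1 : (M.scale α hα).cnt s = ∑ i : {i : Fin σ.q // σ.a i ≠ 0},
      if α * σ.a i.1 ≤ s then Module.finrank ℝ (σ.rg i.1) else 0 := by
    rw [Mdl.cnt]
    simp only [Mdl.scale, hl]
    rw [Nat.card_eq_fintype_card, Fintype.card_subtype, Finset.card_filter, Fintype.sum_sigma]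
    refine Finset.sum_congr rfl fun i _ => ?_
    split_ifs <;> simp
  rw [h1, ← Fintype.sum_subtype_add_sum_subtype (fun i => σ.a i ≠ 0)]
  congr 1
  have h2 : (∑ i, if σ.a i = 0 then Module.finrank ℝ (σ.rg i) else 0) =
      ∑ i : {i : Fin σ.q // ¬ σ.a i ≠ 0}, Module.finrank ℝ (σ.rg i.1) := by
    rw [← Finset.sum_filter]
    apply Finset.sum_subtype
    simp
  rw [h2]
  split_ifs with hs
  · refine Finset.sum_congr rfl fun i _ => ?_
    have := not_not.1 i.2
    rw [if_pos (by rw [this, mul_zero]; exact hs)]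
  · refine Finset.sum_eq_zero fun i _ => ?_
    have := not_not.1 i.2
    rw [if_neg (by rw [this, mul_zero]; exact hs)]
end

section
set_option linter.unusedSectionVars false
set_option linter.deprecated false
set_option linter.unusedVariables false

lemma cnt_one {ι C : Type*} [Fintype ι] [NormedAddCommGroup C] [NormedSpace ℝ C]
    [FiniteDimensional ℝ C] (M : Mdl ι C) (s : ℝ) : (M.scale 1 one_ne_zero).cnt s = M.cnt s := by
  simp [Mdl.cnt, Mdl.scale]

open Classical in
lemma exists_equiv_of_cnt {ι ι' : Type*} [Fintype ι] [Fintype ι'] (l : ι → ℝ) (l' : ι' → ℝ)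
    (h : ∀ s, Nat.card {i // l i ≤ s} = Nat.card {i // l' i ≤ s}) :
    ∃ e : ι ≃ ι', ∀ i, l' (e i) = l i := by
  have hf : ∀ s, Nat.card {i // l i = s} = Nat.card {i // l' i = s} := by
    intro s
    have hfin : ((Set.range l ∪ Set.range l') ∩ Set.Iio s).Finite :=
      ((Set.finite_range l).union (Set.finite_range l')).inter_of_left _
    obtain ⟨s', hs', hb⟩ : ∃ s' < s, ∀ u ∈ Set.range l ∪ Set.range l', u < s → u ≤ s' := by
      rcases ((Set.range l ∪ Set.range l') ∩ Set.Iio s).eq_empty_or_nonempty with he | hne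
      · refine ⟨s - 1, by linarith, fun u hu hus => ?_⟩
        exact absurd (show u ∈ (Set.range l ∪ Set.range l') ∩ Set.Iio s from ⟨hu, hus⟩) (by rw [he]; simp)
      · obtain ⟨m, hm, hmax⟩ := Set.exists_max_image _ id hfin hne
        exact ⟨m, hm.2, fun u hu hus => hmax u ⟨hu, hus⟩⟩
    have split : ∀ {κ : Type _} [Fintype κ] (k : κ → ℝ), (∀ i, k i < s → k i ≤ s') →
        Nat.card {i // k i ≤ s} = Nat.card {i // k i ≤ s'} + Nat.card {i // k i = s} := by
      intro κ _ k hk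
      rw [Nat.card_eq_fintype_card, Nat.card_eq_fintype_card, Nat.card_eq_fintype_card,
        Fintype.card_subtype, Fintype.card_subtype, Fintype.card_subtype, ← Finset.card_union_of_disjoint]
      · congr 1
        ext i
        simp only [Finset.mem_filter, Finset.mem_univ, true_and, Finset.mem_union]
        constructor
        · intro hi
          rcases hi.lt_or_eq with h1 | h1
          · exact Or.inl (hk i h1)
          · exact Or.inr h1
        · rintro (h1 | h1)
          · linarith
          · exact h1.le
      · rw [Finset.disjoint_filter]
        intro i _ h1 h2
        linarith
    have split' : ∀ {κ : Type _} [Fintype κ] (k : κ → ℝ), (∀ i, k i < s → k i ≤ s') →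
        Nat.card {i // k i ≤ s} = Nat.card {i // k i ≤ s'} + Nat.card {i // k i = s} := by
      intro κ _ k hk
      rw [Nat.card_eq_fintype_card, Nat.card_eq_fintype_card, Nat.card_eq_fintype_card,
        Fintype.card_subtype, Fintype.card_subtype, Fintype.card_subtype, ← Finset.card_union_of_disjoint]
      · congr 1
        ext i
        simp only [Finset.mem_filter, Finset.mem_univ, true_and, Finset.mem_union]
        constructor
        · intro hi
          rcases hi.lt_or_eq with h1 | h1
          · exact Or.inl (hk i h1)
          · exact Or.inr h1
        · rintro (h1 | h1)
          · linarith
          · exact h1.le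
      · rw [Finset.disjoint_filter]
        intro i _ h1 h2
        linarith
    have e1 := split l (fun i hi => hb _ (Or.inl ⟨i, rfl⟩) hi)
    have e2 := split' l' (fun i hi => hb _ (Or.inr ⟨i, rfl⟩) hi)
    rw [h s, h s'] at e1
    omega
  have he : ∀ s, Nonempty ({i // l i = s} ≃ {i // l' i = s}) := fun s =>
    Finite.card_eq.1 (hf s)
  refine ⟨Equiv.ofFiberEquiv (f := l) (g := l') fun s => (he s).some, fun i => ?_⟩
  exact Equiv.ofFiberEquiv_map _ i

lemma model_suff {ι C ι' C' : Type} [Fintype ι] [NormedAddCommGroup C] [NormedSpace ℝ C]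
    [FiniteDimensional ℝ C] [Fintype ι'] [NormedAddCommGroup C'] [NormedSpace ℝ C']
    [FiniteDimensional ℝ C'] (M : Mdl ι C) (M' : Mdl ι' C') (hc : ∀ s, M.cnt s = M'.cnt s)
    (Q : C ≃ₗ[ℝ] C') (hQ : ∀ x, Q (M.Ac x) = M'.Ac (Q x)) :
    ∃ h : ((ι → ℝ) × C) ≃ₜ ((ι' → ℝ) × C'), AH h ∧ ∀ t x, h (M.φ t x) = M'.φ t (h x) := by
  obtain ⟨e, he⟩ := exists_equiv_of_cnt M.lam M'.lam hc
  haveI : CompleteSpace C := FiniteDimensional.complete ℝ C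
  haveI : CompleteSpace C' := FiniteDimensional.complete ℝ C'
  let E1 : (ι → ℝ) ≃ₗ[ℝ] (ι' → ℝ) := LinearEquiv.funCongrLeft ℝ ℝ e.symm
  let E : ((ι → ℝ) × C) ≃L[ℝ] ((ι' → ℝ) × C') := (LinearEquiv.prodCongr E1 Q).toContinuousLinearEquiv
  refine ⟨E.toHomeomorph, AH.linear E, fun t x => ?_⟩
  refine fl_intertwine (A := M.gen) (B := M'.gen) (L := (E : ((ι → ℝ) × C) →L[ℝ] _)) (fun x => ?_) t x
  have hE : ∀ x, E x = (fun i => x.1 (e.symm i), Q x.2) := fun x => rfl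
  simp only [ContinuousLinearEquiv.coe_coe]
  rw [hE, Mdl.gen_apply, Mdl.gen_apply, hE]
  ext i
  · simp only
    rw [← he, e.apply_symm_apply]
  · simp [hQ]

lemma orb_scale {ι C : Type*} [Fintype ι] [NormedAddCommGroup C] [NormedSpace ℝ C]
    [FiniteDimensional ℝ C] (M : Mdl ι C) (α : ℝ) (hα : α ≠ 0) (x) :
    (M.scale α hα).orb x = M.orb x := by
  ext y
  constructor
  · rintro ⟨t, rfl⟩
    exact ⟨t * α, (M.φ_scale α hα t x).symm⟩
  · rintro ⟨t, rfl⟩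
    refine ⟨t / α, ?_⟩
    simp only
    rw [M.φ_scale, div_mul_cancel₀ _ hα]

lemma image_orb {ι C ι' C' : Type*} [Fintype ι] [NormedAddCommGroup C] [NormedSpace ℝ C]
    [FiniteDimensional ℝ C] [Fintype ι'] [NormedAddCommGroup C'] [NormedSpace ℝ C']
    [FiniteDimensional ℝ C'] {M : Mdl ι C} {M' : Mdl ι' C'} {h : ((ι → ℝ) × C) → ((ι' → ℝ) × C')}
    (hh : ∀ t x, h (M.φ t x) = M'.φ t (h x)) (x) : h '' M.orb x = M'.orb (h x) := by
  rw [Mdl.orb, Mdl.orb, ← Set.range_comp]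
  congr 1
  ext1 t
  exact hh t x

/-- The necessity statement for models. -/
def ModelNec : Prop := ∀ {ι C ι' C' : Type} [Fintype ι] [NormedAddCommGroup C] [NormedSpace ℝ C]
    [FiniteDimensional ℝ C] [Fintype ι'] [NormedAddCommGroup C'] [NormedSpace ℝ C']
    [FiniteDimensional ℝ C'] (M : Mdl ι C) (M' : Mdl ι' C')
    (h : ((ι → ℝ) × C) ≃ₜ ((ι' → ℝ) × C')), AH h → (∀ x, h '' M.orb x = M'.orb (h x)) →
    ∃ (α : ℝ) (hα : α ≠ 0), (∀ s, M.cnt s = (M'.scale α hα).cnt s) ∧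
      ∃ Q : C ≃ₗ[ℝ] C', ∀ x, Q (M.Ac x) = α • M'.Ac (Q x)

lemma memH1_iff {d : ℕ} (h : Euc d ≃ₜ Euc d) : MemH1minus h ↔ AH h := by
  constructor
  · intro H
    exact ⟨(H (1/2) (by norm_num) (by norm_num)).1, fun γ h0 h1 => (H γ h0 h1).2.1,
      fun γ h0 h1 => (H γ h0 h1).2.2⟩
  · intro H γ h0 h1
    exact ⟨H.zero, H.hol γ h0 h1, H.hol' γ h0 h1⟩

theorem assembly (NEC : ModelNec) {d : ℕ} (A B : Matrix (Fin d) (Fin d) ℝ) :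
    (∃ h : Euc d ≃ₜ Euc d, MemH1minus h ∧ IsOrbitEquiv A B h) ↔
      (∃ α : ℝ, α ≠ 0 ∧ (∀ j : ℕ, j < d → lyapExp A j = lyapExp (α • B) j) ∧
        IsCentralSimilar A B α) := by
  classical
  obtain ⟨ι, _, M, g, hg, gc, hAc, hell⟩ := exists_model A
  obtain ⟨ι', _, M', g', hg', gc', hAc', hell'⟩ := exists_model B
  have hellA : ∀ s, ell A s = M.cnt s + if 0 ≤ s then Module.finrank ℝ (XC A) else 0 := by
    intro s
    have := hell 1 one_ne_zero s
    rwa [one_smul, cnt_one] at this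
  have gorb : ∀ x, g '' flowOrbit A x = M.orb (g x) := by
    intro x
    rw [Mdl.orb, flowOrbit, ← Set.range_comp]
    congr 1
    ext1 t
    exact gc t x
  have gorb' : ∀ x, g' '' flowOrbit B x = M'.orb (g' x) := by
    intro x
    rw [Mdl.orb, flowOrbit, ← Set.range_comp]
    congr 1
    ext1 t
    exact gc' t x
  have img : ∀ {X Y : Type} [TopologicalSpace X] [TopologicalSpace Y] (g : X ≃ₜ Y) (s : Set X)
      (t : Set Y), g '' s = t → g.symm '' t = s := by
    intro X Y _ _ g s t hs
    rw [← hs]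
    simp [Set.image_image]
  constructor
  · rintro ⟨h, hH, hO⟩
    obtain ⟨α, hα, hcnt, Q, hQ⟩ := NEC M M' (g.symm.trans (h.trans g'))
      (hg.symm.trans (((memH1_iff h).1 hH).trans hg')) (by
        intro x
        have e1 := img g _ _ (gorb (g.symm x))
        rw [g.apply_symm_apply] at e1
        calc _ = g' '' (h '' (g.symm '' M.orb x)) := by
              rw [Set.image_image, Set.image_image]; rfl
          _ = _ := by rw [e1, hO, gorb']; rfl)
    refine ⟨α, hα, ?_, ?_⟩
    · rw [lyapExp_eq_iff]
      intro s
      rw [hellA, hell' α hα, hcnt, Q.finrank_eq]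
    · have hA : ∀ x ∈ XC A, Matrix.toEuclideanLin A x ∈ XC A := by
        intro x hx
        rw [← hAc ⟨x, hx⟩]; exact (M.Ac ⟨x, hx⟩).2
      have hB : ∀ x ∈ XC B, Matrix.toEuclideanLin B x ∈ XC B := by
        intro x hx
        rw [← hAc' ⟨x, hx⟩]; exact (M'.Ac ⟨x, hx⟩).2
      refine ⟨hA, hB, Q, fun x => ?_⟩
      have e1 : (Matrix.toEuclideanLin A).restrict hA x = M.Ac x :=
        Subtype.ext (by rw [hAc]; rfl)
      have e2 : (Matrix.toEuclideanLin B).restrict hB (Q x) = M'.Ac (Q x) :=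
        Subtype.ext (by rw [hAc']; rfl)
      rw [e1, e2, hQ]
  · rintro ⟨α, hα, hl, hA, hB, Q, hQ⟩
    rw [lyapExp_eq_iff] at hl
    have hcnt : ∀ s, M.cnt s = (M'.scale α hα).cnt s := by
      intro s
      have := hl s
      rw [hellA, hell' α hα, Q.finrank_eq] at this
      omega
    obtain ⟨k, hk, hkc⟩ := model_suff M (M'.scale α hα) hcnt Q (by
      intro x
      have e1 : (Matrix.toEuclideanLin A).restrict hA x = M.Ac x :=
        Subtype.ext (by rw [hAc]; rfl)
      have e2 : (Matrix.toEuclideanLin B).restrict hB (Q x) = M'.Ac (Q x) :=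
        Subtype.ext (by rw [hAc']; rfl)
      have := hQ x
      rw [e1, e2] at this
      rw [this]; rfl)
    refine ⟨g.trans (k.trans g'.symm), (memH1_iff _).2 (hg.trans (hk.trans hg'.symm)), fun x => ?_⟩
    have e1 := gorb x
    have e2 := image_orb hkc (g x)
    rw [orb_scale] at e2
    have e3 := img g' _ _ (gorb' (g'.symm (k (g x))))
    rw [g'.apply_symm_apply] at e3
    calc _ = g'.symm '' (k '' (g '' flowOrbit A x)) := by rw [Set.image_image, Set.image_image]; rfl
      _ = _ := by rw [e1, e2, e3]; rfl
end

section
set_option linter.unusedSectionVars false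
set_option linter.deprecated false
set_option linter.unusedVariables false

section TimeLift
variable {E : Type*} [NormedAddCommGroup E] [NormedSpace ℝ E] [CompleteSpace E]

lemma fl_fixed_iff (A : E →L[ℝ] E) (x : E) : A x = 0 ↔ ∀ t, fl A t x = x := by
  constructor
  · intro h t
    have := fl_intertwine (A := (0 : ℝ →L[ℝ] ℝ)) (B := A)
      (L := ContinuousLinearMap.smulRight (1 : ℝ →L[ℝ] ℝ) x) (fun s => by simp [h]) t 1
    simpa [fl] using this.symm
  · intro h
    have h1 := fl_hasDerivAt_apply A x 0
    have h2 : HasDerivAt (fun s => fl A s x) 0 0 := by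
      simp only [h]; exact hasDerivAt_const _ _
    have := h1.unique h2
    rwa [h] at this

lemma fl_small_period {A : E →L[ℝ] E} {x : E} {b : ℝ} (hb : b ≠ 0)
    (h : ∀ s ∈ Set.uIcc 0 b, fl A s x = x) : A x = 0 := by
  have h1 : HasDerivWithinAt (fun s => fl A s x) (A (fl A 0 x)) (Set.uIcc 0 b) 0 :=
    (fl_hasDerivAt_apply A x 0).hasDerivWithinAt
  have h2 : HasDerivWithinAt (fun s => fl A s x) 0 (Set.uIcc 0 b) 0 :=
    (hasDerivWithinAt_const _ _ x).congr (fun s hs => h s hs) (h 0 Set.left_mem_uIcc)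
  have hu : UniqueDiffWithinAt ℝ (Set.uIcc 0 b) 0 :=
    uniqueDiffOn_Icc (by simpa using hb) 0 Set.left_mem_uIcc
  have := hu.eq_deriv _ h1 h2
  simpa [fl_zero] using this

lemma lift_unique {A : E →L[ℝ] E} {w : E} (hw : A w ≠ 0) {σ₁ σ₂ : ℝ → ℝ} {a b : ℝ}
    (h1 : ContinuousOn σ₁ (Set.uIcc a b)) (h2 : ContinuousOn σ₂ (Set.uIcc a b)) (ha : σ₁ a = σ₂ a)
    (h : ∀ t ∈ Set.uIcc a b, fl A (σ₁ t) w = fl A (σ₂ t) w) : σ₁ b = σ₂ b := by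
  by_contra hne
  apply hw
  refine fl_small_period (b := σ₁ b - σ₂ b) (sub_ne_zero.2 hne) fun s hs => ?_
  have := intermediate_value_uIcc (h1.sub h2)
  have hs' : s ∈ Set.uIcc ((σ₁ - σ₂) a) ((σ₁ - σ₂) b) := by
    simpa [ha] using hs
  obtain ⟨t, ht, rfl⟩ := this hs'
  have h3 := h t ht
  simp only [Pi.sub_apply]
  rw [sub_eq_add_neg, add_comm, fl_add_apply, h3, fl_neg_self]

lemma section_countable (A : E →L[ℝ] E) (w : E) (f : E →L[ℝ] ℝ) (c : ℝ) :
    {s : ℝ | f (fl A s w) = c ∧ f (A (fl A s w)) ≠ 0}.Countable := by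
  set Z := {s : ℝ | f (fl A s w) = c ∧ f (A (fl A s w)) ≠ 0} with hZ
  have h := countable_setOfPred_isolated_right_within (s := Z)
  refine h.mono fun s hs => (show s ∈ Z ∧ 𝓝[Z ∩ Set.Ioi s] s = ⊥ from ⟨hs, ?_⟩)
  have hd : HasDerivAt (fun s => f (fl A s w)) (f (A (fl A s w))) s :=
    f.hasFDerivAt.comp_hasDerivAt s (fl_hasDerivAt_apply A w s)
  have h1 := hd.eventually_ne (c := c) hs.2
  rw [← Filter.empty_mem_iff_bot]
  have h2 : {z | f (fl A z w) ≠ c} ∈ 𝓝[Z ∩ Set.Ioi s] s :=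
    nhdsWithin_mono s (fun z hz => by simpa using (ne_of_gt hz.2)) h1
  filter_upwards [h2, self_mem_nhdsWithin] with z hz hz'
  exact hz hz'.1.1

lemma local_lift (A : E →L[ℝ] E) {γ : ℝ → E} (hγ : Continuous γ) {w₀ : E}
    (hO : ∀ t, ∃ s, γ t = fl A s w₀) (t₀ : ℝ) (hne : A (γ t₀) ≠ 0) :
    ∃ ε > 0, ∃ σ : ℝ → ℝ, ContinuousOn σ (Metric.ball t₀ ε) ∧
      ∀ t ∈ Metric.ball t₀ ε, γ t = fl A (σ t) (γ t₀) := by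
  set w := γ t₀ with hw
  obtain ⟨f, hf⟩ := SeparatingDual.exists_eq_one (R := ℝ) hne
  have hG : Continuous fun p : ℝ × E => f (A (fl A p.1 p.2)) :=
    f.continuous.comp (A.continuous.comp (fl_cont A))
  have hG0 : ∀ᶠ p in 𝓝 ((0 : ℝ), w), 1 / 2 < f (A (fl A p.1 p.2)) := by
    refine hG.continuousAt.eventually (lt_mem_nhds ?_)
    simp [fl_zero, hf]; norm_num
  obtain ⟨δ', hδ', hG1⟩ := Metric.eventually_nhds_iff.1 hG0
  set δ := δ' / 2 with hδ
  have hδ0 : 0 < δ := by positivity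
  have hG2 : ∀ s y, |s| ≤ δ → dist y w < δ' → 1 / 2 < f (A (fl A s y)) := by
    intro s y hs hy
    refine hG1 (y := (s, y)) ?_
    rw [Prod.dist_eq, max_lt_iff]
    exact ⟨by simp [Real.dist_eq]; linarith, hy⟩
  have mono : ∀ y, dist y w < δ' → ∀ s ∈ Set.Icc (-δ) δ, ∀ s' ∈ Set.Icc (-δ) δ, s ≤ s' →
      1 / 2 * (s' - s) ≤ f (fl A s' y) - f (fl A s y) := by
    intro y hy
    have hd : ∀ s, HasDerivAt (fun s => f (fl A s y)) (f (A (fl A s y))) s := fun s =>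
      f.hasFDerivAt.comp_hasDerivAt s (fl_hasDerivAt_apply A y s)
    refine Convex.mul_sub_le_image_sub_of_le_deriv (convex_Icc _ _)
      (fun s _ => (hd s).continuousAt.continuousWithinAt)
      (fun s _ => (hd s).differentiableAt.differentiableWithinAt) ?_
    intro s hs
    rw [interior_Icc] at hs
    rw [(hd s).deriv]
    exact (hG2 s y (abs_le.2 ⟨hs.1.le, hs.2.le⟩) hy).le
  have hfc : ∀ᶠ y in 𝓝 w, |f y - f w| < δ / 2 := by
    have : Continuous fun y => |f y - f w| := by fun_prop
    refine this.continuousAt.eventually (gt_mem_nhds ?_)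
    simpa using by positivity
  obtain ⟨r', hr', hfc'⟩ := Metric.eventually_nhds_iff.1 hfc
  set r := min r' δ'
  have hr : 0 < r := lt_min hr' hδ'
  have hu : ∀ y, ∃ u, dist y w < r → (u ∈ Set.Icc (-δ) δ ∧ f (fl A u y) = f w) := by
    intro y
    by_cases hy : dist y w < r
    · have hy1 := hfc' (hy.trans_le (min_le_left _ _))
      have hy2 := hy.trans_le (min_le_right _ _)
      rw [abs_lt] at hy1
      have m1 := mono y hy2 (-δ) ⟨le_rfl, by linarith⟩ 0 ⟨by linarith, hδ0.le⟩ (by linarith)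
      have m2 := mono y hy2 0 ⟨by linarith, hδ0.le⟩ δ ⟨by linarith, le_rfl⟩ hδ0.le
      have e0 : fl A 0 y = y := by simp [fl_zero]
      rw [e0] at m1 m2
      have hcont : ContinuousOn (fun s => f (fl A s y)) (Set.Icc (-δ) δ) :=
        (f.continuous.comp ((fl_cont A).comp (Continuous.prodMk continuous_id continuous_const))).continuousOn
      obtain ⟨u, hu, hu'⟩ := intermediate_value_Icc (by linarith : -δ ≤ δ) hcont
        (show f w ∈ Set.Icc (f (fl A (-δ) y)) (f (fl A δ y)) from ⟨by linarith, by linarith⟩)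
      exact ⟨u, fun _ => ⟨hu, hu'⟩⟩
    · exact ⟨0, fun h => absurd h hy⟩
  choose u hu using hu
  obtain ⟨c, hc⟩ := (isCompact_Icc (a := -δ) (b := δ)).exists_bound_of_continuousOn
    (fl_continuous A).continuousOn
  have hlip : ∀ y y', dist y w < r → dist y' w < r → |u y - u y'| ≤ 2 * (‖f‖ * (c * ‖y - y'‖)) := by
    intro y y' hy hy'
    obtain ⟨h1, h2⟩ := hu y hy
    obtain ⟨h3, h4⟩ := hu y' hy'
    have h5 : |f (fl A (u y') y) - f (fl A (u y') y')| ≤ ‖f‖ * (c * ‖y - y'‖) := by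
      rw [← map_sub, ← map_sub, ← Real.norm_eq_abs]
      refine (f.le_opNorm _).trans ?_
      gcongr
      refine (ContinuousLinearMap.le_opNorm _ _).trans ?_
      gcongr
      exact hc _ h3
    rw [h4, ← h2] at h5
    have hy2 := hy.trans_le (min_le_right r' δ')
    rcases le_total (u y) (u y') with hle | hle
    · have := mono y hy2 _ h1 _ h3 hle
      have h6 := (le_abs_self _).trans h5
      rw [abs_of_nonpos (by linarith)]; linarith
    · have := mono y hy2 _ h3 _ h1 hle
      have h6 := (neg_le_abs _).trans h5
      rw [abs_of_nonneg (by linarith)]; linarith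
  have hucont : ContinuousOn u (Metric.ball w r) := by
    refine (LipschitzOnWith.of_dist_le_mul (K := Real.toNNReal (2 * (‖f‖ * |c|))) ?_).continuousOn
    intro y hy y' hy'
    rw [Real.dist_eq, dist_eq_norm, Real.coe_toNNReal _ (by positivity)]
    refine (hlip y y' hy hy').trans ?_
    calc _ ≤ 2 * (‖f‖ * (|c| * ‖y - y'‖)) := by gcongr; exact le_abs_self c
      _ = _ := by ring
  obtain ⟨ε, hε, hεr⟩ := Metric.continuousAt_iff.1 (hγ.continuousAt (x := t₀)) r hr
  have hmaps : Set.MapsTo γ (Metric.ball t₀ ε) (Metric.ball w r) := fun t ht => hεr ht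
  have hσc : ContinuousOn (fun t => u (γ t)) (Metric.ball t₀ ε) :=
    hucont.comp hγ.continuousOn hmaps
  set q : ℝ → E := fun t => fl A (u (γ t)) (γ t) with hq
  have hqc : ContinuousOn q (Metric.ball t₀ ε) :=
    (fl_cont A).comp_continuousOn (hσc.prodMk hγ.continuousOn)
  have hcount : (q '' Metric.ball t₀ ε).Countable := by
    refine ((section_countable A w₀ f (f w)).image (fun s => fl A s w₀)).mono ?_
    rintro _ ⟨t, ht, rfl⟩
    obtain ⟨s, hs⟩ := hO t
    have h1 := hu (γ t) (hmaps ht)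
    have h2 := hG2 (u (γ t)) (γ t) (abs_le.2 h1.1) ((hεr ht).trans_le (min_le_right _ _))
    refine ⟨u (γ t) + s, ⟨?_, ?_⟩, ?_⟩
    · rw [fl_add_apply, ← hs]; exact h1.2
    · rw [fl_add_apply, ← hs]; linarith
    · simp only [hq]; rw [fl_add_apply, ← hs]
  have hconn : IsPreconnected (q '' Metric.ball t₀ ε) :=
    ((convex_ball t₀ ε).isPreconnected).image _ hqc
  have hsub := hcount.isTotallyDisconnected _ subset_rfl hconn
  have ht0 : t₀ ∈ Metric.ball t₀ ε := Metric.mem_ball_self hε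
  refine ⟨ε, hε, fun t => u w - u (γ t), continuousOn_const.sub hσc, fun t ht => ?_⟩
  have h1 : q t = q t₀ := hsub ⟨t, ht, rfl⟩ ⟨t₀, ht0, rfl⟩
  simp only [hq] at h1
  have h2 : fl A (-u (γ t)) (fl A (u (γ t)) (γ t)) = fl A (-u (γ t)) (fl A (u w) w) :=
    congrArg _ h1
  rw [fl_neg_self] at h2
  rw [h2, ← fl_add_apply]
  congr 2
  ring

lemma half_lift (A : E →L[ℝ] E) {γ : ℝ → E} (hγ : Continuous γ) {w₀ : E}
    (hO : ∀ t, ∃ s, γ t = fl A s w₀) (hne : ∀ t, A (γ t) ≠ 0) {T : ℝ} (hT : 0 ≤ T) :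
    ∃ σ : ℝ → ℝ, Continuous σ ∧ σ 0 = 0 ∧ ∀ t ∈ Set.Icc 0 T, γ t = fl A (σ t) (γ 0) := by
  choose ε hε σ hσc hσ using fun t₀ => local_lift A hγ hO t₀ (hne t₀)
  obtain ⟨δ, hδ, hL⟩ := lebesgue_number_lemma_of_metric (isCompact_Icc (a := (0:ℝ)) (b := T))
    (c := fun t₀ => Metric.ball t₀ (ε t₀)) (fun _ => Metric.isOpen_ball)
    (fun t _ => Set.mem_iUnion.2 ⟨t, Metric.mem_ball_self (hε t)⟩)
  have key : ∀ n : ℕ, ∃ τ : ℝ → ℝ, Continuous τ ∧ τ 0 = 0 ∧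
      ∀ t ∈ Set.Icc 0 (min T (n * (δ / 2))), γ t = fl A (τ t) (γ 0) := by
    intro n
    induction n with
    | zero =>
      refine ⟨fun _ => 0, continuous_const, rfl, fun t ht => ?_⟩
      have h1 := ht.2.trans (min_le_right _ _)
      have h0 : t = 0 := le_antisymm (by simpa using h1) ht.1
      rw [h0]; simp [fl_zero]
    | succ n ih =>
      obtain ⟨τ, hτc, hτ0, hτ⟩ := ih
      set a := min T (n * (δ / 2)) with ha
      have ha0 : 0 ≤ a := le_min hT (by positivity)
      have haT : a ≤ T := min_le_left _ _
      set b := min T ((n + 1 : ℕ) * (δ / 2)) with hb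
      have hba : b ≤ a + δ / 2 := by
        rw [ha, ← min_add_add_right]
        refine min_le_min (by linarith) ?_
        push_cast; linarith
      obtain ⟨i, hi⟩ := hL a ⟨ha0, haT⟩
      have hsub : ∀ t ∈ Set.Icc a b, t ∈ Metric.ball i (ε i) := by
        intro t ht
        refine hi ?_
        rw [Metric.mem_ball, Real.dist_eq, abs_of_nonneg (by linarith [ht.1])]
        linarith [ht.2]
      have hab : a ≤ b := by
        refine min_le_min le_rfl ?_
        push_cast; nlinarith
      have hcl : Continuous fun t : ℝ => max a (min b t) := by fun_prop
      have hcl' : ∀ t, max a (min b t) ∈ Set.Icc a b := fun t =>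
        ⟨le_max_left _ _, max_le hab (min_le_left _ _)⟩
      refine ⟨fun t => τ (min a t) + (σ i (max a (min b t)) - σ i a), ?_, ?_, ?_⟩
      · refine (hτc.comp (by fun_prop)).add (Continuous.sub ?_ continuous_const)
        exact (hσc i).comp_continuous hcl fun t => hsub _ (hcl' t)
      · simp only
        rw [min_eq_right ha0, hτ0, max_eq_left ((min_le_right _ _).trans ha0)]; ring
      · intro t ht
        rcases le_total t a with hta | hta
        · simp only
          rw [min_eq_right hta, max_eq_left ((min_le_right _ _).trans hta), sub_self, add_zero]
          exact hτ t ⟨ht.1, hta⟩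
        · simp only
          rw [min_eq_left hta, min_eq_right ht.2, max_eq_right hta, add_comm, fl_add_apply,
            ← hτ a ⟨ha0, le_rfl⟩, hσ i t (hsub t ⟨hta, ht.2⟩), hσ i a (hsub a ⟨le_rfl, hab⟩),
            ← fl_add_apply]
          congr 2; ring
  obtain ⟨n, hn⟩ := exists_nat_ge (T / (δ / 2))
  obtain ⟨τ, h1, h2, h3⟩ := key n
  refine ⟨τ, h1, h2, fun t ht => h3 t ⟨ht.1, le_min ht.2 (ht.2.trans ?_)⟩⟩
  rwa [div_le_iff₀ (by positivity)] at hn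

lemma full_lift (A : E →L[ℝ] E) {γ : ℝ → E} (hγ : Continuous γ) {w₀ : E}
    (hO : ∀ t, ∃ s, γ t = fl A s w₀) (hne : ∀ t, A (γ t) ≠ 0) :
    ∃ σ : ℝ → ℝ, Continuous σ ∧ σ 0 = 0 ∧ ∀ t, γ t = fl A (σ t) (γ 0) := by
  have hR : ∀ R : ℝ, 0 ≤ R → ∃ σ : ℝ → ℝ, Continuous σ ∧ σ 0 = 0 ∧
      ∀ t ∈ Set.Icc (-R) R, γ t = fl A (σ t) (γ 0) := by
    intro R hR
    obtain ⟨σ, h1, h2, h3⟩ := half_lift A hγ hO hne hR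
    obtain ⟨σ', h1', h2', h3'⟩ := half_lift A (γ := fun t => γ (-t)) (hγ.comp continuous_neg)
      (fun t => hO (-t)) (fun t => hne (-t)) hR
    refine ⟨fun t => σ (max t 0) + σ' (max (-t) 0), ?_, ?_, ?_⟩
    · exact (h1.comp (by fun_prop)).add (h1'.comp (by fun_prop))
    · simp [h2, h2']
    · intro t ht
      rcases le_total 0 t with h0 | h0
      · simp only
        rw [max_eq_left h0, max_eq_right (by linarith), h2', add_zero]
        exact h3 t ⟨h0, ht.2⟩
      · simp only
        rw [max_eq_right h0, max_eq_left (by linarith), h2, zero_add]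
        have := h3' (-t) ⟨by linarith, by linarith [ht.1]⟩
        simpa using this
  choose! σ hc h0 hσ using hR
  have agree : ∀ R R' t, 0 ≤ R → 0 ≤ R' → |t| ≤ R → |t| ≤ R' → σ R t = σ R' t := by
    intro R R' t hR hR' h1 h2
    refine lift_unique (A := A) (w := γ 0) (hne 0) (a := 0) (b := t) (hc R hR).continuousOn
      (hc R' hR').continuousOn (by rw [h0 R hR, h0 R' hR']) fun s hs => ?_
    have hs' : |s| ≤ |t| := by
      have := Set.abs_sub_left_of_mem_uIcc hs
      simpa using this
    rw [← hσ R hR s (abs_le.1 (hs'.trans h1)), ← hσ R' hR' s (abs_le.1 (hs'.trans h2))]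
  refine ⟨fun t => σ (|t|) t, ?_, ?_, ?_⟩
  · rw [continuous_iff_continuousAt]
    intro t₀
    have hp : 0 ≤ |t₀| + 1 := by positivity
    refine ContinuousAt.congr (f := σ (|t₀| + 1)) (hc _ hp).continuousAt ?_
    have : ∀ᶠ t in 𝓝 t₀, |t| < |t₀| + 1 :=
      continuous_abs.continuousAt.eventually (gt_mem_nhds (by linarith))
    filter_upwards [this] with t ht
    exact agree _ _ t hp (abs_nonneg t) ht.le le_rfl
  · simp [h0]
  · intro t
    exact hσ _ (abs_nonneg t) t (abs_le.1 le_rfl)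

end TimeLift
end

section
set_option linter.unusedSectionVars false
set_option linter.deprecated false
set_option linter.unusedVariables false

namespace Mdl
variable {ι C : Type*} [Fintype ι] [NormedAddCommGroup C] [NormedSpace ℝ C]
    [FiniteDimensional ℝ C] [CompleteSpace C] (M : Mdl ι C)

lemma φ_zero (x) : M.φ 0 x = x := by simp [φ, fl_zero]
lemma φ_add (s t : ℝ) (x) : M.φ (s + t) x = M.φ s (M.φ t x) := fl_add_apply _ _ _ _
lemma φ_neg_self (t : ℝ) (x) : M.φ (-t) (M.φ t x) = x := fl_neg_self _ _ _
lemma φ_self_neg (t : ℝ) (x) : M.φ t (M.φ (-t) x) = x := fl_self_neg _ _ _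
lemma φ_cont : Continuous fun p : ℝ × ((ι → ℝ) × C) => M.φ p.1 p.2 := fl_cont _
lemma φ_cont_t (x) : Continuous fun t => M.φ t x :=
  M.φ_cont.comp (Continuous.prodMk continuous_id continuous_const)
lemma φ_cont_x (t : ℝ) : Continuous (M.φ t) := (fl M.gen t).continuous
lemma φ_vadd (t : ℝ) (x y) : M.φ t (x + y) = M.φ t x + M.φ t y := map_add _ _ _
lemma φ_vsub (t : ℝ) (x y) : M.φ t (x - y) = M.φ t x - M.φ t y := map_sub _ _ _
lemma φ_vsmul (t c : ℝ) (x) : M.φ t (c • x) = c • M.φ t x := map_smul _ _ _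
lemma φ_v0 (t : ℝ) : M.φ t 0 = 0 := map_zero _

lemma mem_orb_self (x) : x ∈ M.orb x := ⟨0, M.φ_zero x⟩
lemma mem_orb (t x) : M.φ t x ∈ M.orb x := ⟨t, rfl⟩
lemma orb_symm {x y} (h : y ∈ M.orb x) : x ∈ M.orb y := by
  obtain ⟨t, rfl⟩ := h
  exact ⟨-t, M.φ_neg_self t x⟩
lemma orb_trans {x y z} (h : y ∈ M.orb x) (h' : z ∈ M.orb y) : z ∈ M.orb x := by
  obtain ⟨t, rfl⟩ := h
  obtain ⟨s, rfl⟩ := h'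
  exact ⟨s + t, M.φ_add s t x⟩
lemma orb_eq {x y} (h : y ∈ M.orb x) : M.orb y = M.orb x :=
  Set.ext fun z => ⟨fun hz => M.orb_trans h hz, fun hz => M.orb_trans (M.orb_symm h) hz⟩

lemma fixed_iff (x) : M.gen x = 0 ↔ ∀ t, M.φ t x = x := fl_fixed_iff _ _

lemma fixed_iff_orb (x) : M.gen x = 0 ↔ M.orb x = {x} := by
  rw [fixed_iff]
  constructor
  · intro h
    ext y
    constructor
    · rintro ⟨t, rfl⟩; exact h t
    · rintro rfl; exact M.mem_orb_self _
  · intro h t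
    have := M.mem_orb t x
    rwa [h] at this

lemma gen_φ (t : ℝ) (x) : M.gen (M.φ t x) = 0 ↔ M.gen x = 0 := by
  rw [fixed_iff_orb, fixed_iff_orb, M.orb_eq (M.mem_orb t x)]
  constructor
  · intro h
    have := M.mem_orb_self x
    rw [h] at this
    rw [h, ← (Set.mem_singleton_iff.1 this)]
  · intro h
    have := M.mem_orb t x
    rw [h] at this
    rw [h, (Set.mem_singleton_iff.1 this)]

/-- stable subspace -/
def S : Submodule ℝ ((ι → ℝ) × C) where
  carrier := {x | x.2 = 0 ∧ ∀ i, 0 < M.lam i → x.1 i = 0}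
  add_mem' := by
    rintro x y ⟨h1, h2⟩ ⟨h3, h4⟩
    exact ⟨by simp [h1, h3], fun i hi => by simp [h2 i hi, h4 i hi]⟩
  zero_mem' := by simp
  smul_mem' := by
    rintro c x ⟨h1, h2⟩
    exact ⟨by simp [h1], fun i hi => by simp [h2 i hi]⟩

lemma mem_S {x} : x ∈ M.S ↔ x.2 = 0 ∧ ∀ i, 0 < M.lam i → x.1 i = 0 := Iff.rfl

/-- time reversal -/
abbrev rev : Mdl ι C := M.scale (-1) (by norm_num)

lemma rev_lam (i) : M.rev.lam i = - M.lam i := by simp [rev, scale]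
lemma rev_φ (t x) : M.rev.φ t x = M.φ (-t) x := by rw [φ_scale]; simp
lemma rev_orb (x) : M.rev.orb x = M.orb x := orb_scale _ _ _ _

/-- unstable subspace -/
def U : Submodule ℝ ((ι → ℝ) × C) := M.rev.S

lemma mem_U {x} : x ∈ M.U ↔ x.2 = 0 ∧ ∀ i, M.lam i < 0 → x.1 i = 0 := by
  rw [U, mem_S]
  simp [rev_lam]

lemma rev_S : M.rev.S = M.U := rfl
lemma rev_U : M.rev.U = M.S := by
  ext x
  rw [mem_U, mem_S]
  simp [rev_lam]

lemma SU_zero {x} (h1 : x ∈ M.S) (h2 : x ∈ M.U) : x = 0 := by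
  rw [mem_S] at h1
  rw [mem_U] at h2
  refine Prod.ext (funext fun i => ?_) h1.1
  rcases lt_or_gt_of_ne (M.lam_ne i) with h | h
  · exact h2.2 i h
  · exact h1.2 i h

lemma S_inv (t : ℝ) {x} (h : x ∈ M.S) : M.φ t x ∈ M.S := by
  rw [mem_S] at h ⊢
  refine ⟨by rw [φ_snd, h.1, map_zero], fun i hi => by rw [φ_fst, h.2 i hi, mul_zero]⟩

lemma S_orb {x y} (hy : y ∈ M.orb x) : y ∈ M.S ↔ x ∈ M.S := by
  constructor
  · intro h
    obtain ⟨t, rfl⟩ := M.orb_symm hy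
    exact M.S_inv t h
  · intro h
    obtain ⟨t, rfl⟩ := hy
    exact M.S_inv t h

lemma U_inv (t : ℝ) {x} (h : x ∈ M.U) : M.φ t x ∈ M.U := by
  have := M.rev.S_inv (-t) h
  rwa [rev_φ, neg_neg] at this

lemma U_orb {x y} (hy : y ∈ M.orb x) : y ∈ M.U ↔ x ∈ M.U := by
  rw [← rev_orb] at hy
  exact M.rev.S_orb hy

lemma S_tendsto {x} (h : x ∈ M.S) : Tendsto (fun t => M.φ t x) atTop (𝓝 0) := by
  rw [mem_S] at h
  have h0 : (0 : (ι → ℝ) × C) = ((fun _ => 0), 0) := rfl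
  rw [h0]
  refine Tendsto.prodMk_nhds ?_ ?_ |>.congr fun t => (M.φ_eq t x).symm
  · rw [tendsto_pi_nhds]
    intro i
    rcases lt_or_gt_of_ne (M.lam_ne i) with hi | hi
    · have : Tendsto (fun t : ℝ => M.lam i * t) atTop atBot :=
        tendsto_id.const_mul_atTop_of_neg hi
      have := (Real.tendsto_exp_atBot.comp this).mul_const (x.1 i)
      simpa using this
    · simp [h.2 i hi]
  · simp [h.1]

lemma U_tendsto {x} (h : x ∈ M.U) : Tendsto (fun t => M.φ t x) atBot (𝓝 0) := by
  have := (M.rev.S_tendsto h).comp tendsto_neg_atBot_atTop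
  refine this.congr fun t => ?_
  simp only [Function.comp]
  rw [rev_φ, neg_neg]

lemma center_zero {c : C} (h : ∀ ε > 0, ∃ t, ‖fl M.Ac t c‖ < ε) : c = 0 := by
  by_contra hc
  obtain ⟨p, hp⟩ := M.σ.nilp
  have hex : ∃ k, (M.σ.N ^ k) c = 0 := ⟨p, by rw [hp]; rfl⟩
  classical
  set k := Nat.find hex with hk
  have hk1 : (M.σ.N ^ k) c = 0 := Nat.find_spec hex
  have hk0 : k ≠ 0 := by
    intro h0
    rw [h0] at hk1
    exact hc (by simpa using hk1)
  obtain ⟨j, hj⟩ := Nat.exists_eq_succ_of_ne_zero hk0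
  have hj1 : (M.σ.N ^ j) c ≠ 0 := Nat.find_min hex (by omega)
  obtain ⟨b, hb, hrot⟩ := M.σ.rot_bdd
  have hNfl : ∀ t, (M.σ.N ^ j) (fl M.Ac t c) = fl M.σ.K t ((M.σ.N ^ j) c) := by
    intro t
    have e1 : fl M.Ac t = fl M.σ.K t * fl M.σ.N t := by
      have := M.hz
      calc fl M.Ac t = fl (M.σ.K + M.σ.N) t := congrArg (fun X => fl X t) this
        _ = _ := fl_add_op M.σ.KN t
    have e2 : Commute (M.σ.N ^ j) (fl M.σ.K t) := fl_commute (M.σ.KN.symm.pow_left j) t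
    have e3 : Commute (M.σ.N ^ j) (fl M.σ.N t) := fl_commute ((Commute.refl _).pow_left j) t
    have e4 : fl M.σ.N t ((M.σ.N ^ j) c) = (M.σ.N ^ j) c := by
      refine (fl_fixed_iff M.σ.N _).1 ?_ t
      rw [← ContinuousLinearMap.mul_apply, ← pow_succ', ← Nat.succ_eq_add_one, ← hj, hk1]
    rw [e1, ← ContinuousLinearMap.mul_apply, ← mul_assoc, e2.eq, mul_assoc, e3.eq]
    simp only [ContinuousLinearMap.mul_apply]
    rw [e4]
  have hlow : ∀ t, ‖(M.σ.N ^ j) c‖ ≤ b * (‖M.σ.N ^ j‖ * ‖fl M.Ac t c‖) := by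
    intro t
    calc ‖(M.σ.N ^ j) c‖ = ‖fl M.σ.K (-t) ((M.σ.N ^ j) (fl M.Ac t c))‖ := by
          rw [hNfl, fl_neg_self]
      _ ≤ b * ‖(M.σ.N ^ j) (fl M.Ac t c)‖ := (ContinuousLinearMap.le_opNorm _ _).trans (by gcongr; exact hrot _)
      _ ≤ _ := by gcongr; exact ContinuousLinearMap.le_opNorm _ _
  have hpos : 0 < ‖(M.σ.N ^ j) c‖ := norm_pos_iff.2 hj1
  obtain ⟨t, ht⟩ := h (‖(M.σ.N ^ j) c‖ / (b * (‖M.σ.N ^ j‖ + 1))) (by positivity)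
  have := hlow t
  rw [lt_div_iff₀ (by positivity)] at ht
  nlinarith [norm_nonneg (fl M.Ac t c), norm_nonneg (M.σ.N ^ j), mul_nonneg hb.le (norm_nonneg (fl M.Ac t c))]

lemma zero_mem_closure_iff (x) : (0 : (ι → ℝ) × C) ∈ closure (M.orb x) ↔ x ∈ M.S ∨ x ∈ M.U := by
  constructor
  · intro h
    rw [Metric.mem_closure_iff] at h
    have h' : ∀ ε > 0, ∃ t, ‖M.φ t x‖ < ε := by
      intro ε hε
      obtain ⟨_, ⟨t, rfl⟩, ht⟩ := h ε hε
      exact ⟨t, by simpa [dist_comm] using ht⟩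
    have hc : x.2 = 0 := M.center_zero fun ε hε => by
      obtain ⟨t, ht⟩ := h' ε hε
      exact ⟨t, by rw [← φ_snd]; exact (norm_snd_le _).trans_lt ht⟩
    by_contra hno
    rw [not_or, mem_S, mem_U] at hno
    obtain ⟨h1, h2⟩ := hno
    push Not at h1 h2
    obtain ⟨i, hi, hxi⟩ := h1 hc
    obtain ⟨j, hj, hxj⟩ := h2 hc
    obtain ⟨t, ht⟩ := h' (min |x.1 i| |x.1 j|) (lt_min (abs_pos.2 hxi) (abs_pos.2 hxj))
    have hb : ∀ k, Real.exp (M.lam k * t) * |x.1 k| < min |x.1 i| |x.1 j| := by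
      intro k
      have := ((norm_le_pi_norm _ k).trans (norm_fst_le (M.φ t x))).trans_lt ht
      rwa [φ_fst, norm_mul, Real.norm_eq_abs, Real.norm_eq_abs, Real.abs_exp] at this
    rcases le_total 0 t with h0 | h0
    · have h3 := (hb i).trans_le (min_le_left _ _)
      have : 1 ≤ Real.exp (M.lam i * t) := Real.one_le_exp (by positivity)
      nlinarith [abs_nonneg (x.1 i)]
    · have h3 := (hb j).trans_le (min_le_right _ _)
      have : 1 ≤ Real.exp (M.lam j * t) := Real.one_le_exp (by nlinarith)
      nlinarith [abs_nonneg (x.1 j)]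
  · rintro (h | h)
    · exact mem_closure_of_tendsto (M.S_tendsto h) (Eventually.of_forall fun t => M.mem_orb t x)
    · exact mem_closure_of_tendsto (M.U_tendsto h) (Eventually.of_forall fun t => M.mem_orb t x)

/-- prolongation relation -/
def R (x y : (ι → ℝ) × C) : Prop :=
  (x, y) ∈ closure {p : ((ι → ℝ) × C) × ((ι → ℝ) × C) | p.2 ∈ M.orb p.1}

lemma R_symm {x y} (h : M.R x y) : M.R y x := by
  have := image_closure_subset_closure_image (continuous_swap (X := (ι → ℝ) × C) (Y := (ι → ℝ) × C))
    (s := {p | p.2 ∈ M.orb p.1})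
  have h2 := this ⟨(x, y), h, rfl⟩
  refine closure_mono ?_ h2
  rintro _ ⟨p, hp, rfl⟩
  exact M.orb_symm hp

lemma R_SU {x y} (hx : x ∈ M.S) (hy : y ∈ M.U) : M.R x y := by
  have h1 : Tendsto (fun t : ℝ => (x + M.φ (-t) y, M.φ t x + y)) atTop (𝓝 (x + 0, 0 + y)) := by
    refine Tendsto.prodMk_nhds (tendsto_const_nhds.add ?_) ((M.S_tendsto hx).add tendsto_const_nhds)
    exact (M.U_tendsto hy).comp tendsto_neg_atTop_atBot
  rw [add_zero, zero_add] at h1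
  refine mem_closure_of_tendsto h1 (Eventually.of_forall fun t => ⟨t, ?_⟩)
  simp only
  rw [φ_vadd, φ_self_neg]

lemma R_SS {x y} (hx : x ∈ M.S) (hy : y ∈ M.S) (hx0 : x ≠ 0) (hy0 : y ≠ 0) (h : M.R x y) :
    y ∈ M.orb x := by
  rw [R, mem_closure_iff_seq_limit] at h
  obtain ⟨p, hp, hlim⟩ := h
  choose t ht using hp
  have hl1 : Tendsto (fun n => (p n).1) atTop (𝓝 x) := (continuous_fst.tendsto _).comp hlim
  have hl2 : Tendsto (fun n => (p n).2) atTop (𝓝 y) := (continuous_snd.tendsto _).comp hlim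
  have coord : ∀ z ∈ M.S, z ≠ 0 → ∃ i, M.lam i < 0 ∧ z.1 i ≠ 0 := by
    intro z hz hz0
    by_contra hno
    push Not at hno
    exact hz0 (M.SU_zero hz (M.mem_U.2 ⟨hz.1, hno⟩))
  have hci : ∀ (i : ι), Continuous fun z : (ι → ℝ) × C => |z.1 i| := fun i => by fun_prop
  obtain ⟨i, hi, hxi⟩ := coord x hx hx0
  obtain ⟨j, hj, hyj⟩ := coord y hy hy0
  have eq : ∀ n k, |(p n).2.1 k| = Real.exp (M.lam k * t n) * |(p n).1.1 k| := by
    intro n k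
    rw [← ht n]
    simp only
    rw [φ_fst, abs_mul, Real.abs_exp]
  -- lower bound
  have b1 : ∀ᶠ n in atTop, |x.1 i| / 2 < |(p n).1.1 i| :=
    (((hci i).tendsto _).comp hl1).eventually (lt_mem_nhds (half_lt_self (abs_pos.2 hxi)))
  have b2 : ∀ᶠ n in atTop, |(p n).2.1 i| < |y.1 i| + 1 :=
    (((hci i).tendsto _).comp hl2).eventually (gt_mem_nhds (by simp))
  have b3 : ∀ᶠ n in atTop, |y.1 j| / 2 < |(p n).2.1 j| :=
    (((hci j).tendsto _).comp hl2).eventually (lt_mem_nhds (half_lt_self (abs_pos.2 hyj)))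
  have b4 : ∀ᶠ n in atTop, |(p n).1.1 j| < |x.1 j| + 1 :=
    (((hci j).tendsto _).comp hl1).eventually (gt_mem_nhds (by simp))
  have hxi' := abs_pos.2 hxi
  have hyj' := abs_pos.2 hyj
  set A := Real.log ((|y.1 i| + 1) / (|x.1 i| / 2)) / M.lam i with hA
  set B := Real.log (|y.1 j| / 2 / (|x.1 j| + 1)) / M.lam j with hB
  have hbd : ∀ᶠ n in atTop, t n ∈ Set.Icc A B := by
    filter_upwards [b1, b2, b3, b4] with n h1 h2 h3 h4
    rw [eq] at h2 h3
    constructor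
    · rw [hA, div_le_iff_of_neg hi, mul_comm, Real.le_log_iff_exp_le (by positivity), le_div_iff₀ (by positivity)]
      have := Real.exp_pos (M.lam i * t n)
      nlinarith
    · rw [hB, le_div_iff_of_neg hj, mul_comm, Real.log_le_iff_le_exp (by positivity), div_le_iff₀ (by positivity)]
      have := Real.exp_pos (M.lam j * t n)
      nlinarith
  obtain ⟨s, -, ψ, hψ, hs⟩ := isCompact_Icc.tendsto_subseq' hbd.frequently
  refine ⟨s, ?_⟩
  have h1 : Tendsto (fun n => M.φ (t (ψ n)) (p (ψ n)).1) atTop (𝓝 (M.φ s x)) :=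
    (M.φ_cont.tendsto (s, x)).comp (hs.prodMk_nhds (hl1.comp hψ.tendsto_atTop))
  refine tendsto_nhds_unique h1 ?_
  refine (hl2.comp hψ.tendsto_atTop).congr fun n => (ht (ψ n)).symm

end Mdl

section OE
variable {ι C ι' C' : Type*} [Fintype ι] [NormedAddCommGroup C] [NormedSpace ℝ C]
    [FiniteDimensional ℝ C] [CompleteSpace C] [Fintype ι'] [NormedAddCommGroup C']
    [NormedSpace ℝ C'] [FiniteDimensional ℝ C'] [CompleteSpace C']
    {M : Mdl ι C} {M' : Mdl ι' C'} {h : ((ι → ℝ) × C) ≃ₜ ((ι' → ℝ) × C')}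

/-- all-Hölder orbit equivalence of models -/
structure OE0 (M : Mdl ι C) (M' : Mdl ι' C') (h : ((ι → ℝ) × C) ≃ₜ ((ι' → ℝ) × C')) : Prop where
  ah : AH h
  orb : ∀ x, h '' M.orb x = M'.orb (h x)

lemma OE0.symm (H : OE0 M M' h) : OE0 M' M h.symm where
  ah := H.ah.symm
  orb x := by
    have := H.orb (h.symm x)
    rw [h.apply_symm_apply] at this
    rw [← this, Set.image_image]
    simp

lemma OE0.mem (H : OE0 M M' h) {x y} : h y ∈ M'.orb (h x) ↔ y ∈ M.orb x := by
  rw [← H.orb]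
  exact h.injective.mem_set_image

lemma OE0.scale (H : OE0 M M' h) {α β : ℝ} (hα : α ≠ 0) (hβ : β ≠ 0) :
    OE0 (M.scale α hα) (M'.scale β hβ) h where
  ah := H.ah
  orb x := by rw [orb_scale, orb_scale, H.orb]

lemma OE0.fixed (H : OE0 M M' h) (x) : M'.gen (h x) = 0 ↔ M.gen x = 0 := by
  rw [Mdl.fixed_iff_orb, Mdl.fixed_iff_orb, ← H.orb]
  rw [← Set.image_singleton, Set.image_eq_image h.injective]

lemma OE0.lift' (H : OE0 M M' h) {x} (hx : M.gen x ≠ 0) :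
    ∃ τ : ℝ → ℝ, Continuous τ ∧ τ 0 = 0 ∧ ∀ t, h (M.φ t x) = M'.φ (τ t) (h x) := by
  have hx' : M'.gen (h x) ≠ 0 := by rwa [Ne, H.fixed]
  have := full_lift M'.gen (γ := fun t => h (M.φ t x)) (h.continuous.comp (M.φ_cont_t x))
    (w₀ := h x) (fun t => by
      have := H.mem.2 (M.mem_orb t x)
      obtain ⟨s, hs⟩ := this
      exact ⟨s, hs.symm⟩) (fun t => by rw [Ne, H.fixed, M.gen_φ]; exact hx)
  simp only [M.φ_zero] at this
  exact this

lemma OE0.lift (H : OE0 M M' h) {x} (hx : M.gen x ≠ 0) :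
    ∃ τ : ℝ → ℝ, Continuous τ ∧ τ 0 = 0 ∧ Function.Bijective τ ∧ (StrictMono τ ∨ StrictAnti τ) ∧
      ∀ t, h (M.φ t x) = M'.φ (τ t) (h x) := by
  have hx' : M'.gen (h x) ≠ 0 := by rwa [Ne, H.fixed]
  obtain ⟨τ, hc, h0, hτ⟩ := H.lift' hx
  obtain ⟨τ', hc', h0', hτ'⟩ := H.symm.lift' hx'
  rw [h.symm_apply_apply] at hτ'
  have e1 : ∀ t, τ' (τ t) = t := by
    intro t
    refine lift_unique (A := M.gen) (w := x) hx (σ₁ := fun t => τ' (τ t)) (σ₂ := fun t => t) (a := 0) (b := t)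
      (hc'.comp hc).continuousOn continuous_id.continuousOn (by simp [h0, h0']) fun s _ => ?_
    have h1 := hτ' (τ s)
    rw [← hτ, h.symm_apply_apply] at h1
    exact h1.symm
  have e2 : ∀ t, τ (τ' t) = t := by
    intro t
    refine lift_unique (A := M'.gen) (w := h x) hx' (σ₁ := fun t => τ (τ' t)) (σ₂ := fun t => t) (a := 0) (b := t)
      (hc.comp hc').continuousOn continuous_id.continuousOn (by simp [h0, h0']) fun s _ => ?_
    have h1 := hτ (τ' s)
    rw [← hτ', h.apply_symm_apply] at h1
    exact h1.symm
  have hinj : Function.Injective τ := Function.LeftInverse.injective e1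
  exact ⟨τ, hc, h0, ⟨hinj, Function.RightInverse.surjective e2⟩, hc.strictMono_of_inj hinj, hτ⟩

lemma OE0.R (H : OE0 M M' h) {x y} (hR : M.R x y) : M'.R (h x) (h y) := by
  have := image_closure_subset_closure_image
    (f := fun p : ((ι → ℝ) × C) × ((ι → ℝ) × C) => (h p.1, h p.2)) (by fun_prop)
    (s := {p | p.2 ∈ M.orb p.1})
  refine closure_mono ?_ (this ⟨(x, y), hR, rfl⟩)
  rintro _ ⟨p, hp, rfl⟩
  exact H.mem.2 hp

lemma OE0.SU (H : OE0 M M' h) (x) : (h x ∈ M'.S ∨ h x ∈ M'.U) ↔ (x ∈ M.S ∨ x ∈ M.U) := by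
  rw [← Mdl.zero_mem_closure_iff, ← Mdl.zero_mem_closure_iff, ← H.orb, ← h.image_closure, ← H.ah.zero]
  exact h.injective.mem_set_image

/-- orbit equivalence with matching stable and unstable spaces -/
structure OE (M : Mdl ι C) (M' : Mdl ι' C') (h : ((ι → ℝ) × C) ≃ₜ ((ι' → ℝ) × C')) : Prop extends
    OE0 M M' h where
  S : ∀ x, h x ∈ M'.S ↔ x ∈ M.S
  U : ∀ x, h x ∈ M'.U ↔ x ∈ M.U

lemma OE.symm (H : OE M M' h) : OE M' M h.symm where
  toOE0 := H.toOE0.symm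
  S x := by rw [← H.S, h.apply_symm_apply]
  U x := by rw [← H.U, h.apply_symm_apply]

lemma OE.rev (H : OE M M' h) : OE M.rev M'.rev h where
  toOE0 := H.toOE0.scale _ _
  S x := H.U x
  U x := by rw [Mdl.rev_U, Mdl.rev_U]; exact H.S x

lemma OE0.zero_iff (H : OE0 M M' h) (x) : h x = 0 ↔ x = 0 := by
  rw [← H.ah.zero]
  exact h.injective.eq_iff

lemma OE0.split_aux (H : OE0 M M' h)
    (hex : ∃ x ∈ M.S, x ≠ 0 ∧ h x ∈ M'.S) : OE M M' h := by
  obtain ⟨x, hxS, hx0, hxS'⟩ := hex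
  have hx0' : h x ≠ 0 := by rwa [Ne, H.zero_iff]
  have a1 : ∀ y ∈ M.S, h y ∈ M'.S := by
    intro y hy
    by_cases hy0 : y = 0
    · rw [hy0, H.ah.zero]; exact zero_mem _
    rcases (H.SU y).2 (Or.inl hy) with h1 | h1
    · exact h1
    · exfalso
      have := H.symm.R (M'.R_SU hxS' h1)
      rw [h.symm_apply_apply, h.symm_apply_apply] at this
      have h3 := H.mem.2 (M.R_SS hxS hy hx0 hy0 this)
      have h4 := (M'.S_orb h3).2 hxS'
      exact hy0 ((H.zero_iff y).1 (M'.SU_zero h4 h1))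
  have a2 : ∀ y ∈ M.U, h y ∈ M'.U := by
    intro y hy
    by_cases hy0 : y = 0
    · rw [hy0, H.ah.zero]; exact zero_mem _
    rcases (H.SU y).2 (Or.inr hy) with h1 | h1
    · exfalso
      have := H.R (M.R_SU hxS hy)
      have h3 := H.mem.1 (M'.R_SS hxS' h1 hx0' (by rwa [Ne, H.zero_iff]) this)
      exact hy0 (M.SU_zero ((M.S_orb h3).2 hxS) hy)
    · exact h1
  refine ⟨H, fun y => ⟨fun hy => ?_, a1 y⟩, fun y => ⟨fun hy => ?_, a2 y⟩⟩
  · rcases (H.SU y).1 (Or.inl hy) with h1 | h1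
    · exact h1
    · have := (H.zero_iff y).1 (M'.SU_zero hy (a2 y h1))
      rw [this]; exact zero_mem _
  · rcases (H.SU y).1 (Or.inr hy) with h1 | h1
    · have := (H.zero_iff y).1 (M'.SU_zero (a1 y h1) hy)
      rw [this]; exact zero_mem _
    · exact h1

lemma OE0.split (H : OE0 M M' h) : OE M M' h ∨ OE M M'.rev h := by
  by_cases c1 : ∃ x ∈ M.S, x ≠ 0 ∧ h x ∈ M'.S
  · exact Or.inl (H.split_aux c1)
  by_cases c2 : ∃ x ∈ M.U, x ≠ 0 ∧ h x ∈ M'.U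
  · left
    have := (H.scale (α := -1) (β := -1) (by norm_num) (by norm_num)).split_aux c2
    refine ⟨H, fun x => ?_, fun x => this.S x⟩
    have h2 := this.U x
    rwa [Mdl.rev_U, Mdl.rev_U] at h2
  right
  push Not at c1 c2
  have H2 : OE0 M M'.rev h := by
    have := H.scale (α := 1) (β := -1) one_ne_zero (by norm_num)
    exact ⟨H.ah, fun x => by rw [Mdl.rev_orb, H.orb]⟩
  have b1 : ∀ x ∈ M.S, h x ∈ M'.U := by
    intro x hx
    by_cases hx0 : x = 0
    · rw [hx0, H.ah.zero]; exact zero_mem _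
    · exact ((H.SU x).2 (Or.inl hx)).resolve_left (c1 x hx hx0)
  have b2 : ∀ x ∈ M.U, h x ∈ M'.S := by
    intro x hx
    by_cases hx0 : x = 0
    · rw [hx0, H.ah.zero]; exact zero_mem _
    · exact ((H.SU x).2 (Or.inr hx)).resolve_right (c2 x hx hx0)
  refine ⟨H2, fun x => ⟨fun hx => ?_, b1 x⟩, fun x => ?_⟩
  · rcases (H.SU x).1 (Or.inr hx) with h1 | h1
    · exact h1
    · have := (H.zero_iff x).1 (M'.SU_zero (b2 x h1) hx)
      rw [this]; exact zero_mem _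
  · rw [Mdl.rev_U]
    refine ⟨fun hx => ?_, b2 x⟩
    rcases (H.SU x).1 (Or.inl hx) with h1 | h1
    · have := (H.zero_iff x).1 (M'.SU_zero hx (b1 x h1))
      rw [this]; exact zero_mem _
    · exact h1

end OE
end

section
set_option linter.unusedSectionVars false
set_option linter.deprecated false
set_option linter.unusedVariables false

section DimH
variable {E F : Type*} [NormedAddCommGroup E] [NormedSpace ℝ E]
  [NormedAddCommGroup F] [NormedSpace ℝ F]

lemma Hol.get1 {f : E → F} (hf : Hol f) {γ : ℝ} (h0 : 0 < γ) (h1 : γ < 1) :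
    ∃ r > 0, r ≤ 1 ∧ ∀ x y, ‖x‖ < r → ‖y‖ < r → ‖f x - f y‖ ≤ ‖x - y‖ ^ γ := by
  obtain ⟨r, hr, K, hK, H⟩ := hf.get (γ := (γ + 1) / 2) (by linarith) (by linarith)
  have hd : 0 < (1 - γ) / 2 := by linarith
  -- K * u^((1-γ)/2) ≤ 1 for u ≤ u0
  set u0 : ℝ := (1 / K) ^ (1 / ((1 - γ) / 2)) with hu0
  have hu0p : 0 < u0 := Real.rpow_pos_of_pos (by positivity) _
  refine ⟨min (min r (u0 / 2)) 1, by positivity, min_le_right _ _, fun x y hx hy => ?_⟩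
  have hx1 : ‖x‖ < r := lt_of_lt_of_le hx ((min_le_left _ _).trans (min_le_left _ _))
  have hy1 : ‖y‖ < r := lt_of_lt_of_le hy ((min_le_left _ _).trans (min_le_left _ _))
  have hx2 : ‖x‖ < u0 / 2 := lt_of_lt_of_le hx ((min_le_left _ _).trans (min_le_right _ _))
  have hy2 : ‖y‖ < u0 / 2 := lt_of_lt_of_le hy ((min_le_left _ _).trans (min_le_right _ _))
  have h2 := H x y hx1 hy1
  have h3 : ‖x - y‖ ≤ u0 := (norm_sub_le _ _).trans (by linarith)
  rcases eq_or_lt_of_le (norm_nonneg (x - y)) with h4 | h4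
  · rw [← h4, Real.zero_rpow (by linarith)] at h2
    rw [← h4, Real.zero_rpow (by linarith)]
    simpa using h2
  · refine h2.trans ?_
    have : (γ + 1) / 2 = (1 - γ) / 2 + γ := by ring
    rw [this, Real.rpow_add h4, ← mul_assoc]
    have h5 : ‖x - y‖ ^ ((1 - γ) / 2) ≤ 1 / K := by
      calc _ ≤ u0 ^ ((1 - γ) / 2) := Real.rpow_le_rpow h4.le h3 hd.le
        _ = 1 / K := by
          rw [hu0, ← Real.rpow_mul (by positivity), one_div_mul_cancel hd.ne', Real.rpow_one]
    have h6 : K * ‖x - y‖ ^ ((1 - γ) / 2) ≤ 1 := by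
      calc _ ≤ K * (1 / K) := by gcongr
        _ = 1 := by field_simp
    calc _ ≤ 1 * ‖x - y‖ ^ γ := by gcongr
      _ = _ := one_mul _

lemma AH.dimH_le {h : E ≃ₜ F} (H : AH h) {P : Set E} {P' : Set F}
    (hP : ∀ y ∈ P', h.symm y ∈ P)
    (cov : ∀ ρ > 0, ∃ L : ℕ → F →L[ℝ] F, P' ⊆ ⋃ n, L n '' (P' ∩ Metric.ball 0 ρ)) :
    dimH P' ≤ dimH P := by
  have key : ∀ n : ℕ, dimH P' ≤ dimH P * (((1 : NNReal) + (n+1 : NNReal)⁻¹ : NNReal) : ENNReal) := by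
    intro n
    set γ : NNReal := ((1 : NNReal) + (n+1 : NNReal)⁻¹)⁻¹ with hγ
    have hg0 : 0 < γ := by positivity
    have hg1 : γ < 1 := by
      rw [hγ]
      apply inv_lt_one_of_one_lt₀
      have : 0 < (n+1 : NNReal)⁻¹ := by positivity
      exact lt_add_of_pos_right 1 this
    obtain ⟨r, hr, _, hh⟩ := H.hol.get1 (γ := γ) (by exact_mod_cast hg0) (by exact_mod_cast hg1)
    obtain ⟨ρ, hρ, hρ2⟩ : ∃ ρ > 0, ∀ y : F, ‖y‖ < ρ → ‖h.symm y‖ < r := by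
      have hc : ContinuousAt h.symm 0 := h.symm.continuous.continuousAt
      have := Metric.continuousAt_iff.1 hc r hr
      rw [H.symm.zero] at this
      simpa using this
    obtain ⟨L, hL⟩ := cov ρ hρ
    set Q := P' ∩ Metric.ball 0 ρ with hQ
    have h1 : dimH P' ≤ dimH Q := by
      refine (dimH_mono hL).trans ?_
      rw [dimH_iUnion]
      exact iSup_le fun n => (L n).lipschitz.dimH_image_le _
    have h2 : Q ⊆ h '' (P ∩ Metric.ball 0 r) := by
      rintro y ⟨hy, hy2⟩
      refine ⟨h.symm y, ⟨hP y hy, ?_⟩, h.apply_symm_apply y⟩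
      simpa using hρ2 y (by simpa using hy2)
    have h3 : HolderOnWith 1 γ h (P ∩ Metric.ball 0 r) := by
      intro x hx y hy
      have := hh x y (by simpa using hx.2) (by simpa using hy.2)
      rw [edist_dist, edist_dist, dist_eq_norm, dist_eq_norm, ENNReal.coe_one, one_mul,
        ENNReal.ofReal_rpow_of_nonneg (norm_nonneg _) (by positivity)]
      exact ENNReal.ofReal_le_ofReal this
    have h4 := h3.dimH_image_le hg0
    refine h1.trans ((dimH_mono h2).trans (h4.trans ?_))
    have h5 : dimH (P ∩ Metric.ball 0 r) ≤ dimH P := dimH_mono Set.inter_subset_left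
    rw [ENNReal.div_eq_inv_mul, mul_comm]
    have : ((γ : ENNReal))⁻¹ = (((1 : NNReal) + (n+1 : NNReal)⁻¹ : NNReal) : ENNReal) := by
      rw [← ENNReal.coe_inv hg0.ne', hγ, inv_inv]
    rw [this]
    gcongr
  have ht : Tendsto (fun n : ℕ => dimH P * (((1 : NNReal) + (n+1 : NNReal)⁻¹ : NNReal) : ENNReal)) atTop
      (𝓝 (dimH P * ((1 : NNReal) : ENNReal))) := by
    refine ENNReal.Tendsto.const_mul ?_ (Or.inl (by simp)) |>.trans le_rfl
    rw [ENNReal.tendsto_coe]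
    have : Tendsto (fun n : ℕ => (n+1 : NNReal)⁻¹) atTop (𝓝 0) := by
      have h1 := tendsto_one_div_add_atTop_nhds_zero_nat (𝕜 := NNReal)
      simpa using h1
    simpa using this.const_add 1
  simpa using ge_of_tendsto' ht key

lemma dimH_submodule [FiniteDimensional ℝ E] (V : Submodule ℝ E) :
    dimH (V : Set E) = Module.finrank ℝ V := by
  have h1 := (V.subtypeₗᵢ.isometry).dimH_image Set.univ
  rw [Real.dimH_univ_eq_finrank] at h1
  rw [← h1]
  simp

lemma AH.finrank_le [FiniteDimensional ℝ E] [FiniteDimensional ℝ F] {h : E ≃ₜ F} (H : AH h)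
    {V : Submodule ℝ E} {V' : Submodule ℝ F}
    (hP : ∀ y ∈ V', h.symm y ∈ V) : Module.finrank ℝ V' ≤ Module.finrank ℝ V := by
  have := H.dimH_le (P := V) (P' := V') hP (fun ρ hρ => ⟨fun n => (n : ℝ) • 1, fun y hy => ?_⟩)
  · rw [dimH_submodule, dimH_submodule] at this
    exact_mod_cast this
  · obtain ⟨n, hn⟩ := exists_nat_gt (‖y‖ / ρ)
    have hn0 : (0 : ℝ) < n := lt_of_le_of_lt (by positivity) hn
    refine Set.mem_iUnion.2 ⟨n, (n : ℝ)⁻¹ • y, ⟨V'.smul_mem _ hy, ?_⟩, ?_⟩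
    · rw [div_lt_iff₀ hρ] at hn
      rw [mem_ball_zero_iff, norm_smul, norm_inv, Real.norm_of_nonneg hn0.le,
        inv_mul_lt_iff₀ hn0]
      exact hn
    · simp [smul_smul, hn0.ne']

lemma AH.finrank_eq [FiniteDimensional ℝ E] [FiniteDimensional ℝ F] {h : E ≃ₜ F} (H : AH h)
    {V : Submodule ℝ E} {V' : Submodule ℝ F}
    (hP : ∀ x, h x ∈ V' ↔ x ∈ V) : Module.finrank ℝ V' = Module.finrank ℝ V :=
  le_antisymm (H.finrank_le fun y hy => by rw [← hP]; simpa using hy)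
    (H.symm.finrank_le fun x hx => by simpa [hP] using hx)
end DimH
end

section
set_option linter.unusedSectionVars false
set_option linter.deprecated false
set_option linter.unusedVariables false

namespace Mdl
variable {ι C : Type*} [Fintype ι] [NormedAddCommGroup C] [NormedSpace ℝ C]
    [FiniteDimensional ℝ C] [CompleteSpace C] (M : Mdl ι C)

lemma le_norm (x : (ι → ℝ) × C) (i : ι) : |x.1 i| ≤ ‖x‖ :=
  (norm_le_pi_norm x.1 i).trans (norm_fst_le x)

/-- decay bound -/
lemma S_bound {x : (ι → ℝ) × C} (h2 : x.2 = 0) {c : ℝ} (hc : ∀ i, x.1 i ≠ 0 → M.lam i ≤ c)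
    {t : ℝ} (ht : 0 ≤ t) : ‖M.φ t x‖ ≤ Real.exp (c * t) * ‖x‖ := by
  rw [Prod.norm_def]
  refine max_le ?_ ?_
  · refine (pi_norm_le_iff_of_nonneg (by positivity)).2 fun i => ?_
    rw [φ_fst, norm_mul, Real.norm_of_nonneg (Real.exp_pos _).le]
    by_cases hi : x.1 i = 0
    · rw [hi]; simp; positivity
    · have := hc i hi
      have h3 : ‖x.1 i‖ ≤ ‖x‖ := le_norm x i
      gcongr
  · rw [φ_snd, h2, map_zero, norm_zero]; positivity

/-- slowest stable index -/
def Slow (i : ι) : Prop := M.lam i < 0 ∧ ∀ j, M.lam j < 0 → M.lam j ≤ M.lam i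

lemma exists_slow {j : ι} (hj : M.lam j < 0) : ∃ i, M.Slow i := by
  classical
  obtain ⟨i, hi, hi2⟩ := (Finset.univ.filter fun i => M.lam i < 0).exists_max_image M.lam
    ⟨j, by simpa using hj⟩
  exact ⟨i, by simpa using hi, fun j hj => hi2 j (by simpa using hj)⟩

lemma S_slow_bound {x} (hx : x ∈ M.S) {i0} (h0 : M.Slow i0) {t : ℝ} (ht : 0 ≤ t) :
    ‖M.φ t x‖ ≤ Real.exp (M.lam i0 * t) * ‖x‖ := by
  refine M.S_bound hx.1 (fun i hi => h0.2 i ?_) ht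
  rcases lt_or_gt_of_ne (M.lam_ne i) with h | h
  · exact h
  · exact absurd (hx.2 i h) hi

/-- points whose orbit follows that of `x` to order `< r` -/
def Fset (x : (ι → ℝ) × C) (r : ℝ) : Set ((ι → ℝ) × C) :=
  {y | y ∈ M.S ∧ ∀ ρ : ℝ, 1 < ρ → ρ < r → ∃ δ : ℝ, 0 < δ ∧
    ∀ z ∈ M.orb x, ‖z‖ < δ → ∃ w ∈ M.orb y, ‖z - w‖ ≤ ‖z‖ ^ ρ}

lemma Fset_of {x : (ι → ℝ) × C} (hx : x ∈ M.S) {i0} (h0 : M.Slow i0) (hx0 : x.1 i0 ≠ 0)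
    {r : ℝ} {y} (hy : y ∈ M.S) (s : ℝ)
    (hs : ∀ i, r * M.lam i0 < M.lam i → M.lam i < 0 → (M.φ s y).1 i = x.1 i) : y ∈ M.Fset x r := by
  refine ⟨hy, fun ρ h1 h2 => ?_⟩
  set a := M.lam i0 with ha
  have ha0 : a < 0 := h0.1
  set D := ‖x - M.φ s y‖ with hD
  have hxp : 0 < |x.1 i0| := abs_pos.2 hx0
  have ht : Tendsto (fun t : ℝ => |x.1 i0| ^ ρ * Real.exp ((-(r - ρ) * a) * t)) atTop atTop := by
    refine Tendsto.const_mul_atTop (Real.rpow_pos_of_pos hxp _) ?_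
    refine Real.tendsto_exp_atTop.comp (tendsto_id.const_mul_atTop ?_)
    nlinarith
  obtain ⟨t0, ht0⟩ := (ht.eventually_ge_atTop D).exists_forall_of_atTop
  refine ⟨|x.1 i0| * Real.exp (a * max t0 0), by positivity, ?_⟩
  rintro z ⟨t, rfl⟩ hz
  have h3 : |(M.φ t x).1 i0| ≤ ‖M.φ t x‖ := le_norm _ _
  rw [φ_fst, abs_mul, abs_of_pos (Real.exp_pos _), mul_comm] at h3
  have h4 : max t0 0 < t := by
    have := lt_of_le_of_lt h3 hz
    rw [mul_lt_mul_iff_right₀ hxp, Real.exp_lt_exp] at this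
    nlinarith
  have ht1 : t0 ≤ t := (le_max_left _ _).trans h4.le
  have ht2 : 0 ≤ t := (le_max_right _ _).trans h4.le
  refine ⟨M.φ t (M.φ s y), M.orb_trans (M.mem_orb s y) (M.mem_orb _ _), ?_⟩
  simp only
  rw [← φ_vsub]
  have h5 : x - M.φ s y ∈ M.S := M.S.sub_mem hx (M.S_inv s hy)
  have h6 : ‖M.φ t (x - M.φ s y)‖ ≤ Real.exp (r * a * t) * D := by
    refine M.S_bound h5.1 (fun i hi => ?_) ht2
    by_contra hcon
    push Not at hcon
    rcases lt_or_gt_of_ne (M.lam_ne i) with h | h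
    · apply hi
      have := hs i hcon h
      simp [this]
    · exact hi (h5.2 i h)
  refine h6.trans ?_
  have h7 : (|x.1 i0| * Real.exp (a * t)) ^ ρ ≤ ‖M.φ t x‖ ^ ρ :=
    Real.rpow_le_rpow (by positivity) h3 (by linarith)
  refine le_trans ?_ h7
  rw [Real.mul_rpow (by positivity) (by positivity), ← Real.exp_mul]
  calc _ ≤ Real.exp (r * a * t) * (|x.1 i0| ^ ρ * Real.exp ((-(r - ρ) * a) * t)) := by
        gcongr; exact ht0 t ht1
    _ = |x.1 i0| ^ ρ * (Real.exp (r * a * t) * Real.exp ((-(r - ρ) * a) * t)) := by ring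
    _ = _ := by rw [← Real.exp_add]; congr 2; ring

lemma Fset_imp {x : (ι → ℝ) × C} (hx : x ∈ M.S) {i0} (h0 : M.Slow i0) (hx0 : x.1 i0 ≠ 0)
    {r : ℝ} (hr : 1 < r) {y} (hy : y ∈ M.Fset x r) :
    ∃ s, ∀ i, r * M.lam i0 < M.lam i → M.lam i < 0 → (M.φ s y).1 i = x.1 i := by
  set a := M.lam i0 with ha
  have ha0 : a < 0 := h0.1
  obtain ⟨ρ, hρ1, hρr, hρ⟩ : ∃ ρ : ℝ, 1 < ρ ∧ ρ < r ∧ ∀ i, r * a < M.lam i → ρ * a < M.lam i := by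
    have h1 : ∀ᶠ ρ : ℝ in 𝓝[<] r, 1 < ρ := eventually_nhdsWithin_of_eventually_nhds (lt_mem_nhds hr)
    have h2 : ∀ᶠ ρ : ℝ in 𝓝[<] r, ρ < r := self_mem_nhdsWithin
    have h3 : ∀ᶠ ρ : ℝ in 𝓝[<] r, ∀ i, r * a < M.lam i → ρ * a < M.lam i := by
      rw [eventually_all]
      intro i
      by_cases hi : r * a < M.lam i
      · have hc : Tendsto (fun ρ : ℝ => ρ * a) (𝓝 r) (𝓝 (r * a)) :=
          (continuous_id.mul continuous_const).tendsto _
        filter_upwards [eventually_nhdsWithin_of_eventually_nhds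
          (hc.eventually (gt_mem_nhds hi))] with ρ h _ using h
      · exact Eventually.of_forall fun _ h => absurd h hi
    obtain ⟨ρ, h⟩ := (h1.and (h2.and h3)).exists
    exact ⟨ρ, h.1, h.2.1, h.2.2⟩
  obtain ⟨δ, hδ, H⟩ := hy.2 ρ hρ1 hρr
  have hev : ∀ᶠ t : ℝ in atTop, ∃ u, ‖M.φ t x - M.φ u y‖ ≤ ‖M.φ t x‖ ^ ρ := by
    have := (M.S_tendsto hx).norm
    rw [norm_zero] at this
    filter_upwards [this.eventually (gt_mem_nhds hδ)] with t ht
    obtain ⟨w, ⟨u, rfl⟩, hw⟩ := H _ (M.mem_orb t x) ht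
    exact ⟨u, hw⟩
  obtain ⟨u, hu⟩ := Filter.skolem.1 hev
  have key : ∀ i, r * a < M.lam i →
      Tendsto (fun t => Real.exp (M.lam i * (u t - t)) * y.1 i) atTop (𝓝 (x.1 i)) := by
    intro i hi
    rw [tendsto_iff_norm_sub_tendsto_zero]
    have hlim : Tendsto (fun t : ℝ => ‖x‖ ^ ρ * Real.exp ((ρ * a - M.lam i) * t)) atTop (𝓝 0) := by
      have h2 : Tendsto (fun t : ℝ => (ρ * a - M.lam i) * t) atTop atBot :=
        tendsto_id.const_mul_atTop_of_neg (by linarith [hρ i hi])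
      simpa using (Real.tendsto_exp_atBot.comp h2).const_mul (‖x‖ ^ ρ)
    refine squeeze_zero' (Eventually.of_forall fun _ => norm_nonneg _) ?_ hlim
    filter_upwards [hu, eventually_ge_atTop 0] with t ht ht0
    have h1 : |(M.φ t x - M.φ (u t) y).1 i| ≤ ‖x‖ ^ ρ * Real.exp (ρ * a * t) := by
      refine (le_norm _ i).trans (ht.trans ?_)
      calc _ ≤ (Real.exp (a * t) * ‖x‖) ^ ρ :=
            Real.rpow_le_rpow (norm_nonneg _) (M.S_slow_bound hx h0 ht0) (by linarith)
        _ = _ := by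
          rw [Real.mul_rpow (by positivity) (by positivity), ← Real.exp_mul, mul_comm]
          congr 2; ring
    rw [Prod.fst_sub, Pi.sub_apply, φ_fst, φ_fst] at h1
    have h2 : Real.exp (M.lam i * (u t - t)) * y.1 i - x.1 i =
        Real.exp (-(M.lam i * t)) * -(Real.exp (M.lam i * t) * x.1 i - Real.exp (M.lam i * u t) * y.1 i) := by
      have e1 : Real.exp (-(M.lam i * t)) * Real.exp (M.lam i * t) = 1 := by
        rw [← Real.exp_add]; simp
      have e2 : Real.exp (-(M.lam i * t)) * Real.exp (M.lam i * u t) =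
          Real.exp (M.lam i * (u t - t)) := by
        rw [← Real.exp_add]; congr 1; ring
      linear_combination (-x.1 i) * (1 - e1) + (y.1 i) * (-e2) + 2 * x.1 i * (1 - e1) - (x.1 i) * (-e1) - 2 * x.1 i + x.1 i * e1 
    rw [h2, norm_mul, norm_neg, Real.norm_of_nonneg (Real.exp_pos _).le, Real.norm_eq_abs]
    calc _ ≤ Real.exp (-(M.lam i * t)) * (‖x‖ ^ ρ * Real.exp (ρ * a * t)) := by gcongr
      _ = ‖x‖ ^ ρ * (Real.exp (-(M.lam i * t)) * Real.exp (ρ * a * t)) := by ring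
      _ = _ := by rw [← Real.exp_add]; congr 2; ring
  have hra : r * a < a := by nlinarith
  have k0 := key i0 hra
  have hy0 : y.1 i0 ≠ 0 := by
    intro h
    rw [h] at k0
    simp only [mul_zero] at k0
    exact hx0 (tendsto_nhds_unique k0 tendsto_const_nhds)
  have k1 : Tendsto (fun t => Real.exp (a * (u t - t))) atTop (𝓝 (x.1 i0 / y.1 i0)) := by
    have := k0.div_const (y.1 i0)
    simpa [hy0] using this
  have hq : 0 < x.1 i0 / y.1 i0 :=
    lt_of_le_of_ne (ge_of_tendsto' k1 fun t => (Real.exp_pos _).le) (div_ne_zero hx0 hy0).symm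
  have k2 : Tendsto (fun t => u t - t) atTop (𝓝 (Real.log (x.1 i0 / y.1 i0) / a)) := by
    have := ((Real.continuousAt_log hq.ne').tendsto.comp k1).div_const a
    simpa [Function.comp_def, ha0.ne] using this
  refine ⟨Real.log (x.1 i0 / y.1 i0) / a, fun i h1 h2 => ?_⟩
  rw [φ_fst]
  refine tendsto_nhds_unique ?_ (key i h1)
  exact ((Real.continuous_exp.tendsto _).comp (k2.const_mul _)).mul_const _

lemma Fset_inv {x y : (ι → ℝ) × C} {r : ℝ} (h : y ∈ M.Fset x r) (t : ℝ) : M.φ t y ∈ M.Fset x r := by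
  refine ⟨M.S_inv t h.1, ?_⟩
  rw [M.orb_eq (M.mem_orb t y)]
  exact h.2

/-- parametrization -/
def Gpar (x : (ι → ℝ) × C) (c : ℝ) (p : ℝ × ({i // M.lam i ≤ c} → ℝ)) : (ι → ℝ) × C :=
  open Classical in
  (fun i => if h : M.lam i ≤ c then p.2 ⟨i, h⟩ else Real.exp (-(M.lam i * p.1)) * x.1 i, 0)

lemma Gpar_contDiff (x : (ι → ℝ) × C) (c : ℝ) : ContDiff ℝ 1 (M.Gpar x c) := by
  unfold Gpar
  refine ContDiff.prodMk (contDiff_pi.2 fun i => ?_) contDiff_const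
  by_cases h : M.lam i ≤ c
  · simp only [h, dite_true]
    exact (contDiff_apply ℝ ℝ (⟨i, h⟩ : {i // M.lam i ≤ c})).comp contDiff_snd
  · simp only [h, dite_false]
    exact (Real.contDiff_exp.comp ((contDiff_const.mul contDiff_fst).neg)).mul contDiff_const

lemma dimH_Fset {x : (ι → ℝ) × C} (hx : x ∈ M.S) {i0} (h0 : M.Slow i0) (hx0 : x.1 i0 ≠ 0)
    {r : ℝ} (hr : 1 < r) : dimH (M.Fset x r) = ((1 + M.cnt (r * M.lam i0) : ℕ) : ENNReal) := by
  classical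
  set c := r * M.lam i0 with hc
  have ha0 : M.lam i0 < 0 := h0.1
  have hc0 : c < M.lam i0 := by rw [hc]; nlinarith
  have han := ha0.ne
  have hfr : Module.finrank ℝ (ℝ × ({i // M.lam i ≤ c} → ℝ)) = 1 + M.cnt c := by
    simp [cnt]
  refine le_antisymm ?_ ?_
  · have hsub : M.Fset x r ⊆ Set.range (M.Gpar x c) := by
      intro y hy
      obtain ⟨s, hs⟩ := M.Fset_imp hx h0 hx0 hr hy
      refine ⟨(s, fun i => y.1 i), ?_⟩
      unfold Gpar
      ext i
      · by_cases h : M.lam i ≤ c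
        · simp [h]
        · simp only [h, dite_false]
          push Not at h
          rcases lt_or_gt_of_ne (M.lam_ne i) with h2 | h2
          · rw [← hs i h h2, φ_fst, ← mul_assoc, ← Real.exp_add]; simp
          · rw [hx.2 i h2, hy.1.2 i h2, mul_zero]
      · exact hy.1.1.symm
    refine (dimH_mono hsub).trans ((M.Gpar_contDiff x c).dimH_range_le.trans ?_)
    rw [hfr]
  · set π : ((ι → ℝ) × C) →L[ℝ] (ℝ × ({i // M.lam i ≤ c} → ℝ)) :=
      ((ContinuousLinearMap.proj i0).prod (ContinuousLinearMap.pi fun i : {i // M.lam i ≤ c} =>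
        ContinuousLinearMap.proj i.1)).comp (ContinuousLinearMap.fst ℝ (ι → ℝ) C) with hπ
    have h1 : dimH (π '' M.Fset x r) ≤ dimH (M.Fset x r) := π.lipschitz.dimH_image_le _
    refine le_trans ?_ h1
    have h2 : {p : ℝ × ({i // M.lam i ≤ c} → ℝ) | 0 < p.1 / x.1 i0} ⊆ π '' M.Fset x r := by
      rintro ⟨u, z⟩ hp
      simp only [Set.mem_setOf_eq] at hp
      set s := - Real.log (u / x.1 i0) / M.lam i0 with hs
      have hS : M.Gpar x c (s, z) ∈ M.S := by
        refine ⟨rfl, fun i hi => ?_⟩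
        simp [Gpar, not_le.2 (hc0.trans (ha0.trans hi)), hx.2 i hi]
      refine ⟨M.Gpar x c (s, z), M.Fset_of hx h0 hx0 hS s (fun i h1 h2 => ?_), ?_⟩
      · rw [φ_fst]
        have h1' : ¬ M.lam i ≤ c := not_le.2 h1
        simp only [Gpar, h1', dite_false]
        rw [← mul_assoc, ← Real.exp_add]; simp
      · simp only [hπ, Gpar]
        ext i
        · simp only [ContinuousLinearMap.comp_apply, ContinuousLinearMap.prod_apply]
          simp only [ContinuousLinearMap.coe_fst', ContinuousLinearMap.proj_apply, not_le.2 hc0, dite_false]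
          have : -(M.lam i0 * s) = Real.log (u / x.1 i0) := by rw [hs]; field_simp
          rw [this, Real.exp_log hp]; field_simp
        · have := i.2
          simp [this]
    refine le_trans ?_ (dimH_mono h2)
    rw [Real.dimH_of_nonempty_interior, hfr]
    rw [IsOpen.interior_eq]
    · exact ⟨(x.1 i0, 0), by simp [hx0]⟩
    · exact isOpen_lt continuous_const (continuous_fst.div_const _)

/-- `S` as a function space -/
lemma finrank_S : Module.finrank ℝ M.S = Nat.card {i // M.lam i < 0} := by
  classical
  let e : M.S ≃ₗ[ℝ] ({i // M.lam i < 0} → ℝ) :=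
    { toFun := fun x i => x.1.1 i
      map_add' := fun x y => rfl
      map_smul' := fun c x => rfl
      invFun := fun z => ⟨(fun i => if h : M.lam i < 0 then z ⟨i, h⟩ else 0, 0), rfl, fun i hi => by
        simp [not_lt.2 hi.le]⟩
      left_inv := by
        rintro ⟨x, hx⟩
        ext i
        · by_cases h : M.lam i < 0
          · simp [h]
          · have : 0 < M.lam i := lt_of_le_of_ne (not_lt.1 h) (M.lam_ne i).symm
            simp [h, hx.2 i this]
        · exact hx.1.symm
      right_inv := by
        intro z
        ext i
        have := i.2
        simp [this] }
  rw [e.finrank_eq]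
  simp

lemma cnt_slow {i0} (h0 : M.Slow i0) {s : ℝ} (hs : s < 0) (h1 : M.lam i0 ≤ s) :
    M.cnt s = Module.finrank ℝ M.S := by
  rw [finrank_S, cnt]
  refine Nat.card_congr (Equiv.subtypeEquivRight fun i => ?_)
  exact ⟨fun h => lt_of_le_of_lt h hs, fun h => (h0.2 i h).trans h1⟩

lemma slow_mem [DecidableEq ι] {i0} (h0 : M.lam i0 < 0) (c : ℝ) : (Pi.single i0 c, (0 : C)) ∈ M.S := by
  refine ⟨rfl, fun i hi => ?_⟩
  have : i ≠ i0 := by rintro rfl; exact absurd h0 (not_lt.2 hi.le)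
  simp [this]
end Mdl

open Mdl
section
variable {ι C ι' C' : Type*} [Fintype ι] [NormedAddCommGroup C] [NormedSpace ℝ C]
    [FiniteDimensional ℝ C] [CompleteSpace C] [Fintype ι'] [NormedAddCommGroup C']
    [NormedSpace ℝ C'] [FiniteDimensional ℝ C'] [CompleteSpace C']
    {M : Mdl ι C} {M' : Mdl ι' C'} {h : ((ι → ℝ) × C) ≃ₜ ((ι' → ℝ) × C')}

lemma OE.Fset (H : OE M M' h) {x y : (ι → ℝ) × C} {r : ℝ} (hy : y ∈ M.Fset x r) :
    h y ∈ M'.Fset (h x) r := by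
  refine ⟨(H.S y).2 hy.1, fun ρ' h1 h2 => ?_⟩
  set ρ := (ρ' + r) / 2 with hρ
  have hρ1 : ρ' < ρ := by rw [hρ]; linarith
  have hρ2 : ρ < r := by rw [hρ]; linarith
  have hρ0 : 0 < ρ := by linarith
  set γ := Real.sqrt (ρ' / ρ) with hγ
  have hγ0 : 0 < γ := Real.sqrt_pos.2 (by positivity)
  have hγ1 : γ < 1 := by
    rw [hγ, Real.sqrt_lt' one_pos, div_lt_iff₀ hρ0]; linarith
  have hγ2 : γ * (ρ * γ) = ρ' := by
    have : γ * γ = ρ' / ρ := Real.mul_self_sqrt (by positivity)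
    calc γ * (ρ * γ) = ρ * (γ * γ) := by ring
      _ = ρ' := by rw [this]; field_simp
  obtain ⟨r1, hr1, hr1', K1⟩ := H.ah.hol.get1 hγ0 hγ1
  obtain ⟨r2, hr2, hr2', K2⟩ := H.ah.symm.hol.get1 hγ0 hγ1
  obtain ⟨δ, hδ, K3⟩ := hy.2 ρ (by linarith) hρ2
  obtain ⟨δ', hδ', K4⟩ : ∃ δ' > 0, ∀ y, ‖y‖ < δ' → ‖h.symm y‖ < min δ (r1 / 2) := by
    have hc : ContinuousAt h.symm 0 := h.symm.continuous.continuousAt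
    have := Metric.continuousAt_iff.1 hc (min δ (r1 / 2)) (by positivity)
    rw [H.ah.symm.zero] at this
    simpa using this
  refine ⟨min δ' r2, by positivity, fun z' hz' hn => ?_⟩
  set z := h.symm z' with hz
  have hzz : h z = z' := h.apply_symm_apply z'
  have hzo : z ∈ M.orb x := by rw [← H.mem, hzz]; exact hz'
  have hzn := K4 z' (hn.trans_le (min_le_left _ _))
  rw [← hz] at hzn
  obtain ⟨w, hw, hw2⟩ := K3 z hzo (hzn.trans_le (min_le_left _ _))
  have hz1 : ‖z‖ < r1 / 2 := hzn.trans_le (min_le_right _ _)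
  have hzle : ‖z‖ ^ ρ ≤ ‖z‖ := by
    have := Real.rpow_le_rpow_of_exponent_ge' (norm_nonneg z) (by linarith) zero_le_one
      (show (1:ℝ) ≤ ρ by linarith)
    simpa using this
  have hwn : ‖w‖ < r1 := by
    have : ‖w‖ ≤ ‖z‖ + ‖z - w‖ := by
      calc ‖w‖ = ‖z - (z - w)‖ := by simp
        _ ≤ _ := norm_sub_le _ _
    linarith
  refine ⟨h w, H.mem.2 hw, ?_⟩
  have e1 := K1 z w (by linarith) hwn
  have e2 : ‖z‖ ≤ ‖z'‖ ^ γ := by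
    have := K2 z' 0 (hn.trans_le (min_le_right _ _)) (by simpa using hr2)
    rw [H.ah.symm.zero] at this
    simpa using this
  rw [hzz] at e1
  calc _ ≤ ‖z - w‖ ^ γ := e1
    _ ≤ (‖z‖ ^ ρ) ^ γ := Real.rpow_le_rpow (norm_nonneg _) hw2 hγ0.le
    _ = ‖z‖ ^ (ρ * γ) := by rw [← Real.rpow_mul (norm_nonneg _)]
    _ ≤ (‖z'‖ ^ γ) ^ (ρ * γ) := Real.rpow_le_rpow (norm_nonneg _) e2 (by positivity)
    _ = _ := by rw [← Real.rpow_mul (norm_nonneg _), hγ2]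

lemma OE.dimH_Fset_le (H : OE M M' h) (x : (ι → ℝ) × C) (r : ℝ) :
    dimH (M'.Fset (h x) r) ≤ dimH (M.Fset x r) := by
  refine H.ah.dimH_le (fun y hy => ?_) (fun ρ hρ => ⟨fun n => fl M'.gen (-(n:ℝ)), fun y hy => ?_⟩)
  · have := H.symm.Fset hy
    simpa using this
  · have h1 := (M'.S_tendsto hy.1).comp tendsto_natCast_atTop_atTop
    have h2 := h1.eventually (Metric.ball_mem_nhds 0 hρ)
    obtain ⟨n, hn⟩ := h2.exists
    exact Set.mem_iUnion.2 ⟨n, M'.φ n y, ⟨M'.Fset_inv hy n, hn⟩, M'.φ_neg_self n y⟩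

lemma OE.generic (H : OE M M' h) {i0 i0'} (h0 : M.Slow i0) (h0' : M'.Slow i0') :
    ∃ x ∈ M.S, x.1 i0 ≠ 0 ∧ (h x).1 i0' ≠ 0 := by
  classical
  set y : (ι' → ℝ) × C' := (Pi.single i0' 1, 0) with hy
  have hyS : y ∈ M'.S := M'.slow_mem h0'.1 1
  set x1 := h.symm y with hx1
  have hhx : h x1 = y := h.apply_symm_apply y
  have hx1S : x1 ∈ M.S := by rw [← H.S, hhx]; exact hyS
  by_cases hx : x1.1 i0 ≠ 0
  · exact ⟨x1, hx1S, hx, by rw [hhx, hy]; simp⟩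
  push Not at hx
  have hc : Continuous fun ε : ℝ => (h (x1 + ε • (Pi.single i0 1, (0:C)))).1 i0' := by
    have := h.continuous
    fun_prop
  have ht := hc.tendsto 0
  simp only [zero_smul, add_zero, hhx] at ht
  have h1 : ∀ᶠ ε : ℝ in 𝓝[≠] 0, (h (x1 + ε • (Pi.single i0 1, (0:C)))).1 i0' ≠ 0 :=
    eventually_nhdsWithin_of_eventually_nhds (ht.eventually_ne (by rw [hy]; simp))
  obtain ⟨ε, hε, hε0⟩ := (h1.and self_mem_nhdsWithin).exists
  refine ⟨_, M.S.add_mem hx1S (M.S.smul_mem ε (M.slow_mem h0.1 1)), ?_, hε⟩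
  simpa [hx] using hε0

lemma OE.finrank_S (H : OE M M' h) : Module.finrank ℝ M'.S = Module.finrank ℝ M.S :=
  H.ah.finrank_eq H.S

lemma OE.slow (H : OE M M' h) {i0} (h0 : M.Slow i0) : ∃ i, M'.Slow i := by
  have h1 := H.finrank_S
  rw [Mdl.finrank_S, Mdl.finrank_S] at h1
  haveI : Nonempty {i // M.lam i < 0} := ⟨⟨i0, h0.1⟩⟩
  have h2 : 0 < Nat.card {i // M.lam i < 0} := Nat.card_pos
  rw [← h1] at h2
  obtain ⟨⟨⟨j, hj⟩⟩, _⟩ := Nat.card_pos_iff.1 h2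
  exact M'.exists_slow hj

lemma OE.cnt_S (H : OE M M' h) {i0 i0'} (h0 : M.Slow i0) (h0' : M'.Slow i0') {s : ℝ} (hs : s < 0) :
    M.cnt s = M'.cnt (s * (M'.lam i0' / M.lam i0)) := by
  have ha := h0.1
  have ha' := h0'.1
  have han := ha.ne
  have hq : 0 < M'.lam i0' / M.lam i0 := div_pos_of_neg_of_neg ha' ha
  rcases le_or_gt (M.lam i0) s with h1 | h1
  · rw [M.cnt_slow h0 hs h1, M'.cnt_slow h0' (mul_neg_of_neg_of_pos hs hq), H.finrank_S]
    have : M'.lam i0' = M.lam i0 * (M'.lam i0' / M.lam i0) := by field_simp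
    rw [this]
    have e : M.lam i0 * (M'.lam i0' / M.lam i0) / M.lam i0 = (M'.lam i0' / M.lam i0) := by field_simp
    rw [e]
    gcongr
  · obtain ⟨x, hx, hx0, hx0'⟩ := H.generic h0 h0'
    set r := s / M.lam i0 with hr
    have hr1 : 1 < r := by
      rw [hr, one_lt_div_of_neg ha]; exact h1
    have e1 := M.dimH_Fset hx h0 hx0 hr1
    have e2 := M'.dimH_Fset ((H.S x).2 hx) h0' hx0' hr1
    have e3 : dimH (M'.Fset (h x) r) = dimH (M.Fset x r) := by
      refine le_antisymm (H.dimH_Fset_le x r) ?_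
      have := H.symm.dimH_Fset_le (h x) r
      simpa using this
    rw [e1, e2] at e3
    have e4 : 1 + M'.cnt (r * M'.lam i0') = 1 + M.cnt (r * M.lam i0) := by exact_mod_cast e3
    have e5 : r * M.lam i0 = s := by rw [hr]; field_simp
    have e6 : r * M'.lam i0' = s * (M'.lam i0' / M.lam i0) := by rw [hr]; field_simp
    rw [e5, e6] at e4
    omega
end
end

section
set_option linter.unusedSectionVars false
set_option linter.deprecated false
set_option linter.unusedVariables false

namespace Mdl
variable {ι C : Type*} [Fintype ι] [NormedAddCommGroup C] [NormedSpace ℝ C]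
    [FiniteDimensional ℝ C] [CompleteSpace C] (M : Mdl ι C)

lemma subExp_Ac : SubExp M.Ac := by
  intro ε hε
  obtain ⟨c, hc, h⟩ := M.σ.subExp_KN ε hε
  refine ⟨c, hc, fun t => ?_⟩
  have e : fl M.Ac t = fl (M.σ.K + M.σ.N) t := congrArg (fun A => fl A t) M.hz
  rw [e]; exact h t

lemma growth {b : ℝ} (hb0 : 0 ≤ b) (hb : ∀ i, M.lam i ≤ b) {ε : ℝ} (hε : 0 < ε) :
    ∃ c > 0, ∀ t x, 0 ≤ t → ‖M.φ t x‖ ≤ c * Real.exp ((b + ε) * t) * ‖x‖ := by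
  obtain ⟨c, hc, h⟩ := M.subExp_Ac ε hε
  refine ⟨c + 1, by positivity, fun t x ht => ?_⟩
  rw [Prod.norm_def]
  refine max_le ?_ ?_
  · refine (pi_norm_le_iff_of_nonneg (by positivity)).2 fun i => ?_
    rw [φ_fst, norm_mul, Real.norm_of_nonneg (Real.exp_pos _).le]
    have h3 : ‖x.1 i‖ ≤ ‖x‖ := le_norm x i
    have h4 := hb i
    have h5 : Real.exp (M.lam i * t) ≤ Real.exp ((b + ε) * t) := by
      gcongr; linarith
    calc _ ≤ 1 * Real.exp ((b + ε) * t) * ‖x‖ := by rw [one_mul]; gcongr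
      _ ≤ _ := by gcongr; linarith
  · rw [φ_snd]
    have h1 := (fl M.Ac t).le_opNorm x.2
    have h2 := h t
    rw [abs_of_nonneg ht] at h2
    have h3 : ‖x.2‖ ≤ ‖x‖ := norm_snd_le x
    calc _ ≤ ‖fl M.Ac t‖ * ‖x.2‖ := h1
      _ ≤ (c * Real.exp (ε * t)) * ‖x‖ := by gcongr
      _ ≤ _ := by gcongr <;> linarith

/-- fastest unstable index -/
def Fast (i : ι) : Prop := 0 < M.lam i ∧ ∀ j, M.lam j ≤ M.lam i

lemma exists_fast {j : ι} (hj : 0 < M.lam j) : ∃ i, M.Fast i := by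
  classical
  obtain ⟨i, hi, hi2⟩ := (Finset.univ : Finset ι).exists_max_image M.lam ⟨j, Finset.mem_univ j⟩
  exact ⟨i, hj.trans_le (hi2 j (Finset.mem_univ j)), fun j => hi2 j (Finset.mem_univ j)⟩

lemma fast_mem [DecidableEq ι] {i0} (h0 : 0 < M.lam i0) (c : ℝ) : (Pi.single i0 c, (0 : C)) ∈ M.U :=
  M.rev.slow_mem (by rw [rev_lam]; linarith) c

lemma φ_single [DecidableEq ι] (i0 : ι) (c t : ℝ) :
    M.φ t (Pi.single i0 c, (0 : C)) = Real.exp (M.lam i0 * t) • (Pi.single i0 c, (0 : C)) := by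
  rw [φ_eq]
  ext i
  · by_cases h : i = i0
    · subst h; simp
    · simp [h]
  · simp
end Mdl
open Mdl

lemma small_scale {E : Type*} [NormedAddCommGroup E] [NormedSpace ℝ E] (f : E → ℝ) (hf : ContinuousAt f 0)
    (v : E) {r : ℝ} (hr : f 0 < r) : ∃ ε : ℝ, 0 < ε ∧ f (ε • v) < r := by
  have h1 : Tendsto (fun ε : ℝ => ε • v) (𝓝 0) (𝓝 0) := by
    have : Continuous fun ε : ℝ => ε • v := by fun_prop
    simpa using this.tendsto 0
  have h2 := (hf.tendsto.comp h1).eventually (gt_mem_nhds hr)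
  have h3 : ∀ᶠ ε : ℝ in 𝓝[>] 0, f (ε • v) < r := eventually_nhdsWithin_of_eventually_nhds h2
  obtain ⟨ε, hε, hε2⟩ := (h3.and self_mem_nhdsWithin).exists
  exact ⟨ε, hε2, hε⟩

section
variable {ι C ι' C' : Type*} [Fintype ι] [NormedAddCommGroup C] [NormedSpace ℝ C]
    [FiniteDimensional ℝ C] [CompleteSpace C] [Fintype ι'] [NormedAddCommGroup C']
    [NormedSpace ℝ C'] [FiniteDimensional ℝ C'] [CompleteSpace C']
    {M : Mdl ι C} {M' : Mdl ι' C'} {h : ((ι → ℝ) × C) ≃ₜ ((ι' → ℝ) × C')}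

lemma OE.ratio_aux (H : OE M M' h) {i0 i0' j0 j0'} (h0 : M.Slow i0) (h0' : M'.Slow i0')
    (k0 : M.Fast j0) (k0' : M'.Fast j0') {γ ε : ℝ} (hγ0 : 0 < γ) (hγ1 : γ < 1) (hε : 0 < ε) :
    M'.lam j0' * γ ^ 2 * (M.lam i0 / M'.lam i0') ≤ M.lam j0 + ε := by
  classical
  set a := M.lam i0 with ha
  set a' := M'.lam i0' with ha'
  set b := M.lam j0 with hb
  set b' := M'.lam j0' with hb'
  have ha0 : a < 0 := h0.1
  have ha0' : a' < 0 := h0'.1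
  have hb0 : 0 < b := k0.1
  have hb0' : 0 < b' := k0'.1
  obtain ⟨r1, hr1, hr1', K1⟩ := H.ah.hol.get1 hγ0 hγ1
  obtain ⟨r2, hr2, hr2', K2⟩ := H.ah.symm.hol.get1 hγ0 hγ1
  -- choice of x, y
  have hcs : ContinuousAt (fun p => ‖h.symm p‖) 0 := h.symm.continuous.norm.continuousAt
  have hid : ContinuousAt (fun p : (ι' → ℝ) × C' => ‖p‖) 0 := continuous_norm.continuousAt
  have hs0 : h.symm 0 = 0 := H.ah.symm.zero
  obtain ⟨e1, he1, he1'⟩ := small_scale (fun p => ‖p‖) hid (Pi.single i0' 1, (0:C'))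
    (r := r2) (by simpa using hr2)
  obtain ⟨e2, he2, he2'⟩ := small_scale (fun p => ‖h.symm p‖) hcs (Pi.single j0' 1, (0:C'))
    (r := r1) (by simpa [hs0] using hr1)
  set X : (ι' → ℝ) × C' := e1 • (Pi.single i0' 1, (0:C')) with hX
  set v : (ι' → ℝ) × C' := e2 • (Pi.single j0' 1, (0:C')) with hv
  set x := h.symm X with hx
  set y := h.symm v with hy
  have hhx : h x = X := h.apply_symm_apply X
  have hhy : h y = v := h.apply_symm_apply v
  have hXS : X ∈ M'.S := M'.S.smul_mem _ (M'.slow_mem ha0' 1)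
  have hvU : v ∈ M'.U := M'.U.smul_mem _ (M'.fast_mem hb0' 1)
  have hxS : x ∈ M.S := by rw [← H.S, hhx]; exact hXS
  have hyU : y ∈ M.U := by rw [← H.U, hhy]; exact hvU
  have hX0 : X.1 i0' = e1 := by simp [hX]
  have hv0 : v.1 j0' = e2 := by simp [hv]
  -- the sequence
  set z : ℕ → (ι → ℝ) × C := fun n => x + M.φ (-(n:ℝ)) y with hz
  have hzn : ∀ n : ℕ, M.φ n (z n) = M.φ n x + y := by
    intro n; rw [hz]; simp only; rw [φ_vadd, φ_self_neg]
  have hnat : Tendsto (fun n : ℕ => (n : ℝ)) atTop atTop := tendsto_natCast_atTop_atTop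
  have hz1 : Tendsto z atTop (𝓝 x) := by
    have := ((M.U_tendsto hyU).comp (tendsto_neg_atTop_atBot.comp hnat)).const_add x
    simpa [Function.comp_def] using this
  have hz2 : Tendsto (fun n : ℕ => M.φ n (z n)) atTop (𝓝 y) := by
    simp only [hzn]
    have := ((M.S_tendsto hxS).comp hnat).add_const y
    simpa [Function.comp_def] using this
  have hτ : ∀ n : ℕ, ∃ t, M'.φ t (h (z n)) = h (M.φ n (z n)) := by
    intro n
    exact H.mem.2 (M.mem_orb n (z n))
  choose τ hτ using hτ
  have hhz1 : Tendsto (fun n => h (z n)) atTop (𝓝 X) := by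
    rw [← hhx]; exact (h.continuous.tendsto _).comp hz1
  have hhz2 : Tendsto (fun n : ℕ => h (M.φ n (z n))) atTop (𝓝 v) := by
    rw [← hhy]; exact (h.continuous.tendsto _).comp hz2
  have coord : ∀ i : ι', Continuous fun p : (ι' → ℝ) × C' => p.1 i := fun i => by fun_prop
  -- lower bound
  obtain ⟨L, hL⟩ : ∃ L : ℝ, ∀ᶠ n : ℕ in atTop, a' * τ n ≤ a * γ * n + L := by
    refine ⟨Real.log (‖x‖ ^ γ / (e1 / 2)), ?_⟩
    have e3 : ∀ᶠ n : ℕ in atTop, e1 / 2 < (h (z n)).1 i0' := by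
      have := ((coord i0').tendsto _).comp hhz1
      rw [hX0] at this
      exact this.eventually (lt_mem_nhds (by linarith))
    have e4 : ∀ᶠ n : ℕ in atTop, ‖M.φ n (z n)‖ < r1 := hz2.norm.eventually (gt_mem_nhds he2')
    filter_upwards [e3, e4] with n h3 h4
    have h5 := K1 _ _ h4 he2'
    rw [hhy, ← hτ n] at h5
    have h6 := (le_norm (M'.φ (τ n) (h (z n)) - v) i0').trans h5
    have h7 : v.1 i0' = 0 := (M'.mem_U.1 hvU).2 i0' ha0'
    rw [Prod.fst_sub, Pi.sub_apply, h7, sub_zero, φ_fst, abs_mul, abs_of_pos (Real.exp_pos _),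
      abs_of_pos (lt_trans (by positivity) h3), hzn, add_sub_cancel_right] at h6
    have h8 : ‖M.φ n x‖ ^ γ ≤ Real.exp (a * γ * n) * ‖x‖ ^ γ := by
      calc _ ≤ (Real.exp (a * n) * ‖x‖) ^ γ :=
            Real.rpow_le_rpow (norm_nonneg _) (M.S_slow_bound hxS h0 (Nat.cast_nonneg n)) hγ0.le
        _ = _ := by
          rw [Real.mul_rpow (by positivity) (by positivity), ← Real.exp_mul]
          congr 2; ring
    have h9 : Real.exp (a' * τ n) * (e1 / 2) ≤ Real.exp (a * γ * n) * ‖x‖ ^ γ :=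
      le_trans (by gcongr) (h6.trans h8)
    have h10 : 0 < ‖x‖ ^ γ := by
      by_contra hcon
      have : ‖x‖ ^ γ ≤ 0 := not_lt.1 hcon
      have h11 : 0 < Real.exp (a' * τ n) * (e1 / 2) := by positivity
      nlinarith [Real.exp_pos (a * γ * n)]
    rw [← Real.exp_le_exp, Real.exp_add, Real.exp_log (by positivity), ← mul_div_assoc,
      le_div_iff₀ (by positivity)]
    exact h9
  have hτt : Tendsto τ atTop atTop := by
    have h1 : Tendsto (fun n : ℕ => (a * γ * n + L) / a') atTop atTop := by
      have h2 : Tendsto (fun n : ℕ => a * γ * (n:ℝ)) atTop atBot :=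
        hnat.const_mul_atTop_of_neg (by nlinarith)
      simp only [div_eq_mul_inv]
      exact (tendsto_atBot_add_const_right _ L h2).atBot_mul_const_of_neg (inv_lt_zero.2 ha0')
    refine tendsto_atTop_mono' _ ?_ h1
    filter_upwards [hL] with n hn
    rw [div_le_iff_of_neg ha0']; linarith
  -- upper bound
  have hup : ∀ᶠ n : ℕ in atTop, b' * γ * τ n ≤ (b + ε) * n := by
    by_contra hcon
    rw [not_eventually] at hcon
    set P : ℕ → (ι' → ℝ) × C' := fun n => h (z n) - (2:ℝ) • M'.φ (-τ n) v with hP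
    have hφv : ∀ t, M'.φ t v = Real.exp (b' * t) • v := by
      intro t; rw [hv, φ_vsmul, φ_single, smul_comm]
    have hPX : Tendsto P atTop (𝓝 X) := by
      have h1 : Tendsto (fun n => M'.φ (-τ n) v) atTop (𝓝 0) :=
        (M'.U_tendsto hvU).comp (tendsto_neg_atTop_atBot.comp hτt)
      have := hhz1.sub (h1.const_smul (2:ℝ))
      simpa using this
    obtain ⟨c, hc, hgr⟩ := M.growth (b := b) hb0.le k0.2 (ε := ε / 2) (by positivity)
    set l : Filter ℕ := atTop ⊓ 𝓟 {n | ¬ (b' * γ * τ n ≤ (b + ε) * n)} with hl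
    haveI : l.NeBot := by
      rw [hl, ← frequently_mem_iff_neBot]; exact hcon
    have hle : l ≤ atTop := inf_le_left
    have hev : ∀ᶠ n : ℕ in l, (b + ε) * (n:ℝ) < b' * γ * τ n := by
      have : {n : ℕ | ¬ (b' * γ * τ n ≤ (b + ε) * n)} ∈ l := mem_inf_of_right (mem_principal_self _)
      filter_upwards [this] with n hn using not_le.1 hn
    have hd : Tendsto (fun n : ℕ => M.φ n (h.symm (P n)) - M.φ n (z n)) l (𝓝 0) := by
      rw [tendsto_zero_iff_norm_tendsto_zero]
      have hlim : Tendsto (fun n : ℕ => c * (2 * ‖v‖) ^ γ * Real.exp (-(ε/2) * n)) l (𝓝 0) := by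
        have h2 : Tendsto (fun n : ℕ => -(ε/2) * (n:ℝ)) atTop atBot :=
          hnat.const_mul_atTop_of_neg (by linarith)
        have := (Real.tendsto_exp_atBot.comp h2).const_mul (c * (2 * ‖v‖) ^ γ)
        rw [mul_zero] at this
        exact this.mono_left hle
      refine squeeze_zero' (Eventually.of_forall fun _ => norm_nonneg _) ?_ hlim
      have e5 : ∀ᶠ n : ℕ in l, ‖P n‖ < r2 := (hPX.norm.eventually (gt_mem_nhds he1')).filter_mono hle
      have e6 : ∀ᶠ n : ℕ in l, ‖h (z n)‖ < r2 := (hhz1.norm.eventually (gt_mem_nhds he1')).filter_mono hle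
      filter_upwards [hev, e5, e6] with n hn h5 h6
      have h7 := K2 _ _ h5 h6
      rw [h.symm_apply_apply] at h7
      have h8 : ‖P n - h (z n)‖ = Real.exp (-(b' * τ n)) * (2 * ‖v‖) := by
        rw [hP]; simp only
        rw [hφv, sub_sub_cancel_left, norm_neg, norm_smul, norm_smul, Real.norm_of_nonneg (Real.exp_pos _).le]
        simp; ring
      rw [h8, Real.mul_rpow (by positivity) (by positivity), ← Real.exp_mul] at h7
      rw [← φ_vsub]
      calc _ ≤ c * Real.exp ((b + ε/2) * n) * ‖h.symm (P n) - z n‖ := hgr _ _ (Nat.cast_nonneg n)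
        _ ≤ c * Real.exp ((b + ε/2) * n) * (Real.exp (-(b' * τ n) * γ) * (2 * ‖v‖) ^ γ) := by gcongr
        _ = c * (2 * ‖v‖) ^ γ * Real.exp ((b + ε/2) * n + -(b' * τ n) * γ) := by
            rw [Real.exp_add]; ring
        _ ≤ _ := by
            gcongr
            nlinarith
    have hd2 : Tendsto (fun n : ℕ => M.φ n (h.symm (P n))) l (𝓝 y) := by
      have := hd.add (hz2.mono_left hle)
      simpa using this
    have hd3 : Tendsto (fun n : ℕ => (h (M.φ n (h.symm (P n)))).1 j0') l (𝓝 e2) := by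
      rw [← hv0, ← hhy]
      exact ((coord j0').comp h.continuous).tendsto _ |>.comp hd2
    have hneg : ∀ᶠ n : ℕ in l, (h (M.φ n (h.symm (P n)))).1 j0' ≤ 0 := by
      have e7 : ∀ᶠ n : ℕ in atTop, (h (M.φ n (z n))).1 j0' < 2 * e2 := by
        have := ((coord j0').tendsto _).comp hhz2
        rw [hv0] at this
        exact this.eventually (gt_mem_nhds (by linarith))
      filter_upwards [e7.filter_mono hle] with n hn
      have h1 : h (M.φ n (h.symm (P n))) ∈ M'.orb (P n) := by
        have := H.mem.2 (M.mem_orb n (h.symm (P n)))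
        simpa using this
      obtain ⟨s, hs⟩ := h1
      simp only at hs
      rw [← hs]
      have h2 : P n = M'.φ (-τ n) (h (M.φ n (z n)) - (2:ℝ) • v) := by
        rw [φ_vsub, φ_vsmul, ← hτ n, φ_neg_self]
      rw [h2, φ_fst, φ_fst]
      have h3 : (h (M.φ n (z n)) - (2:ℝ) • v).1 j0' ≤ 0 := by
        simp [hv0]; linarith
      have h4 := Real.exp_pos (b' * -τ n)
      have h5 := Real.exp_pos (b' * s)
      exact mul_nonpos_of_nonneg_of_nonpos h5.le (mul_nonpos_of_nonneg_of_nonpos h4.le h3)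
    have := le_of_tendsto hd3 hneg
    linarith
  -- combine
  have hfin : ∀ᶠ n : ℕ in atTop, b' * γ ^ 2 * (a / a') + b' * γ * (L / a') * (n:ℝ)⁻¹ ≤ b + ε := by
    filter_upwards [hL, hup, eventually_gt_atTop 0] with n h1 h2 h3
    have hn : (0:ℝ) < n := Nat.cast_pos.2 h3
    have h4 : (a * γ * n + L) / a' ≤ τ n := by rw [div_le_iff_of_neg ha0']; linarith
    have h5 : b' * γ * ((a * γ * n + L) / a') ≤ (b + ε) * n := le_trans (by gcongr) h2
    have ha'' := ha0'.ne
    calc _ = b' * γ * ((a * γ * n + L) / a') / n := by field_simp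
      _ ≤ _ := by rw [div_le_iff₀ hn]; exact h5
  have hlim : Tendsto (fun n : ℕ => b' * γ ^ 2 * (a / a') + b' * γ * (L / a') * (n:ℝ)⁻¹) atTop
      (𝓝 (b' * γ ^ 2 * (a / a'))) := by
    have := ((tendsto_inv_atTop_zero.comp hnat).const_mul (b' * γ * (L / a'))).const_add
      (b' * γ ^ 2 * (a / a'))
    simpa [Function.comp_def] using this
  exact le_of_tendsto hlim hfin

lemma OE.ratio_le (H : OE M M' h) {i0 i0' j0 j0'} (h0 : M.Slow i0) (h0' : M'.Slow i0')
    (k0 : M.Fast j0) (k0' : M'.Fast j0') :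
    M'.lam j0' * (M.lam i0 / M'.lam i0') ≤ M.lam j0 := by
  have h1 : ∀ n : ℕ, M'.lam j0' * (1 - 1 / ((n:ℝ) + 2)) ^ 2 * (M.lam i0 / M'.lam i0')
      ≤ M.lam j0 + 1 / ((n:ℝ) + 2) := by
    intro n
    refine H.ratio_aux h0 h0' k0 k0' ?_ ?_ (by positivity)
    · rw [sub_pos, div_lt_one (by positivity)]; linarith [(Nat.cast_nonneg n : (0:ℝ) ≤ n)]
    · have : 0 < 1 / ((n:ℝ) + 2) := by positivity
      linarith
  have h2 : Tendsto (fun n : ℕ => 1 / ((n:ℝ) + 2)) atTop (𝓝 0) := by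
    have h3 : Tendsto (fun n : ℕ => (n:ℝ) + 2) atTop atTop :=
      tendsto_atTop_add_const_right _ _ tendsto_natCast_atTop_atTop
    simpa [Function.comp_def] using tendsto_inv_atTop_zero.comp h3
  have h4 := (((h2.const_sub 1).pow 2).const_mul (M'.lam j0')).mul_const (M.lam i0 / M'.lam i0')
  have h5 := h2.const_add (M.lam j0)
  simpa using le_of_tendsto_of_tendsto' h4 h5 h1

lemma OE.ratio (H : OE M M' h) {i0 i0' j0 j0'} (h0 : M.Slow i0) (h0' : M'.Slow i0')
    (k0 : M.Fast j0) (k0' : M'.Fast j0') :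
    M'.lam j0' / M.lam j0 = M'.lam i0' / M.lam i0 := by
  have h1 := H.ratio_le h0 h0' k0 k0'
  have h2 := H.symm.ratio_le h0' h0 k0' k0
  have ha := h0.1
  have ha' := h0'.1
  have hb := k0.1
  have hb' := k0'.1
  have hq : 0 < M'.lam i0' / M.lam i0 := div_pos_of_neg_of_neg ha' ha
  have hq' : M.lam i0 / M'.lam i0' = (M'.lam i0' / M.lam i0)⁻¹ := (inv_div _ _).symm
  rw [hq', ← div_eq_mul_inv, div_le_iff₀ hq] at h1
  rw [div_eq_iff hb.ne']
  linarith

/-- `q` is the time ratio seen by all hyperbolic directions -/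
structure Rat (M : Mdl ι C) (M' : Mdl ι' C') (q : ℝ) : Prop where
  pos : 0 < q
  s : ∀ s < 0, M.cnt s = M'.cnt (s * q)
  u : ∀ s < 0, M.rev.cnt s = M'.rev.cnt (s * q)
  ss : ∀ i i', M.Slow i → M'.Slow i' → M'.lam i' = M.lam i * q
  su : ∀ i i', M.rev.Slow i → M'.rev.Slow i' → M'.rev.lam i' = M.rev.lam i * q

lemma cnt_zero_of_noslow (hn : ¬ ∃ i, M.Slow i) {s : ℝ} (hs : s < 0) : M.cnt s = 0 := by
  rw [Mdl.cnt, Nat.card_eq_zero]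
  left
  refine ⟨fun ⟨i, hi⟩ => hn (M.exists_slow (j := i) (lt_of_le_of_lt hi hs))⟩

lemma Slow.eq {i j} (hi : M.Slow i) (hj : M.Slow j) : M.lam i = M.lam j :=
  le_antisymm (hj.2 i hi.1) (hi.2 j hj.1)

lemma cnt_pos_iff (s : ℝ) : 0 < M.cnt s ↔ ∃ i, M.lam i ≤ s := by
  rw [Mdl.cnt, Nat.card_pos_iff]
  constructor
  · rintro ⟨⟨i, hi⟩, _⟩; exact ⟨i, hi⟩
  · rintro ⟨i, hi⟩; exact ⟨⟨i, hi⟩, inferInstance⟩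

lemma OE.rat (H : OE M M' h) : ∃ q, Rat M M' q := by
  have noS : (¬ ∃ i, M.Slow i) → ¬ ∃ i, M'.Slow i := fun hn ⟨i, hi⟩ => hn (H.symm.slow hi)
  have noU : (¬ ∃ i, M.rev.Slow i) → ¬ ∃ i, M'.rev.Slow i := fun hn ⟨i, hi⟩ => hn (H.rev.symm.slow hi)
  by_cases hS : ∃ i, M.Slow i
  · obtain ⟨i0, h0⟩ := hS
    obtain ⟨i0', h0'⟩ := H.slow h0
    have hq : 0 < M'.lam i0' / M.lam i0 := div_pos_of_neg_of_neg h0'.1 h0.1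
    have hss : ∀ i i', M.Slow i → M'.Slow i' → M'.lam i' = M.lam i * (M'.lam i0' / M.lam i0) := by
      intro i i' hi hi'
      rw [Slow.eq hi h0, Slow.eq hi' h0']
      have := h0.1.ne
      field_simp
    by_cases hU : ∃ i, M.rev.Slow i
    · obtain ⟨u0, k0⟩ := hU
      obtain ⟨u0', k0'⟩ := H.rev.slow k0
      set q := M'.rev.lam u0' / M.rev.lam u0 with hqd
      have hq2 : 0 < q := div_pos_of_neg_of_neg k0'.1 k0.1
      have hc : ∀ s < 0, M.rev.cnt s = M'.rev.cnt (s * q) := fun s hs => H.rev.cnt_S k0 k0' hs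
      obtain ⟨j0, f0⟩ := M.exists_fast (j := u0) (by have := k0.1; rw [rev_lam] at this; linarith)
      obtain ⟨j0', f0'⟩ := M'.exists_fast (j := u0') (by have := k0'.1; rw [rev_lam] at this; linarith)
      have e1 : M.lam j0 * q ≤ M'.lam j0' := by
        have h1 : 0 < M.rev.cnt (-M.lam j0) := (cnt_pos_iff _).2 ⟨j0, (M.rev_lam j0).le⟩
        rw [hc _ (by linarith [f0.1])] at h1
        obtain ⟨i, hi⟩ := (cnt_pos_iff _).1 h1
        rw [rev_lam] at hi
        linarith [f0'.2 i]
      have e2 : M'.lam j0' ≤ M.lam j0 * q := by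
        have h1 : 0 < M'.rev.cnt (-M'.lam j0') := (cnt_pos_iff _).2 ⟨j0', (M'.rev_lam j0').le⟩
        have e : -M'.lam j0' = (-M'.lam j0' / q) * q := by field_simp
        rw [e, ← hc _ (div_neg_of_neg_of_pos (by linarith [f0'.1]) hq2)] at h1
        obtain ⟨i, hi⟩ := (cnt_pos_iff _).1 h1
        rw [rev_lam, le_div_iff₀ hq2] at hi
        have := f0.2 i
        nlinarith
      have hqq : q = M'.lam i0' / M.lam i0 := by
        rw [← H.ratio h0 h0' f0 f0', eq_div_iff f0.1.ne']
        linarith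
      rw [hqq] at hc
      refine ⟨_, hq, fun s hs => H.cnt_S h0 h0' hs, hc, hss, ?_⟩
      intro i i' hi hi'
      rw [← hqq, hqd, Slow.eq hi k0, Slow.eq hi' k0']
      have := k0.1.ne
      field_simp
    · refine ⟨_, hq, fun s hs => H.cnt_S h0 h0' hs, fun s hs => ?_, hss, fun i i' hi => absurd ⟨i, hi⟩ hU⟩
      rw [cnt_zero_of_noslow hU hs, cnt_zero_of_noslow (noU hU) (mul_neg_of_neg_of_pos hs hq)]
  · by_cases hU : ∃ i, M.rev.Slow i
    · obtain ⟨u0, k0⟩ := hU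
      obtain ⟨u0', k0'⟩ := H.rev.slow k0
      have hq2 : 0 < M'.rev.lam u0' / M.rev.lam u0 := div_pos_of_neg_of_neg k0'.1 k0.1
      refine ⟨_, hq2, fun s hs => ?_, fun s hs => H.rev.cnt_S k0 k0' hs, fun i i' hi => absurd ⟨i, hi⟩ hS, ?_⟩
      · rw [cnt_zero_of_noslow hS hs, cnt_zero_of_noslow (noS hS) (mul_neg_of_neg_of_pos hs hq2)]
      · intro i i' hi hi'
        rw [Slow.eq hi k0, Slow.eq hi' k0']
        have := k0.1.ne
        field_simp
    · refine ⟨1, one_pos, fun s hs => ?_, fun s hs => ?_, fun i i' hi => absurd ⟨i, hi⟩ hS, fun i i' hi => absurd ⟨i, hi⟩ hU⟩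
      · rw [cnt_zero_of_noslow hS hs, cnt_zero_of_noslow (noS hS) (by linarith)]
      · rw [cnt_zero_of_noslow hU hs, cnt_zero_of_noslow (noU hU) (by linarith)]
end
end

section
set_option linter.unusedSectionVars false
set_option linter.deprecated false
set_option linter.unusedVariables false

section
variable {V : Type*} [NormedAddCommGroup V] [NormedSpace ℝ V] [CompleteSpace V]

lemma nilp_two (N : V →L[ℝ] V) (hN : IsNilpotent N) {v : V} (hv : N (N v) = 0) (t : ℝ) :
    fl N t v = v + t • N v := by
  obtain ⟨p, hp⟩ := hN
  have hp2 : N ^ (p + 2) = 0 := by rw [pow_add, hp, zero_mul]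
  rw [nilp_fl N hp2, ContinuousLinearMap.sum_apply, Finset.sum_range_succ', Finset.sum_range_succ',
    Finset.sum_eq_zero]
  · simp [add_comm]
  · intro k _
    have : (N ^ (k + 1 + 1)) v = 0 := by
      rw [add_assoc, pow_add, ContinuousLinearMap.mul_apply, pow_two, ContinuousLinearMap.mul_apply, hv,
        map_zero]
    simp [this]

lemma lin_bdd_zero {v w : V} {R : ℝ} (h : ∀ t : ℝ, 0 ≤ t → ‖v + t • w‖ ≤ R) : w = 0 := by
  by_contra hw
  have hw' : 0 < ‖w‖ := norm_pos_iff.2 hw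
  have hR : 0 ≤ R := (norm_nonneg _).trans (h 0 le_rfl)
  have h1 := h ((R + ‖v‖ + 1) / ‖w‖) (by positivity)
  have h2 : ‖((R + ‖v‖ + 1) / ‖w‖) • w‖ = R + ‖v‖ + 1 := by
    rw [norm_smul, Real.norm_of_nonneg (by positivity)]; field_simp
  have h3 : ‖((R + ‖v‖ + 1) / ‖w‖) • w‖ ≤ ‖v + ((R + ‖v‖ + 1) / ‖w‖) • w‖ + ‖v‖ := by
    calc _ = ‖(v + ((R + ‖v‖ + 1) / ‖w‖) • w) - v‖ := by simp
      _ ≤ _ := norm_sub_le _ _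
  linarith

lemma nilp_bdd (N : V →L[ℝ] V) (hN : IsNilpotent N) {c : V} {R : ℝ}
    (h : ∀ t : ℝ, 0 ≤ t → ‖fl N t c‖ ≤ R) : N c = 0 := by
  by_contra hc
  obtain ⟨p, hp⟩ := hN
  have hex : ∃ k, (N ^ (k+1)) c = 0 := ⟨p, by rw [pow_succ, hp, zero_mul]; rfl⟩
  classical
  set k := Nat.find hex with hk
  have hk1 : (N ^ (k+1)) c = 0 := Nat.find_spec hex
  have hk0 : k ≠ 0 := by
    intro h0
    rw [h0] at hk1
    exact hc (by simpa using hk1)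
  obtain ⟨j, hj⟩ := Nat.exists_eq_succ_of_ne_zero hk0
  have hj1 : (N ^ (j+1)) c ≠ 0 := Nat.find_min hex (by omega)
  apply hj1
  rw [hj, Nat.succ_eq_add_one] at hk1
  have e : ∀ t, (N ^ j) (fl N t c) = (N ^ j) c + t • (N ^ (j+1)) c := by
    intro t
    have e3 : Commute (N ^ j) (fl N t) := fl_commute ((Commute.refl _).pow_left j) t
    rw [← ContinuousLinearMap.mul_apply, e3.eq, ContinuousLinearMap.mul_apply,
      nilp_two N ⟨p, hp⟩, ← ContinuousLinearMap.mul_apply, ← pow_succ']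
    rw [← ContinuousLinearMap.mul_apply, ← ContinuousLinearMap.mul_apply, ← pow_two, ← pow_add,
      ← hk1]
    congr 2; ring
  refine lin_bdd_zero (v := (N ^ j) c) (R := ‖N ^ j‖ * R) fun t ht => ?_
  rw [← e]
  exact (ContinuousLinearMap.le_opNorm _ _).trans (by gcongr; exact h t ht)
end

namespace Mdl
variable {ι C : Type*} [Fintype ι] [NormedAddCommGroup C] [NormedSpace ℝ C]
    [FiniteDimensional ℝ C] [CompleteSpace C] (M : Mdl ι C)

lemma fl_Ac (t : ℝ) (c : C) : fl M.Ac t c = fl M.σ.K t (fl M.σ.N t c) := by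
  have e1 : fl M.Ac t = fl M.σ.K t * fl M.σ.N t := by
    have := M.hz
    calc fl M.Ac t = fl (M.σ.K + M.σ.N) t := congrArg (fun X => fl X t) this
      _ = _ := fl_add_op M.σ.KN t
  rw [e1]; rfl

/-- points with bounded orbits -/
def B : Submodule ℝ ((ι → ℝ) × C) where
  carrier := {x | x.1 = 0 ∧ M.σ.N x.2 = 0}
  add_mem' := by
    rintro x y ⟨h1, h2⟩ ⟨h3, h4⟩
    exact ⟨by simp [h1, h3], by simp [h2, h4]⟩
  zero_mem' := ⟨rfl, map_zero _⟩
  smul_mem' := by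
    rintro c x ⟨h1, h2⟩
    exact ⟨by simp [h1], by simp [h2]⟩

lemma mem_B {x} : x ∈ M.B ↔ x.1 = 0 ∧ M.σ.N x.2 = 0 := Iff.rfl

lemma B_φ {x} (hx : x ∈ M.B) (t : ℝ) : M.φ t x = (0, fl M.σ.K t x.2) := by
  rw [φ_eq, fl_Ac, (fl_fixed_iff M.σ.N _).1 hx.2]
  ext i
  · simp [hx.1]
  · rfl

lemma KN_apply (c : C) : M.σ.N (M.σ.K c) = M.σ.K (M.σ.N c) := by
  have := congrArg (fun L : C →L[ℝ] C => L c) M.σ.KN.eq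
  simpa using this.symm

lemma N_flK (t : ℝ) (c : C) : M.σ.N (fl M.σ.K t c) = fl M.σ.K t (M.σ.N c) := by
  have := congrArg (fun L : C →L[ℝ] C => L c) (fl_commute M.σ.KN.symm t).eq
  simpa using this

lemma B_inv {x} (hx : x ∈ M.B) (t : ℝ) : M.φ t x ∈ M.B := by
  rw [B_φ _ hx]
  refine ⟨rfl, ?_⟩
  simp only
  rw [N_flK, hx.2, map_zero]

lemma B_bound : ∃ c > 0, ∀ t, ∀ x ∈ M.B, ‖M.φ t x‖ ≤ c * ‖x‖ := by
  obtain ⟨c, hc, h⟩ := M.σ.rot_bdd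
  refine ⟨c, hc, fun t x hx => ?_⟩
  rw [B_φ _ hx, Prod.norm_def]
  refine max_le (by simp; positivity) ?_
  calc _ ≤ ‖fl M.σ.K t‖ * ‖x.2‖ := ContinuousLinearMap.le_opNorm _ _
    _ ≤ c * ‖x‖ := by gcongr; exact h t; exact norm_snd_le x

lemma bdd_plus {x} {R : ℝ} (h : ∀ t : ℝ, 0 ≤ t → ‖M.φ t x‖ ≤ R) :
    M.σ.N x.2 = 0 ∧ ∀ i, 0 < M.lam i → x.1 i = 0 := by
  constructor
  · obtain ⟨c, hc, hr⟩ := M.σ.rot_bdd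
    refine nilp_bdd M.σ.N M.σ.nilp (R := c * R) fun t ht => ?_
    have h1 : fl M.σ.N t x.2 = fl M.σ.K (-t) (M.φ t x).2 := by rw [φ_snd, fl_Ac, fl_neg_self]
    rw [h1]
    calc _ ≤ ‖fl M.σ.K (-t)‖ * ‖(M.φ t x).2‖ := ContinuousLinearMap.le_opNorm _ _
      _ ≤ c * R := by gcongr; exact hr _; exact (norm_snd_le _).trans (h t ht)
  · intro i hi
    by_contra hx
    have hx' : 0 < |x.1 i| := abs_pos.2 hx
    have h1 : Tendsto (fun t : ℝ => Real.exp (M.lam i * t) * |x.1 i|) atTop atTop :=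
      (Real.tendsto_exp_atTop.comp (tendsto_id.const_mul_atTop hi)).atTop_mul_const hx'
    obtain ⟨t, ht, ht0⟩ := ((h1.eventually_gt_atTop R).and (eventually_ge_atTop 0)).exists
    have h2 := (le_norm (M.φ t x) i).trans (h t ht0)
    rw [φ_fst, abs_mul, abs_of_pos (Real.exp_pos _)] at h2
    linarith

lemma rev_N : M.rev.σ.N = -M.σ.N := by simp [rev, scale, Spl.scale]

lemma rev_B : M.rev.B = M.B := by
  ext x
  rw [mem_B, mem_B, rev_N]
  simp

lemma bdd_minus {x} {R : ℝ} (h : ∀ t : ℝ, t ≤ 0 → ‖M.φ t x‖ ≤ R) :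
    M.σ.N x.2 = 0 ∧ ∀ i, M.lam i < 0 → x.1 i = 0 := by
  have := M.rev.bdd_plus (x := x) (R := R) fun t ht => by rw [rev_φ]; exact h _ (by linarith)
  rw [rev_N] at this
  refine ⟨by simpa using this.1, fun i hi => this.2 i (by rw [rev_lam]; linarith)⟩

lemma mem_B_iff {x} : x ∈ M.B ↔ ∃ R, ∀ t, ‖M.φ t x‖ ≤ R := by
  constructor
  · intro hx
    obtain ⟨c, hc, h⟩ := M.B_bound
    exact ⟨_, fun t => h t x hx⟩
  · rintro ⟨R, h⟩
    have h1 := M.bdd_plus fun t _ => h t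
    have h2 := M.bdd_minus fun t _ => h t
    refine ⟨?_, h1.1⟩
    ext i
    rcases lt_or_gt_of_ne (M.lam_ne i) with hi | hi
    · exact h2.2 i hi
    · exact h1.2 i hi

lemma gen_B {x} (hx : x ∈ M.B) : M.gen x = 0 ↔ M.σ.K x.2 = 0 := by
  have h1 : M.Ac x.2 = M.σ.K x.2 := by
    have := congrArg (fun L : C →L[ℝ] C => L x.2) M.hz
    simpa [hx.2] using this
  rw [gen_apply, hx.1, h1, Prod.ext_iff]
  simp [funext_iff]

lemma K_eig {v : C} {l : ℝ} (h : M.σ.K v = l • v) : M.σ.K v = 0 := by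
  by_cases hv : v = 0
  · rw [hv, map_zero]
  obtain ⟨c, hc, hr⟩ := M.σ.rot_bdd
  have h1 : ∀ t, fl M.σ.K t v = Real.exp (l * t) • v := by
    intro t
    have := fl_intertwine (A := l • (1 : ℝ →L[ℝ] ℝ)) (B := M.σ.K)
      (L := ContinuousLinearMap.smulRight (1 : ℝ →L[ℝ] ℝ) v)
      (fun s => by simp [h, smul_smul, mul_comm]) t 1
    rw [fl_scalar] at this
    simpa using this.symm
  have hv' : 0 < ‖v‖ := norm_pos_iff.2 hv
  have h2 : ∀ t, Real.exp (l * t) ≤ c := by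
    intro t
    have h3 : ‖fl M.σ.K t v‖ ≤ c * ‖v‖ := (ContinuousLinearMap.le_opNorm _ _).trans (by gcongr; exact hr t)
    rw [h1, norm_smul, Real.norm_of_nonneg (Real.exp_pos _).le] at h3
    exact le_of_mul_le_mul_right h3 hv'
  have hl : l = 0 := by
    by_contra hl
    have h3 := h2 (c / l)
    rw [mul_div_cancel₀ _ hl] at h3
    linarith [Real.add_one_le_exp c]
  rw [h, hl, zero_smul]

lemma KK_zero {v : C} (h : M.σ.K (M.σ.K v) = 0) : M.σ.K v = 0 := by
  obtain ⟨c, hc, hr⟩ := M.σ.rot_bdd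
  -- via the `P i`
  have h1 : ∀ i, M.σ.P i (M.σ.K v) = 0 := by
    intro i
    have e1 : M.σ.K (M.σ.K (M.σ.P i v)) = -(M.σ.b i ^ 2) • M.σ.P i v := by
      have := congrArg (fun L : C →L[ℝ] C => L v) (M.σ.KK i)
      simpa using this
    have e2 : ∀ w, M.σ.K (M.σ.P i w) = M.σ.P i (M.σ.K w) := by
      intro w
      have := congrArg (fun L : C →L[ℝ] C => L w) (M.σ.PK i).eq
      simpa using this.symm
    rw [e2, e2, h, map_zero] at e1
    by_cases hb : M.σ.b i = 0
    · have := congrArg (fun L : C →L[ℝ] C => L v) (M.σ.K0 i hb)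
      rw [← e2]
      simpa using this
    · have : M.σ.P i v = 0 := by
        have h3 := smul_eq_zero.1 e1.symm
        rcases h3 with h3 | h3
        · exact absurd h3 (by simpa using hb)
        · exact h3
      rw [← e2, this, map_zero]
  rw [← M.σ.sum_P (M.σ.K v)]
  exact Finset.sum_eq_zero fun i _ => h1 i

lemma exists_periodic {x} (hx : x ∈ M.B) (hg : M.gen x ≠ 0) :
    ∃ y ∈ M.B, M.gen y ≠ 0 ∧ ∃ T > 0, M.φ T y = y := by
  rw [Ne, M.gen_B hx] at hg
  obtain ⟨i, hi⟩ : ∃ i, M.σ.K (M.σ.P i x.2) ≠ 0 := by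
    by_contra hcon
    push Not at hcon
    apply hg
    rw [← M.σ.sum_P x.2, map_sum]
    exact Finset.sum_eq_zero fun i _ => hcon i
  have hb : 0 < M.σ.b i := by
    refine lt_of_le_of_ne (M.σ.b_nonneg i) fun h0 => hi ?_
    have := congrArg (fun L : C →L[ℝ] C => L x.2) (M.σ.K0 i h0.symm)
    simpa using this
  have hyB : ((0 : ι → ℝ), M.σ.P i x.2) ∈ M.B := by
    refine ⟨rfl, ?_⟩
    have := congrArg (fun L : C →L[ℝ] C => L x.2) (M.σ.PN i).eq
    simp only [ContinuousLinearMap.mul_apply] at this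
    simp only
    rw [← this, hx.2, map_zero]
  refine ⟨(0, M.σ.P i x.2), hyB, ?_, 2 * Real.pi / M.σ.b i, by positivity, ?_⟩
  · rw [Ne, M.gen_B hyB]; exact hi
  · rw [M.B_φ hyB]
    have := congrArg (fun L : C →L[ℝ] C => L x.2) (rot_fl hb (M.σ.KK i) (2 * Real.pi / M.σ.b i))
    simp only [ContinuousLinearMap.mul_apply] at this
    rw [this, mul_div_cancel₀ _ hb.ne']
    simp
end Mdl
end

section
set_option linter.unusedSectionVars false
set_option linter.deprecated false
set_option linter.unusedVariables false

namespace Mdl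
variable {ι C : Type*} [Fintype ι] [NormedAddCommGroup C] [NormedSpace ℝ C]
    [FiniteDimensional ℝ C] [CompleteSpace C] (M : Mdl ι C)

/-- a time change that keeps a nonfixed bounded orbit close to its starting point is bounded -/
lemma close_bdd {x} (hx : x ∈ M.B) (hg : M.gen x ≠ 0) :
    ∃ η > 0, ∃ T0 > 0, ∀ (D : ℝ → ℝ) (s : Set ℝ), Continuous D → IsPreconnected s → ∀ t1 ∈ s,
      (∀ t ∈ s, ‖M.φ (D t) x - x‖ < η) → ∀ t ∈ s, |D t - D t1| ≤ T0 := by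
  obtain ⟨c, hc, hb⟩ := M.B_bound
  obtain ⟨T0, hT0, hne⟩ : ∃ T0 > 0, M.φ T0 x ≠ x := by
    rw [Ne, M.fixed_iff] at hg
    push Not at hg
    obtain ⟨T, hT⟩ := hg
    rcases lt_trichotomy T 0 with h | h | h
    · refine ⟨-T, by linarith, fun h1 => hT ?_⟩
      have := M.φ_self_neg T x
      rwa [h1] at this
    · rw [h, M.φ_zero] at hT; exact absurd rfl hT
    · exact ⟨T, h, hT⟩
  set ρ := ‖M.φ T0 x - x‖ with hρ
  have hρ0 : 0 < ρ := norm_pos_iff.2 (sub_ne_zero.2 hne)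
  have k1 : ρ ≤ c * ‖M.φ (-T0) x - x‖ := by
    have e : M.φ T0 x - x = - M.φ T0 (M.φ (-T0) x - x) := by
      rw [M.φ_vsub, M.φ_self_neg]; abel
    rw [hρ, e, norm_neg]
    exact hb _ _ (M.B.sub_mem (M.B_inv hx _) hx)
  refine ⟨ρ / ((c + 1) * (c + 1)), by positivity, T0, hT0, fun D s hD hs t1 ht1 hcl t ht => ?_⟩
  by_contra hcon
  push Not at hcon
  -- key estimate
  have key : ∀ θ t2, t2 ∈ s → D t2 = θ + D t1 → ρ ≤ (c + 1) * ‖M.φ θ x - x‖ → False := by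
    intro θ t2 ht2 hD2 hθ
    have h1 := hcl t1 ht1
    have h2 := hcl t2 ht2
    rw [hD2, M.φ_add] at h2
    have h3 := hb θ _ (M.B.sub_mem (M.B_inv hx (D t1)) hx)
    rw [M.φ_vsub] at h3
    have h4 : ‖M.φ θ x - x‖ ≤ ‖M.φ θ (M.φ (D t1) x) - x‖ + ‖M.φ θ (M.φ (D t1) x) - M.φ θ x‖ := by
      have : M.φ θ x - x = (M.φ θ (M.φ (D t1) x) - x) - (M.φ θ (M.φ (D t1) x) - M.φ θ x) := by abel
      rw [this]; exact norm_sub_le _ _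
    have h5 : ‖M.φ θ x - x‖ < (c + 1) * (ρ / ((c + 1) * (c + 1))) := by nlinarith
    have h6 : (c + 1) * ‖M.φ θ x - x‖ < (c + 1) * ((c + 1) * (ρ / ((c + 1) * (c + 1)))) := by gcongr
    have h7 : (c + 1) * ((c + 1) * (ρ / ((c + 1) * (c + 1)))) = ρ := by field_simp
    linarith
  rcases lt_abs.1 hcon with h | h
  · obtain ⟨t2, ht2, e⟩ := hs.intermediate_value ht1 ht hD.continuousOn
      (show T0 + D t1 ∈ Set.Icc (D t1) (D t) from ⟨by linarith, by linarith⟩)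
    refine key T0 t2 ht2 e ?_
    rw [← hρ]; nlinarith
  · obtain ⟨t2, ht2, e⟩ := hs.intermediate_value ht ht1 hD.continuousOn
      (show -T0 + D t1 ∈ Set.Icc (D t) (D t1) from ⟨by linarith, by linarith⟩)
    refine key (-T0) t2 ht2 e ?_
    nlinarith [norm_nonneg (M.φ (-T0) x - x)]

/-- version with a different base point -/
lemma close_bdd' {x} (hx : x ∈ M.B) (hg : M.gen x ≠ 0) :
    ∃ η > 0, ∃ T0 > 0, ∀ (D : ℝ → ℝ) (s : Set ℝ) (b), b ∈ M.B → Continuous D → IsPreconnected s →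
      ∀ t1 ∈ s, (∀ t ∈ s, ‖M.φ (D t) b - x‖ < η) → ∀ t ∈ s, |D t - D t1| ≤ T0 := by
  obtain ⟨c, hc, hb⟩ := M.B_bound
  obtain ⟨η, hη, T0, hT0, h⟩ := M.close_bdd hx hg
  refine ⟨η / (c + 1), by positivity, T0, hT0, fun D s b hbB hD hs t1 ht1 hcl t ht => ?_⟩
  have := h (fun t => D t - D t1) s (by fun_prop) hs t1 ht1 (fun t ht => ?_) t ht
  · simpa using this
  have h1 := hcl t1 ht1
  have h2 := hcl t ht
  have e1 : M.φ (D t) b = M.φ (D t - D t1) (M.φ (D t1) b) := by rw [← M.φ_add]; ring_nf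
  have h3 := hb (D t - D t1) _ (M.B.sub_mem (M.B_inv hbB (D t1)) hx)
  rw [M.φ_vsub, ← e1] at h3
  have h4 : ‖M.φ (D t - D t1) x - x‖ ≤ ‖M.φ (D t) b - x‖ + ‖M.φ (D t) b - M.φ (D t - D t1) x‖ := by
    have : M.φ (D t - D t1) x - x
      = (M.φ (D t) b - x) - (M.φ (D t) b - M.φ (D t - D t1) x) := by abel
    rw [this]; exact norm_sub_le _ _
  have h5 : (c + 1) * (η / (c + 1)) = η := by field_simp
  nlinarith
end Mdl

section
variable {ι C ι' C' : Type*} [Fintype ι] [NormedAddCommGroup C] [NormedSpace ℝ C]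
    [FiniteDimensional ℝ C] [CompleteSpace C] [Fintype ι'] [NormedAddCommGroup C']
    [NormedSpace ℝ C'] [FiniteDimensional ℝ C'] [CompleteSpace C']
    {M : Mdl ι C} {M' : Mdl ι' C'} {h : ((ι → ℝ) × C) ≃ₜ ((ι' → ℝ) × C')}

lemma OE0.B_imp (H : OE0 M M' h) {x} (hx : x ∈ M.B) : h x ∈ M'.B := by
  obtain ⟨R, hR⟩ := M.mem_B_iff.1 hx
  obtain ⟨R', hR'⟩ := ((isCompact_closedBall (0 : (ι → ℝ) × C) R).image
    h.continuous).isBounded.exists_norm_le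
  refine M'.mem_B_iff.2 ⟨R', fun t => ?_⟩
  have : M'.φ t (h x) ∈ h '' M.orb x := by rw [H.orb]; exact M'.mem_orb t _
  obtain ⟨y, ⟨s, rfl⟩, e⟩ := this
  rw [← e]
  exact hR' _ ⟨_, by simpa using hR s, rfl⟩

lemma OE0.B (H : OE0 M M' h) (x) : h x ∈ M'.B ↔ x ∈ M.B :=
  ⟨fun hx => by simpa using H.symm.B_imp hx, H.B_imp⟩

/-- continuous lift of the time along the orbit of `x` -/
def IsLift (M : Mdl ι C) (M' : Mdl ι' C') (h : ((ι → ℝ) × C) ≃ₜ ((ι' → ℝ) × C')) (x : (ι → ℝ) × C) (τ : ℝ → ℝ) :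
    Prop := Continuous τ ∧ τ 0 = 0 ∧ ∀ t, h (M.φ t x) = M'.φ (τ t) (h x)

/-- linear behaviour of the lift -/
def Lin (M : Mdl ι C) (M' : Mdl ι' C') (h : ((ι → ℝ) × C) ≃ₜ ((ι' → ℝ) × C')) (κ : ℝ) (x : (ι → ℝ) × C) : Prop :=
  ∃ τ, IsLift M M' h x τ ∧ ∃ b, ∀ t, |τ t - κ * t| ≤ b

lemma Mdl.lift_uniq (M : Mdl ι C) {x} (hx : M.gen x ≠ 0) {σ₁ σ₂ : ℝ → ℝ} (h1 : Continuous σ₁)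
    (h2 : Continuous σ₂) (h0 : σ₁ 0 = σ₂ 0) (h : ∀ t, M.φ (σ₁ t) x = M.φ (σ₂ t) x) (t) :
    σ₁ t = σ₂ t :=
  lift_unique hx h1.continuousOn h2.continuousOn h0 fun t _ => h t

lemma OE0.near (H : OE0 M M' h) {x} (hx : x ∈ M.B) (hg : M.gen x ≠ 0) :
    ∃ δ > 0, ∀ y ∈ M.B, ‖y - x‖ < δ → ∀ τx τy, IsLift M M' h x τx →
      IsLift M M' h y τy → ∃ T0, ∀ t, |τy t - τx t| ≤ T0 := by
  obtain ⟨c, hc, hb⟩ := M.B_bound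
  obtain ⟨c', hc', hb'⟩ := M'.B_bound
  have hx' := H.B_imp hx
  have hg' : M'.gen (h x) ≠ 0 := by rwa [Ne, H.fixed]
  obtain ⟨η, hη, T0, hT0, hcl⟩ := M'.close_bdd hx' hg'
  have hu := (isCompact_closedBall (0 : (ι → ℝ) × C)
    (c * (‖x‖ + 1))).uniformContinuousOn_of_continuous h.continuous.continuousOn
  rw [Metric.uniformContinuousOn_iff] at hu
  obtain ⟨δ1, hδ1, hu⟩ := hu (η / (c' * (1 + c'))) (by positivity)
  obtain ⟨δ2, hδ2, hu2⟩ := Metric.continuousAt_iff.1 (h.continuous.continuousAt (x := x))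
    (η / (c' * (1 + c'))) (by positivity)
  refine ⟨min (min δ2 (δ1 / c)) 1, by positivity, fun y hy hyx τx τy hτx hτy => ⟨T0, fun t => ?_⟩⟩
  have hy1 : ‖y - x‖ < δ2 := hyx.trans_le ((min_le_left _ _).trans (min_le_left _ _))
  have hy2 : ‖y - x‖ < δ1 / c := hyx.trans_le ((min_le_left _ _).trans (min_le_right _ _))
  have hy3 : ‖y - x‖ < 1 := hyx.trans_le (min_le_right _ _)
  have hy4 : ‖y‖ ≤ ‖x‖ + 1 := by
    have : y = x + (y - x) := by abel
    calc ‖y‖ = ‖x + (y - x)‖ := by rw [← this]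
      _ ≤ _ := (norm_add_le _ _).trans (by linarith)
  have := hcl (fun t => τy t - τx t) Set.univ (hτy.1.sub hτx.1) isPreconnected_univ 0 trivial
    (fun t _ => ?_) t trivial
  · simpa [hτx.2.1, hτy.2.1] using this
  have a1 : ‖M'.φ (τy t) (h y) - M'.φ (τx t) (h x)‖ < η / (c' * (1 + c')) := by
    rw [← hτx.2.2, ← hτy.2.2, ← dist_eq_norm]
    apply hu
    · simp only [Metric.mem_closedBall, dist_zero_right]
      exact (hb t y hy).trans (by gcongr)
    · simp only [Metric.mem_closedBall, dist_zero_right]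
      exact (hb t x hx).trans (by gcongr; linarith)
    · rw [dist_eq_norm, ← M.φ_vsub]
      calc _ ≤ c * ‖y - x‖ := hb t _ (M.B.sub_mem hy hx)
        _ < c * (δ1 / c) := by gcongr
        _ = δ1 := by field_simp
  have a2 : ‖h y - h x‖ < η / (c' * (1 + c')) := by
    rw [← dist_eq_norm]; exact hu2 (by rwa [dist_eq_norm])
  have a3 := hb' (τy t) _ (M'.B.sub_mem (H.B_imp hy) hx')
  rw [M'.φ_vsub] at a3
  have a4 : ‖M'.φ (τy t) (h x) - M'.φ (τx t) (h x)‖ < (1 + c') * (η / (c' * (1 + c'))) := by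
    have : M'.φ (τy t) (h x) - M'.φ (τx t) (h x) = (M'.φ (τy t) (h y) - M'.φ (τx t) (h x))
      - (M'.φ (τy t) (h y) - M'.φ (τy t) (h x)) := by abel
    rw [this]
    refine (norm_sub_le _ _).trans_lt ?_
    nlinarith
  have a5 : M'.φ (τy t - τx t) (h x) - h x
      = M'.φ (-τx t) (M'.φ (τy t) (h x) - M'.φ (τx t) (h x)) := by
    rw [M'.φ_vsub, M'.φ_neg_self, ← M'.φ_add]; ring_nf
  rw [a5]
  calc _ ≤ c' * _ := hb' _ _ (M'.B.sub_mem (M'.B_inv hx' _) (M'.B_inv hx' _))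
    _ < c' * ((1 + c') * (η / (c' * (1 + c')))) := by gcongr
    _ = η := by field_simp

lemma OE0.exists_lift (H : OE0 M M' h) {x} (hx : M.gen x ≠ 0) : ∃ τ, IsLift M M' h x τ := by
  obtain ⟨τ, h1, h2, -, -, h3⟩ := H.lift hx
  exact ⟨τ, h1, h2, h3⟩

lemma OE0.lin_near (H : OE0 M M' h) {x} (hx : x ∈ M.B) (hg : M.gen x ≠ 0) :
    ∃ δ > 0, ∀ y ∈ M.B, M.gen y ≠ 0 → ‖y - x‖ < δ → ∀ κ, Lin M M' h κ x ↔ Lin M M' h κ y := by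
  obtain ⟨δ, hδ, hn⟩ := H.near hx hg
  refine ⟨δ, hδ, fun y hy hgy hyx κ => ⟨?_, ?_⟩⟩
  · rintro ⟨τx, h1, b, h2⟩
    obtain ⟨τy, h3⟩ := H.exists_lift hgy
    obtain ⟨T0, h4⟩ := hn y hy hyx τx τy h1 h3
    refine ⟨τy, h3, b + T0, fun t => ?_⟩
    have e : τy t - κ * t = (τx t - κ * t) + (τy t - τx t) := by ring
    rw [e]; exact (abs_add_le _ _).trans (add_le_add (h2 t) (h4 t))
  · rintro ⟨τy, h1, b, h2⟩
    obtain ⟨τx, h3⟩ := H.exists_lift hg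
    obtain ⟨T0, h4⟩ := hn y hy hyx τx τy h3 h1
    refine ⟨τx, h3, b + T0, fun t => ?_⟩
    have e : τx t - κ * t = (τy t - κ * t) - (τy t - τx t) := by ring
    rw [e]; exact (abs_sub _ _).trans (add_le_add (h2 t) (h4 t))

lemma OE0.lin_seg (H : OE0 M M' h) {x y} (hx : x ∈ M.B) (hy : y ∈ M.B)
    (hs : ∀ z ∈ segment ℝ x y, M.gen z ≠ 0) {κ} (hl : Lin M M' h κ x) : Lin M M' h κ y := by
  have hB : ∀ z ∈ segment ℝ x y, z ∈ M.B := fun z hz =>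
    M.B.convex.segment_subset hx hy hz
  have := (convex_segment (𝕜 := ℝ) x y).isPreconnected.induction₂
    (fun z w => Lin M M' h κ z ↔ Lin M M' h κ w) ?_ (fun a b c _ _ _ h1 h2 => h1.trans h2)
    (fun a b _ _ h1 => h1.symm) (left_mem_segment ℝ x y) (right_mem_segment ℝ x y)
  · exact this.1 hl
  intro z hz
  obtain ⟨δ, hδ, hn⟩ := H.lin_near (hB z hz) (hs z hz)
  filter_upwards [self_mem_nhdsWithin, mem_nhdsWithin_of_mem_nhds (Metric.ball_mem_nhds z hδ)]
    with w hw hwb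
  exact hn w (hB w hw) (hs w hw) (by rwa [Metric.mem_ball, dist_eq_norm] at hwb) κ

lemma OE0.lin_seg' (H : OE0 M M' h) {x y} (hx : x ∈ M.B) (hy : y ∈ M.B) (hgx : M.gen x ≠ 0)
    (hxy : ∀ l : ℝ, M.σ.K y.2 ≠ l • M.σ.K x.2) {κ} (hl : Lin M M' h κ x) : Lin M M' h κ y := by
  refine H.lin_seg hx hy ?_ hl
  rintro z ⟨a, b, ha, hb, hab, rfl⟩ h0
  rw [M.gen_B (M.B.add_mem (M.B.smul_mem _ hx) (M.B.smul_mem _ hy))] at h0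
  simp only [Prod.snd_add, Prod.smul_snd, map_add, map_smul] at h0
  by_cases hb0 : b = 0
  · have ha1 : a = 1 := by linarith
    rw [hb0, ha1] at h0
    simp only [one_smul, zero_smul, add_zero] at h0
    exact hgx ((M.gen_B hx).2 h0)
  · apply hxy (-(b⁻¹ * a))
    rw [neg_smul, mul_smul, ← smul_neg, ← eq_neg_of_add_eq_zero_right h0, smul_smul,
      inv_mul_cancel₀ hb0, one_smul]

lemma OE0.lin_all (H : OE0 M M' h) {x y} (hx : x ∈ M.B) (hy : y ∈ M.B) (hgx : M.gen x ≠ 0)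
    (hgy : M.gen y ≠ 0) {κ} (hl : Lin M M' h κ x) : Lin M M' h κ y := by
  by_cases hxy : ∀ l : ℝ, M.σ.K y.2 ≠ l • M.σ.K x.2
  · exact H.lin_seg' hx hy hgx hxy hl
  push Not at hxy
  obtain ⟨l, hl'⟩ := hxy
  have hKx : M.σ.K x.2 ≠ 0 := by rwa [Ne, ← M.gen_B hx]
  have hKy : M.σ.K y.2 ≠ 0 := by rwa [Ne, ← M.gen_B hy]
  have hKKx : M.σ.K (M.σ.K x.2) ≠ 0 := fun h0 => hKx (M.KK_zero h0)
  set w : (ι → ℝ) × C := (0, M.σ.K x.2) with hw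
  have hwB : w ∈ M.B := ⟨rfl, by simp only [hw]; rw [M.KN_apply, hx.2, map_zero]⟩
  have hgw : M.gen w ≠ 0 := by rw [Ne, M.gen_B hwB]; exact hKKx
  have h1 : Lin M M' h κ w := by
    refine H.lin_seg' hx hwB hgx (fun l' h2 => hKKx (M.K_eig h2)) hl
  refine H.lin_seg' hwB hy hgw (fun l' h2 => ?_) h1
  rw [hl'] at h2
  simp only [hw] at h2
  by_cases hl0 : l' = 0
  · rw [hl0, zero_smul] at h2
    rw [h2] at hl'; exact hKy hl'
  · refine hKKx (M.K_eig (l := l'⁻¹ * l) ?_)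
    rw [mul_smul, h2, smul_smul, inv_mul_cancel₀ hl0, one_smul]

lemma OE0.lin_per (H : OE0 M M' h) {x} (hg : M.gen x ≠ 0) {T : ℝ} {τ} (hτ : IsLift M M' h x τ)
    (hT : M.φ T x = x) (t : ℝ) : τ (t + T) = τ t + τ T := by
  have hg' : M'.gen (h x) ≠ 0 := by rwa [Ne, H.fixed]
  obtain ⟨h1, h2, h3⟩ := hτ
  refine M'.lift_uniq hg' (σ₁ := fun t => τ (t + T)) (σ₂ := fun t => τ t + τ T) (by fun_prop)
    (by fun_prop) (by simp [h2]) (fun t => ?_) t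
  rw [← h3, M.φ_add, hT, M'.φ_add, ← h3 T, hT, h3]

lemma OE0.exists_kappa (H : OE0 M M' h) {x0} (hx : x0 ∈ M.B) (hg : M.gen x0 ≠ 0) :
    ∃ κ, κ ≠ 0 ∧ ∀ x ∈ M.B, M.gen x ≠ 0 → Lin M M' h κ x := by
  obtain ⟨y, hy, hgy, T, hT, hTy⟩ := M.exists_periodic hx hg
  obtain ⟨τ, h1, h2, hbij, -, h3⟩ := H.lift hgy
  have hτ : IsLift M M' h y τ := ⟨h1, h2, h3⟩
  have hτT : τ T ≠ 0 := fun h0 => hT.ne' (hbij.1 (h0.trans h2.symm))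
  refine ⟨τ T / T, by positivity, fun x hxB hgx => H.lin_all hy hxB hgy hgx ⟨τ, hτ, ?_⟩⟩
  have hper : Function.Periodic (fun t => τ t - τ T / T * t) T := by
    intro t
    simp only
    rw [H.lin_per hgy hτ hTy]
    field_simp
    ring
  obtain ⟨b, hb⟩ := (isCompact_Icc (a := (0:ℝ)) (b := T)).exists_bound_of_continuousOn
    (f := fun t => τ t - τ T / T * t) (by fun_prop)
  refine ⟨b, fun t => ?_⟩
  obtain ⟨s, hs, e⟩ := hper.exists_mem_Ico₀ hT t
  rw [e]
  exact hb s ⟨hs.1, hs.2.le⟩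

lemma Lin.inv (H : OE0 M M' h) {κ x} (hκ : κ ≠ 0) (hg : M.gen x ≠ 0) (hl : Lin M M' h κ x) :
    Lin M' M h.symm κ⁻¹ (h x) := by
  have hg' : M'.gen (h x) ≠ 0 := by rwa [Ne, H.fixed]
  obtain ⟨τ, ⟨h1, h2, h3⟩, b, hb⟩ := hl
  obtain ⟨τ2, h4, h5, h6⟩ := H.symm.exists_lift hg'
  have e : ∀ s, τ (τ2 s) = s := by
    refine M'.lift_uniq hg' (σ₁ := fun s => τ (τ2 s)) (σ₂ := fun s => s) (by fun_prop)
      (by fun_prop) (by simp [h2, h5]) (fun t => ?_)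
    rw [← h3]
    have := h6 t
    rw [h.symm_apply_apply] at this
    rw [← this, h.apply_symm_apply]
  refine ⟨τ2, ⟨h4, h5, h6⟩, |κ⁻¹| * b, fun s => ?_⟩
  have e2 : τ2 s - κ⁻¹ * s = - (κ⁻¹ * (τ (τ2 s) - κ * τ2 s)) := by
    rw [e]; field_simp; ring
  rw [e2, abs_neg, abs_mul]
  gcongr
  exact hb _

lemma Lin.rev {κ x} (hl : Lin M M' h κ x) : Lin M.rev M'.rev h κ x := by
  obtain ⟨τ, ⟨h1, h2, h3⟩, b, hb⟩ := hl
  refine ⟨fun t => -τ (-t), ⟨by fun_prop, by simp [h2], fun t => ?_⟩, b, fun t => ?_⟩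
  · rw [Mdl.rev_φ, Mdl.rev_φ, h3, neg_neg]
  · have := hb (-t)
    rw [← abs_neg] at this
    convert this using 2; ring

/-- periods are scaled by `κ` -/
def Per (M : Mdl ι C) (M' : Mdl ι' C') (h : ((ι → ℝ) × C) ≃ₜ ((ι' → ℝ) × C')) (κ : ℝ) : Prop :=
  ∀ x ∈ M.B, ∀ T, M.φ T x = x ↔ M'.φ (κ * T) (h x) = h x

lemma OE0.per_imp (H : OE0 M M' h) {x κ T} (hl : M.gen x ≠ 0 → Lin M M' h κ x)
    (hT : M.φ T x = x) : M'.φ (κ * T) (h x) = h x := by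
  by_cases hg : M.gen x = 0
  · rw [(M'.fixed_iff _).1 ((H.fixed x).2 hg)]
  obtain ⟨τ, hτ, b, hb⟩ := hl hg
  have e : ∀ n : ℕ, τ (n * T) = n * τ T := by
    intro n
    induction n with
    | zero => simp [hτ.2.1]
    | succ n ih => push_cast; rw [add_mul, one_mul, H.lin_per hg hτ hT, ih]; ring
  have e2 : τ T = κ * T := by
    by_contra hne
    have h0 : 0 < |τ T - κ * T| := abs_pos.2 (sub_ne_zero.2 hne)
    obtain ⟨n, hn⟩ := exists_nat_gt (b / |τ T - κ * T|)
    rw [div_lt_iff₀ h0] at hn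
    have := hb (n * T)
    rw [e] at this
    have e3 : n * τ T - κ * (n * T) = n * (τ T - κ * T) := by ring
    rw [e3, abs_mul, Nat.abs_cast] at this
    linarith
  rw [← e2, ← hτ.2.2, hT]

lemma OE0.per (H : OE0 M M' h) {κ} (hκ : κ ≠ 0)
    (hl : ∀ x ∈ M.B, M.gen x ≠ 0 → Lin M M' h κ x) : Per M M' h κ := by
  intro x hx T
  refine ⟨H.per_imp (hl x hx), fun h1 => ?_⟩
  have := H.symm.per_imp (x := h x) (κ := κ⁻¹) (T := κ * T) (fun hg' => ?_) h1
  · rw [h.symm_apply_apply] at this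
    rwa [← mul_assoc, inv_mul_cancel₀ hκ, one_mul] at this
  · have hg : M.gen x ≠ 0 := by rwa [Ne, ← H.fixed]
    exact Lin.inv H hκ hg (hl x hx hg)

lemma Mdl.per_neg (M : Mdl ι C) (t x) : M.φ (-t) x = x ↔ M.φ t x = x := by
  constructor
  · intro h
    have := M.φ_self_neg t x
    rwa [h] at this
  · intro h
    have := M.φ_neg_self t x
    rwa [h] at this

lemma Per.abs {κ} (hp : Per M M' h κ) : Per M M' h |κ| := by
  rcases abs_choice κ with e | e
  · rwa [e]
  · rw [e]
    intro x hx T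
    rw [hp x hx T, neg_mul, Mdl.per_neg]
end
end

section
set_option linter.unusedSectionVars false
set_option linter.deprecated false
set_option linter.unusedVariables false

section
variable {ι C ι' C' : Type*} [Fintype ι] [NormedAddCommGroup C] [NormedSpace ℝ C]
    [FiniteDimensional ℝ C] [CompleteSpace C] [Fintype ι'] [NormedAddCommGroup C']
    [NormedSpace ℝ C'] [FiniteDimensional ℝ C'] [CompleteSpace C']
    {M : Mdl ι C} {M' : Mdl ι' C'} {h : ((ι → ℝ) × C) ≃ₜ ((ι' → ℝ) × C')}

lemma Mdl.S_le (M : Mdl ι C) {s} (hs : s ∈ M.S) {t : ℝ} (ht : 0 ≤ t) : ‖M.φ t s‖ ≤ ‖s‖ := by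
  have := M.S_bound hs.1 (c := 0) (fun i hi => not_lt.1 fun h => hi (hs.2 i h)) ht
  simpa using this

lemma OE0.p9_conv (H : OE0 M M' h) {x s} (hx : x ∈ M.B) (hs : s ∈ M.S) :
    Tendsto (fun t => h (M.φ t (x + s)) - h (M.φ t x)) atTop (𝓝 0) := by
  obtain ⟨c, hc, hb⟩ := M.B_bound
  have hu := (isCompact_closedBall (0 : (ι → ℝ) × C)
    (c * ‖x‖ + ‖s‖)).uniformContinuousOn_of_continuous h.continuous.continuousOn
  rw [Metric.uniformContinuousOn_iff] at hu
  rw [Metric.tendsto_nhds]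
  intro ε hε
  obtain ⟨δ, hδ, hu⟩ := hu ε hε
  filter_upwards [(Metric.tendsto_nhds.1 (M.S_tendsto hs)) δ hδ, eventually_ge_atTop 0] with t ht ht0
  rw [dist_zero_right, ← dist_eq_norm]
  apply hu
  · rw [Metric.mem_closedBall, dist_zero_right, M.φ_vadd]
    exact (norm_add_le _ _).trans (add_le_add (hb t x hx) (M.S_le hs ht0))
  · rw [Metric.mem_closedBall, dist_zero_right]
    exact (hb t x hx).trans (by linarith [norm_nonneg s])
  · rw [M.φ_vadd, dist_eq_norm, add_sub_cancel_left]
    rwa [dist_zero_right] at ht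

lemma OE0.p9_bdd (H : OE0 M M' h) {x s κ τ b' w} (hx : x ∈ M.B) (hs : s ∈ M.S)
    (hg : M.gen x ≠ 0) (hl : Lin M M' h κ x) (hτ : IsLift M M' h (x + s) τ) (hb' : b' ∈ M'.B)
    (e : h (x + s) = b' + w) (hw : Tendsto (fun t => M'.φ (τ t) w) atTop (𝓝 0)) :
    ∃ b t1, ∀ t, t1 ≤ t → |τ t - κ * t| ≤ b := by
  obtain ⟨c', hc', hB'⟩ := M'.B_bound
  obtain ⟨τx, hτx, b0, hb0⟩ := hl
  have hx' := H.B_imp hx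
  have hg' : M'.gen (h x) ≠ 0 := by rwa [Ne, H.fixed]
  obtain ⟨η, hη, T0, hT0, hcl⟩ := M'.close_bdd' hx' hg'
  have h1 : Tendsto (fun t => M'.φ (τ t) b' - M'.φ (τx t) (h x)) atTop (𝓝 0) := by
    have := (H.p9_conv hx hs).sub hw
    rw [sub_zero] at this
    refine this.congr fun t => ?_
    rw [hτ.2.2, hτx.2.2, e, M'.φ_vadd]; abel
  obtain ⟨t1, ht1⟩ := eventually_atTop.1 ((Metric.tendsto_nhds.1 h1) (η / c') (by positivity))
  have h2 := hcl (fun t => τ t - τx t) (Set.Ici t1) b' hb' (hτ.1.sub hτx.1) isPreconnected_Ici t1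
    Set.self_mem_Ici (fun t ht => ?_)
  · refine ⟨T0 + |τ t1 - τx t1| + b0, t1, fun t ht => ?_⟩
    have h3 := h2 t ht
    have h4 := hb0 t
    rw [abs_le] at *
    have h5 := abs_le.1 (le_refl |τ t1 - τx t1|)
    constructor <;> linarith [h3.1, h3.2, h4.1, h4.2, h5.1, h5.2]
  · have h3 := ht1 t ht
    rw [dist_zero_right] at h3
    have e2 : M'.φ (τ t - τx t) b' - h x
        = M'.φ (-τx t) (M'.φ (τ t) b' - M'.φ (τx t) (h x)) := by
      rw [M'.φ_vsub, M'.φ_neg_self, ← M'.φ_add]; ring_nf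
    rw [e2]
    calc _ ≤ c' * _ := hB' _ _ (M'.B.sub_mem (M'.B_inv hb' _) (M'.B_inv hx' _))
      _ < c' * (η / c') := by gcongr
      _ = η := by field_simp

lemma OE0.p9_cases (H : OE0 M M' h) {x s κ} (hx : x ∈ M.B) (hs : s ∈ M.S) (hκ : κ ≠ 0)
    (hg : M.gen x ≠ 0) (hl : Lin M M' h κ x) :
    (0 < κ ∧ ∃ b' ∈ M'.B, ∃ s' ∈ M'.S, h (x + s) = b' + s' ∧ ∃ τ, IsLift M M' h (x + s) τ ∧
      ∃ b t1, ∀ t, t1 ≤ t → |τ t - κ * t| ≤ b) ∨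
    (κ < 0 ∧ ∀ i', M'.lam i' < 0 → (h (x + s)).1 i' = 0) := by
  have hgz : M.gen (x + s) ≠ 0 := by
    intro h0
    apply hg
    rw [M.gen_apply] at h0 ⊢
    have h1 := (Prod.ext_iff.1 h0).2
    simp only [Prod.snd_add, hs.1, add_zero] at h1
    rw [h1, hx.1]
    ext i <;> simp
  obtain ⟨τ, h1, h2, hbij, hmono, h3⟩ := H.lift hgz
  have hτ : IsLift M M' h (x + s) τ := ⟨h1, h2, h3⟩
  obtain ⟨c, hc, hb⟩ := M.B_bound
  obtain ⟨R, hR⟩ := ((isCompact_closedBall (0 : (ι → ℝ) × C) (c * ‖x‖ + ‖s‖)).image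
    h.continuous).isBounded.exists_norm_le
  have hR' : ∀ t, 0 ≤ t → ‖M'.φ (τ t) (h (x + s))‖ ≤ R := by
    intro t ht
    rw [← h3]
    refine hR _ ⟨_, ?_, rfl⟩
    rw [Metric.mem_closedBall, dist_zero_right, M.φ_vadd]
    exact (norm_add_le _ _).trans (add_le_add (hb t x hx) (M.S_le hs ht))
  have hdec : h (x + s) = (0, (h (x+s)).2) + ((h (x+s)).1, 0) := by ext <;> simp
  rcases hmono with hm | hm
  · have hp := M'.bdd_plus (x := h (x + s)) (R := R) fun t ht => by
      obtain ⟨t', rfl⟩ := hbij.2 t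
      refine hR' t' ?_
      rw [← h2] at ht
      exact hm.le_iff_le.1 ht
    have hb' : ((0, (h (x+s)).2) : (ι' → ℝ) × C') ∈ M'.B := ⟨rfl, hp.1⟩
    have hs' : (((h (x+s)).1, 0) : (ι' → ℝ) × C') ∈ M'.S := ⟨rfl, hp.2⟩
    have htop : Tendsto τ atTop atTop := by
      refine tendsto_atTop_atTop.2 fun b => ?_
      obtain ⟨t, rfl⟩ := hbij.2 b
      exact ⟨t, fun a ha => hm.monotone ha⟩
    obtain ⟨b, t1, hbt⟩ := H.p9_bdd hx hs hg hl hτ hb' hdec ((M'.S_tendsto hs').comp htop)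
    refine Or.inl ⟨?_, _, hb', _, hs', hdec, τ, hτ, b, t1, hbt⟩
    by_contra hneg
    have hneg : κ < 0 := lt_of_le_of_ne (not_lt.1 hneg) hκ
    obtain ⟨t, ht1, ht2⟩ := ((htop.eventually_gt_atTop b).and
      (eventually_ge_atTop (max t1 0))).exists
    have := (abs_le.1 (hbt t ((le_max_left _ _).trans ht2))).2
    have := (le_max_right _ _).trans ht2
    nlinarith
  · have hp := M'.bdd_minus (x := h (x + s)) (R := R) fun t ht => by
      obtain ⟨t', rfl⟩ := hbij.2 t
      refine hR' t' ?_
      rw [← h2] at ht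
      exact hm.le_iff_ge.1 ht
    have hb' : ((0, (h (x+s)).2) : (ι' → ℝ) × C') ∈ M'.B := ⟨rfl, hp.1⟩
    have hs' : (((h (x+s)).1, 0) : (ι' → ℝ) × C') ∈ M'.U := M'.mem_U.2 ⟨rfl, hp.2⟩
    have htop : Tendsto τ atTop atBot := by
      refine tendsto_atTop_atBot.2 fun b => ?_
      obtain ⟨t, rfl⟩ := hbij.2 b
      exact ⟨t, fun a ha => hm.antitone ha⟩
    obtain ⟨b, t1, hbt⟩ := H.p9_bdd hx hs hg hl hτ hb' hdec ((M'.U_tendsto hs').comp htop)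
    refine Or.inr ⟨?_, hp.2⟩
    by_contra hneg
    have hneg : 0 < κ := lt_of_le_of_ne (not_lt.1 hneg) hκ.symm
    obtain ⟨t, ht1, ht2⟩ := ((htop.eventually_lt_atBot (-b)).and
      (eventually_ge_atTop (max t1 0))).exists
    have := (abs_le.1 (hbt t ((le_max_left _ _).trans ht2))).1
    have := (le_max_right _ _).trans ht2
    nlinarith

lemma Mdl.gen_smul_ne (M : Mdl ι C) {x} (hg : M.gen x ≠ 0) {ε : ℝ} (hε : 0 < ε) : M.gen (ε • x) ≠ 0 := by
  rw [map_smul]; exact smul_ne_zero hε.ne' hg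

lemma OE.p9_pos (H : OE M M' h) {x s κ} (hx : x ∈ M.B) (hg : M.gen x ≠ 0) (hs : s ∈ M.S)
    (hs0 : s ≠ 0) (hκ : κ ≠ 0) (hl : ∀ x ∈ M.B, M.gen x ≠ 0 → Lin M M' h κ x) : 0 < κ := by
  by_contra hneg
  have h1 : ∀ ε : ℝ, 0 < ε → ∀ i', M'.lam i' < 0 → (h (ε • x + s)).1 i' = 0 := by
    intro ε hε
    have hgε := M.gen_smul_ne hg hε
    rcases H.toOE0.p9_cases (M.B.smul_mem ε hx) hs hκ hgε (hl _ (M.B.smul_mem ε hx) hgε)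
      with h2 | h2
    · exact absurd h2.1 hneg
    · exact h2.2
  have h2 : ∀ i', M'.lam i' < 0 → (h s).1 i' = 0 := by
    intro i' hi'
    have hc : Continuous fun ε : ℝ => (h (ε • x + s)).1 i' := by
      have : Continuous fun ε : ℝ => h (ε • x + s) := h.continuous.comp (by fun_prop)
      fun_prop
    have h3 := (hc.tendsto 0).mono_left (nhdsWithin_le_nhds (s := Set.Ioi (0:ℝ)))
    simp only [zero_smul, zero_add] at h3
    refine tendsto_nhds_unique h3 (tendsto_const_nhds.congr' ?_)
    filter_upwards [self_mem_nhdsWithin] with ε hε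
    exact (h1 ε hε i' hi').symm
  have h3 : h s ∈ M'.S := (H.S s).2 hs
  have h4 : h s ∈ M'.U := M'.mem_U.2 ⟨h3.1, h2⟩
  exact hs0 ((H.toOE0.zero_iff s).1 (M'.SU_zero h3 h4))

lemma OE.p9_rate_γ (H : OE M M' h) {x κ i i'} (hx : x ∈ M.B) (hg : M.gen x ≠ 0) (hi : M.Slow i)
    (hi' : M'.Slow i') (hκ : 0 < κ) (hl : ∀ x ∈ M.B, M.gen x ≠ 0 → Lin M M' h κ x) {γ : ℝ}
    (hγ : 0 < γ) (hγ1 : γ < 1) : M.lam i ≤ γ * (M'.lam i' * κ) := by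
  classical
  obtain ⟨r, hr, hr1, hhol⟩ := H.ah.hol'.get1 hγ hγ1
  obtain ⟨c, hc, hb⟩ := M.B_bound
  obtain ⟨ρ, hρ, hcont⟩ := Metric.continuousAt_iff.1 (h.continuous.continuousAt (x := 0))
    (r / 2) (by positivity)
  simp only [dist_zero_right, H.ah.zero] at hcont
  set e0 : (ι → ℝ) × C := (Pi.single i 1, 0) with he0
  have he0S : e0 ∈ M.S := M.slow_mem hi.1 1
  set ε := ρ / (c * ‖x‖ + ‖e0‖ + 1) with hε
  have hε0 : 0 < ε := by positivity
  have hgε := M.gen_smul_ne hg hε0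
  have hxε := M.B.smul_mem ε hx
  have hsε := M.S.smul_mem ε he0S
  rcases H.toOE0.p9_cases hxε hsε hκ.ne' hgε (hl _ hxε hgε) with h2 | h2
  swap
  · exact absurd h2.1 (by linarith)
  obtain ⟨-, b', hb', s', hs', hdec, τ, hτ, b, t1, hbt⟩ := h2
  have hsmall : ∀ t, 0 ≤ t → ‖M.φ t (ε • x + ε • e0)‖ < ρ := by
    intro t ht
    rw [M.φ_vadd, M.φ_vsmul, M.φ_vsmul]
    have k1 := hb t x hx
    have k2 := M.S_le he0S ht
    calc _ ≤ ε * ‖M.φ t x‖ + ε * ‖M.φ t e0‖ := by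
          refine (norm_add_le _ _).trans (le_of_eq ?_)
          rw [norm_smul, norm_smul, Real.norm_of_nonneg hε0.le]
      _ ≤ ε * (c * ‖x‖ + ‖e0‖) := by rw [mul_add]; gcongr
      _ < ε * (c * ‖x‖ + ‖e0‖ + 1) := mul_lt_mul_of_pos_left (lt_add_one _) hε0
      _ = ρ := by rw [hε]; field_simp
  have htop : Tendsto τ atTop atTop := by
    have k : Tendsto (fun t => κ * t - b) atTop atTop :=
      tendsto_atTop_add_const_right _ _ (tendsto_id.const_mul_atTop hκ)
    refine tendsto_atTop_mono' _ ?_ k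
    filter_upwards [eventually_ge_atTop t1] with t ht
    linarith [(abs_le.1 (hbt t ht)).1]
  have hs'small := (Metric.tendsto_nhds.1 ((M'.S_tendsto hs').comp htop)) (r / 2) (by positivity)
  set a := M.lam i
  set a' := M'.lam i'
  have ha' : a' < 0 := hi'.1
  have key : ∀ᶠ t in atTop, Real.exp (a * t) * ε
      ≤ (Real.exp (a' * κ * t) * (Real.exp (-a' * b) * ‖s'‖)) ^ γ := by
    filter_upwards [hs'small, eventually_ge_atTop t1, eventually_ge_atTop 0,
      htop.eventually_ge_atTop 0] with t k1 k2 k3 k4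
    simp only [Function.comp, dist_zero_right] at k1
    have k5 : ‖M'.φ (τ t) (h (ε • x + ε • e0))‖ < r / 2 := by
      rw [← hτ.2.2]; exact hcont (hsmall t k3)
    have e1 : M'.φ (τ t) (h (ε • x + ε • e0)) = M'.φ (τ t) b' + M'.φ (τ t) s' := by
      rw [hdec, M'.φ_vadd]
    have k6 : ‖M'.φ (τ t) b'‖ < r := by
      have : M'.φ (τ t) b' = M'.φ (τ t) (h (ε • x + ε • e0)) - M'.φ (τ t) s' := by rw [e1]; abel
      rw [this]
      exact (norm_sub_le _ _).trans_lt (by linarith)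
    have k7 := hhol _ _ (k5.trans (by linarith)) k6
    rw [e1, add_sub_cancel_left, ← e1, ← hτ.2.2, h.symm_apply_apply] at k7
    have k8 : h.symm (M'.φ (τ t) b') ∈ M.B := H.toOE0.symm.B_imp (M'.B_inv hb' _)
    have k9 := Mdl.le_norm (M.φ t (ε • x + ε • e0) - h.symm (M'.φ (τ t) b')) i
    rw [Prod.fst_sub, Pi.sub_apply, k8.1, M.φ_fst] at k9
    simp only [Prod.fst_add, Prod.smul_fst, hx.1, he0, Pi.add_apply, Pi.smul_apply, Pi.zero_apply,
      smul_eq_mul, Pi.single_eq_same, mul_zero, mul_one, zero_add, sub_zero] at k9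
    rw [abs_of_pos (by positivity)] at k9
    refine k9.trans (k7.trans ?_)
    refine Real.rpow_le_rpow (norm_nonneg _) ?_ hγ.le
    refine (M'.S_slow_bound hs' hi' k4).trans ?_
    rw [← mul_assoc, ← Real.exp_add]
    gcongr
    have := (abs_le.1 (hbt t k2)).1
    change a' * τ t ≤ a' * κ * t + -a' * b
    nlinarith
  by_contra hcon
  push Not at hcon
  set m := a - γ * (a' * κ) with hm
  have hm0 : 0 < m := by linarith
  have h5 : Tendsto (fun t : ℝ => Real.exp (m * t) * ε) atTop atTop :=
    (Real.tendsto_exp_atTop.comp (tendsto_id.const_mul_atTop hm0)).atTop_mul_const hε0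
  obtain ⟨t, k1, k2⟩ := (key.and (h5.eventually_gt_atTop ((Real.exp (-a' * b) * ‖s'‖) ^ γ))).exists
  rw [Real.mul_rpow (Real.exp_pos _).le (by positivity), ← Real.exp_mul] at k1
  have e2 : Real.exp (a * t) = Real.exp (m * t) * Real.exp (a' * κ * t * γ) := by
    rw [← Real.exp_add, hm]; congr 1; ring
  rw [e2] at k1
  have := Real.exp_pos (a' * κ * t * γ)
  nlinarith

lemma OE.p9_rate (H : OE M M' h) {x κ i i'} (hx : x ∈ M.B) (hg : M.gen x ≠ 0) (hi : M.Slow i)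
    (hi' : M'.Slow i') (hκ : 0 < κ) (hl : ∀ x ∈ M.B, M.gen x ≠ 0 → Lin M M' h κ x) :
    M.lam i ≤ M'.lam i' * κ := by
  by_contra hcon
  push Not at hcon
  have h1 := hi.1
  have hm : M'.lam i' * κ < 0 := mul_neg_of_neg_of_pos hi'.1 hκ
  set m := M'.lam i' * κ
  set a := M.lam i
  have hq : a / m < 1 := by rw [div_lt_one_of_neg hm]; exact hcon
  have hq0 : 0 < a / m := div_pos_of_neg_of_neg h1 hm
  have := H.p9_rate_γ hx hg hi hi' hκ hl (γ := (a / m + 1) / 2) (by linarith) (by linarith)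
  change a ≤ (a / m + 1) / 2 * m at this
  have e : (a / m + 1) / 2 * m = (a + m) / 2 := by
    have := hm.ne
    field_simp
  linarith

lemma OE.p9 (H : OE M M' h) {x κ i i'} (hx : x ∈ M.B) (hg : M.gen x ≠ 0) (hi : M.Slow i)
    (hi' : M'.Slow i') (hκ : κ ≠ 0) (hl : ∀ x ∈ M.B, M.gen x ≠ 0 → Lin M M' h κ x) :
    0 < κ ∧ M.lam i = M'.lam i' * κ := by
  classical
  have hpos : 0 < κ := by
    refine H.p9_pos hx hg (M.slow_mem hi.1 1) ?_ hκ hl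
    intro h0
    have := congrFun (Prod.ext_iff.1 h0).1 i
    simp at this
  refine ⟨hpos, le_antisymm (H.p9_rate hx hg hi hi' hpos hl) ?_⟩
  have := H.symm.p9_rate (x := h x) (κ := κ⁻¹) (H.toOE0.B_imp hx)
    (by rwa [Ne, H.toOE0.fixed]) hi' hi (by positivity) (fun y hy hgy => ?_)
  · calc _ ≤ M.lam i * κ⁻¹ * κ := by gcongr
      _ = _ := by field_simp
  · have hB : h.symm y ∈ M.B := H.toOE0.symm.B_imp hy
    have hg2 : M.gen (h.symm y) ≠ 0 := by rwa [Ne, H.toOE0.symm.fixed]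
    have := Lin.inv H.toOE0 hκ hg2 (hl _ hB hg2)
    rwa [h.apply_symm_apply] at this

/-- without hyperbolic part every ratio is admissible -/
lemma Rat.of_noslow {q q' : ℝ} (R : Rat M M' q) (hq' : 0 < q') (h1 : ¬ ∃ i, M.Slow i)
    (h2 : ¬ ∃ i, M.rev.Slow i) : Rat M M' q' where
  pos := hq'
  s s hs := by
    rw [cnt_zero_of_noslow h1 hs]
    have hq := R.pos
    have := R.s (s * q' / q) (by have := mul_neg_of_neg_of_pos hs hq'; exact div_neg_of_neg_of_pos this hq)
    rw [cnt_zero_of_noslow h1 (div_neg_of_neg_of_pos (mul_neg_of_neg_of_pos hs hq') hq),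
      div_mul_cancel₀ _ hq.ne'] at this
    exact this
  u s hs := by
    rw [cnt_zero_of_noslow h2 hs]
    have hq := R.pos
    have := R.u (s * q' / q) (by have := mul_neg_of_neg_of_pos hs hq'; exact div_neg_of_neg_of_pos this hq)
    rw [cnt_zero_of_noslow h2 (div_neg_of_neg_of_pos (mul_neg_of_neg_of_pos hs hq') hq),
      div_mul_cancel₀ _ hq.ne'] at this
    exact this
  ss i i' hi := absurd ⟨i, hi⟩ h1
  su i i' hi := absurd ⟨i, hi⟩ h2

theorem OE.per (H : OE M M' h) : ∃ κ > 0, Per M M' h κ ∧ Rat M M' κ⁻¹ := by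
  obtain ⟨q, R⟩ := H.rat
  by_cases hex : ∃ x ∈ M.B, M.gen x ≠ 0
  swap
  · push Not at hex
    refine ⟨q⁻¹, inv_pos.2 R.pos, fun x hx T => ?_, by rwa [inv_inv]⟩
    have h1 := hex x hx
    rw [(M.fixed_iff x).1 h1, (M'.fixed_iff (h x)).1 ((H.toOE0.fixed x).2 h1)]
    simp
  obtain ⟨x, hx, hg⟩ := hex
  obtain ⟨κ, hκ, hl⟩ := H.toOE0.exists_kappa hx hg
  have hper := H.toOE0.per hκ hl
  by_cases h1 : ∃ i, M.Slow i
  · obtain ⟨i, hi⟩ := h1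
    obtain ⟨i', hi'⟩ := H.slow hi
    obtain ⟨hp, e⟩ := H.p9 hx hg hi hi' hκ hl
    have e2 := R.ss i i' hi hi'
    have e3 : κ⁻¹ = q := by
      rw [e] at e2
      have := hi'.1.ne
      have e4 : M'.lam i' * 1 = M'.lam i' * (κ * q) := by linarith
      have e5 := mul_left_cancel₀ this e4
      field_simp; linarith
    exact ⟨κ, hp, hper, e3 ▸ R⟩
  by_cases h2 : ∃ i, M.rev.Slow i
  · obtain ⟨i, hi⟩ := h2
    obtain ⟨i', hi'⟩ := H.rev.slow hi
    have hgr : ∀ x, M.rev.gen x = 0 ↔ M.gen x = 0 := by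
      intro x
      rw [Mdl.fixed_iff_orb, Mdl.fixed_iff_orb, Mdl.rev_orb]
    obtain ⟨hp, e⟩ := H.rev.p9 (x := x) (by rwa [Mdl.rev_B]) (by rwa [Ne, hgr]) hi hi' hκ
      (fun y hy hgy => (hl y (by rwa [Mdl.rev_B] at hy) (by rwa [Ne, hgr] at hgy)).rev)
    have e2 := R.su i i' hi hi'
    have e3 : κ⁻¹ = q := by
      rw [e] at e2
      have := hi'.1.ne
      have e4 : M'.rev.lam i' * 1 = M'.rev.lam i' * (κ * q) := by linarith
      have e5 := mul_left_cancel₀ this e4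
      field_simp; linarith
    exact ⟨κ, hp, hper, e3 ▸ R⟩
  have hκ' : 0 < |κ| := abs_pos.2 hκ
  exact ⟨|κ|, hκ', hper.abs, R.of_noslow (inv_pos.2 hκ') h1 h2⟩
end
end

section
set_option linter.unusedSectionVars false
set_option linter.deprecated false
set_option linter.unusedVariables false

section
variable {C : Type*} [AddCommGroup C] [Module ℝ C]

/-- algebraic description of the cores -/
def Alg (N : Module.End ℝ C) (W : Submodule ℝ C) (δ : ℕ) : Submodule ℝ C :=
  ⨆ n : ℕ, (W ⊓ LinearMap.ker (N ^ (2*n+δ))).map (N ^ n)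

lemma pow_app (N : Module.End ℝ C) (a b : ℕ) (x : C) : (N ^ a) ((N ^ b) x) = (N ^ (a+b)) x := by
  rw [pow_add]; rfl

lemma pow_big (N : Module.End ℝ C) {a b : ℕ} {x : C} (h : (N ^ a) x = 0) (hab : a ≤ b) :
    (N ^ b) x = 0 := by
  obtain ⟨k, rfl⟩ := Nat.exists_eq_add_of_le hab
  rw [add_comm, ← pow_app, h, map_zero]

lemma pow_inv {N : Module.End ℝ C} {W : Submodule ℝ C} (hW : ∀ x ∈ W, N x ∈ W) (n : ℕ) :
    ∀ x ∈ W, (N ^ n) x ∈ W := by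
  induction n with
  | zero => intro x hx; simpa using hx
  | succ k ih => intro x hx; rw [pow_succ]; exact ih _ (hW _ hx)

lemma Alg.mem {N : Module.End ℝ C} {W : Submodule ℝ C} {δ n : ℕ} {c : C} (hc : c ∈ W)
    (h : (N ^ (2*n+δ)) c = 0) : (N ^ n) c ∈ Alg N W δ :=
  (le_iSup (fun n : ℕ => (W ⊓ LinearMap.ker (N ^ (2*n+δ))).map (N ^ n)) n)
    (Submodule.mem_map_of_mem ⟨hc, h⟩)

lemma Alg.ind {N : Module.End ℝ C} {W : Submodule ℝ C} {δ : ℕ} {p : C → Prop} {x : C}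
    (hx : x ∈ Alg N W δ) (h0 : p 0) (hadd : ∀ x y, p x → p y → p (x+y))
    (hg : ∀ n : ℕ, ∀ c ∈ W, (N ^ (2*n+δ)) c = 0 → p ((N ^ n) c)) : p x := by
  unfold Alg at hx
  refine Submodule.iSup_induction _ (motive := p) hx ?_ h0 hadd
  rintro n _ ⟨c, ⟨hc, hk⟩, rfl⟩
  exact hg n c hc hk

lemma Alg.le {N : Module.End ℝ C} {W : Submodule ℝ C} {δ : ℕ} (hW : ∀ x ∈ W, N x ∈ W) :
    Alg N W δ ≤ W := by
  intro x hx
  exact Alg.ind hx W.zero_mem (fun _ _ => W.add_mem) (fun n c hc _ => pow_inv hW n c hc)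

lemma Alg.inv {N L : Module.End ℝ C} {W : Submodule ℝ C} {δ : ℕ} (hc : Commute L N)
    (hW : ∀ x ∈ W, L x ∈ W) : ∀ x ∈ Alg N W δ, L x ∈ Alg N W δ := by
  intro x hx
  have e : ∀ n c, L ((N ^ n) c) = (N ^ n) (L c) := fun n c =>
    LinearMap.congr_fun (hc.pow_right n).eq c
  refine Alg.ind (p := fun x => L x ∈ Alg N W δ) hx (by simp) ?_ ?_
  · intro x y h1 h2; rw [map_add]; exact add_mem h1 h2
  · intro n c hc h; rw [e]; refine Alg.mem (hW c hc) ?_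
    rw [← e, h, map_zero]

lemma Alg.char {N : Module.End ℝ C} {W : Submodule ℝ C} {δ : ℕ} (hδ : δ ≤ 1)
    (hN : IsNilpotent N) (hW : ∀ x ∈ W, N x ∈ W) {x : C} (hx : x ∈ W)
    (h : ∀ n : ℕ, ∃ w ∈ W, (N ^ n) x = (N ^ (2*n+1-δ)) w) : x ∈ Alg N W δ := by
  have key : ∀ i : ℕ, ∃ y ∈ W, ∃ a ∈ Alg N W δ, (N ^ (i+δ)) a = 0 ∧ x = a + (N ^ i) y := by
    intro i
    induction i with
    | zero =>
      refine ⟨x, hx, 0, zero_mem _, by simp, by simp⟩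
    | succ i ih =>
      obtain ⟨y, hy, a, ha, ha0, hxa⟩ := ih
      obtain ⟨z, hz, e⟩ := h (i+δ)
      have e1 : (N ^ (2*i+δ)) y = (N ^ (2*i+δ+1)) z := by
        rw [hxa, map_add, ha0, zero_add, pow_app] at e
        have i1 : i + δ + i = 2*i+δ := by omega
        have i2 : 2 * (i+δ) + 1 - δ = 2*i+δ+1 := by omega
        rw [i1, i2] at e
        exact e
      have e2 : (N ^ (2*i+δ)) (y - N z) = 0 := by
        rw [map_sub, e1, pow_succ]; simp
      refine ⟨z, hz, a + (N ^ i) (y - N z), add_mem ha (Alg.mem (sub_mem hy (hW z hz)) e2), ?_, ?_⟩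
      · rw [map_add, pow_app, pow_big N ha0 (by omega), pow_big N e2 (by omega), add_zero]
      · rw [map_sub, hxa, pow_succ, Module.End.mul_apply]; abel
  obtain ⟨p, hp⟩ := hN
  obtain ⟨y, hy, a, ha, -, e⟩ := key p
  rw [hp] at e
  rw [e]; simpa using ha

lemma Alg.core {N : Module.End ℝ C} {W : Submodule ℝ C} {δ : ℕ} (hδ : δ ≤ 1)
    (hW : ∀ x ∈ W, N x ∈ W) (j : ℕ) (hj : δ ≤ j) :
    LinearMap.ker N ⊓ (Alg N W δ).map (N ^ j) = LinearMap.ker N ⊓ W.map (N ^ (2*j+1-δ)) := by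
  apply le_antisymm
  · rintro _ ⟨hk, x, hx, rfl⟩
    refine ⟨hk, ?_⟩
    refine Alg.ind (p := fun x => (N ^ j) x ∈ W.map (N ^ (2*j+1-δ))) hx (by simp) ?_ ?_
    · intro x y h1 h2; rw [map_add]; exact add_mem h1 h2
    · intro n c hc h0
      rw [pow_app]
      by_cases hn : j + 1 - δ ≤ n
      · refine ⟨(N ^ (n - (j+1-δ))) c, pow_inv hW _ c hc, ?_⟩
        rw [pow_app]
        congr 2; omega
      · rw [pow_big N h0 (by omega)]; exact zero_mem _
  · rintro _ ⟨hk, w, hw, rfl⟩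
    refine ⟨hk, (N ^ (j+1-δ)) w, Alg.mem hw ?_, ?_⟩
    · have : N ((N ^ (2*j+1-δ)) w) = 0 := hk
      have e : (N ^ (2*(j+1-δ)+δ)) w = N ((N ^ (2*j+1-δ)) w) := by
        rw [← Module.End.mul_apply, ← pow_succ']
        congr 2; omega
      rw [e, this]
    · rw [pow_app]; congr 2; omega
end
end

section
set_option linter.unusedSectionVars false
set_option linter.deprecated false
set_option linter.unusedVariables false

open Polynomial in
/-- truncated exponential -/
def expP (p : ℕ) : ℝ[X] := ∑ j ∈ Finset.range p, monomial j (1 / (j.factorial : ℝ))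

open Polynomial in
lemma expP_coeff (p m : ℕ) (h : m < p) : (expP p).coeff m = 1 / (m.factorial : ℝ) := by
  rw [expP, finsetSum_coeff]
  simp only [coeff_monomial]
  rw [Finset.sum_ite_eq' (Finset.range p) m]
  simp [h]

open Polynomial in
lemma pade_sum (n e k : ℕ) (hne : n ≤ e) (hk : k < n) :
    ∑ i ∈ Finset.range (n+1), (((-1:ℝ))^(n-i) * (n.choose i) * ((e+n-1-i).factorial : ℝ)) *
      (1 / ((e+k-i).factorial : ℝ)) = 0 := by
  set P : ℝ[X] := (descPochhammer ℝ (n-1-k)).comp (C ((e+n-1 : ℕ) : ℝ) - X) with hP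
  have hdeg : P.natDegree < n := by
    have h1 : P.natDegree ≤ _ := natDegree_comp_le
    have h2 : (C ((e+n-1 : ℕ) : ℝ) - X : ℝ[X]).natDegree ≤ 1 := by
      refine (natDegree_sub_le _ _).trans ?_
      simp
    rw [descPochhammer_natDegree] at h1
    have := Nat.mul_le_mul_left (n-1-k) h2
    omega
  have h := congrFun (Polynomial.fwdDiff_iter_eq_zero_of_degree_lt hdeg) (0:ℝ)
  rw [fwdDiff_iter_eq_sum_shift] at h
  simp only [Pi.zero_apply] at h
  rw [← h]
  apply Finset.sum_congr rfl
  intro i hi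
  have hi' : i ≤ n := by simpa [Nat.lt_succ_iff] using hi
  have hev : P.eval (0 + i • (1:ℝ)) = ((e+n-1-i).descFactorial (n-1-k) : ℝ) := by
    rw [hP, eval_comp, ← descPochhammer_eval_eq_descFactorial ℝ]
    congr 1
    rw [Nat.cast_sub (m := i) (n := e+n-1) (by omega)]
    simp
  rw [hev, zsmul_eq_mul]
  have hf := Nat.factorial_mul_descFactorial (n := e+n-1-i) (k := n-1-k) (by omega)
  have e1 : e+n-1-i-(n-1-k) = e+k-i := by omega
  rw [e1] at hf
  rw [← hf]
  have : ((e+k-i).factorial : ℝ) ≠ 0 := by positivity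
  push_cast
  field_simp

open Polynomial in
lemma pade (n e : ℕ) (hne : n ≤ e) : ∃ g : ℝ[X], g.natDegree ≤ n ∧ g.coeff n = 1 ∧
    ∀ p, e + n ≤ p → ∀ m, e ≤ m → m < e + n → (g * expP p).coeff m = 0 := by
  rcases Nat.eq_zero_or_pos n with rfl | hn
  · exact ⟨1, by simp, by simp, fun p hp m h1 h2 => by omega⟩
  set G : ℕ → ℝ := fun i => ((-1:ℝ))^(n-i) * (n.choose i) * ((e+n-1-i).factorial : ℝ) /
    ((e-1).factorial : ℝ) with hG
  set g : ℝ[X] := ∑ i ∈ Finset.range (n+1), monomial i (G i) with hg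
  have hgc : ∀ i ≤ n, g.coeff i = G i := by
    intro i hi
    rw [hg, finsetSum_coeff]
    simp only [coeff_monomial]
    rw [Finset.sum_ite_eq' (Finset.range (n+1)) i]
    simp [Nat.lt_succ_iff, hi]
  have hgd : g.natDegree ≤ n := by
    refine natDegree_sum_le_of_forall_le _ _ ?_
    intro i hi
    exact (natDegree_monomial_le _).trans (by simpa [Nat.lt_succ_iff] using hi)
  refine ⟨g, hgd, ?_, ?_⟩
  · rw [hgc n le_rfl, hG]
    have : e + n - 1 - n = e - 1 := by omega
    have h2 : ((e-1).factorial : ℝ) ≠ 0 := by positivity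
    simp [this, h2]
  · intro p hp m hm1 hm2
    rw [coeff_mul, Finset.Nat.sum_antidiagonal_eq_sum_range_succ_mk]
    obtain ⟨k, rfl⟩ := Nat.exists_eq_add_of_le hm1
    have hsub : Finset.range (n+1) ⊆ Finset.range (e+k).succ := by
      intro i hi; simp at hi ⊢; omega
    rw [← Finset.sum_subset hsub]
    · have := pade_sum n e k hne (by omega)
      have h2 : (0:ℝ) = (1/((e-1).factorial : ℝ)) * 0 := by simp
      rw [h2, ← this, Finset.mul_sum]
      apply Finset.sum_congr rfl
      intro i hi
      have hi' : i ≤ n := by simpa [Nat.lt_succ_iff] using hi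
      simp only
      rw [hgc i hi', expP_coeff _ _ (by omega), hG]
      ring
    · intro i _ hi
      have : n < i := by simpa [Nat.lt_succ_iff] using hi
      simp only
      rw [coeff_eq_zero_of_natDegree_lt (by omega), zero_mul]

section
variable {C : Type*} [NormedAddCommGroup C] [NormedSpace ℝ C] [CompleteSpace C]

/-- polynomial in `N` -/
def PolyIn (N T : C →L[ℝ] C) : Prop := ∃ f : Polynomial ℝ, T = Polynomial.aeval N f

lemma PolyIn.comm {N T K : C →L[ℝ] C} (h : PolyIn N T) (hK : Commute K N) : Commute K T := by
  obtain ⟨f, rfl⟩ := h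
  induction f using Polynomial.induction_on' with
  | add p q hp hq => rw [map_add]; exact hp.add_right hq
  | monomial n a =>
    rw [Polynomial.aeval_monomial]
    exact (Algebra.commute_algebraMap_right a K).mul_right (hK.pow_right n)

lemma PolyIn.mem {N T : C →L[ℝ] C} (h : PolyIn N T) {W : Submodule ℝ C}
    (hW : ∀ x ∈ W, N x ∈ W) : ∀ x ∈ W, T x ∈ W := by
  have hp : ∀ n : ℕ, ∀ x ∈ W, (N ^ n) x ∈ W := by
    intro n
    induction n with
    | zero => intro x hx; simpa using hx
    | succ k ih => intro x hx; rw [pow_succ]; exact ih _ (hW _ hx)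
  obtain ⟨f, rfl⟩ := h
  intro x hx
  induction f using Polynomial.induction_on' with
  | add p q hp hq => rw [map_add]; exact add_mem hp hq
  | monomial n a =>
    rw [Polynomial.aeval_monomial, ContinuousLinearMap.mul_apply]
    rw [Algebra.algebraMap_eq_smul_one]
    exact W.smul_mem _ (hp n x hx)

lemma polyIn_scale (N : C →L[ℝ] C) (s t : ℝ) (f : Polynomial ℝ) :
    PolyIn N (s • Polynomial.aeval (t • N) f) :=
  ⟨s • f.comp (Polynomial.C t * Polynomial.X), by
    rw [map_smul, Polynomial.aeval_comp]
    simp [Algebra.algebraMap_eq_smul_one]⟩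

lemma poly_limit (N : C →L[ℝ] C) (f : Polynomial ℝ) (n : ℕ) (hf : f.natDegree ≤ n) :
    Tendsto (fun t : ℝ => (t⁻¹)^n • Polynomial.aeval (t • N) f) (Bornology.cobounded ℝ)
      (𝓝 (f.coeff n • N ^ n)) := by
  have h1 : ∀ t : ℝ, (t⁻¹)^n • Polynomial.aeval (t • N) f =
      ∑ i ∈ Finset.range (n+1), ((t⁻¹)^n * t^i * f.coeff i) • N ^ i := by
    intro t
    rw [Polynomial.aeval_eq_sum_range' (Nat.lt_succ_of_le hf), Finset.smul_sum]
    apply Finset.sum_congr rfl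
    intro i _
    rw [smul_pow, smul_smul, smul_smul]
    congr 1; ring
  simp only [h1]
  have hne : ∀ᶠ t : ℝ in Bornology.cobounded ℝ, t ≠ 0 := Bornology.eventually_ne_cobounded 0
  have h2 : f.coeff n • N ^ n = ∑ i ∈ Finset.range (n+1), (if i = n then f.coeff n else 0) • N ^ i := by
    rw [Finset.sum_range_succ, Finset.sum_eq_zero]
    · simp
    · intro i hi
      have : i ≠ n := by simp at hi; omega
      simp [this]
  rw [h2]
  apply tendsto_finsetSum
  intro i hi
  have hi' : i ≤ n := by simpa [Nat.lt_succ_iff] using hi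
  refine Tendsto.smul_const ?_ _
  rcases hi'.eq_or_lt with rfl | hlt
  · rw [if_pos rfl]
    refine tendsto_const_nhds.congr' ?_
    filter_upwards [hne] with t ht
    rw [← mul_pow, inv_mul_cancel₀ ht, one_pow, one_mul]
  · rw [if_neg hlt.ne]
    have h3 : Tendsto (fun t : ℝ => (t⁻¹)^(n-i) * f.coeff i) (Bornology.cobounded ℝ) (𝓝 0) := by
      have := ((tendsto_inv₀_cobounded (α := ℝ)).pow (n-i)).mul_const (f.coeff i)
      simpa [zero_pow (Nat.sub_ne_zero_of_lt hlt)] using this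
    refine h3.congr' ?_
    filter_upwards [hne] with t ht
    have : (t⁻¹)^n = (t⁻¹)^(n-i) * (t⁻¹)^i := by rw [← pow_add]; congr 1; omega
    rw [this, mul_assoc ((t⁻¹)^(n-i)), ← mul_pow, inv_mul_cancel₀ ht, one_pow, mul_one]

lemma pade_op (N : C →L[ℝ] C) (hN : IsNilpotent N) (n e : ℕ) (h1 : n ≤ e) (h2 : e ≤ n + 1) :
    ∃ G L H : ℝ → (C →L[ℝ] C), ∃ l : ℝ, (e = n → l = 0) ∧
      (∀ t, PolyIn N (G t)) ∧ (∀ t, PolyIn N (L t)) ∧ (∀ t, PolyIn N (H t)) ∧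
      Tendsto G (Bornology.cobounded ℝ) (𝓝 (N ^ n)) ∧
      Tendsto L (Bornology.cobounded ℝ) (𝓝 (l • N ^ n)) ∧
      ∀ t, G t * fl N t = L t + N ^ (e+n) * H t := by
  obtain ⟨p0, hp0⟩ := hN
  set p := p0 + (e + n) with hp
  have hNp : N ^ p = 0 := by rw [hp, pow_add, hp0, zero_mul]
  obtain ⟨g, hgd, hgn, hg0⟩ := pade n e h1
  set F := g * expP p with hF
  set Lp : Polynomial ℝ := ∑ m ∈ Finset.range e, Polynomial.monomial m (F.coeff m) with hLp
  have hLc : ∀ m, Lp.coeff m = if m < e then F.coeff m else 0 := by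
    intro i
    rw [hLp, Polynomial.finsetSum_coeff]
    simp only [Polynomial.coeff_monomial]
    rw [Finset.sum_ite_eq' (Finset.range e) i]
    simp
  have hLd : Lp.natDegree ≤ n := by
    refine Polynomial.natDegree_sum_le_of_forall_le _ _ ?_
    intro i hi
    have : i < e := by simpa using hi
    exact (Polynomial.natDegree_monomial_le _).trans (by omega)
  have hdvd : (Polynomial.X : Polynomial ℝ) ^ (e+n) ∣ F - Lp := by
    rw [Polynomial.X_pow_dvd_iff]
    intro m hm
    rw [Polynomial.coeff_sub, hLc]
    split_ifs with h
    · simp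
    · rw [hg0 p (by omega) m (by omega) hm, sub_zero]
  obtain ⟨Hp, hHp⟩ := hdvd
  refine ⟨fun t => (t⁻¹)^n • Polynomial.aeval (t • N) g,
    fun t => (t⁻¹)^n • Polynomial.aeval (t • N) Lp,
    fun t => ((t⁻¹)^n * t^(e+n)) • Polynomial.aeval (t • N) Hp, Lp.coeff n, ?_,
    fun t => polyIn_scale N _ _ _, fun t => polyIn_scale N _ _ _, fun t => polyIn_scale N _ _ _, ?_,
    poly_limit N Lp n hLd, ?_⟩
  · intro h; rw [hLc, if_neg (by omega)]
  · have := poly_limit N g n hgd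
    rwa [hgn, one_smul] at this
  · intro t
    have hE : fl N t = Polynomial.aeval (t • N) (expP p) := by
      rw [nilp_fl N hNp, expP, map_sum]
      apply Finset.sum_congr rfl
      intro k _
      rw [Polynomial.aeval_monomial, smul_pow, Algebra.algebraMap_eq_smul_one, smul_mul_smul_comm,
        one_mul]
      congr 1; ring
    have hF2 : F = Lp + Polynomial.X ^ (e+n) * Hp := by rw [← hHp]; ring
    rw [hE, smul_mul_assoc, ← map_mul, ← hF, hF2, map_add, map_mul, map_pow, Polynomial.aeval_X,
      smul_add, smul_pow, smul_mul_assoc, smul_smul, mul_smul_comm]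
end
end

section
set_option linter.unusedSectionVars false
set_option linter.deprecated false
set_option linter.unusedVariables false

section
variable {ι C : Type*} [Fintype ι] [NormedAddCommGroup C] [NormedSpace ℝ C]
    [FiniteDimensional ℝ C] [CompleteSpace C] (M : Mdl ι C)

namespace Mdl

/-- nilpotent part as a linear map -/
def Nl : Module.End ℝ C := (M.σ.N : C →ₗ[ℝ] C)
/-- rotation part as a linear map -/
def Kl : Module.End ℝ C := (M.σ.K : C →ₗ[ℝ] C)

lemma Nl_apply (c : C) : M.Nl c = M.σ.N c := rfl
lemma Kl_apply (c : C) : M.Kl c = M.σ.K c := rfl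

lemma Nl_pow (n : ℕ) (c : C) : (M.Nl ^ n) c = (M.σ.N ^ n) c := by
  induction n generalizing c with
  | zero => simp
  | succ k ih => rw [pow_succ, pow_succ, Module.End.mul_apply, ih]; rfl

lemma Nl_nilp : IsNilpotent M.Nl := by
  obtain ⟨p, hp⟩ := M.σ.nilp
  refine ⟨p, ?_⟩
  ext c
  rw [Nl_pow, hp]; rfl

lemma polyIn_flN (t : ℝ) : PolyIn M.σ.N (fl M.σ.N t) := by
  obtain ⟨p, hp⟩ := M.σ.nilp
  rw [nilp_fl M.σ.N hp]
  refine ⟨∑ k ∈ Finset.range p, Polynomial.monomial k (t^k/k.factorial), ?_⟩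
  rw [map_sum]
  apply Finset.sum_congr rfl
  intro k _
  rw [Polynomial.aeval_monomial, Algebra.algebraMap_eq_smul_one, smul_mul_assoc, one_mul]

lemma alg_lower {W : Submodule ℝ C} (hW : ∀ x ∈ W, M.σ.N x ∈ W) {δ : ℕ} (hδ : δ ≤ 1) {c : C}
    (hc : c ∈ Alg M.Nl W δ) : ∃ q : ℝ → C, (∀ t, q t ∈ W) ∧
      Tendsto q (Bornology.cobounded ℝ) (𝓝 c) ∧
      ∃ y : ℝ → C, (∀ t, fl M.Ac t (q t) = fl M.σ.K t (y t)) ∧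
      ∃ y0 : C, Tendsto y (Bornology.cobounded ℝ) (𝓝 y0) ∧ (δ = 0 → y0 = 0) := by
  refine Alg.ind (p := fun c => ∃ q : ℝ → C, (∀ t, q t ∈ W) ∧
      Tendsto q (Bornology.cobounded ℝ) (𝓝 c) ∧
      ∃ y : ℝ → C, (∀ t, fl M.Ac t (q t) = fl M.σ.K t (y t)) ∧
      ∃ y0 : C, Tendsto y (Bornology.cobounded ℝ) (𝓝 y0) ∧ (δ = 0 → y0 = 0)) hc ?_ ?_ ?_
  · exact ⟨fun _ => 0, fun _ => W.zero_mem, tendsto_const_nhds, fun _ => 0, fun t => by simp, 0,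
      tendsto_const_nhds, fun _ => rfl⟩
  · rintro a b ⟨q, h1, h2, y, h3, y0, h4, h5⟩ ⟨q', h1', h2', y', h3', y0', h4', h5'⟩
    exact ⟨fun t => q t + q' t, fun t => W.add_mem (h1 t) (h1' t), h2.add h2',
      fun t => y t + y' t, fun t => by rw [map_add, map_add, h3, h3'], y0 + y0', h4.add h4',
      fun h => by rw [h5 h, h5' h, add_zero]⟩
  · intro n c hc h0
    obtain ⟨G, L, H, l, hl, hG, hL, hH, hGt, hLt, hid⟩ :=
      pade_op M.σ.N M.σ.nilp n (n+δ) (by omega) (by omega)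
    refine ⟨fun t => G t c, fun t => (hG t).mem hW c hc, ?_, fun t => L t c, ?_,
      (l • M.σ.N ^ n) c, ?_, ?_⟩
    · rw [Nl_pow]
      exact ((ContinuousLinearMap.apply ℝ C c).continuous.tendsto _).comp hGt
    · intro t
      rw [fl_Ac]
      congr 1
      have e1 : fl M.σ.N t (G t c) = G t (fl M.σ.N t c) := by
        have := (hG t).comm ((fl_commute (Commute.refl M.σ.N) t).symm)
        exact congrArg (fun X : C →L[ℝ] C => X c) this.eq
      have e2 := congrArg (fun X : C →L[ℝ] C => X c) (hid t)
      have e3 : M.σ.N ^ (n+δ+n) * H t = H t * M.σ.N ^ (n+δ+n) :=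
        ((hH t).comm ((Commute.refl M.σ.N).pow_left _)).eq
      rw [e3] at e2
      have e4 : (M.σ.N ^ (n+δ+n)) c = 0 := by
        rw [← Nl_pow, ← h0]; congr 2; omega
      rw [e1]
      simpa [e4] using e2
    · exact ((ContinuousLinearMap.apply ℝ C c).continuous.tendsto _).comp hLt
    · intro h; rw [hl (by omega), zero_smul]; rfl

lemma alg_upper {W : Submodule ℝ C} (hW : ∀ x ∈ W, M.σ.N x ∈ W) {δ : ℕ} (hδ : δ ≤ 1) {c : C}
    {w : ℕ → C} (hw : ∀ k, w k ∈ W) (hwc : Tendsto w atTop (𝓝 c)) {t : ℕ → ℝ}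
    (ht : Tendsto t atTop (Bornology.cobounded ℝ))
    (h0 : δ = 0 → Tendsto (fun k => fl M.Ac (t k) (w k)) atTop (𝓝 0))
    (h1 : δ = 1 → ∃ R, ∀ k, ‖fl M.Ac (t k) (w k)‖ ≤ R) : c ∈ Alg M.Nl W δ := by
  have hcl : IsClosed (W : Set C) := W.closed_of_finiteDimensional
  have hcW : c ∈ W := hcl.mem_of_tendsto hwc (Eventually.of_forall hw)
  refine Alg.char hδ M.Nl_nilp hW hcW ?_
  intro n
  obtain ⟨G, L, H, l, hl, hG, hL, hH, hGt, hLt, hid⟩ :=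
      pade_op M.σ.N M.σ.nilp n (n+1-δ) (by omega) (by omega)
  obtain ⟨cK, hcK, hK⟩ := M.σ.rot_bdd
  set y : ℕ → C := fun k => fl M.σ.N (t k) (w k) with hy
  have hyn : ∀ k, ‖y k‖ ≤ cK * ‖fl M.Ac (t k) (w k)‖ := by
    intro k
    have : y k = fl M.σ.K (-(t k)) (fl M.Ac (t k) (w k)) := by rw [fl_Ac, fl_neg_self]
    rw [this]
    refine (ContinuousLinearMap.le_opNorm _ _).trans ?_
    gcongr; exact hK _
  have ht' : Tendsto (fun k => -(t k)) atTop (Bornology.cobounded ℝ) :=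
    tendsto_neg_cobounded.comp ht
  have hLk := hLt.comp ht'
  have hGk := hGt.comp ht'
  have hLy : Tendsto (fun k => L (-(t k)) (y k)) atTop (𝓝 0) := by
    apply squeeze_zero_norm (a := fun k => ‖L (-(t k))‖ * (cK * ‖fl M.Ac (t k) (w k)‖))
    · intro k
      refine (ContinuousLinearMap.le_opNorm _ _).trans ?_
      gcongr; exact hyn k
    · rcases Nat.le_one_iff_eq_zero_or_eq_one.1 hδ with rfl | rfl
      · have := hLk.norm.mul (((h0 rfl).norm).const_mul cK)
        simpa using this
      · obtain ⟨R, hR⟩ := h1 rfl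
        have hl0 : l = 0 := hl (by omega)
        rw [hl0, zero_smul] at hLk
        have h3 := (hLk.norm.mul_const (cK * R))
        rw [norm_zero, zero_mul] at h3
        refine squeeze_zero (fun k => by positivity) (fun k => ?_) h3
        simp only [Function.comp]
        gcongr; exact hR k
  have hGw : Tendsto (fun k => G (-(t k)) (w k)) atTop (𝓝 ((M.σ.N ^ n) c)) := by
    exact (isBoundedBilinearMap_apply.continuous.tendsto (M.σ.N ^ n, c)).comp (hGk.prodMk_nhds hwc)
  have hid2 : ∀ k, G (-(t k)) (w k) - L (-(t k)) (y k) = (M.σ.N ^ (n+1-δ+n)) (H (-(t k)) (y k)) := by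
    intro k
    have e := congrArg (fun X : C →L[ℝ] C => X (y k)) (hid (-(t k)))
    simp only [ContinuousLinearMap.mul_apply, ContinuousLinearMap.add_apply] at e
    have e2 : fl M.σ.N (-(t k)) (y k) = w k := by rw [hy]; simp only [fl_neg_self]
    rw [e2] at e
    rw [e]; simp
  have hlim : Tendsto (fun k => (M.σ.N ^ (n+1-δ+n)) (H (-(t k)) (y k))) atTop (𝓝 ((M.σ.N ^ n) c)) := by
    have := hGw.sub hLy
    simp only [hid2, sub_zero] at this
    exact this
  have hcl2 : IsClosed ((W.map (M.Nl ^ (2*n+1-δ)) : Submodule ℝ C) : Set C) :=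
    Submodule.closed_of_finiteDimensional _
  have hmem : (M.σ.N ^ n) c ∈ W.map (M.Nl ^ (2*n+1-δ)) := by
    refine hcl2.mem_of_tendsto hlim (Eventually.of_forall fun k => ?_)
    refine ⟨H (-(t k)) (y k), (hH _).mem hW _ ((M.polyIn_flN _).mem hW _ (hw k)), ?_⟩
    rw [Nl_pow]; congr 2; omega
  obtain ⟨z, hz, e⟩ := hmem
  exact ⟨z, hz, by rw [e, Nl_pow]⟩

end Mdl

/-- sandwiched sets -/
structure Sand (Y : Set ((ι → ℝ) × C)) (W : Submodule ℝ C) : Prop where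
  K : ∀ x ∈ W, M.σ.K x ∈ W
  N : ∀ x ∈ W, M.σ.N x ∈ W
  P : ∀ i, ∀ x ∈ W, M.σ.P i x ∈ W
  up : ∀ x ∈ Y, x.2 ∈ W
  lowS : ∀ x : (ι → ℝ) × C, x.2 ∈ W → (∀ i, 0 < M.lam i → x.1 i = 0) → x ∈ Y
  lowU : ∀ x : (ι → ℝ) × C, x.2 ∈ W → (∀ i, M.lam i < 0 → x.1 i = 0) → x ∈ Y

/-- core of type C -/
def CoreC (Y : Set ((ι → ℝ) × C)) : Set ((ι → ℝ) × C) :=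
  {x | x ∈ Y ∧ ∃ (u : ℕ → (ι → ℝ) × C) (t : ℕ → ℝ), (∀ n, u n ∈ Y) ∧ Tendsto u atTop (𝓝 x) ∧
    Tendsto (fun n => M.φ (t n) (u n)) atTop (𝓝 0)}

/-- core of type E -/
def CoreE (Y : Set ((ι → ℝ) × C)) : Set ((ι → ℝ) × C) :=
  {x | x ∈ Y ∧ ∃ (u : ℕ → (ι → ℝ) × C) (t : ℕ → ℝ), (∀ n, u n ∈ Y) ∧ Tendsto u atTop (𝓝 x) ∧
    Tendsto t atTop (Bornology.cobounded ℝ) ∧ ∃ R, ∀ n, ‖M.φ (t n) (u n)‖ ≤ R}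

variable {M}

lemma exp_decay {l : ℝ} (hl : l < 0) (v : ℝ) {t : ℕ → ℝ} (ht : Tendsto t atTop atTop) :
    Tendsto (fun n => Real.exp (l * t n) * v) atTop (𝓝 0) := by
  have : Tendsto (fun n => l * t n) atTop atBot := ht.const_mul_atTop_of_neg hl
  simpa using (Real.tendsto_exp_atBot.comp this).mul_const v

/-- witness sequences for the lower bound -/
lemma core_low {W : Submodule ℝ C} (hW : ∀ x ∈ W, M.σ.N x ∈ W) {δ : ℕ} (hδ : δ ≤ 1)
    {x : (ι → ℝ) × C} (hx : x.2 ∈ Alg M.Nl W δ) {t : ℕ → ℝ}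
    (ht : Tendsto t atTop (Bornology.cobounded ℝ))
    (hh : ∀ i, Tendsto (fun n => Real.exp (M.lam i * t n) * x.1 i) atTop (𝓝 0)) :
    ∃ u : ℕ → (ι → ℝ) × C, (∀ n, (u n).1 = x.1 ∧ (u n).2 ∈ W) ∧ Tendsto u atTop (𝓝 x) ∧
      (∃ R, ∀ n, ‖M.φ (t n) (u n)‖ ≤ R) ∧
      (δ = 0 → Tendsto (fun n => M.φ (t n) (u n)) atTop (𝓝 0)) := by
  obtain ⟨q, hq, hqc, y, hy, y0, hy0, h00⟩ := M.alg_lower hW hδ hx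
  obtain ⟨cK, hcK, hK⟩ := M.σ.rot_bdd
  have h1 : Tendsto (fun n => (fun i => Real.exp (M.lam i * t n) * x.1 i : ι → ℝ)) atTop (𝓝 0) :=
    tendsto_pi_nhds.2 hh
  have hyt := hy0.comp ht
  have hb : ∀ n, ‖fl M.σ.K (t n) (y (t n))‖ ≤ cK * ‖y (t n)‖ := fun n => by
    refine (ContinuousLinearMap.le_opNorm _ _).trans ?_
    gcongr; exact hK _
  refine ⟨fun n => (x.1, q (t n)), fun n => ⟨rfl, hq _⟩, ?_, ?_, ?_⟩
  · exact tendsto_const_nhds.prodMk_nhds (hqc.comp ht)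
  · obtain ⟨R1, hR1⟩ := h1.norm.bddAbove_range
    obtain ⟨R2, hR2⟩ := hyt.norm.bddAbove_range
    refine ⟨max R1 (cK * R2), fun n => ?_⟩
    rw [M.φ_eq, Prod.norm_def]
    refine max_le_max (hR1 ⟨n, rfl⟩) ?_
    simp only [hy]
    refine (hb n).trans ?_
    gcongr
    exact hR2 ⟨n, rfl⟩
  · intro h
    rw [h00 h] at hyt
    have h2 : Tendsto (fun n => fl M.Ac (t n) (q (t n))) atTop (𝓝 0) := by
      simp only [hy]
      refine squeeze_zero_norm hb ?_
      have := hyt.norm.const_mul cK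
      simpa using this
    simp only [M.φ_eq]
    exact h1.prodMk_nhds h2

lemma tendsto_cob_nat : Tendsto (fun n : ℕ => (n:ℝ)) atTop (Bornology.cobounded ℝ) :=
  by
  rw [← tendsto_norm_atTop_iff_cobounded]
  exact (tendsto_abs_atTop_atTop).comp (tendsto_natCast_atTop_atTop (R := ℝ))

lemma tendsto_cob_neg : Tendsto (fun n : ℕ => -(n:ℝ)) atTop (Bornology.cobounded ℝ) :=
  tendsto_neg_cobounded.comp tendsto_cob_nat

lemma decayS {x : (ι → ℝ) × C} (h : ∀ i, 0 < M.lam i → x.1 i = 0) (i : ι) :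
    Tendsto (fun n : ℕ => Real.exp (M.lam i * (n:ℝ)) * x.1 i) atTop (𝓝 0) := by
  rcases (M.lam_ne i).lt_or_gt with h1 | h1
  · exact exp_decay h1 _ tendsto_natCast_atTop_atTop
  · simp [h i h1]

lemma decayU {x : (ι → ℝ) × C} (h : ∀ i, M.lam i < 0 → x.1 i = 0) (i : ι) :
    Tendsto (fun n : ℕ => Real.exp (M.lam i * (-(n:ℝ))) * x.1 i) atTop (𝓝 0) := by
  rcases (M.lam_ne i).lt_or_gt with h1 | h1
  · simp [h i h1]
  · have := exp_decay (l := -M.lam i) (by linarith) (x.1 i) (tendsto_natCast_atTop_atTop (R := ℝ))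
    simpa using this

lemma commute_l {K N : C →L[ℝ] C} (h : Commute K N) :
    Commute (K : Module.End ℝ C) (N : Module.End ℝ C) := by
  ext c
  exact congrArg (fun X : C →L[ℝ] C => X c) h.eq

lemma Sand.alg {Y W} (H : Sand M Y W) {δ : ℕ} (hδ : δ ≤ 1) {Y' : Set ((ι → ℝ) × C)}
    (up : ∀ x ∈ Y', x.2 ∈ Alg M.Nl W δ)
    (lowS : ∀ x : (ι → ℝ) × C, x.2 ∈ Alg M.Nl W δ → (∀ i, 0 < M.lam i → x.1 i = 0) → x ∈ Y')
    (lowU : ∀ x : (ι → ℝ) × C, x.2 ∈ Alg M.Nl W δ → (∀ i, M.lam i < 0 → x.1 i = 0) → x ∈ Y') :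
    Sand M Y' (Alg M.Nl W δ) where
  K := Alg.inv (L := M.Kl) (commute_l M.σ.KN) H.K
  N := Alg.inv (L := M.Nl) (Commute.refl _) H.N
  P i := Alg.inv (L := (M.σ.P i : Module.End ℝ C)) (commute_l (M.σ.PN i)) (H.P i)
  up := up
  lowS := lowS
  lowU := lowU

lemma Sand.coreC {Y W} (H : Sand M Y W) : Sand M (CoreC M Y) (Alg M.Nl W 0) := by
  refine H.alg (by omega) ?_ ?_ ?_
  · rintro x ⟨hx, u, t, hu, hux, h0⟩
    have h2 : Tendsto (fun n => (u n).2) atTop (𝓝 x.2) := (continuous_snd.tendsto _).comp hux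
    have h3 : Tendsto (fun n => fl M.Ac (t n) (u n).2) atTop (𝓝 0) := by
      have := (continuous_snd.tendsto (0 : (ι → ℝ) × C)).comp h0
      refine (this.congr fun n => ?_)
      exact M.φ_snd _ _
    by_cases ht : Tendsto t atTop (Bornology.cobounded ℝ)
    · exact M.alg_upper H.N (by omega) (fun k => H.up _ (hu k)) h2 ht (fun _ => h3) (by omega)
    · rw [← tendsto_norm_atTop_iff_cobounded, tendsto_atTop] at ht
      push Not at ht
      obtain ⟨T, hT⟩ := ht
      have hT' : ∃ᶠ n in atTop, t n ∈ Set.Icc (-T) T :=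
        hT.mono fun n hn => by
          have := abs_le.1 (le_of_lt hn); exact ⟨this.1, this.2⟩
      obtain ⟨s, hs, g, hg, hgs⟩ := isCompact_Icc.tendsto_subseq' hT'
      have h4 : Tendsto (fun n => M.φ (t (g n)) (u (g n))) atTop (𝓝 (M.φ s x)) := by
        have := (M.φ_cont.tendsto (s, x)).comp (hgs.prodMk_nhds (hux.comp hg.tendsto_atTop))
        exact this
      have h5 : M.φ s x = 0 := tendsto_nhds_unique h4 (h0.comp hg.tendsto_atTop)
      have h6 : x = 0 := by
        have := congrArg (M.φ (-s)) h5
        rwa [M.φ_neg_self, M.φ_v0] at this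
      rw [h6]; exact zero_mem _
  · intro x hx h
    obtain ⟨u, hu, hux, -, h0⟩ := core_low H.N (by omega) hx tendsto_cob_nat (decayS h)
    refine ⟨H.lowS x (Alg.le H.N hx) h, u, _, fun n => H.lowS _ (hu n).2 ?_, hux, h0 rfl⟩
    rw [(hu n).1]; exact h
  · intro x hx h
    obtain ⟨u, hu, hux, -, h0⟩ := core_low H.N (by omega) hx tendsto_cob_neg (decayU h)
    refine ⟨H.lowU x (Alg.le H.N hx) h, u, _, fun n => H.lowU _ (hu n).2 ?_, hux, h0 rfl⟩
    rw [(hu n).1]; exact h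

lemma Sand.coreE {Y W} (H : Sand M Y W) : Sand M (CoreE M Y) (Alg M.Nl W 1) := by
  refine H.alg (by omega) ?_ ?_ ?_
  · rintro x ⟨hx, u, t, hu, hux, ht, R, hR⟩
    have h2 : Tendsto (fun n => (u n).2) atTop (𝓝 x.2) := (continuous_snd.tendsto _).comp hux
    refine M.alg_upper H.N (by omega) (fun k => H.up _ (hu k)) h2 ht (by omega)
      (fun _ => ⟨R, fun k => ?_⟩)
    rw [← M.φ_snd]
    exact (norm_snd_le _).trans (hR k)
  · intro x hx h
    obtain ⟨u, hu, hux, h0, -⟩ := core_low H.N (by omega) hx tendsto_cob_nat (decayS h)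
    refine ⟨H.lowS x (Alg.le H.N hx) h, u, _, fun n => H.lowS _ (hu n).2 ?_, hux,
      tendsto_cob_nat, h0⟩
    rw [(hu n).1]; exact h
  · intro x hx h
    obtain ⟨u, hu, hux, h0, -⟩ := core_low H.N (by omega) hx tendsto_cob_neg (decayU h)
    refine ⟨H.lowU x (Alg.le H.N hx) h, u, _, fun n => H.lowU _ (hu n).2 ?_, hux,
      tendsto_cob_neg, h0⟩
    rw [(hu n).1]; exact h

lemma sand_univ : Sand M Set.univ ⊤ where
  K _ _ := trivial
  N _ _ := trivial
  P _ _ _ := trivial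
  up _ _ := trivial
  lowS _ _ _ := trivial
  lowU _ _ _ := trivial
end
end

section
set_option linter.unusedSectionVars false
set_option linter.deprecated false
set_option linter.unusedVariables false

section
variable {ι C ι' C' : Type*} [Fintype ι] [NormedAddCommGroup C] [NormedSpace ℝ C]
    [FiniteDimensional ℝ C] [CompleteSpace C] [Fintype ι'] [NormedAddCommGroup C']
    [NormedSpace ℝ C'] [FiniteDimensional ℝ C'] [CompleteSpace C']
    {M : Mdl ι C} {M' : Mdl ι' C'} {h : ((ι → ℝ) × C) ≃ₜ ((ι' → ℝ) × C')}

lemma OE0.coreC_imp (H : OE0 M M' h) {Y x} (hx : x ∈ CoreC M Y) : h x ∈ CoreC M' (h '' Y) := by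
  obtain ⟨hY, u, t, hu, hux, h0⟩ := hx
  have : ∀ n, ∃ s, M'.φ s (h (u n)) = h (M.φ (t n) (u n)) := fun n => H.mem.2 (M.mem_orb _ _)
  choose s hs using this
  refine ⟨⟨x, hY, rfl⟩, fun n => h (u n), s, fun n => ⟨_, hu n, rfl⟩,
    (h.continuous.tendsto x).comp hux, ?_⟩
  simp only [hs]
  have := (h.continuous.tendsto 0).comp h0
  rwa [H.ah.zero] at this

lemma Mdl.periodic_B {x} {T : ℝ} (hT : T ≠ 0) (hp : M.φ T x = x) : x ∈ M.B := by
  have hper : Function.Periodic (fun t => M.φ t x) |T| := by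
    have h1 : ∀ t, M.φ (t + T) x = M.φ t x := fun t => by rw [M.φ_add, hp]
    intro t
    rcases abs_choice T with e | e <;> simp only [e]
    · exact h1 t
    · have := h1 (t + -T); simpa using this.symm
  obtain ⟨R, hR⟩ := ((isCompact_Icc (a := (0:ℝ)) (b := |T|)).image
    (M.φ_cont_t x)).isBounded.exists_norm_le
  refine M.mem_B_iff.2 ⟨R, fun t => ?_⟩
  obtain ⟨y, hy, e⟩ := hper.exists_mem_Ico₀ (abs_pos.2 hT) t
  rw [e]
  exact hR _ ⟨y, ⟨hy.1, hy.2.le⟩, rfl⟩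

lemma Mdl.inj_of_notB {x} (hx : x ∉ M.B) {s s' : ℝ} (e : M.φ s x = M.φ s' x) : s = s' := by
  by_contra hne
  apply hx
  apply M.periodic_B (sub_ne_zero.2 hne)
  rw [sub_eq_add_neg, add_comm, M.φ_add, e, M.φ_neg_self]

lemma between {τ : ℝ → ℝ} (h0 : τ 0 = 0) (hm : StrictMono τ ∨ StrictAnti τ) {a b : ℝ}
    (hab : (0 ≤ a ∧ a ≤ b) ∨ (b ≤ a ∧ a ≤ 0)) : |τ a| ≤ |τ b| := by
  rcases hm with hm | hm <;> rcases hab with ⟨h1, h2⟩ | ⟨h1, h2⟩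
  · have e1 := hm.monotone h1; have e2 := hm.monotone h2
    rw [h0] at e1
    rw [abs_of_nonneg e1, abs_of_nonneg (e1.trans e2)]; exact e2
  · have e1 := hm.monotone h1; have e2 := hm.monotone h2
    rw [h0] at e2
    rw [abs_of_nonpos e2, abs_of_nonpos (e1.trans e2)]; linarith
  · have e1 := hm.antitone h1; have e2 := hm.antitone h2
    rw [h0] at e1
    rw [abs_of_nonpos e1, abs_of_nonpos (e2.trans e1)]; linarith
  · have e1 := hm.antitone h1; have e2 := hm.antitone h2
    rw [h0] at e2
    rw [abs_of_nonneg e2, abs_of_nonneg (e2.trans e1)]; exact e1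

lemma OE0.freq_lim (H : OE0 M M' h) {x} {u : ℕ → (ι → ℝ) × C} (hux : Tendsto u atTop (𝓝 x))
    {T r : ℝ} (hf : ∃ᶠ n in atTop, ∃ s ∈ Set.Icc (-T) T, h (M.φ r (u n)) = M'.φ s (h (u n))) :
    ∃ s ∈ Set.Icc (-T) T, h (M.φ r x) = M'.φ s (h x) := by
  obtain ⟨g, hg, hgs⟩ := extraction_of_frequently_atTop hf
  choose s hs e using hgs
  obtain ⟨σ, hσ, g', hg', hlim⟩ := isCompact_Icc.tendsto_subseq hs
  refine ⟨σ, hσ, ?_⟩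
  have hu' : Tendsto (fun n => u (g (g' n))) atTop (𝓝 x) :=
    hux.comp (hg.tendsto_atTop.comp hg'.tendsto_atTop)
  have l1 : Tendsto (fun n => h (M.φ r (u (g (g' n))))) atTop (𝓝 (h (M.φ r x))) :=
    ((h.continuous.comp (M.φ_cont_x r)).tendsto x).comp hu'
  have l2 : Tendsto (fun n => M'.φ (s (g' n)) (h (u (g (g' n))))) atTop (𝓝 (M'.φ σ (h x))) :=
    (M'.φ_cont.tendsto (σ, h x)).comp (hlim.prodMk_nhds ((h.continuous.tendsto x).comp hu'))
  simp only [e] at l1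
  exact tendsto_nhds_unique l1 l2

lemma OE0.coreE_imp (H : OE0 M M' h) {Y x} (hx : x ∈ CoreE M Y) : h x ∈ CoreE M' (h '' Y) := by
  obtain ⟨hY, u, t, hu, hux, ht, R, hR⟩ := hx
  by_cases hB : h x ∈ M'.B
  · obtain ⟨R', hR'⟩ := M'.mem_B_iff.1 hB
    exact ⟨⟨x, hY, rfl⟩, fun _ => h x, fun n => (n:ℝ), fun _ => ⟨x, hY, rfl⟩, tendsto_const_nhds,
      tendsto_cob_nat, R', fun n => hR' _⟩
  have hgx : M.gen x ≠ 0 := by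
    intro h0
    apply hB
    have h1 := (H.fixed x).2 h0
    have h2 : M'.φ 1 (h x) = h x := (M'.fixed_iff _).1 h1 1
    exact M'.periodic_B one_ne_zero h2
  have : ∀ n, ∃ s, M'.φ s (h (u n)) = h (M.φ (t n) (u n)) ∧ (M.gen (u n) ≠ 0 → ∀ r, 0 ≤ r →
      r ≤ |t n| → (∃ s', |s'| ≤ |s| ∧ h (M.φ r (u n)) = M'.φ s' (h (u n))) ∨
        (∃ s', |s'| ≤ |s| ∧ h (M.φ (-r) (u n)) = M'.φ s' (h (u n)))) := by
    intro n
    by_cases hg : M.gen (u n) = 0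
    · obtain ⟨s, hs⟩ := H.mem.2 (M.mem_orb (t n) (u n))
      exact ⟨s, hs, fun h' => absurd hg h'⟩
    · obtain ⟨τ, hτc, hτ0, -, hm, hτ⟩ := H.lift hg
      refine ⟨τ (t n), (hτ _).symm, fun _ r hr0 hr => ?_⟩
      rcases le_total 0 (t n) with h0 | h0
      · rw [abs_of_nonneg h0] at hr
        exact Or.inl ⟨τ r, between hτ0 hm (Or.inl ⟨hr0, hr⟩), hτ r⟩
      · rw [abs_of_nonpos h0] at hr
        exact Or.inr ⟨τ (-r), between hτ0 hm (Or.inr ⟨by linarith, by linarith⟩), hτ (-r)⟩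
  choose s hs hs2 using this
  by_cases hst : Tendsto s atTop (Bornology.cobounded ℝ)
  · obtain ⟨R', hR'⟩ := ((isCompact_closedBall (0 : (ι → ℝ) × C) R).image
      h.continuous).isBounded.exists_norm_le
    refine ⟨⟨x, hY, rfl⟩, fun n => h (u n), s, fun n => ⟨_, hu n, rfl⟩,
      (h.continuous.tendsto x).comp hux, hst, R', fun n => ?_⟩
    rw [hs]
    exact hR' _ ⟨_, by simpa using hR n, rfl⟩
  exfalso
  rw [← tendsto_norm_atTop_iff_cobounded, tendsto_atTop] at hst
  push Not at hst
  obtain ⟨T, hT⟩ := hst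
  rw [← tendsto_norm_atTop_iff_cobounded, tendsto_atTop] at ht
  have hgu : ∀ᶠ n : ℕ in atTop, M.gen (u n) ≠ 0 :=
    ((M.gen.continuous.tendsto x).comp hux).eventually_ne hgx
  obtain ⟨τ, hτc, hτ0, hbij, hm, hτ⟩ := H.lift hgx
  have key : ∀ r, 0 ≤ r → |τ r| ≤ T ∨ |τ (-r)| ≤ T := by
    intro r hr
    have hf := (hT.and_eventually (hgu.and (ht r))).mono (fun n hn => hs2 n hn.2.1 r hr hn.2.2)
    have hf2 := (hT.and_eventually (hgu.and (ht r))).mono (p := _)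
      (q := fun n => (∃ s ∈ Set.Icc (-T) T, h (M.φ r (u n)) = M'.φ s (h (u n))) ∨
        (∃ s ∈ Set.Icc (-T) T, h (M.φ (-r) (u n)) = M'.φ s (h (u n)))) (fun n hn => by
      have hsT : |s n| ≤ T := le_of_lt hn.1
      rcases hs2 n hn.2.1 r hr hn.2.2 with ⟨s', h1, h2⟩ | ⟨s', h1, h2⟩
      · exact Or.inl ⟨s', abs_le.1 (h1.trans hsT), h2⟩
      · exact Or.inr ⟨s', abs_le.1 (h1.trans hsT), h2⟩)
    rcases frequently_or_distrib.1 hf2 with hf3 | hf3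
    · obtain ⟨σ, hσ, e⟩ := H.freq_lim hux hf3
      rw [hτ] at e
      rw [M'.inj_of_notB hB e]
      exact Or.inl (abs_le.2 hσ)
    · obtain ⟨σ, hσ, e⟩ := H.freq_lim hux hf3
      rw [hτ] at e
      rw [M'.inj_of_notB hB e]
      exact Or.inr (abs_le.2 hσ)
  have hT0 : 0 ≤ T := by rcases key 0 le_rfl with h' | h' <;> exact (abs_nonneg _).trans h'
  obtain ⟨a, ha⟩ := hbij.2 (T+1)
  obtain ⟨b, hb⟩ := hbij.2 (-(T+1))
  have ha' : |τ a| = T + 1 := by rw [ha, abs_of_nonneg (by linarith)]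
  have hb' : |τ b| = T + 1 := by rw [hb, abs_neg, abs_of_nonneg (by linarith)]
  have hab : (0 ≤ a ∧ b ≤ 0) ∨ (a ≤ 0 ∧ 0 ≤ b) := by
    rcases hm with hm | hm
    · left
      exact ⟨hm.le_iff_le.1 (by rw [hτ0, ha]; linarith), hm.le_iff_le.1 (by rw [hτ0, hb]; linarith)⟩
    · right
      exact ⟨hm.le_iff_ge.1 (by rw [hτ0, ha]; linarith), hm.le_iff_ge.1 (by rw [hτ0, hb]; linarith)⟩
  rcases hab with ⟨h1, h2⟩ | ⟨h1, h2⟩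
  · have e1 : |τ a| ≤ |τ (max a (-b))| := between hτ0 hm (Or.inl ⟨h1, le_max_left _ _⟩)
    have e2 : |τ b| ≤ |τ (-(max a (-b)))| :=
      between hτ0 hm (Or.inr ⟨by linarith [le_max_right a (-b)], h2⟩)
    rcases key _ (h1.trans (le_max_left a (-b))) with h' | h' <;> linarith
  · have e1 : |τ b| ≤ |τ (max b (-a))| := between hτ0 hm (Or.inl ⟨h2, le_max_left _ _⟩)
    have e2 : |τ a| ≤ |τ (-(max b (-a)))| :=
      between hτ0 hm (Or.inr ⟨by linarith [le_max_right b (-a)], h1⟩)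
    rcases key _ (h2.trans (le_max_left b (-a))) with h' | h' <;> linarith

lemma OE0.coreC (H : OE0 M M' h) (Y) : h '' CoreC M Y = CoreC M' (h '' Y) := by
  apply le_antisymm
  · rintro _ ⟨x, hx, rfl⟩; exact H.coreC_imp hx
  · intro x hx
    have := H.symm.coreC_imp hx
    rw [← Set.image_comp] at this
    simp only [Function.comp_def, h.symm_apply_apply, Set.image_id'] at this
    exact ⟨_, this, h.apply_symm_apply x⟩

lemma OE0.coreE (H : OE0 M M' h) (Y) : h '' CoreE M Y = CoreE M' (h '' Y) := by
  apply le_antisymm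
  · rintro _ ⟨x, hx, rfl⟩; exact H.coreE_imp hx
  · intro x hx
    have := H.symm.coreE_imp hx
    rw [← Set.image_comp] at this
    simp only [Function.comp_def, h.symm_apply_apply, Set.image_id'] at this
    exact ⟨_, this, h.apply_symm_apply x⟩
end
end

section
set_option linter.unusedSectionVars false
set_option linter.deprecated false
set_option linter.unusedVariables false

namespace Spl
variable {V : Type*} [NormedAddCommGroup V] [NormedSpace ℝ V] [FiniteDimensional ℝ V]
  [CompleteSpace V] {A : V →L[ℝ] V} (σ : Spl A)

/-- vectors of `Z` whose components outside `I` vanish -/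
def sel (Z : Submodule ℝ V) (I : Finset (Fin σ.q)) : Submodule ℝ V where
  carrier := {c | c ∈ Z ∧ ∀ i, i ∉ I → σ.P i c = 0}
  add_mem' := by
    rintro a b ⟨h1, h2⟩ ⟨h3, h4⟩
    exact ⟨add_mem h1 h3, fun i hi => by rw [map_add, h2 i hi, h4 i hi, add_zero]⟩
  zero_mem' := ⟨zero_mem _, fun i _ => map_zero _⟩
  smul_mem' := by
    rintro r a ⟨h1, h2⟩
    exact ⟨Z.smul_mem r h1, fun i hi => by rw [map_smul, h2 i hi, smul_zero]⟩

lemma mem_sel {Z : Submodule ℝ V} {I : Finset (Fin σ.q)} {c : V} :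
    c ∈ σ.sel Z I ↔ c ∈ Z ∧ ∀ i, i ∉ I → σ.P i c = 0 := Iff.rfl

lemma finrank_sel {Z : Submodule ℝ V} (hZ : ∀ i, ∀ x ∈ Z, σ.P i x ∈ Z) (I : Finset (Fin σ.q)) :
    Module.finrank ℝ (σ.sel Z I) = ∑ i ∈ I, Module.finrank ℝ (σ.sel Z {i}) := by
  classical
  induction I using Finset.induction_on with
  | empty =>
    have : σ.sel Z ∅ = ⊥ := by
      rw [eq_bot_iff]
      rintro c ⟨-, h⟩
      have := σ.sum_P c
      rw [Finset.sum_eq_zero (fun i _ => h i (Finset.notMem_empty i))] at this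
      exact this.symm
    rw [this]; simp
  | insert j I hj ih =>
    rw [Finset.sum_insert hj, ← ih]
    have hsup : σ.sel Z (insert j I) = σ.sel Z {j} ⊔ σ.sel Z I := by
      apply le_antisymm
      · rintro c ⟨hc, h⟩
        have : c = σ.P j c + (c - σ.P j c) := by abel
        rw [this]
        refine Submodule.add_mem_sup ⟨hZ j c hc, fun i hi => ?_⟩ ⟨sub_mem hc (hZ j c hc), fun i hi => ?_⟩
        · exact σ.P_orth (by simpa using hi) c
        · rw [map_sub]
          by_cases hij : i = j
          · subst hij; rw [P_idem, sub_self]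
          · rw [σ.P_orth hij, h i (by simp [hij, hi]), sub_zero]
      · apply sup_le
        · rintro c ⟨hc, h⟩
          exact ⟨hc, fun i hi => h i (by simp at hi ⊢; exact hi.1)⟩
        · rintro c ⟨hc, h⟩
          exact ⟨hc, fun i hi => h i (by simp at hi; exact hi.2)⟩
    have hinf : σ.sel Z {j} ⊓ σ.sel Z I = ⊥ := by
      rw [eq_bot_iff]
      rintro c ⟨⟨-, h1⟩, ⟨-, h2⟩⟩
      have := σ.sum_P c
      rw [Finset.sum_eq_zero] at this
      · exact this.symm
      · intro i _
        by_cases hij : i = j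
        · subst hij; exact h2 i hj
        · exact h1 i (by simpa using hij)
    have := Submodule.finrank_sup_add_finrank_inf_eq (σ.sel Z {j}) (σ.sel Z I)
    rw [hinf, finrank_bot, add_zero, ← hsup] at this
    exact this

/-- eigenspace of `K²` -/
def eg (ω : ℝ) : Submodule ℝ V where
  carrier := {c | σ.K (σ.K c) = -(ω^2) • c}
  add_mem' := by
    intro a b h1 h2
    simp only [Set.mem_setOf_eq, map_add] at *
    rw [h1, h2, smul_add]
  zero_mem' := by simp
  smul_mem' := by
    intro r a h1
    simp only [Set.mem_setOf_eq, map_smul] at *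
    rw [h1, smul_comm]

lemma mem_eg {ω : ℝ} {c : V} : c ∈ σ.eg ω ↔ σ.K (σ.K c) = -(ω^2) • c := Iff.rfl

lemma KKP (i : Fin σ.q) (c : V) : σ.K (σ.K (σ.P i c)) = -(σ.b i ^ 2) • σ.P i c := by
  have := congrArg (fun L : V →L[ℝ] V => L c) (σ.KK i)
  simpa using this

lemma PK_apply (i : Fin σ.q) (c : V) : σ.P i (σ.K c) = σ.K (σ.P i c) := by
  have := congrArg (fun L : V →L[ℝ] V => L c) (σ.PK i).eq
  simpa using this

lemma PN_apply (i : Fin σ.q) (c : V) : σ.P i (σ.N c) = σ.N (σ.P i c) := by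
  have := congrArg (fun L : V →L[ℝ] V => L c) (σ.PN i).eq
  simpa using this

lemma mem_eg_iff {ω : ℝ} (hω : 0 ≤ ω) {c : V} :
    c ∈ σ.eg ω ↔ ∀ i, σ.b i ≠ ω → σ.P i c = 0 := by
  rw [mem_eg]
  constructor
  · intro h i hi
    have e := congrArg (σ.P i) h
    rw [map_smul, PK_apply, PK_apply, KKP] at e
    have e2 : (ω^2 - σ.b i ^2) • σ.P i c = 0 := by
      rw [sub_smul]; rw [neg_smul, neg_smul, neg_inj] at e; rw [e, sub_self]
    rcases smul_eq_zero.1 e2 with h0 | h0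
    · exfalso
      apply hi
      have : ω^2 = σ.b i^2 := by linarith
      exact ((sq_eq_sq₀ hω (σ.b_nonneg i)).1 this).symm
    · exact h0
  · intro h
    conv_lhs => rw [← σ.sum_P c]
    conv_rhs => rw [← σ.sum_P c]
    rw [map_sum, map_sum, Finset.smul_sum]
    apply Finset.sum_congr rfl
    intro i _
    rw [KKP]
    by_cases hi : σ.b i = ω
    · rw [hi]
    · rw [h i hi, smul_zero, smul_zero]

lemma rot_fixed_iff (T : ℝ) (c : V) :
    fl σ.K T c = c ↔ ∀ i, Real.cos (σ.b i * T) ≠ 1 → σ.P i c = 0 := by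
  have hflP : ∀ i, σ.P i (fl σ.K T c) = fl σ.K T (σ.P i c) := fun i =>
    congrArg (fun L : V →L[ℝ] V => L c) (fl_commute (σ.PK i) T).eq
  have hflP2 : ∀ i, 0 < σ.b i → fl σ.K T (σ.P i c) =
      Real.cos (σ.b i * T) • σ.P i c + (Real.sin (σ.b i * T) / σ.b i) • σ.K (σ.P i c) := fun i hb => by
    have := congrArg (fun L : V →L[ℝ] V => L c) (rot_fl hb (σ.KK i) T)
    simpa using this
  have hflP0 : ∀ i, σ.b i = 0 → fl σ.K T (σ.P i c) = σ.P i c := fun i hb =>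
    congrArg (fun L : V →L[ℝ] V => L c) (rot_fl_zero (σ.K0 i hb) T)
  constructor
  · intro h i hi
    rcases (σ.b_nonneg i).eq_or_lt with hb | hb
    · rw [← hb] at hi; simp at hi
    have e1 := hflP2 i hb
    rw [← hflP, h] at e1
    set v := σ.P i c with hv
    set cs := Real.cos (σ.b i * T)
    set s := Real.sin (σ.b i * T)
    have e2 := congrArg σ.K e1
    rw [map_add, map_smul, map_smul, KKP, ← hv] at e2
    have hcs : s^2 + cs^2 = 1 := Real.sin_sq_add_cos_sq _
    have hbn : σ.b i ≠ 0 := hb.ne'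
    have e3 : ((1-cs)^2 + s^2) • v = 0 := by
      have a1 : (1-cs) • v = (s / σ.b i) • σ.K v := by
        rw [sub_smul, one_smul]; nth_rewrite 1 [e1]; abel
      have a2 : (1-cs) • σ.K v = (s / σ.b i) • (-(σ.b i^2) • v) := by
        rw [sub_smul, one_smul]; nth_rewrite 1 [e2]; abel
      have a3 : ((1-cs)^2) • v = (-(s^2)) • v := by
        rw [pow_two, mul_smul, a1, smul_comm, a2, smul_smul, smul_smul]
        congr 1
        field_simp
      rw [add_smul, a3, neg_smul, neg_add_cancel]
    rcases smul_eq_zero.1 e3 with h0 | h0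
    · exfalso; apply hi
      nlinarith [sq_nonneg (1-cs), sq_nonneg s]
    · exact h0
  · intro h
    conv_lhs => rw [← σ.sum_P c]
    conv_rhs => rw [← σ.sum_P c]
    rw [map_sum]
    apply Finset.sum_congr rfl
    intro i _
    rcases (σ.b_nonneg i).eq_or_lt with hb | hb
    · exact hflP0 i hb.symm
    · by_cases hi : Real.cos (σ.b i * T) = 1
      · have hs : Real.sin (σ.b i * T) = 0 := by
          have := Real.sin_sq_add_cos_sq (σ.b i * T)
          rw [hi] at this
          have h2 : Real.sin (σ.b i * T) ^ 2 = 0 := by linarith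
          exact pow_eq_zero_iff two_ne_zero |>.1 h2
        rw [hflP2 i hb, hi, hs]; simp
      · rw [h i hi, map_zero]

/-- fixed vectors of the rotation in `Z` -/
def fixT (Z : Submodule ℝ V) (T : ℝ) : Submodule ℝ V where
  carrier := {c | c ∈ Z ∧ fl σ.K T c = c}
  add_mem' := by
    rintro a b ⟨h1, h2⟩ ⟨h3, h4⟩
    exact ⟨add_mem h1 h3, by rw [map_add, h2, h4]⟩
  zero_mem' := ⟨zero_mem _, map_zero _⟩
  smul_mem' := by
    rintro r a ⟨h1, h2⟩
    exact ⟨Z.smul_mem r h1, by rw [map_smul, h2]⟩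

lemma finrank_eg {Z : Submodule ℝ V} (hZ : ∀ i, ∀ x ∈ Z, σ.P i x ∈ Z) {ω : ℝ} (hω : 0 ≤ ω) :
    Module.finrank ℝ (Z ⊓ σ.eg ω : Submodule ℝ V) =
      ∑ i with σ.b i = ω, Module.finrank ℝ (σ.sel Z {i}) := by
  have : Z ⊓ σ.eg ω = σ.sel Z ({i | σ.b i = ω} : Finset (Fin σ.q)) := by
    ext c
    rw [Submodule.mem_inf, σ.mem_eg_iff hω, mem_sel]
    simp
  rw [← σ.finrank_sel hZ, this]

lemma finrank_fixT {Z : Submodule ℝ V} (hZ : ∀ i, ∀ x ∈ Z, σ.P i x ∈ Z) (T : ℝ) {F : Finset ℝ}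
    (hF : ∀ i, σ.b i ∈ F) (hF0 : ∀ ν ∈ F, 0 ≤ ν) :
    Module.finrank ℝ (σ.fixT Z T) =
      ∑ ν ∈ F with Real.cos (ν * T) = 1, Module.finrank ℝ (Z ⊓ σ.eg ν : Submodule ℝ V) := by
  have h1 : σ.fixT Z T = σ.sel Z ({i | Real.cos (σ.b i * T) = 1} : Finset (Fin σ.q)) := by
    ext c
    rw [mem_sel]
    show (c ∈ Z ∧ fl σ.K T c = c) ↔ _
    rw [σ.rot_fixed_iff]
    simp
  rw [h1, σ.finrank_sel hZ]
  have h2 : ∀ ν ∈ F.filter (fun ν => Real.cos (ν * T) = 1),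
      Module.finrank ℝ (Z ⊓ σ.eg ν : Submodule ℝ V) = _ := fun ν hν =>
    σ.finrank_eg hZ (hF0 ν (Finset.mem_filter.1 hν).1)
  rw [Finset.sum_congr rfl h2]
  rw [← Finset.sum_fiberwise_of_maps_to (g := σ.b) (t := F.filter (fun ν => Real.cos (ν * T) = 1))]
  · apply Finset.sum_congr rfl
    intro ν hν
    apply Finset.sum_congr _ (fun _ _ => rfl)
    ext i
    simp only [Finset.mem_filter, Finset.mem_univ, true_and]
    constructor
    · rintro ⟨_, h⟩; exact h
    · intro h; exact ⟨by rw [h]; exact (Finset.mem_filter.1 hν).2, h⟩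
  · intro i hi
    simp only [Finset.mem_filter, Finset.mem_univ, true_and] at hi ⊢
    exact ⟨hF i, hi⟩
end Spl

lemma cos_sum_zero {F : Finset ℝ} (hF0 : ∀ ν ∈ F, 0 ≤ ν) (g : ℝ → ℤ)
    (h : ∀ T : ℝ, ∑ ν ∈ F with Real.cos (ν * T) = 1, g ν = 0) : ∀ ν ∈ F, g ν = 0 := by
  have hπ := Real.pi_gt_three
  have hz : 0 ∈ F → g 0 = 0 := by
    intro h0
    set S := ∑ ν ∈ F, ν with hS
    have hS0 : 0 ≤ S := Finset.sum_nonneg hF0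
    have := h (1/(1+S))
    rwa [Finset.sum_eq_single_of_mem 0 (by simp [h0])] at this
    intro ν hν hne
    exfalso
    rw [Finset.mem_filter] at hν
    have hν0 : 0 < ν := lt_of_le_of_ne (hF0 ν hν.1) hne.symm
    have hνS : ν ≤ S := Finset.single_le_sum hF0 hν.1
    have h1 : 0 < ν * (1/(1+S)) := by positivity
    have h2 : ν * (1/(1+S)) ≤ 1 := by rw [mul_one_div, div_le_one (by positivity)]; linarith
    have h3 := (Real.cos_eq_one_iff_of_lt_of_lt (x := ν * (1/(1+S))) (by linarith) (by linarith)).1 hν.2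
    linarith
  by_contra hcon
  push Not at hcon
  obtain ⟨ν0, hν0, hg0⟩ := hcon
  have hne : (F.filter (fun ν => g ν ≠ 0)).Nonempty := ⟨ν0, by simp [hν0, hg0]⟩
  set ω := (F.filter (fun ν => g ν ≠ 0)).max' hne with hω
  have hmem := Finset.max'_mem _ hne
  rw [← hω, Finset.mem_filter] at hmem
  have hω0 : 0 < ω := by
    refine lt_of_le_of_ne (hF0 _ hmem.1) ?_
    intro h0
    rw [← h0] at hmem
    exact hmem.2 (hz hmem.1)
  have := h (2 * Real.pi / ω)
  rw [Finset.sum_eq_single_of_mem ω] at this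
  · exact hmem.2 this
  · rw [Finset.mem_filter]
    refine ⟨hmem.1, ?_⟩
    rw [mul_div_cancel₀ _ hω0.ne', Real.cos_two_pi]
  · intro ν hν hne'
    by_contra hgν
    rw [Finset.mem_filter] at hν
    have hle : ν ≤ ω := Finset.le_max' _ ν (by simp [hν.1, hgν])
    have hlt : ν < ω := lt_of_le_of_ne hle hne'
    have hν0 := hF0 ν hν.1
    have h1 : 0 ≤ ν * (2 * Real.pi / ω) := by positivity
    have h2 : ν * (2 * Real.pi / ω) < 2 * Real.pi := by
      rw [mul_div_assoc', div_lt_iff₀ hω0]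
      nlinarith
    have h3 := (Real.cos_eq_one_iff_of_lt_of_lt (by linarith) h2).1 hν.2
    have h4 : 0 < 2 * Real.pi / ω := by positivity
    have h5 : ν = 0 := by
      rcases mul_eq_zero.1 h3 with h' | h'
      · exact h'
      · linarith
    rw [h5] at hgν hν
    exact hgν (hz hν.1)

lemma count_of_fixT {V V' : Type*} [NormedAddCommGroup V] [NormedSpace ℝ V] [FiniteDimensional ℝ V]
    [CompleteSpace V] {A : V →L[ℝ] V} (σ : Spl A) [NormedAddCommGroup V'] [NormedSpace ℝ V']
    [FiniteDimensional ℝ V'] [CompleteSpace V'] {A' : V' →L[ℝ] V'} (σ' : Spl A')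
    {Z : Submodule ℝ V} {Z' : Submodule ℝ V'} (hZ : ∀ i, ∀ x ∈ Z, σ.P i x ∈ Z)
    (hZ' : ∀ i, ∀ x ∈ Z', σ'.P i x ∈ Z')
    (h : ∀ T, Module.finrank ℝ (σ.fixT Z T) = Module.finrank ℝ (σ'.fixT Z' T)) {ω : ℝ} (hω : 0 ≤ ω) :
    Module.finrank ℝ (Z ⊓ σ.eg ω : Submodule ℝ V) =
      Module.finrank ℝ (Z' ⊓ σ'.eg ω : Submodule ℝ V') := by
  classical
  set F : Finset ℝ := insert ω (Finset.univ.image σ.b ∪ Finset.univ.image σ'.b) with hF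
  have hF0 : ∀ ν ∈ F, 0 ≤ ν := by
    intro ν hν
    simp only [hF, Finset.mem_insert, Finset.mem_union, Finset.mem_image, Finset.mem_univ,
      true_and] at hν
    rcases hν with rfl | ⟨i, rfl⟩ | ⟨i, rfl⟩
    · exact hω
    · exact σ.b_nonneg i
    · exact σ'.b_nonneg i
  have := cos_sum_zero hF0 (fun ν => (Module.finrank ℝ (Z ⊓ σ.eg ν : Submodule ℝ V) : ℤ) -
    Module.finrank ℝ (Z' ⊓ σ'.eg ν : Submodule ℝ V')) (fun T => by
      have e := h T
      rw [σ.finrank_fixT hZ T (F := F) (fun i => by simp [hF]) hF0,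
        σ'.finrank_fixT hZ' T (F := F) (fun i => by simp [hF]) hF0] at e
      rw [Finset.sum_sub_distrib, ← Nat.cast_sum, ← Nat.cast_sum, e, sub_self]) ω (by simp [hF])
  have h2 : (Module.finrank ℝ (Z ⊓ σ.eg ω : Submodule ℝ V) : ℤ) =
    Module.finrank ℝ (Z' ⊓ σ'.eg ω : Submodule ℝ V') := by linarith
  exact_mod_cast h2

section
variable {ι C ι' C' : Type*} [Fintype ι] [NormedAddCommGroup C] [NormedSpace ℝ C]
    [FiniteDimensional ℝ C] [CompleteSpace C] [Fintype ι'] [NormedAddCommGroup C']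
    [NormedSpace ℝ C'] [FiniteDimensional ℝ C'] [CompleteSpace C']
    {M : Mdl ι C} {M' : Mdl ι' C'} {h : ((ι → ℝ) × C) ≃ₜ ((ι' → ℝ) × C')}

lemma finrank_inr (W : Submodule ℝ C) :
    Module.finrank ℝ (W.map (LinearMap.inr ℝ (ι → ℝ) C)) = Module.finrank ℝ W :=
  (Submodule.equivMapOfInjective _ LinearMap.inr_injective W).finrank_eq.symm

lemma mem_inr {W : Submodule ℝ C} {x : (ι → ℝ) × C} :
    x ∈ W.map (LinearMap.inr ℝ (ι → ℝ) C) ↔ x.1 = 0 ∧ x.2 ∈ W := by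
  constructor
  · rintro ⟨w, hw, rfl⟩; exact ⟨rfl, hw⟩
  · rintro ⟨h1, h2⟩; exact ⟨x.2, h2, by ext <;> simp [h1]⟩

lemma Sand.fix_iff {Y W} (S : Sand M Y W) (T : ℝ) (x : (ι → ℝ) × C) :
    x ∈ (M.σ.fixT (LinearMap.ker M.Nl ⊓ W) T).map (LinearMap.inr ℝ (ι → ℝ) C) ↔
      x ∈ Y ∧ x ∈ M.B ∧ M.φ T x = x := by
  rw [mem_inr]
  constructor
  · rintro ⟨h1, ⟨h2, h3⟩, h4⟩
    have hB : x ∈ M.B := ⟨h1, h2⟩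
    refine ⟨S.lowS x h3 fun i _ => by rw [h1]; rfl, hB, ?_⟩
    rw [M.B_φ hB, h4, ← h1]
  · rintro ⟨h1, h2, h3⟩
    refine ⟨h2.1, ⟨h2.2, S.up x h1⟩, ?_⟩
    rw [M.B_φ h2] at h3
    exact congrArg Prod.snd h3

lemma Sand.base (H : OE0 M M' h) (hper : Per M M' h 1) {Y W W'} (S : Sand M Y W)
    (S' : Sand M' (h '' Y) W') {ω : ℝ} (hω : 0 ≤ ω) :
    Module.finrank ℝ ((LinearMap.ker M.Nl ⊓ W) ⊓ M.σ.eg ω : Submodule ℝ C) =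
      Module.finrank ℝ ((LinearMap.ker M'.Nl ⊓ W') ⊓ M'.σ.eg ω : Submodule ℝ C') := by
  refine count_of_fixT M.σ M'.σ ?_ ?_ ?_ hω
  · rintro i x ⟨h1, h2⟩
    refine ⟨?_, S.P i x h2⟩
    show M.σ.N (M.σ.P i x) = 0
    rw [← M.σ.PN_apply, show M.σ.N x = 0 from h1, map_zero]
  · rintro i x ⟨h1, h2⟩
    refine ⟨?_, S'.P i x h2⟩
    show M'.σ.N (M'.σ.P i x) = 0
    rw [← M'.σ.PN_apply, show M'.σ.N x = 0 from h1, map_zero]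
  · intro T
    rw [← finrank_inr (ι := ι) (M.σ.fixT _ T), ← finrank_inr (ι := ι') (M'.σ.fixT _ T)]
    refine (H.ah.finrank_eq fun x => ?_).symm
    rw [S.fix_iff, S'.fix_iff, H.B, h.injective.mem_set_image]
    refine and_congr_right fun _ => and_congr_right fun hB => ?_
    have := hper x hB T
    rw [one_mul] at this
    exact this.symm

lemma OE0.counts (H : OE0 M M' h) (hper : Per M M' h 1) (m : ℕ) :
    ∀ {Y W W'}, Sand M Y W → Sand M' (h '' Y) W' → ∀ {ω : ℝ}, 0 ≤ ω →
    Module.finrank ℝ ((LinearMap.ker M.Nl ⊓ W.map (M.Nl ^ m)) ⊓ M.σ.eg ω : Submodule ℝ C) =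
      Module.finrank ℝ
        ((LinearMap.ker M'.Nl ⊓ W'.map (M'.Nl ^ m)) ⊓ M'.σ.eg ω : Submodule ℝ C') := by
  induction m using Nat.strong_induction_on with
  | _ m ih =>
    intro Y W W' S S' ω hω
    rcases Nat.eq_zero_or_pos m with rfl | hm
    · have := Sand.base H hper S S' hω
      have e1 : W.map (M.Nl ^ 0) = W := by rw [pow_zero]; exact Submodule.map_id W
      have e2 : W'.map (M'.Nl ^ 0) = W' := by rw [pow_zero]; exact Submodule.map_id W'
      rw [e1, e2]; exact this
    · rcases Nat.even_or_odd' m with ⟨j, rfl | rfl⟩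
      · have e := ih j (by omega) S.coreE (by rw [H.coreE]; exact S'.coreE) hω
        rw [Alg.core (N := M.Nl) (δ := 1) (by omega) S.N j (by omega),
          Alg.core (N := M'.Nl) (δ := 1) (by omega) S'.N j (by omega)] at e
        simpa using e
      · have e := ih j (by omega) S.coreC (by rw [H.coreC]; exact S'.coreC) hω
        rw [Alg.core (N := M.Nl) (δ := 0) (by omega) S.N j (by omega),
          Alg.core (N := M'.Nl) (δ := 0) (by omega) S'.N j (by omega)] at e
        simpa using e

lemma OE0.counts_univ (H : OE0 M M' h) (hper : Per M M' h 1) (m : ℕ) {ω : ℝ} (hω : 0 ≤ ω) :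
    Module.finrank ℝ ((LinearMap.ker M.Nl ⊓ LinearMap.range (M.Nl ^ m)) ⊓ M.σ.eg ω : Submodule ℝ C) =
      Module.finrank ℝ ((LinearMap.ker M'.Nl ⊓ LinearMap.range (M'.Nl ^ m)) ⊓ M'.σ.eg ω :
        Submodule ℝ C') := by
  have := H.counts hper m (sand_univ (M := M)) (by rw [Set.image_univ_of_surjective h.surjective]; exact sand_univ) hω
  rw [LinearMap.range_eq_map, LinearMap.range_eq_map]
  exact this
end
end

section
set_option linter.unusedSectionVars false
set_option linter.deprecated false
set_option linter.unusedVariables false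

section
universe u v
variable {F : Type v} [Field F]

/-- restriction of an endomorphism to its range -/
def rgr {V : Type u} [AddCommGroup V] [Module F V] (N : Module.End F V) :
    Module.End F (LinearMap.range N) :=
  LinearMap.restrict N (fun x _ => ⟨x, rfl⟩)

lemma rgr_coe {V : Type u} [AddCommGroup V] [Module F V] (N : Module.End F V)
    (x : LinearMap.range N) : ((rgr N x : LinearMap.range N) : V) = N x := rfl

lemma rgr_pow {V : Type u} [AddCommGroup V] [Module F V] (N : Module.End F V) (m : ℕ)
    (x : LinearMap.range N) : (((rgr N ^ m) x : LinearMap.range N) : V) = (N ^ m) x := by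
  induction m with
  | zero => simp
  | succ m ih => rw [pow_succ', pow_succ', Module.End.mul_apply, Module.End.mul_apply, rgr_coe, ih]

lemma rgr_count {V : Type u} [AddCommGroup V] [Module F V] (N : Module.End F V) (m : ℕ) :
    Module.finrank F (LinearMap.ker (rgr N) ⊓ LinearMap.range (rgr N ^ m) :
      Submodule F (LinearMap.range N)) =
    Module.finrank F (LinearMap.ker N ⊓ LinearMap.range (N ^ (m+1)) : Submodule F V) := by
  have e : (LinearMap.ker (rgr N) ⊓ LinearMap.range (rgr N ^ m)).map (LinearMap.range N).subtype =
      LinearMap.ker N ⊓ LinearMap.range (N ^ (m+1)) := by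
    ext x
    constructor
    · rintro ⟨y, ⟨h1, ⟨⟨z, w, hw⟩, hz⟩⟩, rfl⟩
      refine ⟨?_, w, ?_⟩
      · have := congrArg Subtype.val (LinearMap.mem_ker.1 h1)
        exact this
      · have := congrArg Subtype.val hz
        rw [rgr_pow] at this
        rw [pow_succ, Module.End.mul_apply, hw]
        exact this
    · rintro ⟨h1, w, hw⟩
      rw [pow_succ, Module.End.mul_apply] at hw
      have hx : ((rgr N ^ m) ⟨N w, w, rfl⟩ : V) = x := by rw [rgr_pow]; exact hw
      refine ⟨(rgr N ^ m) ⟨N w, w, rfl⟩, ⟨?_, _, rfl⟩, hx⟩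
      rw [SetLike.mem_coe, LinearMap.mem_ker]
      apply Subtype.ext
      rw [rgr_coe, hx]; exact h1
  rw [← e]
  exact (Submodule.equivMapOfInjective _ (Submodule.injective_subtype _) _).finrank_eq

lemma nil_conj (p : ℕ) : ∀ (V V' : Type u) [AddCommGroup V] [Module F V] [FiniteDimensional F V]
    [AddCommGroup V'] [Module F V'] [FiniteDimensional F V'] (N : Module.End F V)
    (N' : Module.End F V'), N ^ p = 0 → N' ^ p = 0 →
    (∀ m, Module.finrank F (LinearMap.ker N ⊓ LinearMap.range (N ^ m) : Submodule F V) =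
      Module.finrank F (LinearMap.ker N' ⊓ LinearMap.range (N' ^ m) : Submodule F V')) →
    ∃ Q : V ≃ₗ[F] V', ∀ x, Q (N x) = N' (Q x) := by
  induction p with
  | zero =>
    intro V V' _ _ _ _ _ _ N N' hN hN' _
    rw [pow_zero] at hN hN'
    have h1 : ∀ x : V, x = 0 := fun x => by
      have := congrArg (fun L : Module.End F V => L x) hN; simpa using this
    have h2 : ∀ x : V', x = 0 := fun x => by
      have := congrArg (fun L : Module.End F V' => L x) hN'; simpa using this
    haveI : Subsingleton V := ⟨fun x y => by rw [h1 x, h1 y]⟩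
    haveI : Subsingleton V' := ⟨fun x y => by rw [h2 x, h2 y]⟩
    exact ⟨0, fun x => Subsingleton.elim _ _⟩
  | succ p ih =>
    intro V V' _ _ _ _ _ _ N N' hN hN' hc
    have nil : ∀ {W : Type u} [AddCommGroup W] [Module F W] (L : Module.End F W), L ^ (p+1) = 0 →
        rgr L ^ p = 0 := by
      intro W _ _ L hL
      ext ⟨x, w, rfl⟩
      rw [rgr_pow]
      have := congrArg (fun L : Module.End F W => L w) hL
      simpa [pow_succ] using this
    let A : Submodule F V := LinearMap.range N
    let A' : Submodule F V' := LinearMap.range N'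
    obtain ⟨Q0, hQ0⟩ := ih A A' (rgr N) (rgr N') (nil N hN) (nil N' hN')
      (fun m => by rw [rgr_count, rgr_count]; exact hc (m+1))
    obtain ⟨s, hs⟩ := LinearMap.exists_rightInverse_of_surjective N'.rangeRestrict
      (LinearMap.range_rangeRestrict N')
    have hs' : ∀ y : LinearMap.range N', N' (s y) = y := fun y => by
      have := congrArg (fun L => ((L y : LinearMap.range N') : V')) hs
      simpa using this
    let f : V →ₗ[F] V' := s ∘ₗ Q0.toLinearMap ∘ₗ N.rangeRestrict
    have hf : ∀ x, N' (f x) = Q0 ⟨N x, x, rfl⟩ := fun x => hs' _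
    let g0 : A →ₗ[F] LinearMap.ker N' := LinearMap.codRestrict _ (A'.subtype ∘ₗ Q0.toLinearMap - f ∘ₗ A.subtype)
      (by
        intro x
        rw [LinearMap.mem_ker]
        simp only [LinearMap.sub_apply, LinearMap.comp_apply, map_sub, Submodule.subtype_apply,
          LinearEquiv.coe_coe]
        rw [hf]
        have := congrArg Subtype.val (hQ0 x)
        rw [rgr_coe] at this
        rw [← this, sub_eq_zero]; rfl)
    obtain ⟨g, hg⟩ := LinearMap.exists_extend g0
    let Q1 : V →ₗ[F] V' := f + (LinearMap.ker N').subtype ∘ₗ g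
    have hQ1N : ∀ x, N' (Q1 x) = Q0 ⟨N x, x, rfl⟩ := fun x => by
      show N' (f x + (g x : V')) = _
      rw [map_add, hf, show N' (g x : V') = 0 from (g x).2, add_zero]
    have hQ1A : ∀ x : A, Q1 x = Q0 x := fun x => by
      have := congrArg (fun L => ((L x : LinearMap.ker N') : V')) hg
      have h2 : ((g x : LinearMap.ker N') : V') = (Q0 x : V') - f x := this
      show f x + (g x : V') = _
      rw [h2]; abel
    obtain ⟨D, hD1, hD2⟩ := IsModularLattice.exists_disjoint_and_sup_eq
      (inf_le_left : LinearMap.ker N ⊓ A ≤ LinearMap.ker N)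
    obtain ⟨D', hD1', hD2'⟩ := IsModularLattice.exists_disjoint_and_sup_eq
      (inf_le_left : LinearMap.ker N' ⊓ A' ≤ LinearMap.ker N')
    have hk : Module.finrank F (LinearMap.ker N) = Module.finrank F (LinearMap.ker N') := by
      have := hc 0
      rw [pow_zero, pow_zero] at this
      have e1 : LinearMap.range (1 : Module.End F V) = ⊤ := LinearMap.range_id
      have e2 : LinearMap.range (1 : Module.End F V') = ⊤ := LinearMap.range_id
      rwa [e1, e2, inf_top_eq, inf_top_eq] at this
    have hk1 : Module.finrank F (LinearMap.ker N ⊓ A : Submodule F V) =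
        Module.finrank F (LinearMap.ker N' ⊓ A' : Submodule F V') := by
      have := hc 1
      rwa [pow_one, pow_one] at this
    have hD : Module.finrank F D = Module.finrank F D' := by
      have e1 := Submodule.finrank_sup_add_finrank_inf_eq (LinearMap.ker N ⊓ A) D
      have e2 := Submodule.finrank_sup_add_finrank_inf_eq (LinearMap.ker N' ⊓ A') D'
      rw [hD1.eq_bot, hD2, finrank_bot] at e1
      rw [hD1'.eq_bot, hD2', finrank_bot] at e2
      omega
    have hDk : D ≤ LinearMap.ker N := hD2 ▸ le_sup_right
    have hDk' : D' ≤ LinearMap.ker N' := hD2' ▸ le_sup_right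
    have hAD : Disjoint A D := by
      rw [Submodule.disjoint_def] at hD1 ⊢
      exact fun x h1 h2 => hD1 x ⟨hDk h2, h1⟩ h2
    have hAD' : Disjoint A' D' := by
      rw [Submodule.disjoint_def] at hD1' ⊢
      exact fun x h1 h2 => hD1' x ⟨hDk' h2, h1⟩ h2
    let r : D ≃ₗ[F] D' := LinearEquiv.ofFinrankEq _ _ hD
    obtain ⟨E, hE1, hE2⟩ := hAD.exists_isCompl
    let π := Submodule.projectionOnto D E hE2.symm
    have hπD : ∀ x : D, π x = x := fun x => Submodule.projectionOnto_apply_left _ x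
    have hπA : ∀ x : A, π x = 0 := fun x =>
      (Submodule.projectionOnto_apply_eq_zero_iff _).2 (hE1 x.2)
    let Q : V →ₗ[F] V' := Q1 + (D'.subtype ∘ₗ r.toLinearMap - Q1 ∘ₗ D.subtype) ∘ₗ π
    have hQ : ∀ x, Q x = Q1 x + ((r (π x) : V') - Q1 (π x)) := fun x => rfl
    have hQN : ∀ x, Q (N x) = N' (Q x) := by
      intro x
      have e1 := hπA ⟨N x, x, rfl⟩
      have e2 := hQ1A ⟨N x, x, rfl⟩
      simp only at e1 e2
      rw [hQ, hQ, e1, e2]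
      rw [map_add, map_sub, hQ1N, hQ1N, show N' (r (π x) : V') = 0 from hDk' (r (π x)).2]
      have e3 : (⟨N (π x), _, rfl⟩ : A) = 0 := Subtype.ext (hDk (π x).2)
      rw [e3]
      simp
    have hinj : Function.Injective Q := by
      rw [← LinearMap.ker_eq_bot, LinearMap.ker_eq_bot']
      intro x hx
      have e1 : N x = 0 := by
        have e := hQN x
        rw [hx, map_zero, hQ] at e
        have e1 := hπA ⟨N x, x, rfl⟩
        have e2 := hQ1A ⟨N x, x, rfl⟩
        simp only at e1 e2
        rw [e1, e2] at e
        simp at e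
        exact congrArg Subtype.val e
      have hxk : x ∈ LinearMap.ker N := e1
      rw [← hD2, Submodule.mem_sup] at hxk
      obtain ⟨a, ha, y, hy, rfl⟩ := hxk
      have e2 : Q a = Q0 ⟨a, ha.2⟩ := by
        have e1 := hπA ⟨a, ha.2⟩
        simp only at e1
        rw [hQ, e1, ← hQ1A]; simp
      have e3 : Q y = r ⟨y, hy⟩ := by
        have e1 := hπD ⟨y, hy⟩
        simp only at e1
        rw [hQ, e1]; simp
      rw [map_add, e2, e3] at hx
      have h4 : ((r ⟨y, hy⟩ : D') : V') = 0 := by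
        rw [Submodule.disjoint_def] at hAD'
        refine hAD' _ ?_ (r ⟨y, hy⟩).2
        rw [← neg_eq_of_add_eq_zero_right hx]
        exact neg_mem (Q0 _).2
      rw [h4, add_zero] at hx
      have h5 : (⟨y, hy⟩ : D) = 0 := by
        rw [← map_eq_zero_iff r r.injective]; exact Subtype.ext h4
      have h6 : (⟨a, ha.2⟩ : A) = 0 := by
        rw [← map_eq_zero_iff Q0 Q0.injective]; exact Subtype.ext hx
      rw [show a = 0 from congrArg Subtype.val h6, show y = 0 from congrArg Subtype.val h5, add_zero]
    have hdim : Module.finrank F V = Module.finrank F V' := by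
      rw [← LinearMap.finrank_range_add_finrank_ker N, ← LinearMap.finrank_range_add_finrank_ker N', hk,
        Q0.finrank_eq]
    exact ⟨LinearEquiv.ofInjectiveOfFinrankEq Q hinj hdim, hQN⟩
end
end

section
set_option linter.unusedSectionVars false
set_option linter.deprecated false
set_option linter.unusedVariables false

section
universe u

lemma KN_conj_complex (W W' : Type u) [AddCommGroup W] [Module ℝ W] [FiniteDimensional ℝ W]
    [Module ℂ W] [IsScalarTower ℝ ℂ W]
    [AddCommGroup W'] [Module ℝ W'] [FiniteDimensional ℝ W'] [Module ℂ W'] [IsScalarTower ℝ ℂ W']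
    (N : Module.End ℝ W) (N' : Module.End ℝ W') (hI : ∀ (z : ℂ) x, N (z • x) = z • N x)
    (hI' : ∀ (z : ℂ) x, N' (z • x) = z • N' x) (p : ℕ) (hN : N ^ p = 0) (hN' : N' ^ p = 0)
    (hc : ∀ m, Module.finrank ℝ (LinearMap.ker N ⊓ LinearMap.range (N ^ m) : Submodule ℝ W) =
      Module.finrank ℝ (LinearMap.ker N' ⊓ LinearMap.range (N' ^ m) : Submodule ℝ W')) :
    ∃ Q : W ≃ₗ[ℂ] W', ∀ x, Q (N x) = N' (Q x) := by
  haveI : FiniteDimensional ℂ W := Module.Finite.of_restrictScalars_finite ℝ ℂ W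
  haveI : FiniteDimensional ℂ W' := Module.Finite.of_restrictScalars_finite ℝ ℂ W'
  have key : ∀ (U : Type u) [AddCommGroup U] [Module ℝ U] [FiniteDimensional ℝ U] [Module ℂ U]
      [IsScalarTower ℝ ℂ U] (L : Module.End ℝ U) (hL : ∀ (z : ℂ) x, L (z • x) = z • L x),
      ∃ LC : Module.End ℂ U, (∀ x, LC x = L x) ∧ (∀ m x, (LC ^ m) x = (L ^ m) x) ∧
      ∀ m, Module.finrank ℝ (LinearMap.ker L ⊓ LinearMap.range (L ^ m) : Submodule ℝ U) =
        2 * Module.finrank ℂ (LinearMap.ker LC ⊓ LinearMap.range (LC ^ m) : Submodule ℂ U) := by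
    intro U _ _ _ _ _ L hL
    let LC : Module.End ℂ U := { toFun := L, map_add' := map_add L, map_smul' := hL }
    have h1 : ∀ x, LC x = L x := fun x => rfl
    have h2 : ∀ m x, (LC ^ m) x = (L ^ m) x := by
      intro m
      induction m with
      | zero => intro x; simp
      | succ m ih => intro x; rw [pow_succ', pow_succ', Module.End.mul_apply, Module.End.mul_apply, h1, ih]
    refine ⟨LC, h1, h2, fun m => ?_⟩
    have h3 : LinearMap.ker L ⊓ LinearMap.range (L ^ m) =
        (LinearMap.ker LC ⊓ LinearMap.range (LC ^ m)).restrictScalars ℝ := by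
      ext x
      rw [Submodule.restrictScalars_mem, Submodule.mem_inf, Submodule.mem_inf, LinearMap.mem_ker,
        LinearMap.mem_ker, LinearMap.mem_range, LinearMap.mem_range]
      simp only [h1, h2]
    rw [h3, ← Complex.finrank_real_complex]
    exact (Module.finrank_mul_finrank ℝ ℂ
      (LinearMap.ker LC ⊓ LinearMap.range (LC ^ m) : Submodule ℂ U)).symm
  obtain ⟨NC, a1, a2, a3⟩ := key W N hI
  obtain ⟨NC', b1, b2, b3⟩ := key W' N' hI'
  obtain ⟨Q, hQ⟩ := nil_conj p W W' NC NC' (by ext x; rw [a2, hN]; rfl) (by ext x; rw [b2, hN']; rfl)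
    (fun m => by have := hc m; rw [a3, b3] at this; omega)
  exact ⟨Q, fun x => by rw [← a1, hQ, b1]⟩

lemma exists_complex (W : Type u) [AddCommGroup W] [Module ℝ W] (J : Module.End ℝ W)
    (hJ : J * J = -1) : ∃ i : Module ℂ W, IsScalarTower ℝ ℂ W ∧
      ∀ (z : ℂ) (x : W), z • x = z.re • x + z.im • J x := by
  let g := Complex.liftAux J hJ
  letI : Module ℂ W := Module.compHom W g.toRingHom
  have h : ∀ (z : ℂ) (x : W), z • x = z.re • x + z.im • J x := by
    intro z x
    show g z x = _
    rw [Complex.liftAux_apply]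
    simp [Algebra.algebraMap_eq_smul_one]
  refine ⟨inferInstance, ⟨fun r z x => ?_⟩, h⟩
  rw [h, h]
  simp [smul_add, mul_smul]

lemma KN_conj (W W' : Type u) [AddCommGroup W] [Module ℝ W] [FiniteDimensional ℝ W]
    [AddCommGroup W'] [Module ℝ W'] [FiniteDimensional ℝ W']
    (K N : Module.End ℝ W) (K' N' : Module.End ℝ W') (hKN : ∀ x, K (N x) = N (K x))
    (hKN' : ∀ x, K' (N' x) = N' (K' x)) {ω : ℝ} (hK : ∀ x, K (K x) = -(ω^2) • x)
    (hK' : ∀ x, K' (K' x) = -(ω^2) • x) (hK0 : ω = 0 → K = 0) (hK0' : ω = 0 → K' = 0)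
    (p : ℕ) (hN : N ^ p = 0) (hN' : N' ^ p = 0)
    (hc : ∀ m, Module.finrank ℝ (LinearMap.ker N ⊓ LinearMap.range (N ^ m) : Submodule ℝ W) =
      Module.finrank ℝ (LinearMap.ker N' ⊓ LinearMap.range (N' ^ m) : Submodule ℝ W')) :
    ∃ Q : W ≃ₗ[ℝ] W', (∀ x, Q (N x) = N' (Q x)) ∧ ∀ x, Q (K x) = K' (Q x) := by
  by_cases hω : ω = 0
  · obtain ⟨Q, hQ⟩ := nil_conj p W W' N N' hN hN' hc
    exact ⟨Q, hQ, fun x => by rw [hK0 hω, hK0' hω]; simp⟩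
  · have e : ω⁻¹ * ω⁻¹ * ω^2 = 1 := by field_simp
    obtain ⟨i1, i2, i3⟩ := exists_complex W (ω⁻¹ • K) (by
      ext x; simp [hK, smul_smul]; rw [e, one_smul])
    obtain ⟨j1, j2, j3⟩ := exists_complex W' (ω⁻¹ • K') (by
      ext x; simp [hK', smul_smul]; rw [e, one_smul])
    obtain ⟨Q, hQ⟩ := KN_conj_complex W W' N N' (fun z x => by rw [i3, i3]; simp [hKN])
      (fun z x => by rw [j3, j3]; simp [hKN']) p hN hN' hc
    refine ⟨Q.restrictScalars ℝ, hQ, fun x => ?_⟩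
    have e1 : K x = (ω : ℂ) • Complex.I • x := by
      rw [i3, i3]; simp [hω]
    have e2 : K' (Q x) = (ω : ℂ) • Complex.I • Q x := by
      rw [j3, j3]; simp [hω]
    show Q (K x) = K' (Q x)
    rw [e1, e2, map_smul, map_smul]
end
end

section
set_option linter.unusedSectionVars false
set_option linter.deprecated false
set_option linter.unusedVariables false

namespace Spl
variable {V : Type*} [NormedAddCommGroup V] [NormedSpace ℝ V] [FiniteDimensional ℝ V]
  [CompleteSpace V] {A : V →L[ℝ] V} (σ : Spl A)
  {V' : Type*} [NormedAddCommGroup V'] [NormedSpace ℝ V'] [FiniteDimensional ℝ V']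
  [CompleteSpace V'] {A' : V' →L[ℝ] V'} (σ' : Spl A')

lemma P_mem_eg (i : Fin σ.q) (c : V) : σ.P i c ∈ σ.eg (σ.b i) := σ.KKP i c

lemma KN_apply (c : V) : σ.K (σ.N c) = σ.N (σ.K c) :=
  congrArg (fun L : V →L[ℝ] V => L c) σ.KN.eq

lemma eg_K {ω : ℝ} {c : V} (h : c ∈ σ.eg ω) : σ.K c ∈ σ.eg ω := by
  rw [mem_eg] at *; rw [h, map_smul]

lemma eg_N {ω : ℝ} {c : V} (h : c ∈ σ.eg ω) : σ.N c ∈ σ.eg ω := by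
  rw [mem_eg] at *; rw [KN_apply, KN_apply, h, map_smul]

lemma ext_eg {W : Type*} [AddCommGroup W] [Module ℝ W] {f g : V →ₗ[ℝ] W}
    (h : ∀ ω, 0 ≤ ω → ∀ c ∈ σ.eg ω, f c = g c) (c : V) : f c = g c := by
  rw [← σ.sum_P c, map_sum, map_sum]
  exact Finset.sum_congr rfl fun i _ => h _ (σ.b_nonneg i) _ (σ.P_mem_eg i c)

lemma glue (Q : ∀ ω : ℝ, σ.eg ω →ₗ[ℝ] σ'.eg ω) :
    ∃ L : V →ₗ[ℝ] V', ∀ ω, 0 ≤ ω → ∀ c (hc : c ∈ σ.eg ω), L c = Q ω ⟨c, hc⟩ := by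
  let L : V →ₗ[ℝ] V' := ∑ i, (σ'.eg (σ.b i)).subtype ∘ₗ Q (σ.b i) ∘ₗ
    LinearMap.codRestrict (σ.eg (σ.b i)) (σ.P i : V →ₗ[ℝ] V) (σ.P_mem_eg i)
  have hL : ∀ c, L c = ∑ i, (Q (σ.b i) ⟨σ.P i c, σ.P_mem_eg i c⟩ : V') := by
    intro c
    simp only [L, LinearMap.sum_apply]
    rfl
  refine ⟨L, fun ω hω c hc => ?_⟩
  have hm : ∀ i, σ.P i c ∈ σ.eg ω := by
    intro i
    by_cases hi : σ.b i = ω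
    · rw [← hi]; exact σ.P_mem_eg i c
    · rw [(σ.mem_eg_iff hω).1 hc i hi]; exact zero_mem _
  have hterm : ∀ i, (Q (σ.b i) ⟨σ.P i c, σ.P_mem_eg i c⟩ : V') = Q ω ⟨σ.P i c, hm i⟩ := by
    intro i
    by_cases hi : σ.b i = ω
    · subst hi; rfl
    · have h0 := (σ.mem_eg_iff hω).1 hc i hi
      have e1 : (⟨σ.P i c, σ.P_mem_eg i c⟩ : σ.eg (σ.b i)) = 0 := Subtype.ext h0
      have e2 : (⟨σ.P i c, hm i⟩ : σ.eg ω) = 0 := Subtype.ext h0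
      rw [e1, e2]; simp
  rw [hL, Finset.sum_congr rfl fun i _ => hterm i, ← Submodule.coe_sum, ← map_sum]
  congr 2
  apply Subtype.ext
  rw [Submodule.coe_sum]
  exact σ.sum_P c

lemma eg_count (N : Module.End ℝ V) (hN : ∀ x, N x = σ.N x) {ω : ℝ} (hω : 0 ≤ ω)
    (L : Module.End ℝ (σ.eg ω)) (hL : ∀ x, (L x : V) = N x) (m : ℕ) :
    (∀ x, ((L ^ m) x : V) = (N ^ m) x) ∧
    Module.finrank ℝ (LinearMap.ker L ⊓ LinearMap.range (L ^ m) : Submodule ℝ (σ.eg ω)) =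
    Module.finrank ℝ ((LinearMap.ker N ⊓ LinearMap.range (N ^ m)) ⊓ σ.eg ω : Submodule ℝ V) := by
  have hpow : ∀ x, ((L ^ m) x : V) = (N ^ m) x := by
    induction m with
    | zero => intro x; simp
    | succ m ih =>
      intro x; rw [pow_succ', pow_succ', Module.End.mul_apply, Module.End.mul_apply, hL, ih]
  have hP : ∀ i x, σ.P i ((N ^ m) x) = (N ^ m) (σ.P i x) := by
    intro i
    clear hpow
    induction m with
    | zero => intro x; simp
    | succ m ih =>
      intro x
      rw [pow_succ', Module.End.mul_apply, Module.End.mul_apply, hN, hN, PN_apply, ih]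
  refine ⟨hpow, ?_⟩
  have e : (LinearMap.ker L ⊓ LinearMap.range (L ^ m)).map (σ.eg ω).subtype =
      (LinearMap.ker N ⊓ LinearMap.range (N ^ m)) ⊓ σ.eg ω := by
    ext x
    constructor
    · rintro ⟨y, ⟨h1, z, hz⟩, rfl⟩
      refine ⟨⟨?_, z, ?_⟩, y.2⟩
      · rw [SetLike.mem_coe, LinearMap.mem_ker] at *
        rw [Submodule.subtype_apply, ← hL, h1]; rfl
      · rw [← hpow, hz]; rfl
    · rintro ⟨⟨h1, w, hw⟩, h3⟩
      have hmem : ∑ i with σ.b i = ω, σ.P i w ∈ σ.eg ω :=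
        sum_mem fun i hi => by
          rw [← (Finset.mem_filter.1 hi).2]; exact σ.P_mem_eg i w
      refine ⟨⟨x, h3⟩, ⟨?_, ⟨_, hmem⟩, ?_⟩, rfl⟩
      · rw [SetLike.mem_coe, LinearMap.mem_ker] at *
        apply Subtype.ext
        rw [hL]; exact h1
      · apply Subtype.ext
        rw [hpow]
        show (N ^ m) (∑ i with σ.b i = ω, σ.P i w) = x
        rw [map_sum, ← σ.sum_P x, Finset.sum_filter]
        apply Finset.sum_congr rfl
        intro i _
        split_ifs with hi
        · rw [← hP, hw]
        · exact ((σ.mem_eg_iff hω).1 h3 i hi).symm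
  rw [← e]
  exact (Submodule.equivMapOfInjective _ (Submodule.injective_subtype _) _).finrank_eq
end Spl

section
universe u
variable {ι ι' : Type*} {C C' : Type u} [Fintype ι] [NormedAddCommGroup C] [NormedSpace ℝ C]
    [FiniteDimensional ℝ C] [CompleteSpace C] [Fintype ι'] [NormedAddCommGroup C']
    [NormedSpace ℝ C'] [FiniteDimensional ℝ C'] [CompleteSpace C']
    {M : Mdl ι C} {M' : Mdl ι' C'} {h : ((ι → ℝ) × C) ≃ₜ ((ι' → ℝ) × C')}

lemma Spl.eg_zero {V : Type*} [NormedAddCommGroup V] [NormedSpace ℝ V] [FiniteDimensional ℝ V]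
    [CompleteSpace V] {A : V →L[ℝ] V} (σ : Spl A) {c : V} (hc : c ∈ σ.eg 0) : σ.K c = 0 := by
  rw [← σ.sum_P c, map_sum]
  apply Finset.sum_eq_zero
  intro i _
  by_cases hi : σ.b i = 0
  · exact congrArg (fun L : V →L[ℝ] V => L c) (σ.K0 i hi)
  · rw [(σ.mem_eg_iff le_rfl).1 hc i hi, map_zero]

lemma OE0.eg_conj (H : OE0 M M' h) (hper : Per M M' h 1) {ω : ℝ} (hω : 0 ≤ ω) :
    ∃ Q : M.σ.eg ω ≃ₗ[ℝ] M'.σ.eg ω,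
      (∀ x (hx : x ∈ M.σ.eg ω), (Q ⟨M.σ.N x, M.σ.eg_N hx⟩ : C') = M'.σ.N (Q ⟨x, hx⟩)) ∧
      (∀ x (hx : x ∈ M.σ.eg ω), (Q ⟨M.σ.K x, M.σ.eg_K hx⟩ : C') = M'.σ.K (Q ⟨x, hx⟩)) := by
  let K : Module.End ℝ (M.σ.eg ω) := LinearMap.restrict M.Kl fun x hx => M.σ.eg_K hx
  let N : Module.End ℝ (M.σ.eg ω) := LinearMap.restrict M.Nl fun x hx => M.σ.eg_N hx
  let K' : Module.End ℝ (M'.σ.eg ω) := LinearMap.restrict M'.Kl fun x hx => M'.σ.eg_K hx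
  let N' : Module.End ℝ (M'.σ.eg ω) := LinearMap.restrict M'.Nl fun x hx => M'.σ.eg_N hx
  have c1 := fun m => M.σ.eg_count M.Nl (fun _ => rfl) hω N (fun _ => rfl) m
  have c2 := fun m => M'.σ.eg_count M'.Nl (fun _ => rfl) hω N' (fun _ => rfl) m
  obtain ⟨p1, hp1⟩ := M.Nl_nilp
  obtain ⟨p2, hp2⟩ := M'.Nl_nilp
  obtain ⟨Q, hQ1, hQ2⟩ := KN_conj (M.σ.eg ω) (M'.σ.eg ω) K N K' N' (ω := ω)
    (fun x => Subtype.ext (M.σ.KN_apply x)) (fun x => Subtype.ext (M'.σ.KN_apply x))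
    (fun x => Subtype.ext x.2) (fun x => Subtype.ext x.2)
    (by rintro rfl; ext x; exact M.σ.eg_zero x.2) (by rintro rfl; ext x; exact M'.σ.eg_zero x.2)
    (p1 + p2)
    (by ext x; rw [(c1 _).1, pow_add, hp1, zero_mul]; rfl)
    (by ext x; rw [(c2 _).1, pow_add, hp2, mul_zero]; rfl)
    (fun m => by rw [(c1 m).2, (c2 m).2]; exact H.counts_univ hper m hω)
  exact ⟨Q, fun x hx => congrArg Subtype.val (hQ1 ⟨x, hx⟩), fun x hx => congrArg Subtype.val (hQ2 ⟨x, hx⟩)⟩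

theorem OE0.central (H : OE0 M M' h) (hper : Per M M' h 1) :
    ∃ Q : C ≃ₗ[ℝ] C', ∀ x, Q (M.Ac x) = M'.Ac (Q x) := by
  have hall : ∀ ω : ℝ, ∃ (Q : M.σ.eg ω →ₗ[ℝ] M'.σ.eg ω) (R : M'.σ.eg ω →ₗ[ℝ] M.σ.eg ω),
      0 ≤ ω → (∀ x, R (Q x) = x) ∧ (∀ x, Q (R x) = x) ∧
      (∀ x (hx : x ∈ M.σ.eg ω), (Q ⟨M.σ.N x, M.σ.eg_N hx⟩ : C') = M'.σ.N (Q ⟨x, hx⟩)) ∧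
      (∀ x (hx : x ∈ M.σ.eg ω), (Q ⟨M.σ.K x, M.σ.eg_K hx⟩ : C') = M'.σ.K (Q ⟨x, hx⟩)) := by
    intro ω
    by_cases hω : 0 ≤ ω
    · obtain ⟨Q, h1, h2⟩ := H.eg_conj hper hω
      exact ⟨Q.toLinearMap, Q.symm.toLinearMap, fun _ => ⟨Q.symm_apply_apply, Q.apply_symm_apply, h1, h2⟩⟩
    · exact ⟨0, 0, fun h => absurd h hω⟩
  choose Q R hQR using hall
  obtain ⟨L, hL⟩ := M.σ.glue M'.σ Q
  obtain ⟨L', hL'⟩ := M'.σ.glue M.σ R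
  have e1 : ∀ c, L' (L c) = c := M.σ.ext_eg (f := L' ∘ₗ L) (g := LinearMap.id) (fun ω hω c hc => by
    show L' (L c) = c
    rw [hL ω hω c hc, hL' ω hω _ (Q ω ⟨c, hc⟩).2]
    exact congrArg Subtype.val ((hQR ω hω).1 ⟨c, hc⟩))
  have e2 : ∀ c, L (L' c) = c := M'.σ.ext_eg (f := L ∘ₗ L') (g := LinearMap.id) (fun ω hω c hc => by
    show L (L' c) = c
    rw [hL' ω hω c hc, hL ω hω _ (R ω ⟨c, hc⟩).2]
    exact congrArg Subtype.val ((hQR ω hω).2.1 ⟨c, hc⟩))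
  have eN : ∀ c, L (M.σ.N c) = M'.σ.N (L c) :=
    M.σ.ext_eg (f := L ∘ₗ M.Nl) (g := M'.Nl ∘ₗ L) (fun ω hω c hc => by
      show L (M.σ.N c) = M'.σ.N (L c)
      rw [hL ω hω c hc, hL ω hω _ (M.σ.eg_N hc)]
      exact (hQR ω hω).2.2.1 c hc)
  have eK : ∀ c, L (M.σ.K c) = M'.σ.K (L c) :=
    M.σ.ext_eg (f := L ∘ₗ M.Kl) (g := M'.Kl ∘ₗ L) (fun ω hω c hc => by
      show L (M.σ.K c) = M'.σ.K (L c)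
      rw [hL ω hω c hc, hL ω hω _ (M.σ.eg_K hc)]
      exact (hQR ω hω).2.2.2 c hc)
  refine ⟨LinearEquiv.ofLinear L L' (LinearMap.ext e2) (LinearMap.ext e1), fun x => ?_⟩
  show L (M.Ac x) = M'.Ac (L x)
  have z1 : M.Ac x = M.σ.K x + M.σ.N x := congrArg (fun T : C →L[ℝ] C => T x) M.hz
  have z2 : M'.Ac (L x) = M'.σ.K (L x) + M'.σ.N (L x) :=
    congrArg (fun T : C' →L[ℝ] C' => T (L x)) M'.hz
  rw [z1, z2, map_add, eN, eK]
end
end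

section
set_option linter.unusedSectionVars false
set_option linter.deprecated false
set_option linter.unusedVariables false

lemma card_strict {ι ι' : Type*} [Fintype ι] [Fintype ι'] {l : ι → ℝ} {l' : ι' → ℝ}
    (h : ∀ s < 0, Nat.card {i // l i ≤ s} = Nat.card {i // l' i ≤ s}) {s : ℝ} (hs : s ≤ 0) :
    Nat.card {i // l i < s} = Nat.card {i // l' i < s} := by
  have ev : ∀ {κ : Type _} [Fintype κ] (k : κ → ℝ), ∀ᶠ r in 𝓝[<] s, ∀ i, k i < s → k i ≤ r := by
    intro κ _ k
    rw [eventually_all]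
    intro i
    by_cases hi : k i < s
    · filter_upwards [Ioo_mem_nhdsLT hi] with r hr _ using hr.1.le
    · exact Eventually.of_forall fun r h => absurd h hi
  have ev' : ∀ {κ : Type _} [Fintype κ] (k : κ → ℝ), ∀ᶠ r in 𝓝[<] s, ∀ i, k i < s → k i ≤ r := by
    intro κ _ k
    rw [eventually_all]
    intro i
    by_cases hi : k i < s
    · filter_upwards [Ioo_mem_nhdsLT hi] with r hr _ using hr.1.le
    · exact Eventually.of_forall fun r h => absurd h hi
  obtain ⟨r, ⟨h1, h2⟩, h3⟩ := ((ev l).and (ev' l')).and self_mem_nhdsWithin |>.exists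
  have h3 : r < s := h3
  rw [Nat.card_congr (Equiv.subtypeEquivRight (q := fun i => l i ≤ r) fun i =>
      ⟨h1 i, fun h => lt_of_le_of_lt h h3⟩),
    Nat.card_congr (Equiv.subtypeEquivRight (q := fun i => l' i ≤ r) fun i =>
      ⟨h2 i, fun h => lt_of_le_of_lt h h3⟩)]
  exact h r (h3.trans_le hs)

lemma card_split {ι : Type*} [Fintype ι] (p q : ι → Prop) (h : ∀ i, q i ↔ ¬ p i) :
    Nat.card {i // p i} + Nat.card {i // q i} = Nat.card ι := by
  classical
  rw [Nat.card_congr (Equiv.subtypeEquivRight h), ← Nat.card_sum]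
  exact Nat.card_congr (Equiv.sumCompl p)

lemma card_all {ι ι' : Type*} [Fintype ι] [Fintype ι'] {l : ι → ℝ} {l' : ι' → ℝ}
    (hl : ∀ i, l i ≠ 0) (hl' : ∀ i, l' i ≠ 0)
    (h : ∀ s < 0, Nat.card {i // l i ≤ s} = Nat.card {i // l' i ≤ s})
    (h2 : ∀ s < 0, Nat.card {i // - l i ≤ s} = Nat.card {i // - l' i ≤ s}) (s : ℝ) :
    Nat.card {i // l i ≤ s} = Nat.card {i // l' i ≤ s} := by
  rcases lt_or_ge s 0 with hs | hs
  · exact h s hs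
  have a1 := card_split (fun i => l i < 0) (fun i => - l i < 0) (fun i => by
    rw [not_lt, neg_lt_zero]; exact ⟨le_of_lt, fun h => lt_of_le_of_ne h (hl i).symm⟩)
  have a2 := card_split (fun i => l' i < 0) (fun i => - l' i < 0) (fun i => by
    rw [not_lt, neg_lt_zero]; exact ⟨le_of_lt, fun h => lt_of_le_of_ne h (hl' i).symm⟩)
  have a3 := card_split (fun i => l i ≤ s) (fun i => - l i < -s) (fun i => by
    rw [not_le, neg_lt_neg_iff])
  have a4 := card_split (fun i => l' i ≤ s) (fun i => - l' i < -s) (fun i => by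
    rw [not_le, neg_lt_neg_iff])
  have b1 := card_strict h le_rfl
  have b2 := card_strict h2 le_rfl
  have b3 := card_strict h2 (s := -s) (by linarith)
  omega

section
universe u
variable {ι ι' : Type*} {C C' : Type u} [Fintype ι] [NormedAddCommGroup C] [NormedSpace ℝ C]
    [FiniteDimensional ℝ C] [CompleteSpace C] [Fintype ι'] [NormedAddCommGroup C']
    [NormedSpace ℝ C'] [FiniteDimensional ℝ C'] [CompleteSpace C']
    {M : Mdl ι C} {M' : Mdl ι' C'} {h : ((ι → ℝ) × C) ≃ₜ ((ι' → ℝ) × C')}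

theorem OE.final (H : OE M M' h) : ∃ κ : ℝ, 0 < κ ∧ (∀ s, M.cnt s = Nat.card {i // κ * M'.lam i ≤ s}) ∧
    ∃ Q : C ≃ₗ[ℝ] C', ∀ x, Q (M.Ac x) = κ • M'.Ac (Q x) := by
  obtain ⟨κ, hκ, hper, hrat⟩ := H.per
  refine ⟨κ, hκ, ?_, ?_⟩
  · refine card_all M.lam_ne (fun i => mul_ne_zero hκ.ne' (M'.lam_ne i)) ?_ ?_
    · intro s hs
      have := hrat.s s hs
      rw [Mdl.cnt, Mdl.cnt] at this
      rw [this]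
      refine Nat.card_congr (Equiv.subtypeEquivRight fun i => ?_)
      rw [← div_eq_mul_inv, le_div_iff₀ hκ, mul_comm]
    · intro s hs
      have := hrat.u s hs
      rw [Mdl.cnt, Mdl.cnt] at this
      simp only [Mdl.rev_lam] at this
      rw [this]
      refine Nat.card_congr (Equiv.subtypeEquivRight fun i => ?_)
      rw [← div_eq_mul_inv, le_div_iff₀ hκ, neg_mul, mul_comm]
  · have H0 : OE0 M (M'.scale κ hκ.ne') h := ⟨H.ah, fun x => by rw [orb_scale, H.orb]⟩
    refine H0.central ?_
    intro x hx T
    rw [hper x hx T, Mdl.φ_scale, one_mul, mul_comm]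
end

theorem model_nec : ModelNec := by
  intro ι C ι' C' _ _ _ _ _ _ _ _ M M' h hah horb
  haveI : CompleteSpace C := FiniteDimensional.complete ℝ C
  haveI : CompleteSpace C' := FiniteDimensional.complete ℝ C'
  have H0 : OE0 M M' h := ⟨hah, horb⟩
  rcases H0.split with H | H
  · obtain ⟨κ, hκ, h1, h2⟩ := H.final
    exact ⟨κ, hκ.ne', h1, h2⟩
  · obtain ⟨κ, hκ, h1, Q, h2⟩ := H.final
    refine ⟨-κ, neg_ne_zero.2 hκ.ne', fun s => ?_, Q, fun x => ?_⟩
    · rw [h1 s]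
      refine Nat.card_congr (Equiv.subtypeEquivRight fun i => ?_)
      show κ * (-1 * M'.lam i) ≤ s ↔ -κ * M'.lam i ≤ s
      rw [show κ * (-1 * M'.lam i) = -κ * M'.lam i by ring]
    · rw [h2 x]
      show κ • ((-1 : ℝ) • M'.Ac (Q x)) = _
      rw [smul_smul]; congr 1; ring
end

/-- **Hölder classification of linear flows** (Theorem B).
`Φ`, `Ψ` are all-Hölder equivalent iff for some `α ≠ 0` the generators `A^Φ`, `α A^Ψ` are
Lyapunov similar and the central-part generators `A^{Φ_C}`, `α A^{Ψ_C}` are similar. -/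
theorem holder_classification {d : ℕ} (A B : Matrix (Fin d) (Fin d) ℝ) :
    (∃ h : Euc d ≃ₜ Euc d, MemH1minus h ∧ IsOrbitEquiv A B h) ↔
      (∃ α : ℝ, α ≠ 0 ∧ (∀ j : ℕ, j < d → lyapExp A j = lyapExp (α • B) j) ∧
        IsCentralSimilar A B α) :=
  assembly model_nec A B

end LF
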